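/- Let L ≥ 2 be an integer and η > 0. There exist a constant K ≥ 1 (absolute) and a constant C depending only on η and L such that the following holds. Let (v,p,R) be a smooth solution of the Euler–Reynolds system on ℝ×𝕋³ whose frequency and energy levels are below (Ξ, e_v, e_R) to order L in C⁰, and let I ⊆ ℝ be a nonempty union of time intervals with supp R ⊆ I×𝕋³. Set θ = Ξ⁻¹ e_v^{−1/2}. Let e : ℝ → [0,∞) satisfy e(t) ≥ K e_R for all t within distance θ of I, with e^{1/2} twice differentiable and ‖(d/dt)^r e^{1/2}‖_{C⁰(ℝ)} ≤ 1000 (Ξ e_v^{1/2})^r (K e_R)^{1/2} for r = 0,1,2. Let N > 0 satisfy N ≥ Ξ^η and N ≥ (e_v/e_R)^{3/2}, and set b = (e_v^{1/2}/(e_R^{1/2} N))^{1/2}. Then there exists a smooth solution (v₁,p₁,R₁) of the Euler–Reynolds system of the form v₁ = v+V, p₁ = p+P, whose frequency and energy levels are below (C N Ξ, e_R, b⁻¹ e_v^{1/2} e_R^{1/2}/N) to order L in C⁰, with supp R₁ contained in {(t,x) : t is within distance θ of supp e}. Moreover V = ∇×W for some smooth W, both V and P vanish outside (supp e)×𝕋³,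 and: ‖V‖_{C⁰} ≤ C e_R^{1/2}; ‖∇V‖_{C⁰} ≤ C N Ξ e_R^{1/2}; ‖(∂_t+v·∇)V‖_{C⁰} ≤ C b⁻¹ Ξ e_v^{1/2} e_R^{1/2}; ‖W‖_{C⁰} ≤ C Ξ⁻¹ N⁻¹ e_R^{1/2}; ‖∇W‖_{C⁰} ≤ C e_R^{1/2}; ‖(∂_t+v·∇)W‖_{C⁰} ≤ C b⁻¹ N⁻¹ e_v^{1/2} e_R^{1/2}; sup_t | ∫_{𝕋³}|V|² dx − ∫_{𝕋³} e(t) dx | ≤ C e_R/N; sup_t | (d/dt)( ∫_{𝕋³}|V|² dx − ∫_{𝕋³} e(t) dx ) | ≤ C b⁻¹ Ξ e_v^{1/2} e_R/N; ‖P‖_{C⁰} ≤ C e_R; ‖∇P‖_{C⁰} ≤ C N Ξ e_R; ‖(∂_t+v·∇)P‖_{C⁰} ≤ C b⁻¹ Ξ e_v^{1/2} e_R. -/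

import Mathlib

noncomputable section

open MeasureTheory

/-- Points of space ℝ³. -/
abbrev Spc : Type := Fin 3 → ℝ

/-- ℤ³-periodicity of a function on ℝ³. -/
def Per {α : Type*} (f : Spc → α) : Prop :=
  ∀ (x : Spc) (k : Fin 3 → ℤ), f (fun i => x i + (k i : ℝ)) = f x

/-- Spatial partial derivative in direction `j`. -/
def pd {E : Type*} [NormedAddCommGroup E] [NormedSpace ℝ E]
    (j : Fin 3) (f : Spc → E) (x : Spc) : E :=
  fderiv ℝ f x (Pi.single j 1)

/-- Time derivative. -/
def pt {E : Type*} [NormedAddCommGroup E] [NormedSpace ℝ E]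
    (f : ℝ → Spc → E) (t : ℝ) (x : Spc) : E :=
  deriv (fun s => f s x) t

/-- The fundamental domain [0,1)³ of the torus. -/
def Tdom : Set Spc := Set.univ.pi fun _ => Set.Ico (0 : ℝ) 1

/-- Material (advective) derivative `(∂ₜ + v·∇)f` along the vector field `v`. -/
def matD (v : ℝ → Spc → Spc) (f : ℝ → Spc → ℝ) (t : ℝ) (x : Spc) : ℝ :=
  pt f t x + ∑ i, v t x i * pd i (f t) x

/-- Curl of a vector field on ℝ³. -/
def curl (W : Spc → Spc) (x : Spc) : Spc :=
  ![pd 1 (fun y => W y 2) x - pd 2 (fun y => W y 1) x,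
    pd 2 (fun y => W y 0) x - pd 0 (fun y => W y 2) x,
    pd 0 (fun y => W y 1) x - pd 1 (fun y => W y 0) x]

/-- The (pointwise) Euler–Reynolds system
`∂ₜ vˡ + ∂ⱼ(vʲvˡ) + ∂ˡp = ∂ⱼ Rʲˡ`, `∂ⱼ vʲ = 0`. -/
def IsEulerReynolds (v : ℝ → Spc → Spc) (p : ℝ → Spc → ℝ)
    (R : ℝ → Spc → Fin 3 → Fin 3 → ℝ) : Prop :=
  ∀ t x,
    (∀ l, pt (fun s y => v s y l) t x
        + (∑ j, pd j (fun y => v t y j * v t y l) x)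
        + pd l (p t) x
        = ∑ j, pd j (fun y => R t y j l) x) ∧
    (∑ j, pd j (fun y => v t y j) x = 0)

/-- The frequency and energy levels of `(v, p, R)` are below `(Ξ, e_v, e_R)`
to order `L` in `C⁰`: `‖∇^k v‖ ≤ Ξ^k e_v^{1/2}` (1 ≤ k ≤ L),
`‖∇^k p‖ ≤ Ξ^k e_v` (1 ≤ k ≤ L), `‖∇^k R‖ ≤ Ξ^k e_R` (0 ≤ k ≤ L), and
`‖∇^k (∂ₜ+v·∇)R‖ ≤ Ξ^{k+1} e_v^{1/2} e_R` (0 ≤ k ≤ L−1). -/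
def FreqEnergyBelow (L : ℕ) (Ξ ev eR : ℝ) (v : ℝ → Spc → Spc)
    (p : ℝ → Spc → ℝ) (R : ℝ → Spc → Fin 3 → Fin 3 → ℝ) : Prop :=
  (∀ k : ℕ, 1 ≤ k → k ≤ L → ∀ t x l,
    ‖iteratedFDeriv ℝ k (fun y => v t y l) x‖ ≤ Ξ ^ k * Real.sqrt ev) ∧
  (∀ k : ℕ, 1 ≤ k → k ≤ L → ∀ t x,
    ‖iteratedFDeriv ℝ k (p t) x‖ ≤ Ξ ^ k * ev) ∧
  (∀ k : ℕ, k ≤ L → ∀ t x j l,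
    ‖iteratedFDeriv ℝ k (fun y => R t y j l) x‖ ≤ Ξ ^ k * eR) ∧
  (∀ k : ℕ, k + 1 ≤ L → ∀ t x j l,
    ‖iteratedFDeriv ℝ k (fun y => matD v (fun s z => R s z j l) t y) x‖
      ≤ Ξ ^ (k + 1) * Real.sqrt ev * eR)
section
open MeasureTheory
open scoped ContDiff
set_option autoImplicit false
/-- Space-time. -/
abbrev Zt : Type := ℝ × Spc
/-- Smooth space-periodic complex functions on space-time. -/
def SmA : Subalgebra ℂ (Zt → ℂ) where
  carrier := {f | ContDiff ℝ ∞ f ∧ ∀ (t : ℝ) (x : Spc) (k : Fin 3 → ℤ),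
    f (t, fun i => x i + (k i : ℝ)) = f (t, x)}
  mul_mem' := by
    rintro f g ⟨hf, pf⟩ ⟨hg, pg⟩
    exact ⟨hf.mul hg, fun t x k => by simp [pf, pg]⟩
  add_mem' := by
    rintro f g ⟨hf, pf⟩ ⟨hg, pg⟩
    exact ⟨hf.add hg, fun t x k => by simp [pf, pg]⟩
  algebraMap_mem' := fun c => ⟨contDiff_const, fun t x k => rfl⟩
/-- The type of smooth space-periodic complex functions. -/
def Sm : Type := SmA
instance : CommRing Sm := inferInstanceAs (CommRing SmA)
instance : Algebra ℂ Sm := inferInstanceAs (Algebra ℂ SmA)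
instance : CoeFun Sm (fun _ => Zt → ℂ) := ⟨fun f => f.1⟩
namespace Sm
theorem smooth (f : Sm) : ContDiff ℝ ∞ f := f.2.1
theorem per (f : Sm) (t : ℝ) (x : Spc) (k : Fin 3 → ℤ) :
    f (t, fun i => x i + (k i : ℝ)) = f (t, x) := f.2.2 t x k
theorem diff (f : Sm) : Differentiable ℝ f := f.smooth.differentiable (by simp)
theorem diffAt (f : Sm) (z : Zt) : DifferentiableAt ℝ f z := f.diff z
theorem cont (f : Sm) : Continuous f := f.smooth.continuous
theorem ext' {f g : Sm} (h : ∀ z, f z = g z) : f = g := Subtype.ext (funext h)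
@[simp] theorem coe_add (f g : Sm) (z : Zt) : (f + g) z = f z + g z := rfl
@[simp] theorem coe_sub (f g : Sm) (z : Zt) : (f - g) z = f z - g z := rfl
@[simp] theorem coe_neg (f : Sm) (z : Zt) : (-f) z = - f z := rfl
@[simp] theorem coe_mul (f g : Sm) (z : Zt) : (f * g) z = f z * g z := rfl
@[simp] theorem coe_zero (z : Zt) : (0 : Sm) z = 0 := rfl
@[simp] theorem coe_one (z : Zt) : (1 : Sm) z = 1 := rfl
@[simp] theorem coe_smul (c : ℂ) (f : Sm) (z : Zt) : (c • f) z = c * f z := rfl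
@[simp] theorem coe_pow (f : Sm) (n : ℕ) (z : Zt) : (f ^ n) z = f z ^ n := rfl
@[simp] theorem coe_algebraMap (c : ℂ) (z : Zt) : (algebraMap ℂ Sm c) z = c := rfl
@[simp] theorem coe_sum {ι : Type*} (s : Finset ι) (f : ι → Sm) (z : Zt) :
    (∑ i ∈ s, f i) z = ∑ i ∈ s, f i z := by
  classical
  induction s using Finset.induction_on with
  | empty => simp
  | insert a s ha ih => simp [Finset.sum_insert ha, ih]
theorem fderiv_per (f : Sm) (t : ℝ) (x : Spc) (k : Fin 3 → ℤ) :
    fderiv ℝ f (t, fun i => x i + (k i : ℝ)) = fderiv ℝ f (t, x) := by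
  have h : (fun z : Zt => f (z + ((0 : ℝ), (fun i => (k i : ℝ) : Spc)))) = f := by
    funext z
    obtain ⟨s, y⟩ := z
    have := f.per s y k
    simpa [Pi.add_def] using this
  have h2 := fderiv_comp_add_right (𝕜 := ℝ) (f := (f : Zt → ℂ)) (x := (t, x))
    ((0 : ℝ), (fun i => (k i : ℝ) : Spc))
  rw [h] at h2
  rw [h2]
  simp [Pi.add_def]
/-- Directional derivative as a function. -/
def dvf (a : Zt) (f : Sm) : Sm :=
  ⟨fun z => fderiv ℝ f z a, (f.smooth.fderiv_right (by simp)).clm_apply contDiff_const,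
    fun t x k => by beta_reduce; rw [fderiv_per]⟩
/-- Directional derivative as a derivation. -/
def dv (a : Zt) : Derivation ℂ Sm Sm :=
  Derivation.mk'
    { toFun := dvf a
      map_add' := fun f g => ext' fun z => by
        change fderiv ℝ ((f : Zt → ℂ) + (g : Zt → ℂ)) z a = _
        rw [fderiv_add (f.diffAt z) (g.diffAt z)]; rfl
      map_smul' := fun c f => ext' fun z => by
        change fderiv ℝ (c • (f : Zt → ℂ)) z a = _
        rw [fderiv_const_smul (f.diffAt z)]; rfl }
    (fun f g => ext' fun z => by
        change fderiv ℝ ((f : Zt → ℂ) * (g : Zt → ℂ)) z a = _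
        rw [fderiv_mul (f.diffAt z) (g.diffAt z)]
        rfl)
theorem dv_apply (a : Zt) (f : Sm) (z : Zt) : dv a f z = fderiv ℝ f z a := rfl
theorem two_le_inf : (2 : WithTop ℕ∞) ≤ ∞ :=
  (WithTop.coe_le_coe.mpr le_top : ((2 : ℕ∞) : WithTop ℕ∞) ≤ ((⊤ : ℕ∞) : WithTop ℕ∞))
theorem dv_comm (a c : Zt) (f : Sm) : dv a (dv c f) = dv c (dv a f) := by
  apply ext'
  intro z
  have hs : IsSymmSndFDerivAt ℝ (f : Zt → ℂ) z :=
    (f.smooth.contDiffAt).isSymmSndFDerivAt (by simpa [minSmoothness] using two_le_inf)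
  have hd : DifferentiableAt ℝ (fderiv ℝ (f : Zt → ℂ)) z :=
    ((f.smooth.fderiv_right (m := 1) (by rw [one_add_one_eq_two]; exact two_le_inf)).differentiable (by simp)) z
  have key : ∀ a c : Zt, dv a (dv c f) z = fderiv ℝ (fderiv ℝ (f : Zt → ℂ)) z a c := by
    intro a c
    change fderiv ℝ (fun z => fderiv ℝ (f : Zt → ℂ) z c) z a = _
    rw [fderiv_clm_apply hd (differentiableAt_const _)]
    simp
  rw [key, key]
  exact hs a c
/-- Space derivative. -/
def dd (i : Fin 3) : Derivation ℂ Sm Sm := dv ((0 : ℝ), (Pi.single i 1 : Spc))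
/-- Time derivative. -/
def dt : Derivation ℂ Sm Sm := dv ((1 : ℝ), (0 : Spc))
theorem dd_comm (i j : Fin 3) (f : Sm) : dd i (dd j f) = dd j (dd i f) := dv_comm _ _ f
theorem dt_dd (i : Fin 3) (f : Sm) : dt (dd i f) = dd i (dt f) := dv_comm _ _ f
/-- Advective derivative. -/
def DD (u : Fin 3 → Sm) : Derivation ℂ Sm Sm := dt + ∑ i, u i • dd i
theorem DD_apply (u : Fin 3 → Sm) (f : Sm) : DD u f = dt f + ∑ i, u i * dd i f := by
  simp [DD, Fin.sum_univ_three]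
theorem DD_dd (u : Fin 3 → Sm) (i : Fin 3) (f : Sm) :
    DD u (dd i f) = dd i (DD u f) - ∑ k, dd i (u k) * dd k f := by
  simp only [DD_apply, map_add, map_sum, Derivation.leibniz, smul_eq_mul, dt_dd,
    Fin.sum_univ_three, dd_comm i]
  ring
/-- Complex conjugation. -/
def cj (f : Sm) : Sm :=
  ⟨fun z => (starRingEnd ℂ) (f z), by
    have : ContDiff ℝ ∞ (Complex.conjCLE : ℂ → ℂ) := Complex.conjCLE.contDiff
    exact this.comp f.smooth, fun t x k => by beta_reduce; rw [f.per]⟩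
@[simp] theorem cj_apply (f : Sm) (z : Zt) : cj f z = (starRingEnd ℂ) (f z) := rfl
@[simp] theorem cj_add (f g : Sm) : cj (f + g) = cj f + cj g := ext' fun z => by simp
@[simp] theorem cj_sub (f g : Sm) : cj (f - g) = cj f - cj g := ext' fun z => by simp
@[simp] theorem cj_mul (f g : Sm) : cj (f * g) = cj f * cj g := ext' fun z => by simp
@[simp] theorem cj_neg (f : Sm) : cj (-f) = - cj f := ext' fun z => by simp
@[simp] theorem cj_cj (f : Sm) : cj (cj f) = f := ext' fun z => by simp
@[simp] theorem cj_zero : cj 0 = 0 := ext' fun z => by simp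
@[simp] theorem cj_one : cj 1 = 1 := ext' fun z => by simp
@[simp] theorem cj_pow (f : Sm) (n : ℕ) : cj (f ^ n) = cj f ^ n := ext' fun z => by simp
@[simp] theorem cj_smul (c : ℂ) (f : Sm) : cj (c • f) = (starRingEnd ℂ c) • cj f :=
  ext' fun z => by simp
@[simp] theorem cj_algebraMap (c : ℂ) :
    cj (algebraMap ℂ Sm c) = algebraMap ℂ Sm (starRingEnd ℂ c) := ext' fun z => by simp
@[simp] theorem cj_sum {ι : Type*} (s : Finset ι) (f : ι → Sm) :
    cj (∑ i ∈ s, f i) = ∑ i ∈ s, cj (f i) := ext' fun z => by simp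
theorem cj_dv (a : Zt) (f : Sm) : cj (dv a f) = dv a (cj f) := by
  apply ext'
  intro z
  change _ = fderiv ℝ (Complex.conjCLE ∘ (f : Zt → ℂ)) z a
  rw [ContinuousLinearEquiv.comp_fderiv]
  rfl
theorem cj_dd (i : Fin 3) (f : Sm) : cj (dd i f) = dd i (cj f) := cj_dv _ f
theorem cj_dt (f : Sm) : cj (dt f) = dt (cj f) := cj_dv _ f
/-- Real elements. -/
def Re (f : Sm) : Prop := cj f = f
theorem Re.im {f : Sm} (h : Re f) (z : Zt) : (f z).im = 0 := by
  have := congrArg (fun g : Sm => g z) h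
  exact Complex.conj_eq_iff_im.mp this
theorem re_of_im {f : Sm} (h : ∀ z, (f z).im = 0) : Re f :=
  ext' fun z => Complex.conj_eq_iff_im.mpr (h z)
theorem Re.coe {f : Sm} (h : Re f) (z : Zt) : (((f z).re : ℝ) : ℂ) = f z := by
  apply Complex.ext <;> simp [h.im z]
theorem Re.add {f g : Sm} (hf : Re f) (hg : Re g) : Re (f + g) := by
  unfold Re at *; simp [hf, hg]
theorem Re.sub {f g : Sm} (hf : Re f) (hg : Re g) : Re (f - g) := by
  unfold Re at *; simp [hf, hg]
theorem Re.mul {f g : Sm} (hf : Re f) (hg : Re g) : Re (f * g) := by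
  unfold Re at *; simp [hf, hg]
theorem Re.neg {f : Sm} (hf : Re f) : Re (-f) := by
  unfold Re at *; simp [hf]
theorem Re.one : Re 1 := by unfold Re; simp
theorem Re.zero : Re 0 := by unfold Re; simp
theorem Re.rsmul {f : Sm} (hf : Re f) (c : ℝ) : Re ((c : ℂ) • f) := by
  unfold Re at *; rw [cj_smul, hf, Complex.conj_ofReal]
theorem Re.sum {ι : Type*} {s : Finset ι} {f : ι → Sm} (h : ∀ i ∈ s, Re (f i)) :
    Re (∑ i ∈ s, f i) := by
  unfold Re at *; simp; exact Finset.sum_congr rfl h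
theorem Re.dd {f : Sm} (hf : Re f) (i : Fin 3) : Re (dd i f) := by
  unfold Re at *; rw [cj_dd, hf]
theorem Re.dt {f : Sm} (hf : Re f) : Re (dt f) := by
  unfold Re at *; rw [cj_dt, hf]
theorem Re.DD {u : Fin 3 → Sm} (hu : ∀ i, Re (u i)) {f : Sm} (hf : Re f) : Re (DD u f) := by
  rw [DD_apply]; exact hf.dt.add (Re.sum fun i _ => (hu i).mul (hf.dd i))
/-- Equality on a time set. -/
def EqS (S : Set ℝ) (f g : Sm) : Prop := ∀ t ∈ S, ∀ x, f (t, x) = g (t, x)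
theorem EqS.refl (S : Set ℝ) (f : Sm) : EqS S f f := fun _ _ _ => rfl
theorem EqS.symm {S : Set ℝ} {f g : Sm} (h : EqS S f g) : EqS S g f :=
  fun t ht x => (h t ht x).symm
theorem EqS.trans {S : Set ℝ} {f g k : Sm} (h : EqS S f g) (h' : EqS S g k) : EqS S f k :=
  fun t ht x => (h t ht x).trans (h' t ht x)
theorem EqS.add {S : Set ℝ} {f g f' g' : Sm} (h : EqS S f f') (h' : EqS S g g') :
    EqS S (f + g) (f' + g') := fun t ht x => by simp [h t ht x, h' t ht x]
theorem EqS.mul {S : Set ℝ} {f g f' g' : Sm} (h : EqS S f f') (h' : EqS S g g') :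
    EqS S (f * g) (f' * g') := fun t ht x => by simp [h t ht x, h' t ht x]
theorem EqS.mono {S S' : Set ℝ} {f g : Sm} (h : EqS S f g) (hs : S' ⊆ S) : EqS S' f g :=
  fun t ht x => h t (hs ht) x
theorem EqS.dv {S : Set ℝ} (hS : IsOpen S) {f g : Sm} (h : EqS S f g) (a : Zt) :
    EqS S (dv a f) (dv a g) := by
  intro t ht x
  rw [dv_apply, dv_apply]
  have : (f : Zt → ℂ) =ᶠ[nhds (t, x)] g := by
    have hm : (Prod.fst ⁻¹' S : Set Zt) ∈ nhds (t, x) :=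
      (hS.preimage continuous_fst).mem_nhds ht
    filter_upwards [hm] with z hz
    exact h z.1 hz z.2
  rw [this.fderiv_eq]
theorem EqS.dd {S : Set ℝ} (hS : IsOpen S) {f g : Sm} (h : EqS S f g) (i : Fin 3) :
    EqS S (dd i f) (dd i g) := h.dv hS _
theorem EqS.dt {S : Set ℝ} (hS : IsOpen S) {f g : Sm} (h : EqS S f g) :
    EqS S (dt f) (dt g) := h.dv hS _
theorem EqS.DD {S : Set ℝ} (hS : IsOpen S) {f g : Sm} (h : EqS S f g) (u : Fin 3 → Sm) :
    EqS S (DD u f) (DD u g) := by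
  intro t ht x
  simp only [DD_apply, coe_add, coe_sum, coe_mul, (h.dt hS) t ht x]
  congr 1
  exact Finset.sum_congr rfl fun i _ => by rw [(h.dd hS i) t ht x]
/-- A function of time only. -/
def tf (g : ℝ → ℝ) (hg : ContDiff ℝ ∞ g) : Sm :=
  ⟨fun z => ((g z.1 : ℝ) : ℂ),
    Complex.ofRealCLM.contDiff.comp (hg.comp contDiff_fst), fun _ _ _ => rfl⟩
@[simp] theorem tf_apply (g : ℝ → ℝ) (hg : ContDiff ℝ ∞ g) (z : Zt) :
    tf g hg z = ((g z.1 : ℝ) : ℂ) := rfl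
theorem Re.tf (g : ℝ → ℝ) (hg : ContDiff ℝ ∞ g) : Re (tf g hg) := re_of_im fun z => by simp
theorem tf_fderiv (g : ℝ → ℝ) (hg : ContDiff ℝ ∞ g) (z : Zt) (a : Zt) :
    fderiv ℝ (tf g hg : Zt → ℂ) z a = ((a.1 * deriv g z.1 : ℝ) : ℂ) := by
  have h1 : HasDerivAt g (deriv g z.1) z.1 :=
    ((hg.differentiable (by simp)) z.1).hasDerivAt
  have h2 : HasFDerivAt (fun z : Zt => g z.1) (deriv g z.1 • ContinuousLinearMap.fst ℝ ℝ Spc) z :=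
    h1.comp_hasFDerivAt z hasFDerivAt_fst
  have h3 := (Complex.ofRealCLM.hasFDerivAt (x := g z.1)).comp z h2
  have h4 : HasFDerivAt (tf g hg : Zt → ℂ) _ z := h3
  rw [h4.fderiv]
  simp [mul_comm]
@[simp] theorem dd_tf (g : ℝ → ℝ) (hg : ContDiff ℝ ∞ g) (i : Fin 3) : dd i (tf g hg) = 0 :=
  ext' fun z => by
    change fderiv ℝ _ z _ = _
    rw [tf_fderiv]; simp
theorem dt_tf (g : ℝ → ℝ) (hg : ContDiff ℝ ∞ g) (z : Zt) : dt (tf g hg) z = ((deriv g z.1 : ℝ) : ℂ) := by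
    change fderiv ℝ _ z _ = _
    rw [tf_fderiv]; simp
theorem deriv_smooth {g : ℝ → ℝ} (hg : ContDiff ℝ ∞ g) : ContDiff ℝ ∞ (deriv g) := by
  have := (contDiff_infty_iff_deriv.mp hg).2
  exact this
theorem dt_tf' (g : ℝ → ℝ) (hg : ContDiff ℝ ∞ g) :
    dt (tf g hg) = tf (deriv g) (deriv_smooth hg) := ext' fun z => by rw [dt_tf]; rfl
theorem DD_tf (u : Fin 3 → Sm) (g : ℝ → ℝ) (hg : ContDiff ℝ ∞ g) :
    DD u (tf g hg) = tf (deriv g) (deriv_smooth hg) := by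
  rw [DD_apply, dt_tf']; simp
/-- Constants. -/
abbrev cst (c : ℂ) : Sm := algebraMap ℂ Sm c
end Sm
end
theorem mleL {a b c : ℝ} (h : b ≤ c) (h1 : 0 ≤ a) : a * b ≤ a * c := mul_le_mul_of_nonneg_left h h1
theorem mleR {a b c : ℝ} (h : b ≤ c) (h1 : 0 ≤ a) : b * a ≤ c * a := mul_le_mul_of_nonneg_right h h1
section
open Sm
open Finset (sum_congr sum_add_distrib sum_sub_distrib sum_comm sum_mul mul_sum mem_univ sum_neg_distrib sum_nonneg sum_eq_single single_le_sum sum_eq_zero sum_mul_sum sum_le_sum)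
local notation "𝕀" => Fin 6 × Bool
open scoped ContDiff Asymptotics
set_option autoImplicit false
section
/-- `f ≲ g` : uniformly bounded by a constant multiple. -/
def Ls {ι E : Type} [Norm E] (f : ι -> E) (g : ι -> ℝ) : Prop := f =O[⊤] g
theorem Ls.of {ι E : Type} [SeminormedAddCommGroup E] {f : ι -> E} {g : ι -> ℝ} (C : ℝ)
    (h : ∀ i, ‖f i‖ <= C * g i) : Ls f g := by
  apply Asymptotics.IsBigO.of_bound (|C|)
  simp only [Filter.eventually_top]
  intro i
  refine (h i).trans ?_
  rw [Real.norm_eq_abs, <- abs_mul]; exact le_abs_self _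
theorem Ls.bound {ι E : Type} [SeminormedAddCommGroup E] {f : ι -> E} {g : ι -> ℝ} (h : Ls f g) :
    ∃ C, 0 <= C ∧ ∀ i, ‖f i‖ <= C * |g i| := by
  obtain ⟨C, hC, h'⟩ := Asymptotics.IsBigO.exists_nonneg h
  refine ⟨C, hC, ?_⟩
  have := h'.bound
  simpa using this
theorem Ls.mul {ι E : Type} [NormedRing E] {f f' : ι -> E} {g g' : ι -> ℝ} (h : Ls f g) (h' : Ls f' g') :
    Ls (fun i => f i * f' i) (fun i => g i * g' i) := Asymptotics.IsBigO.mul h h'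
theorem Ls.rfl' {ι : Type} {f : ι -> ℝ} : Ls f f := Asymptotics.isBigO_refl _ _
theorem Ls.le {ι : Type} {f g : ι -> ℝ} (h0 : ∀ i, 0 <= f i) (h : ∀ i, f i <= g i) : Ls f g :=
  Ls.of 1 fun i => by rw [Real.norm_eq_abs, abs_of_nonneg (h0 i), one_mul]; exact h i
theorem Ls.eq {ι : Type} {f g : ι -> ℝ} (h : ∀ i, f i = g i) : Ls f g := by
  rw [show f = g from funext h]; exact Ls.rfl'
theorem Ls.trans {ι E : Type} [SeminormedAddCommGroup E] {f : ι -> E} {g k : ι -> ℝ} (h : Ls f g) (h' : Ls g k) :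
    Ls f k := Asymptotics.IsBigO.trans h h'
structure Ctx (ι : Type) where
  pt : ι -> Zt
  u : ι -> Fin 3 -> Sm
  mu : ι -> ℝ
  nu : ι -> ℝ
variable {ι : Type}
/-- Bounds at the base points for words of space derivatives and advective derivatives. -/
inductive Cl (c : Ctx ι) : ℕ -> ℕ -> (ι -> ℝ) -> (ι -> Sm) -> Prop
  | mk {r m : ℕ} {A : ι -> ℝ} {F : ι -> Sm}
      (h0 : Ls (fun i => F i (c.pt i)) A)
      (h1 : ∀ m', m = m' + 1 -> ∀ j, Cl c r m' (fun i => A i * c.mu i) (fun i => dd j (F i)))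
      (h2 : ∀ r', r = r' + 1 -> Cl c r' m (fun i => A i * c.nu i) (fun i => DD (c.u i) (F i))) :
      Cl c r m A F
namespace Cl
variable {c : Ctx ι} {r m : ℕ} {A B : ι -> ℝ} {F G : ι -> Sm}
theorem val (h : Cl c r m A F) : Ls (fun i => F i (c.pt i)) A := by
  cases h; assumption
theorem dd (h : Cl c r (m + 1) A F) (j : Fin 3) :
    Cl c r m (fun i => A i * c.mu i) (fun i => Sm.dd j (F i)) := by
  cases h with | mk h0 h1 h2 => exact h1 m rfl j
theorem DD (h : Cl c (r + 1) m A F) :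
    Cl c r m (fun i => A i * c.nu i) (fun i => Sm.DD (c.u i) (F i)) := by
  cases h with | mk h0 h1 h2 => exact h2 r rfl
/-- Induction principle for proving `Cl`. -/
theorem ind {P : ℕ -> ℕ -> Prop}
    (h : ∀ r m, (∀ m', m = m' + 1 -> P r m') -> (∀ r', r = r' + 1 -> P r' m) -> P r m) (r m : ℕ) :
    P r m := by
  obtain ⟨n, hn⟩ : ∃ n, r + m <= n := ⟨_, le_rfl⟩
  induction n generalizing r m with
  | zero => exact h r m (fun m' h' => by omega) (fun r' h' => by omega)
  | succ n ih => exact h r m (fun m' h' => ih _ _ (by omega)) (fun r' h' => ih _ _ (by omega))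
theorem down (h : Cl c r m A F) {r' m' : ℕ} (hr : r' <= r) (hm : m' <= m) : Cl c r' m' A F := by
  induction h generalizing r' m' with
  | @mk r m A F h0 h1 h2 ih1 ih2 =>
    refine .mk h0 (fun k hk j => ?_) (fun k hk => ?_)
    . obtain ⟨m₁, rfl⟩ : ∃ m₁, m = m₁ + 1 := ⟨m - 1, by omega⟩
      exact ih1 m₁ rfl j hr (by omega)
    . obtain ⟨r₁, rfl⟩ : ∃ r₁, r = r₁ + 1 := ⟨r - 1, by omega⟩
      exact ih2 r₁ rfl (by omega) hm
theorem trans (h : Cl c r m A F) (hA : Ls A B) : Cl c r m B F := by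
  induction h generalizing B with
  | @mk r m A F h0 h1 h2 ih1 ih2 =>
    exact .mk (Ls.trans h0 hA) (fun k hk j => ih1 k hk j (hA.mul Ls.rfl'))
      (fun k hk => ih2 k hk (hA.mul Ls.rfl'))
theorem chg {c' : Ctx ι} (h : Cl c r m A F) (hp : c'.pt = c.pt) (hu : c'.u = c.u)
    (hm : Ls c.mu c'.mu) (hn : Ls c.nu c'.nu) : Cl c' r m A F := by
  induction h with
  | @mk r m A F h0 h1 h2 ih1 ih2 =>
    refine .mk (by rw [hp]; exact h0) (fun k hk j => (ih1 k hk j).trans (Ls.rfl'.mul hm))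
      (fun k hk => ?_)
    rw [hu]
    exact (ih2 k hk).trans (Ls.rfl'.mul hn)
theorem comap {κ : Type} (f : κ -> ι) {c' : Ctx κ} (h : Cl c r m A F)
    (hp : c'.pt = c.pt ∘ f) (hu : c'.u = c.u ∘ f)
    (hm : Ls (c.mu ∘ f) c'.mu) (hn : Ls (c.nu ∘ f) c'.nu) :
    Cl c' r m (A ∘ f) (F ∘ f) := by
  induction h with
  | @mk r m A F h0 h1 h2 ih1 ih2 =>
    refine .mk ?_ (fun k hk j => (ih1 k hk j).trans (Ls.rfl'.mul hm)) (fun k hk => ?_)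
    . rw [hp]
      obtain ⟨C, _, hC⟩ := h0.bound
      exact Asymptotics.IsBigO.of_bound C (by simpa using fun i => hC (f i))
    . have := (ih2 k hk).trans (Ls.rfl'.mul hn)
      rw [hu]; exact this
theorem congr (h : Cl c r m A F)
    (hFG : ∀ i, ∃ S : Set ℝ, IsOpen S ∧ (c.pt i).1 ∈ S ∧ EqS S (F i) (G i)) : Cl c r m A G := by
  induction h generalizing G with
  | @mk r m A F h0 h1 h2 ih1 ih2 =>
    refine .mk ?_ (fun k hk j => ih1 k hk j fun i => ?_) (fun k hk => ih2 k hk fun i => ?_)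
    . have : (fun i => G i (c.pt i)) = fun i => F i (c.pt i) := by
        funext i
        obtain ⟨S, _, h2, h3⟩ := hFG i
        exact (h3 _ h2 _).symm
      rw [this]; exact h0
    . obtain ⟨S, h1, h2, h3⟩ := hFG i
      exact ⟨S, h1, h2, h3.dd h1 j⟩
    . obtain ⟨S, h1, h2, h3⟩ := hFG i
      exact ⟨S, h1, h2, h3.DD h1 _⟩
theorem add (h : Cl c r m A F) (h' : Cl c r m A G) : Cl c r m A (fun i => F i + G i) := by
  induction h generalizing G with
  | @mk r m A F h0 h1 h2 ih1 ih2 =>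
    refine .mk (Asymptotics.IsBigO.add h0 h'.val) (fun k hk j => ?_) (fun k hk => ?_)
    . subst hk
      simp only [map_add]; exact ih1 k rfl j (h'.dd j)
    . subst hk
      simp only [map_add]; exact ih2 k rfl h'.DD
theorem smulc (z : ι -> ℂ) (h : Cl c r m A F) :
    Cl c r m (fun i => ‖z i‖ * A i) (fun i => z i • F i) := by
  induction h with
  | @mk r m A F h0 h1 h2 ih1 ih2 =>
    refine .mk ?_ (fun k hk j => ?_) (fun k hk => ?_)
    . exact Ls.mul (f := z) (Asymptotics.isBigO_norm_right.mpr (Asymptotics.isBigO_refl _ _)) h0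
    . simp only [Derivation.map_smul, mul_assoc]; exact ih1 k hk j
    . simp only [Derivation.map_smul, mul_assoc]; exact ih2 k hk
theorem smul (z : ℂ) (h : Cl c r m A F) : Cl c r m A (fun i => z • F i) :=
  (h.smulc fun _ => z).trans (Asymptotics.IsBigO.const_mul_left (Asymptotics.isBigO_refl _ _) _)
theorem neg (h : Cl c r m A F) : Cl c r m A (fun i => - F i) := by
  simpa using h.smul (-1)
theorem sub (h : Cl c r m A F) (h' : Cl c r m A G) : Cl c r m A (fun i => F i - G i) := by
  simpa [sub_eq_add_neg] using h.add h'.neg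
theorem zero : Cl c r m A (fun _ => 0) := by
  refine ind (P := fun r m => ∀ A : ι -> ℝ, Cl c r m A (fun _ => 0)) ?_ r m A
  intro r m h1 h2 A
  refine .mk (by simp only [coe_zero]; exact Asymptotics.isBigO_zero _ _) (fun k hk j => ?_) (fun k hk => ?_)
  . simpa using h1 k hk _
  . simpa using h2 k hk _
theorem sum {κ : Type*} (s : Finset κ) {F : κ -> ι -> Sm} (h : ∀ k ∈ s, Cl c r m A (F k)) :
    Cl c r m A (fun i => ∑ k ∈ s, F k i) := by
  classical
  induction s using Finset.induction_on with
  | empty => simpa using zero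
  | insert a s ha ih =>
    simp only [Finset.sum_insert ha]
    exact (h a (by simp)).add (ih fun k hk => h k (by simp [hk]))
theorem mul (h : Cl c r m A F) (h' : Cl c r m B G) :
    Cl c r m (fun i => A i * B i) (fun i => F i * G i) := by
  revert A B F G
  refine ind (P := fun r m => ∀ {A B : ι -> ℝ} {F G : ι -> Sm} (_ : Cl c r m A F)
    (_ : Cl c r m B G), Cl c r m (fun i => A i * B i) (fun i => F i * G i)) ?_ r m
  intro r m ih1 ih2 A B F G h h'
  refine .mk (h.val.mul h'.val) (fun k hk j => ?_) (fun k hk => ?_)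
  . subst hk
    simp only [Derivation.leibniz, smul_eq_mul]
    have e1 := ih1 k rfl (h.down le_rfl (Nat.le_succ _)) (h'.dd j)
    have e2 := ih1 k rfl (h'.down le_rfl (Nat.le_succ _)) (h.dd j)
    exact (e1.trans (Ls.eq fun i => by ring)).add (e2.trans (Ls.eq fun i => by ring))
  . subst hk
    simp only [Derivation.leibniz, smul_eq_mul]
    have e1 := ih2 k rfl (h.down (Nat.le_succ _) le_rfl) h'.DD
    have e2 := ih2 k rfl (h'.down (Nat.le_succ _) le_rfl) h.DD
    exact (e1.trans (Ls.eq fun i => by ring)).add (e2.trans (Ls.eq fun i => by ring))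
theorem mul' {D : ι -> ℝ} (h : Cl c r m A F) (h' : Cl c r m B G)
    (hD : Ls (fun i => A i * B i) D) : Cl c r m D (fun i => F i * G i) := (h.mul h').trans hD
/-- Multiplication by a bounded factor. -/
theorem mul1 (h : Cl c r m (fun _ => 1) F) (h' : Cl c r m B G) :
    Cl c r m B (fun i => F i * G i) := h.mul' h' (Ls.eq fun i => by ring)
theorem mul1' (h : Cl c r m A F) (h' : Cl c r m (fun _ => 1) G) :
    Cl c r m A (fun i => F i * G i) := h.mul' h' (Ls.eq fun i => by ring)
theorem cst (z : ι -> ℂ) (hz : Ls z A) : Cl c r m A (fun i => Sm.cst (z i)) := by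
  refine .mk ?_ (fun k hk j => ?_) (fun k hk => ?_)
  . simpa using hz
  . simpa using zero
  . simpa using zero
theorem one : Cl c r m (fun _ => 1) (fun _ => 1) := by
  simpa using cst (c := c) (r := r) (m := m) (fun _ => 1) (Ls.of 1 (by simp) : Ls _ (fun _ => (1 : ℝ)))
theorem cst1 (z : ℂ) : Cl c r m (fun _ => 1) (fun _ => Sm.cst z) :=
  cst _ (Ls.of ‖z‖ (by simp))
theorem cj (hu : ∀ i j, Re (c.u i j)) (h : Cl c r m A F) : Cl c r m A (fun i => Sm.cj (F i)) := by
  induction h with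
  | @mk r m A F h0 h1 h2 ih1 ih2 =>
    refine .mk ?_ (fun k hk j => ?_) (fun k hk => ?_)
    . simp only [cj_apply]
      have := Asymptotics.isBigO_norm_left.mpr h0
      refine Asymptotics.isBigO_norm_left.mp ?_
      simpa using this
    . simpa [cj_dd] using ih1 k hk j
    . have e : ∀ i, Sm.DD (c.u i) (Sm.cj (F i)) = Sm.cj (Sm.DD (c.u i) (F i)) := by
        intro i
        have := hu i
        unfold Re at this
        simp [DD_apply, cj_dd, cj_dt, this]
      simp only [e]; exact ih2 k hk
/-- Build a `Cl (r+1)` bound from a bound on the advective derivative. -/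
theorem build (h : Cl c r m A F)
    (hD : Cl c r m (fun i => A i * c.nu i) (fun i => Sm.DD (c.u i) (F i)))
    (hu : ∀ j k, Cl c r m c.nu (fun i => Sm.dd j (c.u i k))) : Cl c (r + 1) m A F := by
  induction m generalizing A F with
  | zero => exact .mk h.val (fun k hk => by omega) (fun k hk => by
      obtain rfl : r = k := by omega
      exact hD)
  | succ m ih =>
    refine .mk h.val (fun k hk j => ?_) (fun k hk => by
      obtain rfl : r = k := by omega
      exact hD)
    obtain rfl : m = k := by omega
    refine ih (h.dd j) ?_ (fun j k => (hu j k).down le_rfl (Nat.le_succ _))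
    simp only [DD_dd]
    refine Cl.sub ((hD.dd j).trans (Ls.eq fun i => by ring)) (Cl.sum _ fun k _ => ?_)
    exact ((hu j k).down le_rfl (Nat.le_succ _)).mul' (h.dd k) (Ls.eq fun i => by ring)
theorem pow1 (h : Cl c r m (fun _ => 1) F) (n : ℕ) : Cl c r m (fun _ => 1) (fun i => F i ^ n) := by
  induction n with
  | zero => simpa using one
  | succ n ih => simp only [pow_succ]; exact ih.mul1 h
/-- Inverse square roots: if `H² F = 1`. -/
theorem rs {H : ι -> Sm} (hF : Cl c r m (fun _ => 1) F) (hH : ∀ i, H i * H i * F i = 1)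
    (h0 : Ls (fun i => H i (c.pt i)) (fun _ => 1)) : Cl c r m (fun _ => 1) H := by
  have key : ∀ (d : Derivation ℂ Sm Sm) i, d (H i) = ((-1 / 2 : ℂ)) • (H i ^ 3 * d (F i)) := by
    intro d i
    have e := congrArg d (hH i)
    simp only [Derivation.leibniz, smul_eq_mul, Derivation.map_one_eq_zero] at e
    have e2 : (2 : ℂ) • (d (H i)) = - (H i ^ 3 * d (F i)) := by
      have : (2 : ℂ) • (d (H i)) = 2 * d (H i) := by
        rw [two_smul, two_mul]
      rw [this]
      linear_combination (H i) * e - 2 * d (H i) * hH i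
    have e3 : d (H i) = (1 / 2 : ℂ) • ((2 : ℂ) • (d (H i))) := by
      rw [smul_smul]; norm_num
    rw [e3, e2, smul_neg, <- neg_smul]; congr 1; norm_num
  revert hF
  refine ind (P := fun r m => Cl c r m (fun _ => 1) F -> Cl c r m (fun _ => 1) H) ?_ r m
  intro r m ih1 ih2 hF
  refine .mk h0 (fun k hk j => ?_) (fun k hk => ?_)
  . subst hk
    simp only [key]
    exact Cl.smul _ (((ih1 k rfl (hF.down le_rfl (Nat.le_succ _))).pow1 3).mul1 (hF.dd j))
  . subst hk
    simp only [key]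
    exact Cl.smul _ (((ih2 k rfl (hF.down (Nat.le_succ _) le_rfl)).pow1 3).mul1 hF.DD)
/-- Exponential-type factors. -/
theorem expo {P : Fin 3 -> ι -> Sm} {H : ι -> Sm} (hP : ∀ j, Cl c r m c.mu (P j))
    (hd : ∀ j i, Sm.dd j (H i) = P j i * H i)
    (hD : ∀ i, ∃ S : Set ℝ, IsOpen S ∧ (c.pt i).1 ∈ S ∧ EqS S 0 (Sm.DD (c.u i) (H i)))
    (h0 : Ls (fun i => H i (c.pt i)) (fun _ => 1)) : Cl c r m (fun _ => 1) H := by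
  revert hP
  refine ind (P := fun r m => (∀ j, Cl c r m c.mu (P j)) -> Cl c r m (fun _ => 1) H) ?_ r m
  intro r m ih1 ih2 hP
  refine .mk h0 (fun k hk j => ?_) (fun k hk => ?_)
  . subst hk
    simp only [hd]
    exact ((hP j).down le_rfl (Nat.le_succ _)).mul'
      (ih1 k rfl fun j => (hP j).down le_rfl (Nat.le_succ _)) (Ls.eq fun i => by ring)
  . exact Cl.zero.congr hD
end Cl
end
section
theorem pint_hasFDerivAt {F : Type} [NormedAddCommGroup F] [NormedSpace ℝ F] [CompleteSpace F]
    {Ψ : ℝ × Zt -> F} (h : ContDiff ℝ 1 Ψ) (z : Zt) :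
    HasFDerivAt (fun z => ∫ s in (0:ℝ)..1, Ψ (s, z))
      (∫ s in (0:ℝ)..1, (fderiv ℝ Ψ (s, z)).comp (ContinuousLinearMap.inr ℝ ℝ Zt)) z := by
  have hc : Continuous fun q : ℝ × Zt =>
      (fderiv ℝ Ψ q).comp (ContinuousLinearMap.inr ℝ ℝ Zt) :=
    (h.continuous_fderiv (by simp)).clm_comp continuous_const
  have hK : IsCompact (Set.Icc (0:ℝ) 1 ×ˢ Metric.closedBall z 1) :=
    isCompact_Icc.prod (isCompact_closedBall z 1)
  obtain ⟨M, hM⟩ := hK.exists_bound_of_continuousOn (f := fun q : ℝ × Zt =>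
      (fderiv ℝ Ψ q).comp (ContinuousLinearMap.inr ℝ ℝ Zt)) hc.continuousOn
  refine intervalIntegral.hasFDerivAt_integral_of_dominated_of_fderiv_le
    (F := fun z s => Ψ (s, z))
    (F' := fun z s => (fderiv ℝ Ψ (s, z)).comp (ContinuousLinearMap.inr ℝ ℝ Zt))
    (bound := fun _ => M) (Metric.closedBall_mem_nhds z one_pos) ?_ ?_ ?_ ?_ ?_ ?_
  . refine Filter.Eventually.of_forall fun x => ?_
    have : Continuous fun s => Ψ (s, x) := h.continuous.comp (by fun_prop)
    exact this.aestronglyMeasurable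
  . have : Continuous fun s => Ψ (s, z) := h.continuous.comp (by fun_prop)
    exact this.intervalIntegrable _ _
  . have : Continuous fun s : ℝ => (fderiv ℝ Ψ (s, z)).comp (ContinuousLinearMap.inr ℝ ℝ Zt) :=
      hc.comp (g := fun q : ℝ × Zt => (fderiv ℝ Ψ q).comp (ContinuousLinearMap.inr ℝ ℝ Zt))
        (f := fun s : ℝ => (s, z)) (by fun_prop)
    exact this.aestronglyMeasurable
  . refine Filter.Eventually.of_forall fun s hs x hx => hM (s, x) ⟨?_, hx⟩
    rw [Set.uIoc_of_le zero_le_one] at hs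
    exact ⟨hs.1.le, hs.2⟩
  . exact intervalIntegrable_const
  . refine Filter.Eventually.of_forall fun s _ x _ => ?_
    have h1 : HasFDerivAt Ψ (fderiv ℝ Ψ (s, x)) (s, x) :=
      ((h.differentiable (by simp)) (s, x)).hasFDerivAt
    exact h1.comp x (hasFDerivAt_prodMk_right s x)
theorem pint_contDiff {F : Type} [NormedAddCommGroup F] [NormedSpace ℝ F] [CompleteSpace F]
    {Ψ : ℝ × Zt -> F} (h : ContDiff ℝ ∞ Ψ) :
    ContDiff ℝ ∞ (fun z => ∫ s in (0:ℝ)..1, Ψ (s, z)) := by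
  rw [contDiff_infty]
  intro n
  induction n generalizing F with
  | zero =>
    have : Differentiable ℝ (fun z => ∫ s in (0:ℝ)..1, Ψ (s, z)) := fun z =>
      (pint_hasFDerivAt (h.of_le (by simp)) z).differentiableAt
    exact contDiff_zero.mpr this.continuous
  | succ n ih =>
    rw [show ((n + 1 : ℕ) : WithTop ℕ∞) = (n : WithTop ℕ∞) + 1 by push_cast; rfl,
      contDiff_succ_iff_hasFDerivAt]
    refine ⟨_, ?_, fun z => pint_hasFDerivAt (h.of_le (by simp)) z⟩
    apply ih (Ψ := fun q : ℝ × Zt => (fderiv ℝ Ψ q).comp (ContinuousLinearMap.inr ℝ ℝ Zt))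
    exact (h.fderiv_right (by simp)).clm_comp contDiff_const
namespace Sm
/-- Unit vector in space. -/
abbrev ev (i : Fin 3) : Spc := Pi.single i 1
/-- One-dimensional convolution operator. -/
def cv (ρ : ℝ -> ℝ) (hρ : ContDiff ℝ ∞ ρ) (ε : ℝ) (i : Fin 3) (f : Sm) : Sm :=
  ⟨fun z => ∫ s in (0:ℝ)..1, (ρ s : ℂ) * f (z.1, z.2 + (ε * s) • ev i), by
    apply pint_contDiff (Ψ := fun q : ℝ × Zt => (ρ q.1 : ℂ) * f (q.2.1, q.2.2 + (ε * q.1) • ev i))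
    refine (Complex.ofRealCLM.contDiff.comp (hρ.comp contDiff_fst)).mul (f.smooth.comp ?_)
    fun_prop,
   fun t x k => by
    apply intervalIntegral.integral_congr
    intro s _
    beta_reduce
    have := f.per t (x + (ε * s) • ev i) k
    have e : (fun i_1 => x i_1 + (k i_1 : ℝ)) + (ε * s) • ev i
        = fun i_1 => (x + (ε * s) • ev i) i_1 + (k i_1 : ℝ) := by
      funext j
      simp only [Pi.add_apply]; ring
    simp only [e]
    rw [<- this]⟩
variable (ρ : ℝ -> ℝ) (hρ : ContDiff ℝ ∞ ρ) (ε : ℝ) (i : Fin 3)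
theorem cv_apply (f : Sm) (z : Zt) :
    cv ρ hρ ε i f z = ∫ s in (0:ℝ)..1, (ρ s : ℂ) * f (z.1, z.2 + (ε * s) • ev i) := rfl
theorem cv_cont (ρ : ℝ -> ℝ) (hρ : ContDiff ℝ ∞ ρ) (ε : ℝ) (i : Fin 3) (f : Sm) (z : Zt) :
    Continuous fun s : ℝ => (ρ s : ℂ) * f (z.1, z.2 + (ε * s) • ev i) := by
  have h1 := hρ.continuous
  have h2 := f.cont
  fun_prop
theorem cv_add (f g : Sm) : cv ρ hρ ε i (f + g) = cv ρ hρ ε i f + cv ρ hρ ε i g := ext' fun z => by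
  simp only [cv_apply, coe_add, mul_add]
  exact intervalIntegral.integral_add ((cv_cont ρ hρ ε i f z).intervalIntegrable _ _)
    ((cv_cont ρ hρ ε i g z).intervalIntegrable _ _)
theorem cv_smul (a : ℂ) (f : Sm) : cv ρ hρ ε i (a • f) = a • cv ρ hρ ε i f := ext' fun z => by
  simp only [cv_apply, coe_smul, <- intervalIntegral.integral_const_mul]
  congr 1; funext s; ring
/-- The convolution as a linear map. -/
def cvl : Sm →ₗ[ℂ] Sm :=
  { toFun := cv ρ hρ ε i, map_add' := cv_add ρ hρ ε i, map_smul' := cv_smul ρ hρ ε i }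
theorem cvl_apply (f : Sm) (z : Zt) :
    cvl ρ hρ ε i f z = ∫ s in (0:ℝ)..1, (ρ s : ℂ) * f (z.1, z.2 + (ε * s) • ev i) := rfl
theorem cvl_dv (a : Zt) (f : Sm) : dv a (cvl ρ hρ ε i f) = cvl ρ hρ ε i (dv a f) := by
  apply ext'
  intro z
  have hs : ContDiff ℝ ∞ (fun q : ℝ × Zt => (ρ q.1 : ℂ) * f (q.2.1, q.2.2 + (ε * q.1) • ev i)) := by
    refine (Complex.ofRealCLM.contDiff.comp (hρ.comp contDiff_fst)).mul (f.smooth.comp ?_)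
    fun_prop
  have h := pint_hasFDerivAt (hs.of_le (by simp)) z
  rw [dv_apply]
  change fderiv ℝ (fun z : Zt => ∫ s in (0:ℝ)..1, (ρ s : ℂ) * f (z.1, z.2 + (ε * s) • ev i)) z a = _
  rw [h.fderiv]
  rw [ContinuousLinearMap.intervalIntegral_apply]
  . rw [cvl_apply]
    apply intervalIntegral.integral_congr
    intro s _
    beta_reduce
    rw [dv_apply]
    have e1 : HasFDerivAt (fun y : Zt => (ρ s : ℂ) * f (y + ((0:ℝ), (ε * s) • ev i)))
        ((ρ s : ℂ) • fderiv ℝ f (z + ((0:ℝ), (ε * s) • ev i))) z := by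
      have := (f.diffAt (z + ((0:ℝ), (ε * s) • ev i))).hasFDerivAt
      have := this.comp z ((hasFDerivAt_id z).add_const ((0:ℝ), (ε * s) • ev i))
      exact this.const_mul _
    have e2 := (((hs.differentiable (by simp)) (s, z)).hasFDerivAt).comp z
      (hasFDerivAt_prodMk_right s z)
    have e0 : (fun y : Zt => (ρ s : ℂ) * f (y + ((0:ℝ), (ε * s) • ev i))) =
        ((fun q : ℝ × Zt => (ρ q.1 : ℂ) * f (q.2.1, q.2.2 + (ε * q.1) • ev i)) ∘ Prod.mk s) := by
      funext y
      simp [Prod.add_def]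
    rw [e0] at e1
    have e3 := e1.unique e2
    have e4 := congrArg (fun L : Zt →L[ℝ] ℂ => L a) e3
    simp only [ContinuousLinearMap.smul_apply, smul_eq_mul] at e4
    rw [<- e4]
    simp [Prod.add_def]
  . have hc : Continuous fun q : ℝ × Zt => (fderiv ℝ (fun q : ℝ × Zt => (ρ q.1 : ℂ) * f (q.2.1, q.2.2 + (ε * q.1) • ev i)) q).comp (ContinuousLinearMap.inr ℝ ℝ Zt) :=
      (hs.continuous_fderiv (by simp)).clm_comp continuous_const
    exact (hc.comp (f := fun s : ℝ => (s, z)) (by fun_prop)).intervalIntegrable _ _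
theorem cvl_dd (j : Fin 3) (f : Sm) : dd j (cvl ρ hρ ε i f) = cvl ρ hρ ε i (dd j f) :=
  cvl_dv _ _ _ _ _ _
theorem cvl_dt (f : Sm) : dt (cvl ρ hρ ε i f) = cvl ρ hρ ε i (dt f) := cvl_dv _ _ _ _ _ _
theorem cvl_re {f : Sm} (hf : Re f) : Re (cvl ρ hρ ε i f) := by
  apply ext'
  intro z
  rw [cj_apply, cvl_apply, intervalIntegral.integral_of_le zero_le_one, <- integral_conj]
  congr 1
  funext s
  have := congrArg (fun g : Sm => g (z.1, z.2 + (ε * s) • ev i)) hf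
  simp only [cj_apply] at this
  simp [this]
theorem cvl_bound (f : Sm) (z : Zt) (B A : ℝ) (hB : ∀ s ∈ Set.Icc (0:ℝ) 1, |ρ s| <= B)
    (hA : ∀ s ∈ Set.Icc (0:ℝ) 1, ‖f (z.1, z.2 + (ε * s) • ev i)‖ <= A) :
    ‖cvl ρ hρ ε i f z‖ <= B * A := by
  rw [cvl_apply]
  have := intervalIntegral.norm_integral_le_of_norm_le_const (a := (0:ℝ)) (b := 1) (C := B * A)
    (f := fun s => (ρ s : ℂ) * f (z.1, z.2 + (ε * s) • ev i)) (by
      intro s hs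
      rw [Set.uIoc_of_le zero_le_one] at hs
      have hs' : s ∈ Set.Icc (0:ℝ) 1 := ⟨hs.1.le, hs.2⟩
      rw [norm_mul]
      have h0 : 0 <= B := (abs_nonneg _).trans (hB s hs')
      refine mul_le_mul ?_ (hA s hs') (norm_nonneg _) h0
      simpa using hB s hs')
  simpa using this
/-- Derivative along a line. -/
theorem line_hasDerivAt (f : Sm) (z : Zt) (s : ℝ) :
    HasDerivAt (fun s : ℝ => f (z.1, z.2 + (ε * s) • ev i))
      (ε * dd i f (z.1, z.2 + (ε * s) • ev i)) s := by
  have h1 : HasDerivAt (fun s : ℝ => ((z.1, z.2 + (ε * s) • ev i) : Zt)) ((0:ℝ), ε • ev i) s := by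
    refine (hasDerivAt_const _ _).prodMk ?_
    have : HasDerivAt (fun s : ℝ => (ε * s) • ev i) (ε • ev i) s := by
      simpa using ((hasDerivAt_id s).const_mul ε).smul_const (ev i)
    exact this.const_add _
  have h2 := (f.diffAt (z.1, z.2 + (ε * s) • ev i)).hasFDerivAt.comp_hasDerivAt s h1
  refine HasDerivAt.congr_deriv h2 ?_
  rw [show (((0:ℝ), ε • ev i) : Zt) = ε • ((0:ℝ), ev i) by simp, map_smul]
  rw [Complex.real_smul]
  rfl
/-- Integration by parts along the line. -/
theorem cvl_parts (f : Sm) (z : Zt) :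
    (ε : ℂ) * cvl ρ hρ ε i (dd i f) z =
      (ρ 1 : ℂ) * f (z.1, z.2 + ε • ev i) - (ρ 0 : ℂ) * f z
        - cvl (deriv ρ) (deriv_smooth hρ) ε i f z := by
  have hρ' : ∀ s, HasDerivAt (fun s => (ρ s : ℂ)) ((deriv ρ s : ℝ) : ℂ) s := fun s =>
    ((hρ.differentiable (by simp)) s).hasDerivAt.ofReal_comp
  have := intervalIntegral.integral_mul_deriv_eq_deriv_mul (a := (0:ℝ)) (b := 1)
    (fun s _ => hρ' s) (fun s _ => line_hasDerivAt ε i f z s)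
    ((Complex.continuous_ofReal.comp (deriv_smooth hρ).continuous).intervalIntegrable _ _)
    ((by have := (dd i f).cont; fun_prop : Continuous fun s : ℝ =>
      (ε * dd i f (z.1, z.2 + (ε * s) • ev i) : ℂ)).intervalIntegrable _ _)
  rw [cvl_apply, cvl_apply, <- intervalIntegral.integral_const_mul]
  simp only [mul_one, mul_zero, zero_smul, add_zero, Prod.mk.eta] at this
  rw [<- this]
  congr 1; funext s; ring
end Sm
end
section
theorem Ls.of' {ι E : Type} [SeminormedAddCommGroup E] {f : ι -> E} {g : ι -> ℝ} (C : ℝ)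
    (h : ∀ i, ‖f i‖ <= C * |g i|) : Ls f g :=
  Asymptotics.IsBigO.of_bound C (by simpa using h)
namespace Sm
/-- Average in the direction `i`. -/
def av (i : Fin 3) : Sm →ₗ[ℂ] Sm := cvl (fun _ => 1) contDiff_const 1 i
def jr (i : Fin 3) : Sm →ₗ[ℂ] Sm := cvl (fun s => s - 1 / 2) (by fun_prop) 1 i
theorem shift (f : Sm) (z : Zt) (i : Fin 3) : f (z.1, z.2 + ev i) = f z := by
  have := f.per z.1 z.2 (Pi.single i 1)
  have e : z.2 + ev i = fun j => z.2 j + ((Pi.single i 1 : Fin 3 -> ℤ) j : ℝ) := by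
    funext j
    by_cases h : j = i
    . subst h; simp
    . simp [h]
  rw [e, this]
theorem av_apply (i : Fin 3) (f : Sm) (z : Zt) :
    av i f z = ∫ s in (0:ℝ)..1, f (z.1, z.2 + s • ev i) := by
  unfold av; rw [cvl_apply]; simp
theorem dd_av (i : Fin 3) (f : Sm) : dd i (av i f) = 0 := by
  apply ext'; intro z
  unfold av
  rw [cvl_dd]
  have := cvl_parts (fun _ => 1) contDiff_const 1 i f z
  simp only [Complex.ofReal_one, one_mul, one_smul, shift] at this
  rw [this, cvl_apply]
  simp
theorem dd_jr (i : Fin 3) (f : Sm) : dd i (jr i f) = f - av i f := by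
  apply ext'; intro z
  unfold jr
  rw [cvl_dd]
  have := cvl_parts (fun s => s - 1 / 2) (by fun_prop) 1 i f z
  simp only [Complex.ofReal_one, one_mul, one_smul, shift] at this
  rw [this, cvl_apply, coe_sub, av_apply]
  simp
  ring
theorem const_of_dd {i : Fin 3} {h : Sm} (hh : dd i h = 0) (z : Zt) (s : ℝ) :
    h (z.1, z.2 + s • ev i) = h z := by
  have h1 : ∀ s, HasDerivAt (fun s : ℝ => h (z.1, z.2 + (1 * s) • ev i)) 0 s := by
    intro s
    have := line_hasDerivAt 1 i h z s
    rw [hh] at this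
    simpa using this
  have := is_const_of_deriv_eq_zero (fun s => (h1 s).differentiableAt) (fun s => (h1 s).deriv) s 0
  simpa using this
theorem cvl_mul_const (ρ : ℝ -> ℝ) (hρ : ContDiff ℝ ∞ ρ) (ε : ℝ) (i : Fin 3) {h : Sm}
    (hh : dd i h = 0) (f : Sm) : cvl ρ hρ ε i (h * f) = h * cvl ρ hρ ε i f := by
  apply ext'; intro z
  rw [coe_mul, cvl_apply, cvl_apply, <- intervalIntegral.integral_const_mul]
  congr 1
  funext s
  rw [coe_mul, const_of_dd hh]; ring
theorem av_mul_const {i : Fin 3} {h : Sm} (hh : dd i h = 0) (f : Sm) :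
    av i (h * f) = h * av i f := cvl_mul_const _ _ _ _ hh f
theorem av_one (i : Fin 3) : av i 1 = 1 := by
  apply ext'; intro z; rw [av_apply]; simp
theorem av_of_dd {i : Fin 3} {h : Sm} (hh : dd i h = 0) : av i h = h := by
  have := av_mul_const hh 1
  rwa [mul_one, av_one, mul_one] at this
/-- Mean-zero primitive in direction `i`. -/
def jp (i : Fin 3) : Sm →ₗ[ℂ] Sm := jr i - (av i).comp (jr i)
theorem av_dd (i j : Fin 3) (f : Sm) : dd j (av i f) = av i (dd j f) := cvl_dd _ _ _ _ _ _
theorem av_dt (i : Fin 3) (f : Sm) : dt (av i f) = av i (dt f) := cvl_dt _ _ _ _ _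
theorem jr_dd (i j : Fin 3) (f : Sm) : dd j (jr i f) = jr i (dd j f) := cvl_dd _ _ _ _ _ _
theorem jp_apply (i : Fin 3) (f : Sm) : jp i f = jr i f - av i (jr i f) := rfl
theorem jp_dd (i j : Fin 3) (f : Sm) : dd j (jp i f) = jp i (dd j f) := by
  simp only [jp_apply, map_sub, av_dd, jr_dd]
theorem dd_jp (i : Fin 3) (f : Sm) : dd i (jp i f) = f - av i f := by
  simp only [jp_apply, map_sub, dd_jr, dd_av, sub_zero]
theorem av_jp (i : Fin 3) (f : Sm) : av i (jp i f) = 0 := by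
  simp only [jp_apply, map_sub, av_of_dd (dd_av i (jr i f)), sub_self]
/-- Full average. -/
def aV (f : Sm) : Sm := av 2 (av 1 (av 0 f))
theorem aV_add (f g : Sm) : aV (f + g) = aV f + aV g := by simp [aV]
theorem aV_sub (f g : Sm) : aV (f - g) = aV f - aV g := by simp [aV]
theorem aV_dt (f : Sm) : dt (aV f) = aV (dt f) := by simp only [aV, av_dt]
theorem aV_dd' (j : Fin 3) (f : Sm) : dd j (aV f) = aV (dd j f) := by simp only [aV, av_dd]
theorem dd_aV (j : Fin 3) (f : Sm) : dd j (aV f) = 0 := by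
  fin_cases j
  . show dd 0 (av 2 (av 1 (av 0 f))) = 0
    rw [av_dd, av_dd, dd_av]; simp
  . show dd 1 (av 2 (av 1 (av 0 f))) = 0
    rw [av_dd, dd_av]; simp
  . exact dd_av _ _
theorem aV_dd (j : Fin 3) (f : Sm) : aV (dd j f) = 0 := by rw [<- aV_dd', dd_aV]
theorem aV_sum {κ : Type*} (s : Finset κ) (f : κ -> Sm) : aV (∑ k ∈ s, f k) = ∑ k ∈ s, aV (f k) := by
  simp [aV]
theorem aV_re {f : Sm} (h : Re f) : Re (aV f) :=
  cvl_re _ _ _ _ (cvl_re _ _ _ _ (cvl_re _ _ _ _ h))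
/-- Directional inverse divergence. -/
def Ti (i : Fin 3) (r : Fin 3 -> Sm) (j l : Fin 3) : Sm :=
  if j = i then
    if l = i then jp i (r i) - jp i (∑ k, if k = i then 0 else dd k (jp i (r k)))
    else jp i (r l)
  else if l = i then jp i (r j) else 0
theorem Ti_symm (i : Fin 3) (r : Fin 3 -> Sm) (j l : Fin 3) : Ti i r j l = Ti i r l j := by
  unfold Ti
  by_cases h : j = i <;> by_cases h' : l = i <;> simp [h, h']
theorem Ti_div (i : Fin 3) (r : Fin 3 -> Sm) (l : Fin 3) :
    ∑ j, dd j (Ti i r j l) = r l - av i (r l) := by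
  have key : ∀ j, av i (dd j (jp i (r j))) = 0 := by
    intro j; rw [<- av_dd, av_jp]; simp
  have k2 := fun f => dd_jp i f
  by_cases h : l = i
  . subst h
    have e : ∀ j, dd j (Ti l r j l) = (if j = l then r l - av l (r l) -
        (∑ k, if k = l then 0 else dd k (jp l (r k))) else dd j (jp l (r j))) := by
      intro j
      by_cases hj : j = l
      . subst hj
        simp only [Ti, if_true, map_sub, k2, map_sum]
        have : ∑ k, (av j (if k = j then 0 else dd k (jp j (r k)))) = 0 := by
          apply sum_eq_zero; intro k _
          by_cases hk : k = j <;> simp [hk, key]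
        rw [sum_sub_distrib, this]; simp
      . simp [Ti, hj]
    simp only [e]
    fin_cases l <;> simp [Fin.sum_univ_three] <;> ring
  . have e : ∀ j, dd j (Ti i r j l) = if j = i then r l - av i (r l) else 0 := by
      intro j
      by_cases hj : j = i
      . subst hj; simp [Ti, h, k2]
      . simp [Ti, hj, h]
    simp only [e]; simp
/-- Inverse divergence. -/
def TT (r : Fin 3 -> Sm) (j l : Fin 3) : Sm :=
  Ti 0 r j l + Ti 1 (fun l => av 0 (r l)) j l + Ti 2 (fun l => av 1 (av 0 (r l))) j l
theorem TT_symm (r : Fin 3 -> Sm) (j l : Fin 3) : TT r j l = TT r l j := by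
  unfold TT
  rw [Ti_symm 0, Ti_symm 1, Ti_symm 2]
theorem TT_div (r : Fin 3 -> Sm) (l : Fin 3) : ∑ j, dd j (TT r j l) = r l - aV (r l) := by
  unfold TT
  simp only [map_add, sum_add_distrib, Ti_div, aV]
  ring
end Sm
/-- Nonlocal operators, local in time. -/
structure Nl (O : Sm →ₗ[ℂ] Sm) : Prop where
  hd : ∀ j f, dd j (O f) = O (dd j f)
  ht : ∀ f, dt (O f) = O (dt f)
  hc : ∀ h f, (∀ j, dd j h = 0) -> O (h * f) = h * O f
  hb : ∃ B : ℝ, 0 <= B ∧ ∀ (t A : ℝ) f, (∀ x, ‖f (t, x)‖ <= A) -> ∀ x, ‖O f (t, x)‖ <= B * A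
theorem Nl.cvlN (ρ : ℝ -> ℝ) (hρ : ContDiff ℝ ∞ ρ) (ε : ℝ) (i : Fin 3) : Nl (cvl ρ hρ ε i) where
  hd := fun j f => cvl_dd ρ hρ ε i j f
  ht := fun f => cvl_dt ρ hρ ε i f
  hc := fun h f hh => cvl_mul_const ρ hρ ε i (hh i) f
  hb := by
    obtain ⟨B, hB⟩ := (isCompact_Icc (a := (0:ℝ)) (b := 1)).exists_bound_of_continuousOn
      hρ.continuous.continuousOn
    refine ⟨B, (norm_nonneg _).trans (hB 0 (by simp)), fun t A f h x => ?_⟩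
    exact cvl_bound ρ hρ ε i f (t, x) B A hB (fun s _ => h _)
theorem Nl.comp {O O' : Sm →ₗ[ℂ] Sm} (h : Nl O) (h' : Nl O') : Nl (O.comp O') where
  hd := fun j f => by simp [h.hd, h'.hd]
  ht := fun f => by simp [h.ht, h'.ht]
  hc := fun k f hh => by simp [h.hc _ _ hh, h'.hc _ _ hh]
  hb := by
    obtain ⟨B, hB, h1⟩ := h.hb
    obtain ⟨B', hB', h2⟩ := h'.hb
    refine ⟨B * B', mul_nonneg hB hB', fun t A f h x => ?_⟩
    rw [mul_assoc]
    exact h1 t _ _ (h2 t A f h) x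
theorem Nl.sub {O O' : Sm →ₗ[ℂ] Sm} (h : Nl O) (h' : Nl O') : Nl (O - O') where
  hd := fun j f => by simp [h.hd, h'.hd]
  ht := fun f => by simp [h.ht, h'.ht]
  hc := fun k f hh => by simp [h.hc _ _ hh, h'.hc _ _ hh, mul_sub]
  hb := by
    obtain ⟨B, hB, h1⟩ := h.hb
    obtain ⟨B', hB', h2⟩ := h'.hb
    refine ⟨B + B', add_nonneg hB hB', fun t A f h x => ?_⟩
    rw [add_mul]
    exact (norm_sub_le _ _).trans (add_le_add (h1 t A f h x) (h2 t A f h x))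
theorem Nl.avN (i : Fin 3) : Nl (av i) := Nl.cvlN _ _ _ _
theorem Nl.jpN (i : Fin 3) : Nl (jp i) := (Nl.cvlN _ _ _ _).sub ((Nl.avN i).comp (Nl.cvlN _ _ _ _))
theorem Nl.DDN {O : Sm →ₗ[ℂ] Sm} (h : Nl O) (u : Fin 3 -> Sm) (f : Sm) :
    Sm.DD u (O f) = O (Sm.DD u f) - ∑ i, O ((u i - aV (u i)) * dd i f)
      + ∑ i, (u i - aV (u i)) * O (dd i f) := by
  have e : ∀ i, O (Sm.aV (u i) * dd i f) = Sm.aV (u i) * O (dd i f) := fun i =>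
    h.hc _ _ (fun j => dd_aV j (u i))
  simp only [DD_apply, map_add, map_sum, sub_mul, map_sub, e, h.ht, h.hd, sum_sub_distrib]
  ring
/-- Context with all space points. -/
def cx {κ : Type} (tm : κ -> ℝ) (u : κ -> Fin 3 -> Sm) (mu nu : κ -> ℝ) : Ctx (κ × Spc) where
  pt := fun i => (tm i.1, i.2)
  u := fun i => u i.1
  mu := fun i => mu i.1
  nu := fun i => nu i.1
section
variable {κ : Type} {tm : κ -> ℝ} {u : κ -> Fin 3 -> Sm} {mu nu A : κ -> ℝ} {F : κ -> Sm} {m : ℕ}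
theorem Nl.ls {O : Sm →ₗ[ℂ] Sm} (h : Nl O)
    (hF : Ls (fun i : κ × Spc => F i.1 (tm i.1, i.2)) (fun i => A i.1)) :
    Ls (fun i : κ × Spc => O (F i.1) (tm i.1, i.2)) (fun i => A i.1) := by
  obtain ⟨C, hC, h1⟩ := hF.bound
  obtain ⟨B, hB, h2⟩ := h.hb
  apply Asymptotics.isBigO_norm_right.mp
  refine Ls.of (B * C) fun i => ?_
  rw [mul_assoc]
  exact h2 (tm i.1) _ _ (fun x => h1 (i.1, x)) i.2
theorem Nl.cl0 {O : Sm →ₗ[ℂ] Sm} (h : Nl O)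
    (hF : Cl (cx tm u mu nu) 0 m (fun i => A i.1) (fun i => F i.1)) :
    Cl (cx tm u mu nu) 0 m (fun i => A i.1) (fun i => O (F i.1)) := by
  induction m generalizing A F with
  | zero => exact .mk (h.ls hF.val) (fun k hk => by omega) (fun k hk => by omega)
  | succ m ih =>
    refine .mk (h.ls hF.val) (fun k hk j => ?_) (fun k hk => by omega)
    obtain rfl : m = k := by omega
    simp only [h.hd]
    exact ih (A := fun i => A i * mu i) (F := fun i => dd j (F i)) (hF.dd j)
/-- Oscillation of the velocity around its mean. -/
theorem osc_cl (hu : ∀ j k, Cl (cx tm u mu nu) 0 m (fun i => A i.1) (fun i => Sm.dd j (u i.1 k)))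
    (k : Fin 3) : Cl (cx tm u mu nu) 0 m (fun i => A i.1) (fun i => u i.1 k - aV (u i.1 k)) := by
  have e : ∀ f : Sm, f - aV f = jp 0 (dd 0 f) + jp 1 (av 0 (dd 1 f)) + jp 2 (av 1 (av 0 (dd 2 f))) := by
    intro f
    have h1 : ∀ i f, jp i (dd i f) = f - av i f := fun i f => (jp_dd i i f).symm.trans (dd_jp i f)
    rw [<- av_dd 0, <- av_dd 0, <- av_dd 1, h1, h1, h1, aV]
    ring
  simp only [e]
  have h1 := (Nl.jpN 0).cl0 (F := fun i => dd 0 (u i k)) (hu 0 k)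
  have h2 := (Nl.jpN 1).cl0 (F := fun i => av 0 (dd 1 (u i k)))
    ((Nl.avN 0).cl0 (F := fun i => dd 1 (u i k)) (hu 1 k))
  have h3 := (Nl.jpN 2).cl0 (F := fun i => av 1 (av 0 (dd 2 (u i k))))
    ((Nl.avN 1).cl0 (F := fun i => av 0 (dd 2 (u i k)))
      ((Nl.avN 0).cl0 (F := fun i => dd 2 (u i k)) (hu 2 k)))
  exact (h1.add h2).add h3
theorem Nl.cl1 {O : Sm →ₗ[ℂ] Sm} (h : Nl O)
    (hu : ∀ j k, Cl (cx tm u mu nu) 0 m (fun i => nu i.1) (fun i => Sm.dd j (u i.1 k)))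
    (hmu : ∀ i, 1 <= mu i)
    (hF : Cl (cx tm u mu nu) 1 (m + 1) (fun i => A i.1) (fun i => F i.1)) :
    Cl (cx tm u mu nu) 1 m (fun i => A i.1 * mu i.1) (fun i => O (F i.1)) := by
  have hA : Ls (fun i : κ × Spc => A i.1) (fun i => A i.1 * mu i.1) := by
    refine Ls.of' 1 fun i => ?_
    rw [one_mul, abs_mul, Real.norm_eq_abs, abs_of_nonneg (zero_le_one.trans (hmu i.1))]
    exact le_mul_of_one_le_right (abs_nonneg _) (hmu i.1)
  have h0 := (h.cl0 (F := F) (hF.down (r' := 0) (m' := m) (by omega) (by omega))).trans hA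
  have hA2 : Ls (fun i : κ × Spc => A i.1 * nu i.1) (fun i => A i.1 * mu i.1 * nu i.1) :=
    Ls.mul hA Ls.rfl'
  have ho := fun k => osc_cl (A := nu) hu k
  have hd : ∀ k, Cl (cx tm u mu nu) 0 m (fun i => A i.1 * mu i.1) (fun i => dd k (F i.1)) :=
    fun k => (hF.down (r' := 0) (m' := m + 1) (by omega) le_rfl).dd k
  have hD : Cl (cx tm u mu nu) 0 m (fun i => A i.1 * nu i.1) (fun i => Sm.DD (u i.1) (F i.1)) :=
    hF.DD.down (r' := 0) (m' := m) (by omega) (by omega)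
  have e1 := (h.cl0 (A := fun i => A i * nu i) (F := fun i => Sm.DD (u i) (F i)) hD).trans hA2
  have e2 : ∀ k, Cl (cx tm u mu nu) 0 m (fun i => A i.1 * mu i.1 * nu i.1)
      (fun i => O ((u i.1 k - aV (u i.1 k)) * dd k (F i.1))) := fun k =>
    h.cl0 (A := fun i => A i * mu i * nu i) (F := fun i => (u i k - aV (u i k)) * dd k (F i))
      ((ho k).mul' (hd k) (Ls.eq fun i => by ring))
  have e3 : ∀ k, Cl (cx tm u mu nu) 0 m (fun i => A i.1 * mu i.1 * nu i.1)
      (fun i => (u i.1 k - aV (u i.1 k)) * O (dd k (F i.1))) := fun k =>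
    (ho k).mul' (h.cl0 (A := fun i => A i * mu i) (F := fun i => dd k (F i)) (hd k))
      (Ls.eq fun i => by ring)
  have e4 : Cl (cx tm u mu nu) 0 m (fun i => A i.1 * mu i.1 * nu i.1)
      (fun i => Sm.DD (u i.1) (O (F i.1))) := by
    have := (e1.sub (Cl.sum Finset.univ fun k _ => e2 k)).add (Cl.sum Finset.univ fun k _ => e3 k)
    simp only [h.DDN]
    exact this
  exact h0.build e4 hu
theorem Ti.cl1 (d : Fin 3) {F : Fin 3 -> κ -> Sm}
    (hu : ∀ m j k, Cl (cx tm u mu nu) 0 m (fun i => nu i.1) (fun i => Sm.dd j (u i.1 k)))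
    (hmu : ∀ i, 1 <= mu i)
    (hF : ∀ l m, Cl (cx tm u mu nu) 1 m (fun i => A i.1) (fun i => F l i.1)) (j l : Fin 3) (m : ℕ) :
    Cl (cx tm u mu nu) 1 m (fun i => A i.1 * mu i.1 * mu i.1 * mu i.1) (fun i => Ti d (fun l => F l i.1) j l) := by
  have hA : ∀ A : κ -> ℝ, Ls (fun i : κ × Spc => A i.1) (fun i => A i.1 * mu i.1) := by
    intro A
    refine Ls.of' 1 fun i => ?_
    rw [one_mul, abs_mul, Real.norm_eq_abs, abs_of_nonneg (zero_le_one.trans (hmu i.1))]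
    exact le_mul_of_one_le_right (abs_nonneg _) (hmu i.1)
  have h1 : ∀ l m, Cl (cx tm u mu nu) 1 m (fun i => A i.1 * mu i.1) (fun i => jp d (F l i.1)) :=
    fun l m => (Nl.jpN d).cl1 (F := F l) (hu m) hmu (hF l (m + 1))
  have h2 : ∀ l m, Cl (cx tm u mu nu) 1 m (fun i => A i.1 * mu i.1 * mu i.1 * mu i.1) (fun i => jp d (F l i.1)) :=
    fun l m => ((h1 l m).trans (hA fun i => A i * mu i)).trans (hA fun i => A i * mu i * mu i)
  unfold Ti
  by_cases hj : j = d <;> by_cases hl : l = d <;> simp only [hj, hl, if_true, if_false]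
  . refine (h2 d m).sub ?_
    refine (Nl.jpN d).cl1 (A := fun i => A i * mu i * mu i)
      (F := fun i => ∑ k, if k = d then 0 else dd k (jp d (F k i))) (hu m) hmu ?_
    refine Cl.sum _ fun k _ => ?_
    by_cases hk : k = d
    . simp only [hk, if_true]; exact Cl.zero
    . simp only [hk, if_false]; exact (h1 k (m + 1 + 1)).dd k
  . exact h2 l m
  . exact h2 j m
  . exact Cl.zero
theorem TT.cl1 {F : Fin 3 -> κ -> Sm}
    (hu : ∀ m j k, Cl (cx tm u mu nu) 0 m (fun i => nu i.1) (fun i => Sm.dd j (u i.1 k)))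
    (hmu : ∀ i, 1 <= mu i)
    (hF : ∀ l m, Cl (cx tm u mu nu) 1 m (fun i => A i.1) (fun i => F l i.1)) (j l : Fin 3) (m : ℕ) :
    Cl (cx tm u mu nu) 1 m (fun i => A i.1 * mu i.1 ^ 5) (fun i => TT (fun l => F l i.1) j l) := by
  have hA : ∀ A : κ -> ℝ, Ls (fun i : κ × Spc => A i.1) (fun i => A i.1 * mu i.1) := by
    intro A
    refine Ls.of' 1 fun i => ?_
    rw [one_mul, abs_mul, Real.norm_eq_abs, abs_of_nonneg (zero_le_one.trans (hmu i.1))]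
    exact le_mul_of_one_le_right (abs_nonneg _) (hmu i.1)
  have h1 : ∀ l m, Cl (cx tm u mu nu) 1 m (fun i => A i.1 * mu i.1) (fun i => av 0 (F l i.1)) :=
    fun l m => (Nl.avN 0).cl1 (F := F l) (hu m) hmu (hF l (m + 1))
  have h2 : ∀ l m, Cl (cx tm u mu nu) 1 m (fun i => A i.1 * mu i.1 * mu i.1) (fun i => av 1 (av 0 (F l i.1))) :=
    fun l m => (Nl.avN 1).cl1 (F := fun i => av 0 (F l i)) (A := fun i => A i * mu i) (hu m) hmu (h1 l (m + 1))
  unfold TT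
  refine ((((Ti.cl1 0 hu hmu hF j l m).trans (hA fun i => A i * mu i * mu i * mu i)).trans
    (hA fun i => A i * mu i * mu i * mu i * mu i)).trans (Ls.eq fun i => by ring) |>.add ?_).add ?_
  . exact ((Ti.cl1 1 (F := fun l i => av 0 (F l i)) (A := fun i => A i * mu i) hu hmu h1 j l m).trans
      (hA fun i => A i * mu i * mu i * mu i * mu i)).trans (Ls.eq fun i => by ring)
  . exact (Ti.cl1 2 (F := fun l i => av 1 (av 0 (F l i))) (A := fun i => A i * mu i * mu i) hu hmu h2 j l m).trans
      (Ls.eq fun i => by ring)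
end
end
section
namespace Sm
theorem slice (f : Sm) (t : ℝ) (x : Spc) : HasFDerivAt (fun y => f (t, y))
    ((fderiv ℝ f (t, x)).comp (ContinuousLinearMap.inr ℝ ℝ Spc)) x :=
  (f.diffAt (t, x)).hasFDerivAt.comp x (hasFDerivAt_prodMk_right t x)
theorem slice_cont (f : Sm) (t : ℝ) : Continuous fun y => f (t, y) := f.cont.comp (by fun_prop)
theorem int_dd (i : Fin 3) (f : Sm) (t : ℝ) :
    ∫ x in Set.Icc (0 : Spc) 1, dd i f (t, x) = 0 := by
  have h := integral_divergence_of_hasFDerivAt_off_countable' (n := 2) (E := ℂ) (0 : Spc) 1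
    (by intro j; simp) (fun j y => if j = i then f (t, y) else 0)
    (fun j y => if j = i then (fderiv ℝ f (t, y)).comp (ContinuousLinearMap.inr ℝ ℝ Spc) else 0)
    ∅ Set.countable_empty
    (fun j => by
      by_cases hj : j = i
      . simp only [hj, if_true]; exact (slice_cont f t).continuousOn
      . simp only [hj, if_false]; exact continuousOn_const)
    (fun x _ j => by
      by_cases hj : j = i
      . simp only [hj, if_true]; exact slice f t x
      . simp only [hj, if_false]; exact hasFDerivAt_const _ _)
    (by
      have e : (fun y : Spc => ∑ j, (if j = i then (fderiv ℝ f (t, y)).comp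
          (ContinuousLinearMap.inr ℝ ℝ Spc) else 0) (Pi.single j 1)) = fun y => dd i f (t, y) := by
        funext y
        rw [sum_eq_single i]
        . simp; rfl
        . intro j _ hj; simp [hj]
        . simp
      rw [e]
      exact (slice_cont (dd i f) t).continuousOn.integrableOn_compact isCompact_Icc)
  have e : ∀ y : Spc, ∑ j, (if j = i then (fderiv ℝ f (t, y)).comp
      (ContinuousLinearMap.inr ℝ ℝ Spc) else 0) (Pi.single j 1) = dd i f (t, y) := by
    intro y
    rw [sum_eq_single i]
    . simp; rfl
    . intro j _ hj; simp [hj]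
    . simp
  simp only [e] at h
  rw [h]
  apply sum_eq_zero
  intro j _
  by_cases hj : j = i
  . simp only [hj, if_true, Pi.zero_apply, Pi.one_apply]
    rw [sub_eq_zero]
    congr 1
    funext x
    have h1 := f.shift (t, i.insertNth (0:ℝ) x) i
    have e1 : i.insertNth (1:ℝ) x = i.insertNth (0:ℝ) x + ev i := by
      funext k
      refine Fin.succAboveCases i ?_ ?_ k
      . simp [ev]
      . intro k; simp [ev]
    rw [e1]; exact h1
  . simp [hj]
theorem int_Tdom (f : Sm) (t : ℝ) (y : Spc) : ∫ x in Tdom, f (t, x) = aV f (t, y) := by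
  have e0 : ∫ x in Tdom, f (t, x) = ∫ x in Set.Icc (0 : Spc) 1, f (t, x) := by
    apply setIntegral_congr_set
    exact Measure.univ_pi_Ico_ae_eq_Icc (f := (0 : Spc)) (g := 1)
  have e : f = aV f + dd 0 (jp 0 f) + dd 1 (jp 1 (av 0 f)) + dd 2 (jp 2 (av 1 (av 0 f))) := by
    simp only [dd_jp, aV]; ring
  have hc : ∀ x, aV f (t, x) = aV f (t, y) := by
    intro x
    have h0 : ∀ z s i, aV f (z.1, z.2 + s • ev i) = aV f z := fun z s i => const_of_dd (dd_aV i f) z s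
    have e : (t, x) = (t, ((y + (x 0 - y 0) • ev 0) + (x 1 - y 1) • ev 1) + (x 2 - y 2) • ev 2) := by
      congr 1
      funext k
      fin_cases k <;> simp
    rw [e]
    rw [h0 (t, (y + (x 0 - y 0) • ev 0) + (x 1 - y 1) • ev 1), h0 (t, y + (x 0 - y 0) • ev 0), h0 (t, y)]
  have hv : volume (Set.Icc (0:Spc) 1) = 1 := by rw [Real.volume_Icc_pi]; simp
  have hv' : volume.real (Set.Icc (0:Spc) 1) = 1 := by rw [measureReal_def, hv]; simp
  have hv2 : ∀ a : ℂ, IntegrableOn (fun _ => a) (Set.Icc (0:Spc) 1) := fun a =>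
    continuousOn_const.integrableOn_compact isCompact_Icc
  have hi : ∀ g : Sm, IntegrableOn (fun x => g (t, x)) (Set.Icc (0 : Spc) 1) := fun g =>
    (slice_cont g t).continuousOn.integrableOn_compact isCompact_Icc
  rw [e0]
  have e1 : ∀ x, f (t, x) = aV f (t, y) + dd 0 (jp 0 f) (t, x) + dd 1 (jp 1 (av 0 f)) (t, x)
      + dd 2 (jp 2 (av 1 (av 0 f))) (t, x) := by
    intro x
    conv_lhs => rw [e]
    simp [hc]
  simp only [e1]
  rw [integral_add, integral_add, integral_add, int_dd, int_dd, int_dd]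
  . simp [hv']
  . exact hv2 _
  . exact hi _
  . exact (hv2 _).add (hi _)
  . exact hi _
  . exact ((hv2 _).add (hi _)).add (hi _)
  . exact hi _
end Sm
/-- Kernels. -/
def Bp : Type := {ρ : ℝ -> ℝ // ContDiff ℝ ∞ ρ ∧ ∀ s, s ∉ Set.Icc (1 / 4 : ℝ) (3 / 4) -> ρ s = 0}
namespace Bp
def der (ρ : Bp) : Bp := ⟨deriv ρ.1, deriv_smooth ρ.2.1, fun s hs => by
  have : ρ.1 =ᶠ[nhds s] fun _ => 0 := by
    filter_upwards [isClosed_Icc.isOpen_compl.mem_nhds hs] with r hr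
    exact ρ.2.2 r hr
  rw [this.deriv_eq]; simp⟩
def std : Bp := ⟨(ContDiffBump.mk (1 / 8) (1 / 4) (by norm_num) (by norm_num) :
    ContDiffBump (1 / 2 : ℝ)).normed volume, ContDiffBump.contDiff_normed _, fun s hs => by
  by_contra h
  apply hs
  have h1 : s ∈ Function.support ((ContDiffBump.mk (1 / 8) (1 / 4) (by norm_num) (by norm_num) :
    ContDiffBump (1 / 2 : ℝ)).normed volume) := h
  rw [ContDiffBump.support_normed_eq, Metric.mem_ball, Real.dist_eq, abs_lt] at h1
  constructor <;> linarith [h1.1, h1.2]⟩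
theorem std_int : ∫ s in (0:ℝ)..1, std.1 s = 1 := by
  have h := ContDiffBump.integral_normed (μ := volume) (ContDiffBump.mk (1 / 8) (1 / 4) (by norm_num) (by norm_num) :
    ContDiffBump (1 / 2 : ℝ))
  have h' : ∫ s, std.1 s = 1 := h
  refine Eq.trans ?_ h'
  rw [intervalIntegral.integral_of_le zero_le_one]
  apply setIntegral_eq_integral_of_forall_compl_eq_zero
  intro s hs
  apply std.2.2
  intro h
  exact hs ⟨by linarith [h.1], by linarith [h.2]⟩
/-- One-dimensional mollification. -/
def op (ρ : Bp) (ε : ℝ) (i : Fin 3) : Sm →ₗ[ℂ] Sm := cvl ρ.1 ρ.2.1 ε i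
theorem op_dd (ρ : Bp) (ε : ℝ) (i j : Fin 3) (f : Sm) : dd j (ρ.op ε i f) = ρ.op ε i (dd j f) := cvl_dd _ _ _ _ _ _
theorem op_dt (ρ : Bp) (ε : ℝ) (i : Fin 3) (f : Sm) : dt (ρ.op ε i f) = ρ.op ε i (dt f) := cvl_dt _ _ _ _ _
theorem op_re (ρ : Bp) (ε : ℝ) (i : Fin 3) {f : Sm} (h : Re f) : Re (ρ.op ε i f) := cvl_re _ _ _ _ h
theorem dd_op (ρ : Bp) {ε : ℝ} (hε : ε ≠ 0) (i : Fin 3) (f : Sm) :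
    dd i (ρ.op ε i f) = (-(ε : ℂ)⁻¹) • ρ.der.op ε i f := by
  apply ext'; intro z
  rw [op_dd]
  have := cvl_parts ρ.1 ρ.2.1 ε i f z
  rw [ρ.2.2 0 (by norm_num), ρ.2.2 1 (by norm_num)] at this
  have h : (ε : ℂ) ≠ 0 := by exact_mod_cast hε
  have h2 : cvl ρ.1 ρ.2.1 ε i (dd i f) z = (-(ε : ℂ)⁻¹) * cvl (deriv ρ.1) (deriv_smooth ρ.2.1) ε i f z := by
    have this' : (ε : ℂ) * cvl ρ.1 ρ.2.1 ε i (dd i f) z = - cvl (deriv ρ.1) (deriv_smooth ρ.2.1) ε i f z := by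
      rw [this]; simp
    rw [<- mul_right_inj' h, this']; field_simp
  exact h2
theorem bdd (ρ : Bp) : ∃ B : ℝ, 0 <= B ∧ ∀ s ∈ Set.Icc (0:ℝ) 1, |ρ.1 s| <= B := by
  obtain ⟨B, hB⟩ := (isCompact_Icc (a := (0:ℝ)) (b := 1)).exists_bound_of_continuousOn
      ρ.2.1.continuous.continuousOn
  exact ⟨B, (norm_nonneg _).trans (hB 0 (by simp)), hB⟩
theorem std_sub (ε : ℝ) (hε : 0 <= ε) (i : Fin 3) (f : Sm) (t A B : ℝ)
    (hB : ∀ s ∈ Set.Icc (0:ℝ) 1, |std.1 s| <= B)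
    (h : ∀ x, ‖dd i f (t, x)‖ <= A) (x : Spc) : ‖std.op ε i f (t, x) - f (t, x)‖ <= B * (ε * A) := by
  have hA : 0 <= A := (norm_nonneg _).trans (h 0)
  have e : f (t, x) = ∫ s in (0:ℝ)..1, (std.1 s : ℂ) * f (t, x) := by
    rw [intervalIntegral.integral_mul_const, intervalIntegral.integral_ofReal, std_int]; simp
  have e' : std.op ε i f (t, x) - f (t, x) =
      ∫ s in (0:ℝ)..1, (std.1 s : ℂ) * (f (t, x + (ε * s) • ev i) - f (t, x)) := by
    rw [op, cvl_apply]
    conv_lhs => rw [e]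
    rw [<- intervalIntegral.integral_sub]
    . simp only [mul_sub]
    . exact (cv_cont std.1 std.2.1 ε i f (t, x)).intervalIntegrable _ _
    . have := std.2.1.continuous
      exact Continuous.intervalIntegrable (by fun_prop) _ _
  rw [e']
  have := intervalIntegral.norm_integral_le_of_norm_le_const (a := (0:ℝ)) (b := 1) (C := B * (ε * A))
    (f := fun s => (std.1 s : ℂ) * (f (t, x + (ε * s) • ev i) - f (t, x))) (by
      intro s hs
      rw [Set.uIoc_of_le zero_le_one] at hs
      have hs' : s ∈ Set.Icc (0:ℝ) 1 := ⟨hs.1.le, hs.2⟩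
      rw [norm_mul]
      have h0 : 0 <= B := (abs_nonneg _).trans (hB s hs')
      refine mul_le_mul (by simpa using hB s hs') ?_ (norm_nonneg _) h0
      have := Convex.norm_image_sub_le_of_norm_hasDerivWithin_le (s := Set.Icc (0:ℝ) 1) (C := ε * A)
        (f := fun s : ℝ => f (t, x + (ε * s) • ev i)) (x := 0) (y := s)
        (fun r _ => (line_hasDerivAt ε i f (t, x) r).hasDerivWithinAt)
        (fun r _ => by
          rw [norm_mul, Complex.norm_real, Real.norm_of_nonneg hε]
          exact mleL (h _) hε) (convex_Icc _ _) (by simp) hs'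
      simp only [mul_zero, zero_smul, add_zero, sub_zero] at this
      refine this.trans ?_
      rw [Real.norm_of_nonneg hs.1.le]
      exact mul_le_of_le_one_right (mul_nonneg hε hA) hs.2)
  simpa using this
end Bp
/-- Mollification with a product kernel. -/
def mol (ρ : Fin 3 -> Bp) (ε : ℝ) : Sm →ₗ[ℂ] Sm :=
  ((ρ 0).op ε 0).comp (((ρ 1).op ε 1).comp ((ρ 2).op ε 2))
theorem mol_apply (ρ : Fin 3 -> Bp) (ε : ℝ) (f : Sm) :
    mol ρ ε f = (ρ 0).op ε 0 ((ρ 1).op ε 1 ((ρ 2).op ε 2 f)) := rfl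
theorem mol_dd (ρ : Fin 3 -> Bp) (ε : ℝ) (j : Fin 3) (f : Sm) : dd j (mol ρ ε f) = mol ρ ε (dd j f) := by
  simp only [mol_apply, Bp.op_dd]
theorem mol_dt (ρ : Fin 3 -> Bp) (ε : ℝ) (f : Sm) : dt (mol ρ ε f) = mol ρ ε (dt f) := by
  simp only [mol_apply, Bp.op_dt]
theorem mol_re (ρ : Fin 3 -> Bp) (ε : ℝ) {f : Sm} (h : Re f) : Re (mol ρ ε f) :=
  Bp.op_re _ _ _ (Bp.op_re _ _ _ (Bp.op_re _ _ _ h))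
theorem dd_mol (ρ : Fin 3 -> Bp) {ε : ℝ} (hε : ε ≠ 0) (j : Fin 3) (f : Sm) :
    dd j (mol ρ ε f) = (-(ε : ℂ)⁻¹) • mol (Function.update ρ j (ρ j).der) ε f := by
  fin_cases j
  . simp [mol_apply, Bp.dd_op _ hε]
  . simp [mol_apply, Bp.dd_op _ hε, Bp.op_dd]
  . show dd 2 (mol ρ ε f) = (-(ε : ℂ)⁻¹) • mol (Function.update ρ 2 (ρ 2).der) ε f
    rw [mol_apply, mol_apply]
    rw [Bp.op_dd, Bp.op_dd, Bp.dd_op _ hε, map_smul, map_smul]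
    simp
theorem mol_bound (ρ : Fin 3 -> Bp) : ∃ B : ℝ, 0 <= B ∧ ∀ (ε : ℝ) (z : Zt) (A : ℝ) (f : Sm),
    (∀ y : Spc, (∀ j, 0 <= y j ∧ y j <= 1) -> ‖f (z.1, z.2 + ε • y)‖ <= A) -> ‖mol ρ ε f z‖ <= B * A := by
  obtain ⟨B0, h0, H0⟩ := (ρ 0).bdd
  obtain ⟨B1, h1, H1⟩ := (ρ 1).bdd
  obtain ⟨B2, h2, H2⟩ := (ρ 2).bdd
  refine ⟨B0 * (B1 * B2), by positivity, fun ε z A f h => ?_⟩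
  rw [mul_assoc, mul_assoc, mol_apply]
  refine cvl_bound _ _ _ _ _ _ _ _ H0 fun s0 hs0 => ?_
  refine cvl_bound _ _ _ _ _ _ _ _ H1 fun s1 hs1 => ?_
  refine cvl_bound _ _ _ _ _ _ _ _ H2 fun s2 hs2 => ?_
  have := h ![s0, s1, s2] (by
    intro j; fin_cases j
    . exact hs0
    . exact hs1
    . exact hs2)
  convert this using 4
  funext k
  fin_cases k <;> simp
/-- Local estimate for mollification at the frequency of the context. -/
theorem mol_cl {ι : Type} {c : Ctx ι} {A : ι -> ℝ} {h : ι -> Sm} {ε : ι -> ℝ}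
    (hε : ∀ i, ε i * c.mu i = 1)
    (hb : ∃ B : ℝ, ∀ i, ∀ y : Spc, (∀ j, 0 <= y j ∧ y j <= 1) ->
      ‖h i ((c.pt i).1, (c.pt i).2 + ε i • y)‖ <= B * |A i|) (m : ℕ) (ρ : Fin 3 -> Bp) :
    Cl c 0 m A (fun i => mol ρ (ε i) (h i)) := by
  have h0 : ∀ ρ, Ls (fun i => mol ρ (ε i) (h i) (c.pt i)) A := by
    intro ρ
    obtain ⟨B, hB⟩ := hb
    obtain ⟨B', _, hB'⟩ := mol_bound ρ
    refine Ls.of' (B' * B) fun i => ?_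
    rw [mul_assoc]
    exact hB' _ _ _ _ (hB i)
  induction m generalizing ρ with
  | zero => exact .mk (h0 ρ) (fun k hk => by omega) (fun k hk => by omega)
  | succ m ih =>
    refine .mk (h0 ρ) (fun k hk j => ?_) (fun k hk => by omega)
    obtain rfl : m = k := by omega
    have e : ∀ i, dd j (mol ρ (ε i) (h i)) =
        (-(ε i : ℂ)⁻¹) • mol (Function.update ρ j (ρ j).der) (ε i) (h i) := fun i =>
      dd_mol ρ (left_ne_zero_of_mul_eq_one (hε i)) j (h i)
    simp only [e]
    refine (Cl.smulc _ (ih (Function.update ρ j (ρ j).der))).trans ?_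
    refine Ls.of' 1 fun i => ?_
    have : (ε i)⁻¹ = c.mu i := inv_eq_of_mul_eq_one_right (hε i)
    rw [norm_neg, norm_inv, Complex.norm_real, <- norm_inv, this]
    simp [abs_mul, mul_comm]
/-- The standard mollification. -/
def mo (ε : ℝ) : Sm →ₗ[ℂ] Sm := mol (fun _ => Bp.std) ε
theorem mo_sub : ∃ B : ℝ, 0 <= B ∧ ∀ (ε : ℝ) (t A : ℝ) (f : Sm), 0 <= ε ->
    (∀ j x, ‖dd j f (t, x)‖ <= A) -> ∀ x, ‖mo ε f (t, x) - f (t, x)‖ <= B * (ε * A) := by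
  obtain ⟨B, h0, hB⟩ := Bp.std.bdd
  refine ⟨B + B * B + B * (B * B), by positivity, fun ε t A f hε h x => ?_⟩
  have b1 : ∀ j x, ‖dd j (Bp.std.op ε 2 f) (t, x)‖ <= B * A := by
    intro j x
    rw [Bp.op_dd]
    exact cvl_bound _ _ _ _ _ _ _ _ hB fun s _ => h _ _
  have b2 : ∀ j x, ‖dd j (Bp.std.op ε 1 (Bp.std.op ε 2 f)) (t, x)‖ <= B * (B * A) := by
    intro j x
    rw [Bp.op_dd]
    exact cvl_bound _ _ _ _ _ _ _ _ hB fun s _ => b1 _ _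
  have e1 := Bp.std_sub ε hε 2 f t A B hB (h 2) x
  have e2 := Bp.std_sub ε hε 1 _ t _ B hB (b1 1) x
  have e3 := Bp.std_sub ε hε 0 _ t _ B hB (b2 0) x
  have e : mo ε f (t, x) - f (t, x) = (mo ε f (t, x) - Bp.std.op ε 1 (Bp.std.op ε 2 f) (t, x)) +
      (Bp.std.op ε 1 (Bp.std.op ε 2 f) (t, x) - Bp.std.op ε 2 f (t, x)) +
      (Bp.std.op ε 2 f (t, x) - f (t, x)) := by ring
  rw [e]
  refine (norm_add₃_le).trans ?_
  have : ‖mo ε f (t, x) - Bp.std.op ε 1 (Bp.std.op ε 2 f) (t, x)‖ <= B * (ε * (B * (B * A))) := e3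
  calc _ <= B * (ε * (B * (B * A))) + B * (ε * (B * A)) + B * (ε * A) := by linarith
    _ = _ := by ring
end
section
/-- Iterated space derivatives along a word. -/
def wd : List (Fin 3) -> Sm -> Sm
  | [], f => f
  | (i :: w), f => wd w (dd i f)
theorem wd_cl {ι : Type} {c : Ctx ι} {A : ι -> ℝ} {F : ι -> Sm} (m : ℕ) (C : ℝ)
    (h : ∀ (w : List (Fin 3)), w.length <= m -> ∀ i, ‖wd w (F i) (c.pt i)‖ <= C * |A i * c.mu i ^ w.length|) :
    Cl c 0 m A F := by
  induction m generalizing A F with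
  | zero => exact .mk (Ls.of' C fun i => by simpa [wd] using h [] (by simp) i) (fun k hk => by omega) (fun k hk => by omega)
  | succ m ih =>
    refine .mk (Ls.of' C fun i => by simpa [wd] using h [] (by simp) i) (fun k hk j => ?_) (fun k hk => by omega)
    obtain rfl : m = k := by omega
    refine ih fun w hw i => ?_
    have := h (j :: w) (by simpa using hw) i
    rw [wd, List.length_cons, pow_succ'] at this
    simpa [mul_assoc] using this
theorem incr (f : Sm) (t A : ℝ) (h : ∀ j x, ‖dd j f (t, x)‖ <= A) (x y : Spc) (r : ℝ) (hr : ∀ j, |y j| <= r) :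
    ‖f (t, x + y) - f (t, x)‖ <= 3 * (r * A) := by
  have hA : 0 <= A := (norm_nonneg _).trans (h 0 0)
  have one : ∀ (j : Fin 3) (x : Spc) (a : ℝ), |a| <= r -> ‖f (t, x + a • ev j) - f (t, x)‖ <= r * A := by
    intro j x a ha
    have := Convex.norm_image_sub_le_of_norm_hasDerivWithin_le (s := Set.univ) (C := A)
        (f := fun s : ℝ => f (t, x + (1 * s) • ev j)) (x := 0) (y := a)
        (fun r _ => (line_hasDerivAt 1 j f (t, x) r).hasDerivWithinAt)
        (fun r _ => by simpa using h _ _) convex_univ (by simp) (by simp)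
    simp only [one_mul, zero_smul, add_zero, sub_zero, Real.norm_eq_abs] at this
    exact this.trans (by rw [mul_comm]; exact mleR ha hA)
  have e : x + y = ((x + y 0 • ev 0) + y 1 • ev 1) + y 2 • ev 2 := by
    funext k; fin_cases k <;> simp [ev]
  have e0 := one 0 x (y 0) (hr 0)
  have e1 := one 1 (x + y 0 • ev 0) (y 1) (hr 1)
  have e2 := one 2 ((x + y 0 • ev 0) + y 1 • ev 1) (y 2) (hr 2)
  rw [e]
  have := norm_add₃_le (a := f (t, ((x + y 0 • ev 0) + y 1 • ev 1) + y 2 • ev 2) - f (t, (x + y 0 • ev 0) + y 1 • ev 1))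
    (b := f (t, (x + y 0 • ev 0) + y 1 • ev 1) - f (t, x + y 0 • ev 0)) (c := f (t, x + y 0 • ev 0) - f (t, x))
  simp only [sub_add_sub_cancel] at this
  linarith
/-- Normalised input data. -/
structure Dat (L : ℕ) (η C0 K0 : ℝ) where
  X : ℝ
  N : ℝ
  b : ℝ
  E : ℝ
  hX : 2 <= X
  hb : 0 < b
  hE : 0 < E
  h1 : 1 <= N * b ^ 2
  h2 : N * b ^ 3 <= 1
  hη : X ^ η <= N
  v : Fin 3 -> Sm
  p : Sm
  R : Fin 3 -> Fin 3 -> Sm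
  rv : ∀ l, Re (v l)
  rp : Re p
  rR : ∀ j l, Re (R j l)
  symR : ∀ j l, R j l = R l j
  div : ∑ j, dd j (v j) = 0
  eq : ∀ l, dt (v l) + ∑ j, dd j (v j * v l) + dd l p = ∑ j, dd j (R j l)
  bv : ∀ l i w z, w.length + 1 <= L -> ‖wd w (dd i (v l)) z‖ <= X ^ w.length * (X * (N * b ^ 2 * E))
  bp : ∀ i w z, w.length + 1 <= L -> ‖wd w (dd i p) z‖ <= X ^ w.length * (X * (N * b ^ 2 * E) ^ 2)
  ind : ℝ -> ℝ
  bR : ∀ j l w z, w.length <= L -> ‖wd w (R j l) z‖ <= X ^ w.length * (E ^ 2 * ind z.1)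
  bDR : ∀ j l w z, w.length + 1 <= L ->
    ‖wd w (DD v (R j l)) z‖ <= X ^ w.length * (X * (N * b ^ 2 * E) * (E ^ 2 * ind z.1))
  ind0 : ∀ t, 0 <= ind t
  ind1 : ∀ t, ind t <= 1
  g : ℝ -> ℝ
  hg : ContDiff ℝ ∞ g
  bg0 : ∀ t, |g t| <= C0 * (E * ind t)
  bg1 : ∀ t, |deriv g t| <= C0 * (E * ind t * (X * (N * b ^ 2 * E)))
  bg2 : ∀ t, |deriv (deriv g) t| <= C0 * (E * ind t * (X * (N * b ^ 2 * E)) ^ 2)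
  gR : ∀ t s x j l, |t - s| * (X * (N * b ^ 2 * E)) <= 1 -> R j l (s, x) ≠ 0 -> K0 * E ^ 2 <= g t ^ 2
end
variable {L : ℕ} {η C0 K0 : ℝ}
local notation "𝔻" => Dat L η C0 K0
section
namespace Dat
def lam (d : 𝔻) : ℝ := d.N * d.X
def mu (d : 𝔻) : ℝ := d.b * d.lam
def nu (d : 𝔻) : ℝ := d.mu * d.E
def u (d : 𝔻) (k : Fin 3) : Sm := mo (d.mu)⁻¹ (d.v k)
/-- Mollified stress. -/
def Re' (d : 𝔻) (j l : Fin 3) : Sm := mo (d.mu)⁻¹ (d.R j l)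
theorem hN (d : 𝔻) : 0 < d.N := by
  have := d.h1; have := d.hb
  by_contra h
  nlinarith [mul_nonneg (sub_nonneg.2 (not_lt.1 h)) (sq_nonneg d.b)]
theorem hX0 (d : 𝔻) : 0 < d.X := by linarith [d.hX]
theorem b1 (d : 𝔻) : d.b <= 1 := by
  have h1 := d.h1; have h2 := d.h2; have hb := d.hb
  by_contra h
  push Not at h
  nlinarith [mleR h1 hb.le]
theorem N1 (d : 𝔻) : 1 <= d.N := by
  have h1 := d.h1; have hb := d.hb; have hb1 := d.b1; have hN := d.hN
  nlinarith [mleL (show d.b ^ 2 <= 1 by nlinarith) hN.le]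
theorem Nb (d : 𝔻) : 1 <= d.N * d.b := by
  have h1 := d.h1; have hb := d.hb; have hb1 := d.b1; have hN := d.hN
  nlinarith [mleL hb1 (mul_pos hN hb).le]
theorem lam0 (d : 𝔻) : 0 < d.lam := mul_pos d.hN d.hX0
theorem lam1 (d : 𝔻) : 1 <= d.lam := by
  unfold lam; nlinarith [d.N1, d.hX]
theorem mu0 (d : 𝔻) : 0 < d.mu := mul_pos d.hb d.lam0
theorem X_le_mu (d : 𝔻) : d.X <= d.mu := by
  have := d.Nb; have := d.hX0
  unfold mu lam; nlinarith
theorem nu0 (d : 𝔻) : 0 < d.nu := mul_pos d.mu0 d.hE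
theorem bnu (d : 𝔻) : d.X * (d.N * d.b ^ 2 * d.E) = d.b * d.nu := by
  unfold nu mu lam; ring
theorem ru (d : 𝔻) (k : Fin 3) : Re (d.u k) := mol_re _ _ (d.rv k)
theorem divu (d : 𝔻) : ∑ j, dd j (d.u j) = 0 := by
  unfold u mo
  simp only [mol_dd, <- map_sum, d.div, map_zero]
theorem rRe (d : 𝔻) (j l : Fin 3) : Re (d.Re' j l) := mol_re _ _ (d.rR j l)
theorem symRe (d : 𝔻) (j l : Fin 3) : d.Re' j l = d.Re' l j := by unfold Re'; rw [d.symR]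
theorem v1 (hL : 2 <= L) (d : 𝔻) (l i : Fin 3) (z : Zt) : ‖dd i (d.v l) z‖ <= d.b * d.nu := by
  have := d.bv l i [] z (by simp; omega)
  rw [d.bnu] at this
  simpa [wd] using this
theorem v2 (hL : 2 <= L) (d : 𝔻) (l i j : Fin 3) (z : Zt) :
    ‖dd j (dd i (d.v l)) z‖ <= d.X * (d.b * d.nu) := by
  have := d.bv l i [j] z (by simp; omega)
  rw [d.bnu] at this
  simpa [wd] using this
theorem p2 (hL : 2 <= L) (d : 𝔻) (i j : Fin 3) (z : Zt) :
    ‖dd j (dd i d.p) z‖ <= (d.b * d.nu) ^ 2 := by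
  have := d.bp i [j] z (by simp; omega)
  rw [<- d.bnu]
  refine le_trans (by simpa [wd] using this) (le_of_eq (by ring))
theorem Nb4 (d : 𝔻) : 1 <= d.N ^ 2 * d.b ^ 4 := by
  have := d.h1; nlinarith
theorem R2 (hL : 2 <= L) (d : 𝔻) (j l i k : Fin 3) (z : Zt) :
    ‖dd k (dd i (d.R j l)) z‖ <= (d.b * d.nu) ^ 2 := by
  have := d.bR j l [i, k] z (by simp; omega)
  simp only [wd, List.length_cons, List.length_nil] at this
  refine this.trans ?_
  rw [<- d.bnu]
  have h1 := d.Nb4; have h2 := d.ind1 z.1; have h3 := d.ind0 z.1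
  have e : d.X ^ (0 + 1 + 1) * (d.E ^ 2 * d.ind z.1) = (d.X ^ 2 * d.E ^ 2) * d.ind z.1 := by ring
  have e' : (d.X * (d.N * d.b ^ 2 * d.E)) ^ 2 = (d.X ^ 2 * d.E ^ 2) * (d.N ^ 2 * d.b ^ 4) := by ring
  rw [e, e']
  exact mleL (h2.trans h1) (by positivity)
theorem R1 (hL : 2 <= L) (d : 𝔻) (j l i : Fin 3) (z : Zt) :
    ‖dd i (d.R j l) z‖ <= d.X * (d.E ^ 2 * d.ind z.1) := by
  have := d.bR j l [i] z (by simp; omega)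
  simpa [wd] using this
theorem R0 (d : 𝔻) (j l : Fin 3) (z : Zt) :
    ‖d.R j l z‖ <= d.E ^ 2 * d.ind z.1 := by
  have := d.bR j l [] z (by simp)
  simpa [wd] using this
theorem DR0 (hL : 2 <= L) (d : 𝔻) (j l : Fin 3) (z : Zt) :
    ‖DD d.v (d.R j l) z‖ <= d.b * d.nu * (d.E ^ 2 * d.ind z.1) := by
  have := d.bDR j l [] z (by simp; omega)
  rw [d.bnu] at this
  simpa [wd] using this
/-- Global context. -/
def c0 (L : ℕ) (η C0 K0 : ℝ) : Ctx (Dat L η C0 K0 × Zt) where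
  pt := fun i => i.2
  u := fun i => i.1.u
  mu := fun i => i.1.mu
  nu := fun i => i.1.nu
/-- Mollification of something bounded at each time. -/
theorem mo_cl {h : 𝔻 × Zt -> Sm} {H : 𝔻 × Zt -> ℝ} (B : ℝ)
    (hH : ∀ i x, ‖h i (i.2.1, x)‖ <= B * |H i|) (m : ℕ) :
    Cl (c0 L η C0 K0) 0 m H (fun i => mo (i.1.mu)⁻¹ (h i)) :=
  mol_cl (c := c0 L η C0 K0) (ε := fun i => (i.1.mu)⁻¹) (fun i => inv_mul_cancel₀ i.1.mu0.ne')
    ⟨B, fun i y _ => hH i _⟩ m _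
theorem du_cl (hL : 2 <= L) (i k : Fin 3) (m : ℕ) :
    Cl (c0 L η C0 K0) 0 m (fun j => j.1.b * j.1.nu) (fun j => dd i (j.1.u k)) := by
  have := mo_cl (L := L) (η := η) (C0 := C0) (K0 := K0) (h := fun j => dd i (j.1.v k))
    (H := fun j => j.1.b * j.1.nu) 1 (fun j x => by
      rw [abs_of_pos (mul_pos j.1.hb j.1.nu0), one_mul]; exact j.1.v1 hL _ _ _) m
  refine this.congr fun j => ⟨Set.univ, isOpen_univ, trivial, ?_⟩
  unfold u mo; rw [mol_dd]; exact EqS.refl _ _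
theorem ddu_cl (hL : 2 <= L) (i j k : Fin 3) (m : ℕ) :
    Cl (c0 L η C0 K0) 0 m (fun j => j.1.X * (j.1.b * j.1.nu)) (fun q => dd j (dd i (q.1.u k))) := by
  have := mo_cl (L := L) (η := η) (C0 := C0) (K0 := K0) (h := fun q => dd j (dd i (q.1.v k)))
    (H := fun j => j.1.X * (j.1.b * j.1.nu)) 1 (fun j x => by
      rw [abs_of_pos (mul_pos j.1.hX0 (mul_pos j.1.hb j.1.nu0)), one_mul]; exact j.1.v2 hL _ _ _ _) m
  refine this.congr fun j => ⟨Set.univ, isOpen_univ, trivial, ?_⟩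
  unfold u mo; rw [mol_dd, mol_dd]; exact EqS.refl _ _
theorem vu_bound (hL : 2 <= L) : ∃ B : ℝ, 0 <= B ∧ ∀ (d : 𝔻) k z,
    ‖d.u k z - d.v k z‖ <= B * ((d.mu)⁻¹ * (d.b * d.nu)) := by
  obtain ⟨B, hB, h⟩ := mo_sub
  refine ⟨B, hB, fun d k z => ?_⟩
  exact h _ z.1 _ (d.v k) (inv_nonneg.2 d.mu0.le) (fun j x => d.v1 hL _ _ _) z.2
/-- Commutator estimate. -/
theorem comm_cl (hL : 2 <= L) {h : 𝔻 × Zt -> Sm} {H : 𝔻 × Zt -> ℝ} (B : ℝ)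
    (hH : ∀ i x, ‖h i (i.2.1, x)‖ <= B * |H i|) (k : Fin 3) (m : ℕ) :
    Cl (c0 L η C0 K0) 0 m (fun i => H i * ((i.1.mu)⁻¹ * (i.1.b * i.1.nu)))
      (fun i => i.1.u k * mo (i.1.mu)⁻¹ (h i) - mo (i.1.mu)⁻¹ (i.1.v k * h i)) := by
  have h1 : Cl (c0 L η C0 K0) 0 m (fun i => (i.1.mu)⁻¹ * (i.1.b * i.1.nu))
      (fun i => i.1.u k - cst (i.1.v k i.2)) := by
    obtain ⟨B, hB, hb⟩ := vu_bound (η := η) (C0 := C0) (K0 := K0) hL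
    have hv : Ls (fun i : 𝔻 × Zt => (i.1.u k - cst (i.1.v k i.2)) i.2)
        (fun i => (i.1.mu)⁻¹ * (i.1.b * i.1.nu)) := Ls.of B fun i => by
      simpa using hb i.1 k i.2
    refine .mk hv (fun m' _ j => ?_) (fun _ hk => by omega)
    simp only [map_sub, Derivation.map_algebraMap, sub_zero]
    refine (du_cl hL j k m').trans (Ls.eq fun i => ?_)
    have := i.1.mu0.ne'
    simp only [c0]; field_simp
  have h2 := mo_cl B hH m
  have h4 : Cl (c0 L η C0 K0) 0 m (fun i => H i * ((i.1.mu)⁻¹ * (i.1.b * i.1.nu)))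
      (fun i => mo (i.1.mu)⁻¹ ((i.1.v k - cst (i.1.v k i.2)) * h i)) := by
    refine mol_cl (c := c0 L η C0 K0) (ε := fun i => (i.1.mu)⁻¹) (fun i => inv_mul_cancel₀ i.1.mu0.ne')
      ⟨3 * |B|, fun i y hy => ?_⟩ m _
    have e1 := incr (i.1.v k) i.2.1 (i.1.b * i.1.nu) (fun j x => i.1.v1 hL _ _ _) i.2.2 ((i.1.mu)⁻¹ • y) (i.1.mu)⁻¹
      (fun j => by
        simp only [Pi.smul_apply, smul_eq_mul, abs_mul, abs_of_pos (inv_pos.2 i.1.mu0), abs_of_nonneg (hy j).1]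
        exact mul_le_of_le_one_right (inv_pos.2 i.1.mu0).le (hy j).2)
    have e2 := hH i (i.2.2 + (i.1.mu)⁻¹ • y)
    have e3 : ‖h i (i.2.1, i.2.2 + (i.1.mu)⁻¹ • y)‖ <= |B| * |H i| :=
      e2.trans (mleR (le_abs_self _) (abs_nonneg _))
    have pp : 0 < (i.1.mu)⁻¹ * (i.1.b * i.1.nu) := mul_pos (inv_pos.2 i.1.mu0) (mul_pos i.1.hb i.1.nu0)
    simp only [coe_mul, coe_sub, coe_algebraMap, norm_mul]
    refine (mul_le_mul e1 e3 (norm_nonneg _) (by positivity)).trans (le_of_eq ?_)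
    rw [abs_mul, abs_of_pos pp]; ring
  refine ((h1.mul' h2 (Ls.eq fun i => by ring)).sub h4).congr fun i => ⟨Set.univ, isOpen_univ, trivial, ?_⟩
  have e : mo (i.1.mu)⁻¹ ((i.1.v k - cst (i.1.v k i.2)) * h i) =
      mo (i.1.mu)⁻¹ (i.1.v k * h i) - cst (i.1.v k i.2) * mo (i.1.mu)⁻¹ (h i) := by
    rw [sub_mul, map_sub, <- Algebra.smul_def, map_smul, Algebra.smul_def]
  rw [e]
  intro t _ x
  simp only [coe_mul, coe_sub, coe_algebraMap]; ring
theorem congr' {ι : Type} {c : Ctx ι} {r m : ℕ} {A : ι -> ℝ} {F G : ι -> Sm} (h : Cl c r m A F) (e : ∀ i, F i = G i) :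
    Cl c r m A G := by rwa [<- funext e]
theorem eq' (d : 𝔻) (l : Fin 3) :
    dt (d.v l) = ∑ j, dd j (d.R j l) - dd l d.p - ∑ j, d.v j * dd j (d.v l) := by
  rw [<- d.eq l]
  have : ∑ j, dd j (d.v j * d.v l) = ∑ j, d.v j * dd j (d.v l) := by
    simp only [Derivation.leibniz, smul_eq_mul, sum_add_distrib]
    rw [<- mul_sum, d.div]; ring
  rw [this]; ring
theorem Ddu_eq (d : 𝔻) (i l : Fin 3) : DD d.u (dd i (d.u l)) =
    mo (d.mu)⁻¹ (∑ j, dd i (dd j (d.R j l)) - dd i (dd l d.p) - ∑ j, dd i (d.v j) * dd j (d.v l))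
    + ∑ j, (d.u j * mo (d.mu)⁻¹ (dd j (dd i (d.v l))) - mo (d.mu)⁻¹ (d.v j * dd j (dd i (d.v l)))) := by
  have e1 : dt (dd i (d.u l)) = mo (d.mu)⁻¹ (dd i (dt (d.v l))) := by
    unfold u mo; rw [mol_dd, mol_dt, dt_dd]
  have e2 : ∀ j, dd j (dd i (d.u l)) = mo (d.mu)⁻¹ (dd j (dd i (d.v l))) := by
    intro j; unfold u mo; rw [mol_dd, mol_dd]
  rw [DD_apply, e1, d.eq']
  simp only [e2, map_sub, map_sum, Derivation.leibniz, smul_eq_mul, map_add, sum_add_distrib, sum_sub_distrib]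
  simp only [dd_comm i, mul_comm]
  ring
theorem Ddu_cl (hL : 2 <= L) (i k : Fin 3) (m : ℕ) :
    Cl (c0 L η C0 K0) 0 m (fun j => (j.1.b * j.1.nu) ^ 2) (fun j => DD j.1.u (dd i (j.1.u k))) := by
  have h1 := mo_cl (L := L) (η := η) (C0 := C0) (K0 := K0)
    (h := fun d => (∑ j, dd i (dd j (d.1.R j k)) - dd i (dd k d.1.p) - ∑ j, dd i (d.1.v j) * dd j (d.1.v k)))
    (H := fun j => (j.1.b * j.1.nu) ^ 2) 7 (fun j x => by
      rw [abs_of_nonneg (sq_nonneg _)]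
      have a1 : ‖∑ q, dd i (dd q (j.1.R q k)) (j.2.1, x)‖ <= ∑ q : Fin 3, (j.1.b * j.1.nu) ^ 2 :=
        norm_sum_le_of_le _ fun q _ => j.1.R2 hL _ _ _ _ _
      have a2 := j.1.p2 hL k i (j.2.1, x)
      have a3 : ‖∑ q, dd i (j.1.v q) (j.2.1, x) * dd q (j.1.v k) (j.2.1, x)‖ <= ∑ q : Fin 3, (j.1.b * j.1.nu) ^ 2 :=
        norm_sum_le_of_le _ fun q _ => by
          rw [norm_mul, sq]
          exact mul_le_mul (j.1.v1 hL _ _ _) (j.1.v1 hL _ _ _) (norm_nonneg _) (mul_pos j.1.hb j.1.nu0).le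
      simp only [Finset.sum_const, Finset.card_univ, Fintype.card_fin, nsmul_eq_mul] at a1 a3
      simp only [coe_sub, coe_sum, coe_mul]
      refine (norm_sub_le _ _).trans ((add_le_add (norm_sub_le _ _) le_rfl).trans ?_)
      push_cast at a1 a3
      linarith) m
  have h2 : ∀ q, _ := fun q => comm_cl (L := L) (η := η) (C0 := C0) (K0 := K0) hL (h := fun d => dd q (dd i (d.1.v k)))
    (H := fun j => j.1.X * (j.1.b * j.1.nu)) 1 (fun j x => by
      rw [abs_of_pos (mul_pos j.1.hX0 (mul_pos j.1.hb j.1.nu0)), one_mul]; exact j.1.v2 hL _ _ _ _) q m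
  refine congr' (h1.add (Cl.sum Finset.univ fun q _ => (h2 q).trans (Ls.le (fun j => ?_) fun j => ?_))) (fun j => (Ddu_eq j.1 i k).symm)
  . have := j.1.hX0; have := j.1.hb; have := j.1.nu0; have := j.1.mu0; positivity
  . have := j.1.X_le_mu; have hb := j.1.hb; have hn := j.1.nu0; have hm := j.1.mu0
    have : j.1.X * (j.1.mu)⁻¹ <= 1 := by rw [<- div_eq_mul_inv, div_le_one hm]; exact this
    calc _ = (j.1.X * (j.1.mu)⁻¹) * (j.1.b * j.1.nu) ^ 2 := by ring
      _ <= 1 * (j.1.b * j.1.nu) ^ 2 := mleR this (sq_nonneg _)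
      _ = _ := one_mul _
theorem bnu_le (d : 𝔻) : d.b * d.nu <= d.nu := mul_le_of_le_one_left d.nu0.le d.b1
theorem du_cl1 (hL : 2 <= L) (i k : Fin 3) (m : ℕ) :
    Cl (c0 L η C0 K0) 1 m (fun j => j.1.b * j.1.nu) (fun j => dd i (j.1.u k)) := by
  refine Cl.build (du_cl hL i k m) ((Ddu_cl hL i k m).trans (Ls.le (fun j => sq_nonneg _) fun j => ?_)) (fun i k =>
    (du_cl hL i k m).trans (Ls.le (fun j => (mul_pos j.1.hb j.1.nu0).le) fun j => j.1.bnu_le))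
  have := j.1.bnu_le; have h2 := mul_pos j.1.hb j.1.nu0
  simp only [c0]; rw [sq]; exact mleL this h2.le
theorem Re_cl (j l : Fin 3) (m : ℕ) :
    Cl (c0 L η C0 K0) 0 m (fun i => i.1.E ^ 2 * i.1.ind i.2.1) (fun i => i.1.Re' j l) :=
  mo_cl 1 (fun i x => by
    rw [abs_of_nonneg (mul_nonneg (sq_nonneg _) (i.1.ind0 _)), one_mul]; exact i.1.R0 _ _ _) m
theorem dRe_cl (hL : 2 <= L) (k j l : Fin 3) (m : ℕ) :
    Cl (c0 L η C0 K0) 0 m (fun i => i.1.E ^ 2 * i.1.ind i.2.1 * i.1.X) (fun i => dd k (i.1.Re' j l)) :=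
  congr' (mo_cl (h := fun i => dd k (i.1.R j l)) 1 (fun i x => by
    rw [abs_of_nonneg (mul_nonneg (mul_nonneg (sq_nonneg _) (i.1.ind0 _)) i.1.hX0.le), one_mul]
    exact (i.1.R1 hL _ _ _ _).trans (le_of_eq (by ring))) m) (fun i => by unfold Re' mo; rw [mol_dd])
theorem DRe_cl (hL : 2 <= L) (j l : Fin 3) (m : ℕ) :
    Cl (c0 L η C0 K0) 0 m (fun i => i.1.b * (i.1.E ^ 2 * i.1.ind i.2.1) * i.1.nu) (fun i => DD i.1.u (i.1.Re' j l)) := by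
  have h1 := mo_cl (L := L) (η := η) (C0 := C0) (K0 := K0) (h := fun i => DD i.1.v (i.1.R j l))
    (H := fun i => i.1.b * (i.1.E ^ 2 * i.1.ind i.2.1) * i.1.nu) 1 (fun i x => by
      have := i.1.hb; have := i.1.nu0; have := i.1.ind0 i.2.1
      rw [abs_of_nonneg (by positivity), one_mul]
      exact (i.1.DR0 hL _ _ _).trans (le_of_eq (by ring))) m
  have h2 : ∀ q, _ := fun q => comm_cl (L := L) (η := η) (C0 := C0) (K0 := K0) hL (h := fun i => dd q (i.1.R j l))
    (H := fun i => i.1.X * (i.1.E ^ 2 * i.1.ind i.2.1)) 1 (fun i x => by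
      rw [abs_of_nonneg (mul_nonneg i.1.hX0.le (mul_nonneg (sq_nonneg _) (i.1.ind0 _))), one_mul]
      exact i.1.R1 hL _ _ _ _) q m
  refine congr' (h1.add (Cl.sum Finset.univ fun q _ => (h2 q).trans (Ls.le (fun i => ?_) fun i => ?_))) (fun i => ?_)
  . have := i.1.hX0; have := i.1.hb; have := i.1.nu0; have := i.1.mu0; have := i.1.ind0 i.2.1; positivity
  . have := i.1.X_le_mu; have hb := i.1.hb; have hn := i.1.nu0; have hm := i.1.mu0; have hi := i.1.ind0 i.2.1
    have : i.1.X * (i.1.mu)⁻¹ <= 1 := by rw [<- div_eq_mul_inv, div_le_one hm]; exact this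
    calc _ = (i.1.X * (i.1.mu)⁻¹) * (i.1.b * (i.1.E ^ 2 * i.1.ind i.2.1) * i.1.nu) := by ring
      _ <= 1 * _ := mleR this (by positivity)
      _ = _ := one_mul _
  . unfold Re'
    have e1 : dt (mo (i.1.mu)⁻¹ (i.1.R j l)) = mo (i.1.mu)⁻¹ (dt (i.1.R j l)) := by unfold mo; rw [mol_dt]
    have e2 : ∀ q, dd q (mo (i.1.mu)⁻¹ (i.1.R j l)) = mo (i.1.mu)⁻¹ (dd q (i.1.R j l)) := by
      intro q; unfold mo; rw [mol_dd]
    simp only [DD_apply, e1, e2, map_add, map_sum, sum_sub_distrib]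
    ring
theorem Re_cl1 (hL : 2 <= L) (j l : Fin 3) (m : ℕ) :
    Cl (c0 L η C0 K0) 1 m (fun i => i.1.E ^ 2 * i.1.ind i.2.1) (fun i => i.1.Re' j l) := by
  refine Cl.build (Re_cl j l m) ((DRe_cl hL j l m).trans (Ls.le (fun i => ?_) fun i => ?_)) (fun i k =>
    (du_cl hL i k m).trans (Ls.le (fun j => (mul_pos j.1.hb j.1.nu0).le) fun j => j.1.bnu_le))
  . have := i.1.hb; have := i.1.nu0; have := i.1.ind0 i.2.1; positivity
  . have := i.1.b1; have hn := i.1.nu0; have := i.1.ind0 i.2.1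
    have : 0 <= (i.1.E ^ 2 * i.1.ind i.2.1) * i.1.nu := by positivity
    simp only [c0]; nlinarith [i.1.b1]
/-- Context at frequency `X`. -/
def cX (L : ℕ) (η C0 K0 : ℝ) : Ctx (Dat L η C0 K0 × Zt) where
  pt := fun i => i.2
  u := fun i => i.1.u
  mu := fun i => i.1.X
  nu := fun i => i.1.nu
theorem du_clX (hL : 2 <= L) (i k : Fin 3) :
    Cl (cX L η C0 K0) 0 1 (fun j => j.1.nu) (fun j => dd i (j.1.u k)) := by
  refine .mk ((du_cl hL i k 0).val.trans (Ls.le (fun j => (mul_pos j.1.hb j.1.nu0).le) fun j => j.1.bnu_le)) (fun m hm q => ?_) (fun _ h => by omega)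
  obtain rfl : 0 = m := by omega
  refine .mk ((ddu_cl hL i q k 0).val.trans (Ls.le (fun j => (mul_pos j.1.hX0 (mul_pos j.1.hb j.1.nu0)).le) fun j => ?_)) (fun m hm q => by omega) (fun _ h => by omega)
  have := mleL j.1.bnu_le j.1.hX0.le
  simp only [cX]; linarith
theorem Re_clX (hL : 2 <= L) (j l : Fin 3) :
    Cl (cX L η C0 K0) 0 1 (fun i => i.1.E ^ 2 * i.1.ind i.2.1) (fun i => i.1.Re' j l) := by
  refine .mk (Re_cl j l 0).val (fun m hm q => ?_) (fun _ h => by omega)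
  obtain rfl : 0 = m := by omega
  exact .mk (dRe_cl hL q j l 0).val (fun m hm q => by omega) (fun _ h => by omega)
end Dat
end
section
/-- Smooth dependence of fixed points. -/
theorem fix_smooth {E₁ E₂ : Type} [NormedAddCommGroup E₁] [NormedSpace ℝ E₁] [CompleteSpace E₁]
    [NormedAddCommGroup E₂] [NormedSpace ℝ E₂] [CompleteSpace E₂] (T : E₁ × E₂ -> E₂) (hT : ContDiff ℝ ∞ T)
    (hl : ∀ z, LipschitzWith (1 / 2) (fun y => T (z, y))) :
    ∃ γ : E₁ -> E₂, ContDiff ℝ ∞ γ ∧ (∀ z, T (z, γ z) = γ z) ∧ ∀ z y, T (z, y) = y -> y = γ z := by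
  have hc : ∀ z, ContractingWith (1 / 2) (fun y => T (z, y)) := fun z => ⟨by norm_num, hl z⟩
  refine ⟨fun z => (hc z).fixedPoint, ?_, fun z => (hc z).fixedPoint_isFixedPt, fun z y h => (hc z).fixedPoint_unique h⟩
  rw [contDiff_iff_contDiffAt]
  intro z
  set y := (hc z).fixedPoint with hy
  have hyf : T (z, y) = y := (hc z).fixedPoint_isFixedPt
  set f : E₁ × E₂ -> E₂ := fun q => q.2 - T q with hf
  have cf : ContDiff ℝ ∞ f := contDiff_snd.sub hT
  have cdf : ContDiffAt ℝ ∞ f (z, y) := cf.contDiffAt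
  have hinv : (fderiv ℝ f (z, y) ∘L .inr ℝ E₁ E₂).IsInvertible := by
    have hTd : HasFDerivAt T (fderiv ℝ T (z, y)) (z, y) := (hT.differentiable (by simp) _).hasFDerivAt
    have e : fderiv ℝ f (z, y) = ContinuousLinearMap.snd ℝ E₁ E₂ - fderiv ℝ T (z, y) :=
      (hasFDerivAt_snd.sub hTd).fderiv
    have h1 : HasFDerivAt (fun w => T (z, w)) (fderiv ℝ T (z, y) ∘L .inr ℝ E₁ E₂) y :=
      hTd.comp y (hasFDerivAt_prodMk_right z y)
    have h2 : ‖fderiv ℝ T (z, y) ∘L .inr ℝ E₁ E₂‖ < 1 :=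
      lt_of_le_of_lt (h1.le_of_lipschitz (hl z)) (by norm_num)
    refine ⟨ContinuousLinearEquiv.ofUnit (Units.oneSub _ h2), ?_⟩
    rw [e]
    ext w
    simp [ContinuousLinearEquiv.ofUnit]
  have h1 := cdf.contDiffAt_implicitFunction (by simp) hinv
  refine h1.congr_of_eventuallyEq ?_
  filter_upwards [cdf.eventually_apply_implicitFunction (by simp) hinv] with w hw
  refine ((hc w).fixedPoint_unique ?_).symm
  have : f (z, y) = 0 := by simp [hf, hyf]
  rw [this] at hw
  simp only [hf, sub_eq_zero] at hw
  exact hw.symm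
section nem
variable {K : Type} [TopologicalSpace K] [CompactSpace K]
/-- Pointwise application. -/
def napp (K : Type) [TopologicalSpace K] [CompactSpace K] (A B : Type) [NormedAddCommGroup A] [NormedSpace ℝ A] [NormedAddCommGroup B] [NormedSpace ℝ B] :
    C(K, A →L[ℝ] B) →L[ℝ] C(K, A) →L[ℝ] C(K, B) :=
  LinearMap.mkContinuous₂ (LinearMap.mk₂ ℝ (fun (l : C(K, A →L[ℝ] B)) (a : C(K, A)) => (⟨fun k => l k (a k), by fun_prop⟩ : C(K, B)))
    (fun _ _ _ => by ext; simp) (fun _ _ _ => by ext; simp) (fun _ _ _ => by ext; simp) (fun _ _ _ => by ext; simp)) 1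
    (fun l a => by
      rw [ContinuousMap.norm_le _ (by positivity)]
      intro k
      rw [one_mul]
      exact (ContinuousLinearMap.le_opNorm _ _).trans (mul_le_mul (l.norm_coe_le_norm k) (a.norm_coe_le_norm k) (norm_nonneg _) ((norm_nonneg _).trans (l.norm_coe_le_norm k))))
/-- The Nemytskii operator. -/
def nem {A B : Type} [TopologicalSpace A] [TopologicalSpace B] (f : A -> B) (hf : Continuous f) : C(K, A) -> C(K, B) :=
  fun γ => ⟨fun k => f (γ k), hf.comp γ.continuous⟩
theorem nem_cont {A B : Type} [TopologicalSpace A] [TopologicalSpace B] (f : A -> B) (hf : Continuous f) :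
    Continuous (nem (K := K) f hf) := ContinuousMap.continuous_postcomp (⟨f, hf⟩ : C(A, B))
theorem nem_metric {A B : Type} [NormedAddCommGroup A] [NormedAddCommGroup B] (f : A -> B) (hf : Continuous f) (γ : C(K, A))
    {ε : ℝ} (hε : 0 < ε) : ∃ δ > 0, ∀ γ' : C(K, A), dist γ' γ < δ -> ∀ k, dist (f (γ' k)) (f (γ k)) < ε := by
  obtain ⟨δ, hδ, h⟩ := Metric.tendsto_nhds_nhds.1 ((nem_cont (K := K) f hf).tendsto γ) ε hε
  exact ⟨δ, hδ, fun γ' h' k => (ContinuousMap.dist_lt_iff hε).1 (h h') k⟩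
theorem nem_hasFDerivAt {A B : Type} [NormedAddCommGroup A] [NormedSpace ℝ A] [NormedAddCommGroup B] [NormedSpace ℝ B]
    (f : A -> B) (hf : ContDiff ℝ ∞ f) (hf' : Continuous (fderiv ℝ f)) (γ : C(K, A)) :
    HasFDerivAt (nem (K := K) f hf.continuous) (napp K A B (nem (fderiv ℝ f) hf' γ)) γ := by
  rw [hasFDerivAt_iff_isLittleO_nhds_zero, Asymptotics.isLittleO_iff]
  intro ε hε
  obtain ⟨δ, hδ, h⟩ := nem_metric (K := K) _ hf' γ hε
  filter_upwards [Metric.ball_mem_nhds (0 : C(K, A)) hδ] with x hx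
  rw [ContinuousMap.norm_le _ (by positivity)]
  intro k
  have := (convex_segment (γ k) (γ k + x k)).norm_image_sub_le_of_norm_hasFDerivWithin_le' (𝕜 := ℝ) (f := f) (f' := fderiv ℝ f)
    (φ := fderiv ℝ f (γ k)) (C := ε) (fun y _ => (hf.differentiable (by simp) y).hasFDerivAt.hasFDerivWithinAt)
    (fun y hy => by
      rw [segment_eq_image'] at hy
      obtain ⟨s, hs, rfl⟩ := hy
      have h1 : dist (γ + s • x) γ < δ := by
        rw [dist_eq_norm, add_sub_cancel_left, norm_smul, Real.norm_eq_abs, abs_of_nonneg hs.1]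
        rw [mem_ball_zero_iff] at hx
        exact lt_of_le_of_lt (mul_le_of_le_one_left (norm_nonneg _) hs.2) hx
      have h2 := h _ h1 k
      rw [dist_eq_norm] at h2
      simpa [nem] using h2.le) (left_mem_segment ℝ _ _) (right_mem_segment ℝ _ _)
  simp only [add_sub_cancel_left] at this
  refine le_trans ?_ (this.trans (mleL (x.norm_coe_le_norm k) hε.le))
  simp [nem, napp]
theorem nem_contDiff_nat (n : ℕ) : ∀ {A B : Type} [NormedAddCommGroup A] [NormedSpace ℝ A] [NormedAddCommGroup B] [NormedSpace ℝ B]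
    (f : A -> B) (hf : ContDiff ℝ ∞ f), ContDiff ℝ n (nem (K := K) f hf.continuous) := by
  induction n with
  | zero => intro A B _ _ _ _ f hf; rw [Nat.cast_zero, contDiff_zero]; exact nem_cont _ _
  | succ n ih =>
    intro A B _ _ _ _ f hf
    have hf' : ContDiff ℝ ∞ (fderiv ℝ f) := hf.fderiv_right (by simp)
    rw [Nat.cast_succ, contDiff_succ_iff_hasFDerivAt]
    refine ⟨_, ?_, fun γ => nem_hasFDerivAt f hf hf'.continuous γ⟩
    exact (napp K A B).contDiff.comp (ih _ hf')
theorem nem_contDiff {A B : Type} [NormedAddCommGroup A] [NormedSpace ℝ A] [NormedAddCommGroup B] [NormedSpace ℝ B]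
    (f : A -> B) (hf : ContDiff ℝ ∞ f) : ContDiff ℝ ∞ (nem (K := K) f hf.continuous) :=
  contDiff_infty.2 fun n => nem_contDiff_nat n f hf
end nem
open unitInterval
/-- Extension of a curve on the unit interval. -/
def cex {B : Type} [TopologicalSpace B] (γ : C(I, B)) : ℝ -> B := fun s => γ (Set.projIcc 0 1 zero_le_one s)
theorem cex_cont {B : Type} [TopologicalSpace B] (γ : C(I, B)) : Continuous (cex γ) := γ.continuous.comp continuous_projIcc
theorem cint_cont {B : Type} [NormedAddCommGroup B] [NormedSpace ℝ B] [CompleteSpace B] (γ : C(I, B)) :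
    Continuous fun r : I => ∫ s in (0 : ℝ)..(r : ℝ), cex γ s :=
  (intervalIntegral.continuous_primitive (fun a b => (cex_cont γ).intervalIntegrable a b) 0).comp continuous_subtype_val
/-- Primitive operator on curves. -/
def cint (B : Type) [NormedAddCommGroup B] [NormedSpace ℝ B] [CompleteSpace B] : C(I, B) →L[ℝ] C(I, B) :=
  LinearMap.mkContinuous
    { toFun := fun γ => ⟨fun r : I => ∫ s in (0 : ℝ)..(r : ℝ), cex γ s, cint_cont γ⟩
      map_add' := fun γ δ => by
        ext1 r
        exact intervalIntegral.integral_add ((cex_cont γ).intervalIntegrable _ _) ((cex_cont δ).intervalIntegrable _ _)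
      map_smul' := fun a γ => by
        ext1 r
        exact intervalIntegral.integral_smul _ _ } 1 (fun γ => by
    rw [ContinuousMap.norm_le _ (by positivity)]
    intro r
    have := intervalIntegral.norm_integral_le_of_norm_le_const (a := 0) (b := (r : ℝ)) (f := cex γ) (C := ‖γ‖)
      (fun s _ => γ.norm_coe_le_norm _)
    refine this.trans ?_
    rw [sub_zero, abs_of_nonneg r.2.1, mul_comm]
    exact mleR r.2.2 (norm_nonneg _))
theorem cint_apply {B : Type} [NormedAddCommGroup B] [NormedSpace ℝ B] [CompleteSpace B] (γ : C(I, B)) (r : I) :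
    cint B γ r = ∫ s in (0 : ℝ)..(r : ℝ), cex γ s := rfl
theorem cint_norm {B : Type} [NormedAddCommGroup B] [NormedSpace ℝ B] [CompleteSpace B] (γ : C(I, B)) : ‖cint B γ‖ <= ‖γ‖ := by
  have := ContinuousLinearMap.le_of_opNorm_le (cint B) (LinearMap.mkContinuous_norm_le _ zero_le_one _) γ
  simpa using this
end
section
open unitInterval
/-- derivative along a trajectory -/
theorem traj_deriv {u : Fin 3 -> Sm} (hu : ∀ i, Re (u i)) (f : Sm) (t a : ℝ) (Y : ℝ -> Spc) (r : ℝ)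
    (hY : HasDerivAt Y (fun i => a * (u i (t + r * a, Y r)).re) r) :
    HasDerivAt (fun r => f (t + r * a, Y r)) (a * DD u f (t + r * a, Y r)) r := by
  have h1 : HasDerivAt (fun r : ℝ => t + r * a) a r := by
    simpa using ((hasDerivAt_id r).mul_const a).const_add t
  have h2 := (f.diffAt (t + r * a, Y r)).hasFDerivAt.comp_hasDerivAt r (h1.prodMk hY)
  refine h2.congr_deriv ?_
  have e : (a, fun i => a * (u i (t + r * a, Y r)).re) = a • ((1 : ℝ), (0 : Spc)) +
      ∑ i, (a * (u i (t + r * a, Y r)).re) • ((0 : ℝ), (Pi.single i 1 : Spc)) := by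
    refine Prod.ext (by simp [Prod.fst_sum]) ?_
    funext k
    simp [Prod.snd_sum, Finset.sum_apply, Pi.single_apply]
  rw [e, map_add, map_sum]
  simp only [map_smul]
  simp only [DD_apply, coe_add, coe_sum, coe_mul, mul_add, mul_sum]
  congr 1
  refine sum_congr rfl fun i _ => ?_
  rw [<- (hu i).coe (t + r * a, Y r), Complex.real_smul]
  push_cast
  rw [mul_assoc]
  rfl
/-- constants -/
def cconst (B : Type) [NormedAddCommGroup B] [NormedSpace ℝ B] : B →L[ℝ] C(I, B) :=
  LinearMap.mkContinuous { toFun := fun z => ContinuousMap.const I z, map_add' := fun _ _ => rfl, map_smul' := fun _ _ => rfl } 1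
    (fun z => by
      rw [ContinuousMap.norm_le _ (by positivity)]
      intro k
      change ‖z‖ <= 1 * ‖z‖
      rw [one_mul])
theorem cconst_apply {B : Type} [NormedAddCommGroup B] [NormedSpace ℝ B] (z : B) (k : I) : cconst B z k = z := rfl
theorem clamp_exists : ∃ k : ℝ -> ℝ, ContDiff ℝ ∞ k ∧ (∀ s, |s| <= 2 -> k s = s) ∧ ∀ s, |k s| <= 4 := by
  let f : ContDiffBump (0 : ℝ) := ⟨2, 4, by norm_num, by norm_num⟩
  refine ⟨fun s => s * f s, contDiff_id.mul f.contDiff, fun s hs => ?_, fun s => ?_⟩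
  . beta_reduce; rw [f.one_of_mem_closedBall (by simpa using hs), mul_one]
  . by_cases h : |s| <= 4
    . rw [abs_mul, abs_of_nonneg f.nonneg]
      exact (mul_le_of_le_one_right (abs_nonneg _) f.le_one).trans h
    . beta_reduce; rw [f.zero_of_le_dist (by simpa using (not_le.1 h).le)]; simp
theorem re_smooth (f : Sm) : ContDiff ℝ ∞ (fun z => (f z).re) := Complex.reCLM.contDiff.comp f.smooth
def cev : C(I, Spc) →L[ℝ] Spc :=
  LinearMap.mkContinuous { toFun := fun c => c 1, map_add' := fun _ _ => rfl, map_smul' := fun _ _ => rfl } 1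
    (fun c => by rw [one_mul]; exact c.norm_coe_le_norm 1)
theorem flow_aux (F : Zt × ℝ × Spc -> Spc) (hF : ContDiff ℝ ∞ F) (hl : ∀ z r y y', ‖F (z, r, y) - F (z, r, y')‖ <= 1 / 2 * ‖y - y'‖) :
    ∃ Φ : Zt -> Spc, ContDiff ℝ ∞ Φ ∧ (∀ z, ∃ Y : ℝ -> Spc, Y 0 = z.2 ∧ Y 1 = Φ z ∧ ∀ r ∈ Set.Icc (0 : ℝ) 1, HasDerivAt Y (F (z, r, Y r)) r) ∧
    ∀ z (Y : ℝ -> Spc), Y 0 = z.2 -> (∀ r ∈ Set.Icc (0 : ℝ) 1, HasDerivAt Y (F (z, r, Y r)) r) -> Y 1 = Φ z := by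
  set cv : Zt × C(I, Spc) -> C(I, Zt × ℝ × Spc) := fun q =>
    ⟨fun k => (q.1, (k : ℝ), q.2 k), by fun_prop⟩ with hcv
  have ccv : ContDiff ℝ ∞ cv := by
    have e : cv = fun q => (ContinuousLinearMap.compLeftContinuous ℝ I (ContinuousLinearMap.inl ℝ Zt (ℝ × Spc))) (cconst Zt q.1)
      + (ContinuousLinearMap.compLeftContinuous ℝ I ((ContinuousLinearMap.inr ℝ Zt (ℝ × Spc)).comp (ContinuousLinearMap.inr ℝ ℝ Spc))) q.2
      + (⟨fun k => (0, (k : ℝ), 0), by fun_prop⟩ : C(I, Zt × ℝ × Spc)) := by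
      funext q; ext1 k
      simp [hcv, cconst_apply]
    rw [e]
    exact ((((ContinuousLinearMap.contDiff _).comp ((cconst Zt).contDiff.comp contDiff_fst)).add
      ((ContinuousLinearMap.contDiff _).comp contDiff_snd)).add contDiff_const)
  set T : Zt × C(I, Spc) -> C(I, Spc) := fun q => cconst Spc q.1.2 + cint Spc (nem F hF.continuous (cv q)) with hT
  have cT : ContDiff ℝ ∞ T := ((cconst Spc).contDiff.comp (contDiff_snd.comp contDiff_fst)).add
    ((cint Spc).contDiff.comp ((nem_contDiff F hF).comp ccv))
  have lT : ∀ z, LipschitzWith (1 / 2) (fun y => T (z, y)) := by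
    intro z
    refine LipschitzWith.of_dist_le_mul fun a b => ?_
    rw [dist_eq_norm, dist_eq_norm]
    have : T (z, a) - T (z, b) = cint Spc (nem F hF.continuous (cv (z, a)) - nem F hF.continuous (cv (z, b))) := by
      rw [map_sub]; simp [hT]
    rw [this]
    refine (cint_norm _).trans ?_
    rw [ContinuousMap.norm_le _ (by positivity)]
    intro k
    have h1 := hl z k (a k) (b k)
    have h2 := (a - b).norm_coe_le_norm k
    refine le_trans h1 ?_
    push_cast
    exact mleL h2 (by norm_num)
  obtain ⟨γ, cγ, fγ, uγ⟩ := fix_smooth T cT lT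
  have hTap : ∀ z (δ : C(I, Spc)) (r : I), T (z, δ) r = z.2 + ∫ s in (0 : ℝ)..(r : ℝ), F (z, ((Set.projIcc (0 : ℝ) 1 zero_le_one s : I) : ℝ), cex δ s) := by
    intro z δ r; rfl
  have hev : ContDiff ℝ ∞ (fun c : C(I, Spc) => c 1) :=
    cev.contDiff
  refine ⟨fun z => γ z 1, hev.comp cγ, fun z => ?_, fun z Y h0 hY => ?_⟩
  . have hYc : Continuous fun s => F (z, ((Set.projIcc (0 : ℝ) 1 zero_le_one s : I) : ℝ), cex (γ z) s) :=
      hF.continuous.comp (by have := cex_cont (γ z); fun_prop)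
    refine ⟨fun r => z.2 + ∫ s in (0 : ℝ)..r, F (z, ((Set.projIcc (0 : ℝ) 1 zero_le_one s : I) : ℝ), cex (γ z) s), by simp, ?_, fun r hr => ?_⟩
    . have := hTap z (γ z) 1
      rw [fγ] at this
      beta_reduce
      rw [this]; rfl
    . have e : cex (γ z) r = z.2 + ∫ s in (0 : ℝ)..r, F (z, ((Set.projIcc (0 : ℝ) 1 zero_le_one s : I) : ℝ), cex (γ z) s) := by
        have := hTap z (γ z) ⟨r, hr⟩
        rw [fγ] at this
        rw [<- this, cex, Set.projIcc_of_mem _ hr]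
      beta_reduce
      rw [<- e]
      have := (hYc.integral_hasStrictDerivAt 0 r).hasDerivAt.const_add z.2
      refine this.congr_deriv ?_
      rw [Set.projIcc_of_mem _ hr]
  . have hYon : ContinuousOn Y (Set.Icc 0 1) := fun r hr => (hY r hr).continuousAt.continuousWithinAt
    set δ : C(I, Spc) := ⟨fun k => Y k, continuousOn_iff_continuous_restrict.1 hYon⟩ with hδ
    have : T (z, δ) = δ := by
      ext1 r
      rw [hTap, <- h0]
      have e1 : ∫ s in (0 : ℝ)..(r : ℝ), F (z, ((Set.projIcc (0 : ℝ) 1 zero_le_one s : I) : ℝ), cex δ s) = ∫ s in (0 : ℝ)..(r : ℝ), F (z, s, Y s) := by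
        refine intervalIntegral.integral_congr fun s hs => ?_
        rw [Set.uIcc_of_le r.2.1] at hs
        have hs' : s ∈ Set.Icc (0 : ℝ) 1 := ⟨hs.1, hs.2.trans r.2.2⟩
        simp only [cex, Set.projIcc_of_mem _ hs', hδ]
        rfl
      rw [e1, intervalIntegral.integral_eq_sub_of_hasDerivAt (f := Y)]
      . exact add_sub_cancel _ _
      . intro s hs
        rw [Set.uIcc_of_le r.2.1] at hs
        exact hY s ⟨hs.1, hs.2.trans r.2.2⟩
      . refine ContinuousOn.intervalIntegrable ?_
        rw [Set.uIcc_of_le r.2.1]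
        refine hF.continuous.comp_continuousOn (continuousOn_const.prodMk (continuousOn_id.prodMk (hYon.mono ?_)))
        exact Set.Icc_subset_Icc_right r.2.2
    have := congrArg (fun c : C(I, Spc) => c 1) (uγ z δ this)
    exact this
theorem flow_exists (u : Fin 3 -> Sm) (hu : ∀ i, Re (u i)) (A tk τ : ℝ) (hτ : 0 < τ) (hA : ∀ i j z, ‖dd j (u i) z‖ <= A)
    (hs : 24 * (τ * A) <= 1) : ∃ φ : Fin 3 -> Sm, (∀ i, Re (φ i)) ∧ (∀ i x, φ i (tk, x) = 0) ∧
    (∀ i, EqS (Set.Ioo (tk - 2 * τ) (tk + 2 * τ)) (DD u (φ i)) (- u i)) ∧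
    ∀ t ∈ Set.Ioo (tk - 2 * τ) (tk + 2 * τ), ∀ x, ∃ Y : ℝ -> Spc, Y 0 = x ∧ ∀ r ∈ Set.Icc (0 : ℝ) 1,
      HasDerivAt Y (fun i => (tk - t) * (u i (t + r * (tk - t), Y r)).re) r := by
  obtain ⟨k, ck, k1, k2⟩ := clamp_exists
  set κ : ℝ -> ℝ := fun t => τ * k ((t - tk) / τ) with hκ
  have cκ : ContDiff ℝ ∞ κ := contDiff_const.mul (ck.comp ((contDiff_id.sub contDiff_const).div_const _))
  have κ1 : ∀ t, |t - tk| <= 2 * τ -> κ t = t - tk := by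
    intro t ht
    simp only [hκ]
    rw [k1 _ (by rw [abs_div, abs_of_pos hτ, div_le_iff₀ hτ]; exact ht)]
    field_simp
  have κ2 : ∀ t, |κ t| <= 4 * τ := by
    intro t
    simp only [hκ, abs_mul, abs_of_pos hτ]
    nlinarith [k2 ((t - tk) / τ)]
  set F : Zt × ℝ × Spc -> Spc := fun q i => (- κ q.1.1) * (u i (tk + κ q.1.1 + q.2.1 * (- κ q.1.1), q.2.2)).re with hF
  have cF : ContDiff ℝ ∞ F := by
    rw [contDiff_pi]
    intro i
    have h1 : ContDiff ℝ ∞ fun q : Zt × ℝ × Spc => κ q.1.1 := cκ.comp (contDiff_fst.comp contDiff_fst)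
    refine h1.neg.mul ((re_smooth (u i)).comp (ContDiff.prodMk ?_ (contDiff_snd.comp contDiff_snd)))
    exact (contDiff_const.add h1).add ((contDiff_fst.comp contDiff_snd).mul h1.neg)
  obtain ⟨Φ, cΦ, ex, un⟩ := flow_aux F cF (fun z r y y' => by
    rw [pi_norm_le_iff_of_nonneg (by positivity)]
    intro i
    have h1 := incr (u i) (tk + κ z.1 + r * (- κ z.1)) A (fun j x => hA _ _ _) y' (y - y') ‖y - y'‖ (fun j => norm_le_pi_norm (y - y') j)
    rw [add_sub_cancel] at h1
    simp only [hF, Pi.sub_apply]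
    rw [<- mul_sub, norm_mul, <- Complex.sub_re]
    have h2 : ‖(u i (tk + κ z.1 + r * (- κ z.1), y) - u i (tk + κ z.1 + r * (- κ z.1), y')).re‖ <= 3 * (‖y - y'‖ * A) :=
      (Complex.abs_re_le_norm _).trans h1
    have h3 : ‖-κ z.1‖ <= 4 * τ := by rw [norm_neg]; exact κ2 _
    refine (mul_le_mul h3 h2 (norm_nonneg _) (by positivity)).trans ?_
    nlinarith [norm_nonneg (y - y')])
  have Fper : ∀ (z : Zt) (r : ℝ) (y : Spc) (n : Fin 3 -> ℤ), F ((z.1, fun i => z.2 i + (n i : ℝ)), r, fun i => y i + (n i : ℝ)) = F (z, r, y) := by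
    intro z r y n; funext i; simp only [hF]; rw [(u i).per]
  have Φper : ∀ (t : ℝ) (x : Spc) (n : Fin 3 -> ℤ), Φ (t, fun i => x i + (n i : ℝ)) = fun i => Φ (t, x) i + (n i : ℝ) := by
    intro t x n
    obtain ⟨Y, Y0, Y1, hY⟩ := ex (t, x)
    rw [<- un (t, fun i => x i + (n i : ℝ)) (fun r => Y r + fun i => (n i : ℝ)) (by rw [Y0]; rfl) (fun r hr => ?_), Y1]
    . rfl
    . have := (hY r hr).add_const (fun i => (n i : ℝ))
      refine this.congr_deriv ?_
      exact (Fper (t, x) r (Y r) n).symm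
  let φ : Fin 3 -> Sm := fun i => ⟨fun z => ((Φ z i - z.2 i : ℝ) : ℂ), by
    refine ⟨Complex.ofRealCLM.contDiff.comp ((contDiff_pi.1 cΦ i).sub ?_), fun t x n => ?_⟩
    . exact (contDiff_apply ℝ ℝ i).comp contDiff_snd
    . beta_reduce; rw [Φper]; simp⟩
  have hφ : ∀ i z, φ i z = ((Φ z i - z.2 i : ℝ) : ℂ) := fun i z => rfl
  have mem : ∀ t ∈ Set.Ioo (tk - 2 * τ) (tk + 2 * τ), |t - tk| <= 2 * τ := by
    intro t ht; rw [abs_le]; constructor <;> linarith [ht.1, ht.2]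
  have traj : ∀ t, |t - tk| <= 2 * τ -> ∀ x, ∃ Y : ℝ -> Spc, Y 0 = x ∧ Y 1 = Φ (t, x) ∧ ∀ r ∈ Set.Icc (0 : ℝ) 1,
      HasDerivAt Y (fun i => (tk - t) * (u i (t + r * (tk - t), Y r)).re) r := by
    intro t ht x
    obtain ⟨Y, Y0, Y1, hY⟩ := ex (t, x)
    refine ⟨Y, Y0, Y1, fun r hr => (hY r hr).congr_deriv ?_⟩
    funext i
    simp only [hF]
    rw [κ1 t ht]
    congr 1
    . ring
    . congr 3; ring
  have key : ∀ t, |t - tk| <= 2 * τ -> t ≠ tk -> ∀ x i, DD u (φ i) (t, x) + u i (t, x) = 0 := by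
    intro t ht hne x i
    obtain ⟨Y, Y0, Y1, hY⟩ := traj t ht x
    have hc : ∀ s ∈ Set.Icc (0 : ℝ) 1, Φ (t + s * (tk - t), Y s) = Y 1 := by
      intro s hs
      have := un (t + s * (tk - t), Y s) (fun r => Y (s + r * (1 - s))) (by simp) (fun r hr => ?_)
      . rw [<- this]; congr 1; ring
      . have hr' : s + r * (1 - s) ∈ Set.Icc (0 : ℝ) 1 := by
          have h1 := hs.1; have h2 := hs.2; have h3 := hr.1; have h4 := hr.2
          constructor
          . nlinarith
          . nlinarith
        have h1 : HasDerivAt (fun r : ℝ => s + r * (1 - s)) (1 - s) r := by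
          simpa using ((hasDerivAt_id r).mul_const (1 - s)).const_add s
        refine ((hY _ hr').scomp r h1).congr_deriv ?_
        funext j
        have : κ (t + s * (tk - t)) = (t + s * (tk - t)) - tk := by
          refine κ1 _ ?_
          have : t + s * (tk - t) - tk = (1 - s) * (t - tk) := by ring
          rw [this, abs_mul, abs_of_nonneg (by linarith [hs.2])]
          exact (mul_le_of_le_one_left (abs_nonneg _) (by linarith [hs.1])).trans ht
        simp only [hF, this, Pi.smul_apply, smul_eq_mul]
        rw [show tk + (t + s * (tk - t) - tk) + r * -(t + s * (tk - t) - tk) = t + (s + r * (1 - s)) * (tk - t) by ring]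
        ring
    have h1 := traj_deriv hu (φ i) t (tk - t) Y 0 (hY 0 (by simp))
    have h2 : HasDerivAt (fun r => ((Y r i : ℝ) : ℂ)) (((tk - t) * (u i (t + 0 * (tk - t), Y 0)).re : ℝ) : ℂ) 0 :=
      ((hasDerivAt_pi.1 (hY 0 (by simp))) i).ofReal_comp
    have h3 := (h1.add h2).hasDerivWithinAt (s := Set.Icc 0 1)
    have h4 : HasDerivWithinAt (fun _ : ℝ => ((Y 1 i : ℝ) : ℂ)) 0 (Set.Icc 0 1) (0 : ℝ) := hasDerivWithinAt_const _ _ _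
    have h5 := h4.congr (f₁ := ((fun r => φ i (t + r * (tk - t), Y r)) + fun r => ((Y r i : ℝ) : ℂ))) (fun s hs => by
      simp only [Pi.add_apply, hφ, hc s hs]; push_cast; ring) (by simp only [Pi.add_apply, hφ, hc 0 (by simp)]; push_cast; ring)
    have h6 := (uniqueDiffOn_Icc zero_lt_one (0 : ℝ) (by simp)).eq_deriv (Set.Icc (0 : ℝ) 1) h3 h5
    rw [Y0, zero_mul, add_zero] at h6
    push_cast at h6
    rw [(hu i).coe, <- mul_add] at h6
    rcases mul_eq_zero.1 h6 with h | h
    . exact absurd (by exact_mod_cast h) (sub_ne_zero.2 hne.symm)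
    . exact h
  refine ⟨φ, fun i => re_of_im fun z => by rw [hφ]; simp, fun i x => ?_, fun i t ht x => ?_, fun t ht x => ?_⟩
  . have := un (tk, x) (fun _ => x) rfl (fun r _ => by
      refine (hasDerivAt_const r x).congr_deriv ?_
      funext j
      simp [hF, κ1 tk (by simp; linarith)])
    rw [hφ, <- this]; simp
  . rw [coe_neg, <- add_eq_zero_iff_eq_neg]
    by_cases hne : t = tk
    . subst hne
      have hcont : Continuous fun s : ℝ => (DD u (φ i) + u i) (s, x) := (DD u (φ i) + u i).cont.comp (by fun_prop)
      have h1 : Filter.Tendsto (fun s : ℝ => (DD u (φ i) + u i) (s, x)) (nhdsWithin t {t}ᶜ) (nhds ((DD u (φ i) + u i) (t, x))) :=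
        (hcont.tendsto t).mono_left nhdsWithin_le_nhds
      have h2 : Filter.Tendsto (fun s : ℝ => (DD u (φ i) + u i) (s, x)) (nhdsWithin t {t}ᶜ) (nhds 0) := by
        refine tendsto_const_nhds.congr' ?_
        have hm : Set.Ioo (t - 2 * τ) (t + 2 * τ) ∈ nhdsWithin t {t}ᶜ := nhdsWithin_le_nhds (Ioo_mem_nhds ht.1 ht.2)
        filter_upwards [hm, self_mem_nhdsWithin] with s hs hs'
        exact (key s (mem s hs) hs' x i).symm
      exact tendsto_nhds_unique h1 h2
    . exact key t (mem t ht) hne x i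
  . obtain ⟨Y, Y0, _, hY⟩ := traj t (mem t ht) x
    exact ⟨Y, Y0, hY⟩
end
section
/-- Trajectory property. -/
def Traj (u : Fin 3 -> Sm) (tk t : ℝ) (x : Spc) : Prop :=
  ∃ Y : ℝ -> Spc, Y 0 = x ∧ ∀ r ∈ Set.Icc (0 : ℝ) 1,
      HasDerivAt Y (fun i => (tk - t) * (u i (t + r * (tk - t), Y r)).re) r
theorem gron0 {J : Type} [Fintype J] {u : Fin 3 -> Sm} (hu : ∀ i, Re (u i)) (f : J -> Sm) {tk t : ℝ} {x : Spc}
    (hT : Traj u tk t x) (K ε δ : ℝ) (hK : 0 <= K) (hε : 0 <= ε) (hδ : 0 <= δ)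
    (hb : ∀ j, ∀ s ∈ Set.uIcc t tk, ∀ y, |tk - t| * ‖DD u (f j) (s, y)‖ <= K * ‖fun j => f j (s, y)‖ + ε)
    (h0 : ∀ j y, ‖f j (tk, y)‖ <= δ) (j : J) : ‖f j (t, x)‖ <= gronwallBound δ K ε 1 := by
  obtain ⟨Y, Y0, hY⟩ := hT
  have hmem : ∀ r ∈ Set.Icc (0 : ℝ) 1, t + r * (tk - t) ∈ Set.uIcc t tk := by
    intro r hr
    rw [Set.mem_uIcc]
    rcases le_total t tk with h | h
    . left; constructor <;> nlinarith [hr.1, hr.2]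
    . right; constructor <;> nlinarith [hr.1, hr.2]
  have hd : ∀ r ∈ Set.Icc (0 : ℝ) 1, HasDerivAt (fun r => fun j => f j (t + r * (tk - t), Y r))
      (fun j => ((tk - t : ℝ) : ℂ) * DD u (f j) (t + r * (tk - t), Y r)) r := by
    intro r hr
    rw [hasDerivAt_pi]
    intro j
    simpa using traj_deriv hu (f j) t (tk - t) Y r (hY r hr)
  set g : ℝ -> J -> ℂ := fun s j => f j (t + (1 - s) * (tk - t), Y (1 - s)) with hg
  have hI : ∀ s ∈ Set.Icc (0 : ℝ) 1, 1 - s ∈ Set.Icc (0 : ℝ) 1 := fun s hs => ⟨by linarith [hs.2], by linarith [hs.1]⟩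
  have hd' : ∀ s ∈ Set.Icc (0 : ℝ) 1, HasDerivAt g
      ((-1 : ℝ) • fun j => ((tk - t : ℝ) : ℂ) * DD u (f j) (t + (1 - s) * (tk - t), Y (1 - s))) s := by
    intro s hs
    have h1 : HasDerivAt (fun s : ℝ => 1 - s) (-1) s := by simpa using (hasDerivAt_id s).const_sub 1
    exact (hd _ (hI s hs)).scomp s h1
  have := norm_le_gronwallBound_of_norm_deriv_right_le (f := g) (δ := δ) (K := K) (ε := ε) (a := 0) (b := 1)
    (fun s hs => (hd' s hs).continuousAt.continuousWithinAt)
    (fun s hs => (hd' s ⟨hs.1, hs.2.le⟩).hasDerivWithinAt)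
    (by
      rw [pi_norm_le_iff_of_nonneg hδ]
      intro j
      have := h0 j (Y 1)
      simpa [hg] using this)
    (fun s hs => by
      have hs' : s ∈ Set.Icc (0 : ℝ) 1 := ⟨hs.1, hs.2.le⟩
      rw [norm_smul, norm_neg, norm_one, one_mul, pi_norm_le_iff_of_nonneg (by positivity)]
      intro j
      rw [norm_mul, Complex.norm_real]
      exact hb j _ (hmem _ (hI s hs')) _) 1 (by simp)
  have h2 := (norm_le_pi_norm (g 1) j).trans this
  simpa [hg, Y0] using h2
/-- A family of time windows with flows. -/
structure Win (κ : Type) where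
  tk : κ -> ℝ
  τ : κ -> ℝ
  u : κ -> Fin 3 -> Sm
  nu : κ -> ℝ
  hτ : ∀ k, 0 < τ k
  hν : ∀ k, 0 < nu k
  hτν : ∀ k, τ k * nu k <= 1
  hu : ∀ k i, Re (u k i)
  tr : ∀ k t x, |t - tk k| < 2 * τ k -> Traj (u k) (tk k) t x
namespace Win
variable {κ : Type} (W : Win κ)
def win (k : κ) : Set ℝ := {t | |t - W.tk k| < 2 * W.τ k}
theorem win_open (k : κ) : IsOpen (W.win k) := isOpen_lt (by fun_prop) (by fun_prop)
/-- index type of points in windows -/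
def Ix : Type := {i : κ × Zt // i.2.1 ∈ W.win i.1}
/-- The window context. -/
def c (mu : κ -> ℝ) : Ctx W.Ix := ⟨fun i => i.1.2, fun i => W.u i.1.1, fun i => mu i.1.1, fun i => W.nu i.1.1⟩
/-- The initial time context. -/
def c0 (mu : κ -> ℝ) : Ctx (κ × Spc) := ⟨fun i => (W.tk i.1, i.2), fun i => W.u i.1, fun i => mu i.1, fun i => W.nu i.1⟩
variable {W} {mu : κ -> ℝ}
theorem congrW {r m : ℕ} {A : W.Ix -> ℝ} {F G : κ -> Sm} (h : Cl (W.c mu) r m A (fun i => F i.1.1))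
    (he : ∀ k, EqS (W.win k) (F k) (G k)) : Cl (W.c mu) r m A (fun i => G i.1.1) :=
  h.congr fun i => ⟨W.win i.1.1, W.win_open _, i.2, he _⟩
/-- Grönwall for linear systems of transport equations. -/
theorem gron (M : ℕ) (hdu : ∀ i k, Cl (W.c mu) 0 M (fun i => W.nu i.1.1) (fun j => dd i (W.u j.1.1 k)))
    (m : ℕ) (hm : m <= M) {J : Type} [Fintype J] [DecidableEq J] {X : J -> κ -> Sm} {a : J -> J -> κ -> Sm} {r : J -> κ -> Sm} {B : κ -> ℝ}
    (hB : ∀ k, 0 <= B k)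
    (hD : ∀ j k, EqS (W.win k) (DD (W.u k) (X j k)) (∑ j', a j j' k * X j' k + r j k))
    (ha : ∀ j j', Cl (W.c mu) 0 m (fun i => W.nu i.1.1) (fun i => a j j' i.1.1))
    (hr : ∀ j, Cl (W.c mu) 0 m (fun i => B i.1.1 * W.nu i.1.1) (fun i => r j i.1.1))
    (h0 : ∀ j, Cl (W.c0 mu) 0 m (fun i => B i.1) (fun i => X j i.1)) (hmu : ∀ k, 0 <= mu k) (j : J) :
    Cl (W.c mu) 0 m (fun i => B i.1.1) (fun i => X j i.1.1) := by
  induction m generalizing J B with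
  | zero =>
    refine .mk ?_ (fun k hk => by omega) (fun k hk => by omega)
    choose Ca hCa hCa' using fun j j' => (ha j j').val.bound
    choose Cr hCr hCr' using fun j => (hr j).val.bound
    choose Ci hCi hCi' using fun j => (h0 j).val.bound
    set K1 := ∑ j, ∑ j', Ca j j' with hK1
    have hK1' : 0 <= K1 := sum_nonneg fun j _ => sum_nonneg fun j' _ => hCa j j'
    set K2 := ∑ j, Cr j
    have hK2 : 0 <= K2 := sum_nonneg fun j _ => hCr j
    set K3 := ∑ j, Ci j
    have hK3 : 0 <= K3 := sum_nonneg fun j _ => hCi j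
    refine Ls.of (gronwallBound K3 (2 * K1 + 1) (2 * K2) 1) fun i => ?_
    obtain ⟨⟨k, t, x⟩, hi⟩ := i
    change t ∈ W.win k at hi
    have hlin : gronwallBound (K3 * B k) (2 * K1 + 1) (2 * K2 * B k) 1 = gronwallBound K3 (2 * K1 + 1) (2 * K2) 1 * B k := by
      rw [gronwallBound_of_K_ne_0 (by positivity), gronwallBound_of_K_ne_0 (by positivity)]
      ring
    change ‖X j k (t, x)‖ <= _ * B k
    rw [<- hlin]
    refine gron0 (W.hu k) (fun j => X j k) (W.tr k t x hi) _ _ _ (by positivity) (mul_nonneg (by positivity) (hB k)) (mul_nonneg hK3 (hB k)) ?_ ?_ j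
    . intro j s hs y
      have hs' : s ∈ W.win k := by
        refine lt_of_le_of_lt ?_ (show |t - W.tk k| < 2 * W.τ k from hi)
        rcases Set.mem_uIcc.1 hs with h | h
        . rw [abs_sub_comm s, abs_sub_comm t, abs_of_nonneg (by linarith), abs_of_nonneg (by linarith)]; linarith
        . rw [abs_of_nonneg (by linarith), abs_of_nonneg (by linarith)]; linarith
      rw [hD j k s hs' y]
      have hν := W.hν k
      have ht : |W.tk k - t| * W.nu k <= 2 := by
        have h1 : |W.tk k - t| < 2 * W.τ k := by rw [abs_sub_comm]; exact hi
        have := W.hτν k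
        nlinarith
      set n := ‖fun j => X j k (s, y)‖ with hn
      have hn0 : 0 <= n := norm_nonneg _
      have h1 : ‖(∑ j', a j j' k * X j' k + r j k) (s, y)‖ <= K1 * W.nu k * n + K2 * (B k * W.nu k) := by
        simp only [coe_add, coe_sum, coe_mul]
        refine (norm_add_le _ _).trans (add_le_add ((norm_sum_le _ _).trans ?_) ?_)
        . calc _ <= ∑ j', Ca j j' * W.nu k * n := by
                refine sum_le_sum fun j' _ => ?_
                rw [norm_mul]
                have := hCa' j j' ⟨(k, s, y), hs'⟩
                rw [abs_of_pos hν] at this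
                exact mul_le_mul this (norm_le_pi_norm (fun j => X j k (s, y)) j') (norm_nonneg _) (mul_nonneg (hCa _ _) hν.le)
            _ = (∑ j', Ca j j') * (W.nu k * n) := by rw [sum_mul]; simp only [mul_assoc]
            _ <= K1 * (W.nu k * n) := by
                refine mleR ?_ (by positivity)
                exact single_le_sum (f := fun j => ∑ j', Ca j j') (fun j _ => sum_nonneg fun j' _ => hCa j j') (mem_univ j)
            _ = _ := by ring
        . have := hCr' j ⟨(k, s, y), hs'⟩
          rw [abs_of_nonneg (mul_nonneg (hB k) hν.le)] at this
          refine this.trans (mleR ?_ (mul_nonneg (hB k) hν.le))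
          exact single_le_sum (fun j _ => hCr j) (mem_univ j)
      calc _ <= |W.tk k - t| * (K1 * W.nu k * n + K2 * (B k * W.nu k)) := mleL h1 (abs_nonneg _)
        _ = (|W.tk k - t| * W.nu k) * (K1 * n + K2 * B k) := by ring
        _ <= 2 * (K1 * n + K2 * B k) := mleR ht (add_nonneg (by positivity) (mul_nonneg hK2 (hB k)))
        _ <= _ := by nlinarith
    . intro j y
      have := hCi' j (k, y)
      rw [abs_of_nonneg (hB k)] at this
      refine this.trans (mleR ?_ (hB k))
      exact single_le_sum (fun j _ => hCi j) (mem_univ j)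
  | succ m ih =>
    have hX : ∀ j, Cl (W.c mu) 0 m (fun i => B i.1.1) (fun i => X j i.1.1) := ih (by omega) hB hD
      (fun j j' => (ha j j').down le_rfl (by omega)) (fun j => (hr j).down le_rfl (by omega)) (fun j => (h0 j).down le_rfl (by omega))
    refine .mk (hX j).val (fun m' hm' i => ?_) (fun k hk => by omega)
    obtain rfl : m = m' := by omega
    refine ih (by omega) (J := J × Fin 3) (X := fun p k => dd p.2 (X p.1 k)) (B := fun k => B k * mu k)
      (a := fun p p' k => (if p.2 = p'.2 then a p.1 p'.1 k else 0) - (if p.1 = p'.1 then dd p.2 (W.u k p'.2) else 0))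
      (r := fun p k => ∑ j', dd p.2 (a p.1 j' k) * X j' k + dd p.2 (r p.1 k)) (fun k => mul_nonneg (hB k) (hmu k)) ?_ ?_ ?_ ?_ (j, i)
    . rintro ⟨j, i⟩ k t ht x
      have h1 := (hD j k).dd (W.win_open k) i t ht x
      simp only [DD_dd]
      simp only [coe_sub]
      rw [h1]
      simp only [map_add, map_sum, Derivation.leibniz, smul_eq_mul, Fintype.sum_prod_type, sub_mul, ite_mul, zero_mul, sum_sub_distrib,
        Finset.sum_ite_eq, mem_univ, if_true, sum_add_distrib]
      have e2 : ∑ x : J, ∑ x_1, (if j = x then dd i (W.u k x_1) * dd x_1 (X x k) else 0) = ∑ x_1, dd i (W.u k x_1) * dd x_1 (X j k) := by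
        rw [sum_comm]; simp
      rw [e2]
      simp only [coe_add, coe_sub, coe_sum, coe_mul]
      have : ∀ j', X j' k (t, x) * (dd i (a j j' k)) (t, x) = (dd i (a j j' k)) (t, x) * X j' k (t, x) := fun _ => mul_comm _ _
      simp only [this]
      ring
    . rintro ⟨j, i⟩ ⟨j', i'⟩
      dsimp only
      refine Cl.sub ?_ ?_
      . split_ifs
        . exact (ha _ _).down le_rfl (by omega)
        . exact Cl.zero
      . split_ifs
        . exact (hdu _ _).down le_rfl (by omega)
        . exact Cl.zero
    . rintro ⟨j, i⟩
      refine Cl.add (Cl.sum _ fun j' _ => ((ha j j').dd i).mul' (hX j') (Ls.eq fun i => ?_)) (((hr j).dd i).trans (Ls.eq fun i => ?_))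
      . simp only [c]; ring
      . simp only [c]; ring
    . rintro ⟨j, i⟩
      exact (h0 j).dd i
end Win
end
section
namespace Sm
theorem fderiv_space (f : Sm) (z : Zt) (w : Spc) : fderiv ℝ f z ((0 : ℝ), w) = ∑ i, ((w i : ℝ) : ℂ) * dd i f z := by
  have e : ((0 : ℝ), w) = ∑ i, (w i) • ((0 : ℝ), (Pi.single i 1 : Spc)) := by
    refine Prod.ext (by simp [Prod.fst_sum]) ?_
    funext k
    simp [Prod.snd_sum, Finset.sum_apply, Pi.single_apply]
  rw [e, map_sum]
  refine sum_congr rfl fun i _ => ?_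
  rw [map_smul, Complex.real_smul]; rfl
/-- displaced point -/
def dsp (φ : Fin 3 -> Sm) (z : Zt) : Spc := fun i => z.2 i + (φ i z).re
theorem dsp_smooth (φ : Fin 3 -> Sm) : ContDiff ℝ ∞ (dsp φ) := by
  rw [contDiff_pi]
  intro i
  exact ((contDiff_apply ℝ ℝ i).comp contDiff_snd).add (re_smooth (φ i))
theorem dsp_per (φ : Fin 3 -> Sm) (t : ℝ) (x : Spc) (k : Fin 3 -> ℤ) :
    dsp φ (t, fun i => x i + (k i : ℝ)) = fun i => dsp φ (t, x) i + (k i : ℝ) := by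
  funext i; simp only [dsp]; rw [(φ i).per]; ring
theorem dsp_fderiv {φ : Fin 3 -> Sm} (z a : Zt) (i : Fin 3) :
    HasFDerivAt (fun z => dsp φ z i) ((ContinuousLinearMap.proj (R := ℝ) i).comp (ContinuousLinearMap.snd ℝ ℝ Spc) +
      Complex.reCLM.comp (fderiv ℝ (φ i) z)) z := by
  refine HasFDerivAt.add ?_ ?_
  . exact ((ContinuousLinearMap.proj (R := ℝ) (φ := fun _ : Fin 3 => ℝ) i).comp (ContinuousLinearMap.snd ℝ ℝ Spc)).hasFDerivAt
  . exact Complex.reCLM.hasFDerivAt.comp z ((φ i).diffAt z).hasFDerivAt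
/-- Pull-back along a displacement. -/
def pb (φ : Fin 3 -> Sm) (tk : ℝ) (ρ : Sm) : Sm :=
  ⟨fun z => ρ (tk, dsp φ z), ρ.smooth.comp (contDiff_const.prodMk (dsp_smooth φ)), fun t x k => by
    beta_reduce; rw [dsp_per, ρ.per]⟩
theorem pb_apply (φ : Fin 3 -> Sm) (tk : ℝ) (ρ : Sm) (z : Zt) : pb φ tk ρ z = ρ (tk, dsp φ z) := rfl
theorem pb_dv {φ : Fin 3 -> Sm} (hφ : ∀ i, Re (φ i)) (tk : ℝ) (ρ : Sm) (a : Zt) :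
    dv a (pb φ tk ρ) = ∑ i, pb φ tk (dd i ρ) * (cst ((a.2 i : ℝ) : ℂ) + dv a (φ i)) := by
  apply ext'
  intro z
  have h1 : HasFDerivAt (dsp φ) _ z := hasFDerivAt_pi.2 fun i => dsp_fderiv (φ := φ) z a i
  have h2 := (ρ.diffAt (tk, dsp φ z)).hasFDerivAt.comp z ((hasFDerivAt_const tk z).prodMk h1)
  have h3 : dv a (pb φ tk ρ) z = _ := congrArg (fun L => L a) h2.fderiv
  rw [h3]
  change fderiv ℝ ρ (tk, dsp φ z) ((0 : ℝ), _) = _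
  rw [fderiv_space]
  simp only [coe_sum, coe_mul, coe_add, pb_apply, coe_algebraMap]
  refine sum_congr rfl fun i _ => ?_
  have : dv a (φ i) z = ((dv a (φ i) z).re : ℂ) := by
    apply Complex.ext <;> simp
    have : Re (dv a (φ i)) := by unfold Re; rw [cj_dv, hφ i]
    exact this.im z
  rw [this, mul_comm]
  congr 1
  simp [dv_apply]
/-- Oscillating phases. -/
def ex (φ : Fin 3 -> Sm) (p : ℤ) (n : Fin 3 -> ℤ) : Sm :=
  ⟨fun z => Complex.exp (2 * Real.pi * Complex.I * p * ∑ i, n i * ((dsp φ z i : ℝ) : ℂ)), by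
    refine ⟨Complex.contDiff_exp.comp (contDiff_const.mul (ContDiff.sum fun i _ => contDiff_const.mul ?_)), fun t x k => ?_⟩
    . exact Complex.ofRealCLM.contDiff.comp (contDiff_pi.1 (dsp_smooth φ) i)
    . beta_reduce
      rw [dsp_per, <- mul_one (Complex.exp (2 * Real.pi * Complex.I * p * ∑ i, n i * ((dsp φ (t, x) i : ℝ) : ℂ))),
        <- Complex.exp_int_mul_two_pi_mul_I (p * ∑ i, n i * k i), <- Complex.exp_add]
      congr 1
      push_cast
      simp only [mul_add, sum_add_distrib]
      ring⟩
theorem ex_apply (φ : Fin 3 -> Sm) (p : ℤ) (n : Fin 3 -> ℤ) (z : Zt) :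
    ex φ p n z = Complex.exp (2 * Real.pi * Complex.I * p * ∑ i, n i * ((dsp φ z i : ℝ) : ℂ)) := rfl
theorem ex_add (φ : Fin 3 -> Sm) (p : ℤ) (n n' : Fin 3 -> ℤ) : ex φ p (n + n') = ex φ p n * ex φ p n' := by
  apply ext'; intro z
  rw [coe_mul, ex_apply, ex_apply, ex_apply, <- Complex.exp_add]
  congr 1
  simp only [Pi.add_apply, Int.cast_add, add_mul, sum_add_distrib]; ring
theorem ex_zero (φ : Fin 3 -> Sm) (p : ℤ) : ex φ p 0 = 1 := by
  apply ext'; intro z; rw [ex_apply]; simp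
theorem ex_cj (φ : Fin 3 -> Sm) (p : ℤ) (n : Fin 3 -> ℤ) : cj (ex φ p n) = ex φ p (-n) := by
  apply ext'; intro z
  rw [cj_apply, ex_apply, ex_apply, <- Complex.exp_conj]
  congr 1
  have h2 : (starRingEnd ℂ) 2 = 2 := by exact_mod_cast Complex.conj_ofReal 2
  simp [h2]
theorem ex_norm (φ : Fin 3 -> Sm) (p : ℤ) (n : Fin 3 -> ℤ) (z : Zt) : ‖ex φ p n z‖ = 1 := by
  have : ex φ p n z = Complex.exp (((2 * Real.pi * p * ∑ i, n i * dsp φ z i : ℝ) : ℂ) * Complex.I) := by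
    rw [ex_apply]; congr 1; push_cast; ring
  rw [this, Complex.norm_exp_ofReal_mul_I]
theorem ex_dv {φ : Fin 3 -> Sm} (hφ : ∀ i, Re (φ i)) (p : ℤ) (n : Fin 3 -> ℤ) (a : Zt) :
    dv a (ex φ p n) = (2 * Real.pi * Complex.I * p : ℂ) • ((∑ i, cst (n i : ℂ) * (cst ((a.2 i : ℝ) : ℂ) + dv a (φ i))) * ex φ p n) := by
  apply ext'
  intro z
  have h1 : ∀ i, HasFDerivAt (fun z => (n i : ℂ) * ((dsp φ z i : ℝ) : ℂ)) _ z := fun i =>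
    (Complex.ofRealCLM.hasFDerivAt.comp z (dsp_fderiv (φ := φ) z a i)).const_mul (n i : ℂ)
  have h2 := (((HasFDerivAt.fun_sum (u := Finset.univ) fun i _ => h1 i).const_mul (2 * Real.pi * Complex.I * p : ℂ)).cexp)
  have h3 : dv a (ex φ p n) z = _ := congrArg (fun L => L a) h2.fderiv
  rw [h3]
  simp only [ContinuousLinearMap.smul_apply, ContinuousLinearMap.sum_apply, coe_smul, coe_mul, coe_sum, coe_add, coe_algebraMap, smul_eq_mul]
  rw [ex_apply, mul_comm, mul_assoc]
  congr 1
  congr 1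
  refine sum_congr rfl fun i _ => ?_
  have : dv a (φ i) z = ((dv a (φ i) z).re : ℂ) := by
    apply Complex.ext <;> simp
    have : Re (dv a (φ i)) := by unfold Re; rw [cj_dv, hφ i]
    exact this.im z
  rw [this]
  simp [dv_apply]
/-- Equality at a single time. -/
theorem eqT_dd {t : ℝ} {f g : Sm} (h : ∀ x, f (t, x) = g (t, x)) (j : Fin 3) (x : Spc) : dd j f (t, x) = dd j g (t, x) := by
  have key : ∀ f : Sm, dd j f (t, x) = deriv (fun s : ℝ => f (t, x + s • (Pi.single j 1 : Spc))) 0 := by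
    intro f
    have h1 : HasDerivAt (fun s : ℝ => (t, x + s • (Pi.single j 1 : Spc))) ((0 : ℝ), (Pi.single j 1 : Spc)) 0 := by
      refine (hasDerivAt_const _ _).prodMk ?_
      simpa using ((hasDerivAt_id (0 : ℝ)).smul_const (Pi.single j 1 : Spc)).const_add x
    have h2 := (f.diffAt (t, x + (0 : ℝ) • (Pi.single j 1 : Spc))).hasFDerivAt.comp_hasDerivAt (0 : ℝ) h1
    have h3 := h2.deriv
    simp only [zero_smul, add_zero] at h3
    exact h3.symm
  rw [key, key]
  simp only [h]
end Sm
theorem Cl.congr0 {ι : Type} {c : Ctx ι} {m : ℕ} {A : ι -> ℝ} {F G : ι -> Sm} (h : Cl c 0 m A F)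
    (he : ∀ i x, F i ((c.pt i).1, x) = G i ((c.pt i).1, x)) : Cl c 0 m A G := by
  induction m generalizing A F G with
  | zero =>
    refine .mk ?_ (fun k hk => by omega) (fun k hk => by omega)
    have : (fun i => G i (c.pt i)) = fun i => F i (c.pt i) := funext fun i => (he i (c.pt i).2).symm
    rw [this]; exact h.val
  | succ m ih =>
    refine .mk ?_ (fun k hk j => ?_) (fun k hk => by omega)
    . have : (fun i => G i (c.pt i)) = fun i => F i (c.pt i) := funext fun i => (he i (c.pt i).2).symm
      rw [this]; exact h.val
    . obtain rfl : m = k := by omega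
      exact ih (h.dd j) fun i x => eqT_dd (he i) j x
namespace Win
variable {κ : Type} {W : Win κ} {mu : κ -> ℝ}
theorem gron1 {M : ℕ} (hdu : ∀ i k, Cl (W.c mu) 0 M (fun i => W.nu i.1.1) (fun j => dd i (W.u j.1.1 k)))
    (hmu : ∀ k, 0 <= mu k) {F : κ -> Sm} {B : κ -> ℝ} (hB : ∀ k, 0 <= B k)
    (h0 : Cl (W.c0 mu) 0 M (fun i => B i.1) (fun i => F i.1))
    (hD : Cl (W.c mu) 0 M (fun i => B i.1.1 * W.nu i.1.1) (fun i => DD (W.u i.1.1) (F i.1.1))) :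
    Cl (W.c mu) 0 M (fun i => B i.1.1) (fun i => F i.1.1) :=
  gron M hdu M le_rfl (J := Unit) (X := fun _ => F) (a := fun _ _ _ => 0) (r := fun _ k => DD (W.u k) (F k)) hB
    (fun j k => by simpa using EqS.refl _ _) (fun _ _ => Cl.zero) (fun _ => hD) (fun _ => h0) hmu ()
/-- functions transported by the flow -/
theorem transp {M r : ℕ} (hdu : ∀ i k, Cl (W.c mu) r M (fun i => W.nu i.1.1) (fun j => dd i (W.u j.1.1 k)))
    (hmu : ∀ k, 0 <= mu k) {F : κ -> Sm} {B : κ -> ℝ} (hB : ∀ k, 0 <= B k)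
    (h0 : Cl (W.c0 mu) 0 M (fun i => B i.1) (fun i => F i.1))
    (hD : ∀ k, EqS (W.win k) 0 (DD (W.u k) (F k))) :
    Cl (W.c mu) (r + 1) M (fun i => B i.1.1) (fun i => F i.1.1) := by
  have hz : ∀ r, Cl (W.c mu) r M (fun i => B i.1.1 * W.nu i.1.1) (fun i => DD (W.u i.1.1) (F i.1.1)) := fun r =>
    congrW (F := fun _ => 0) Cl.zero hD
  induction r with
  | zero => exact Cl.build (gron1 hdu hmu hB h0 (hz 0)) (hz 0) hdu
  | succ r ih => exact Cl.build (ih fun i k => (hdu i k).down (Nat.le_succ _) le_rfl) (hz _) hdu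
/-- Flow displacement data. -/
structure Flow (W : Win κ) where
  φ : κ -> Fin 3 -> Sm
  re : ∀ k i, Re (φ k i)
  ini : ∀ k i x, φ k i (W.tk k, x) = 0
  D : ∀ k i, EqS (W.win k) (DD (W.u k) (φ k i)) (- W.u k i)
namespace Flow
variable (S : Flow W)
/-- displacement gradient -/
def G (i j : Fin 3) (k : κ) : Sm := dd j (S.φ k i)
theorem DG (i j : Fin 3) (k : κ) : EqS (W.win k) (DD (W.u k) (S.G i j k)) (∑ l, (- dd j (W.u k l)) * S.G i l k + - dd j (W.u k i)) := by
  intro t ht x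
  have h1 := (S.D k i).dd (W.win_open k) j t ht x
  unfold G
  rw [DD_dd, coe_sub, h1]
  simp only [map_neg, coe_add, coe_neg, coe_sum, neg_mul, coe_mul, sum_neg_distrib]
  ring
theorem G_cl0 {M : ℕ} {B : κ -> ℝ} (hdu : ∀ i k, Cl (W.c mu) 0 M (fun i => W.nu i.1.1) (fun j => dd i (W.u j.1.1 k)))
    (hdB : ∀ i k, Cl (W.c mu) 0 M (fun i => B i.1.1 * W.nu i.1.1) (fun j => dd i (W.u j.1.1 k)))
    (hmu : ∀ k, 0 <= mu k) (hB : ∀ k, 0 <= B k) (i j : Fin 3) : Cl (W.c mu) 0 M (fun i => B i.1.1) (fun k => S.G i j k.1.1) := by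
  refine gron M hdu M le_rfl (J := Fin 3) (X := fun j => S.G i j) (a := fun j l k => - dd j (W.u k l)) (r := fun j k => - dd j (W.u k i)) hB
    (fun j k => S.DG i j k) (fun _ _ => (hdu _ _).neg) (fun _ => (hdB _ _).neg) (fun j => ?_) hmu j
  have : Cl (W.c0 mu) 0 M (fun i => B i.1) (fun _ => (0 : Sm)) := Cl.zero
  refine this.congr0 fun k x => ?_
  have := eqT_dd (t := W.tk k.1) (f := 0) (g := S.φ k.1 i) (fun x => by rw [S.ini, coe_zero]) j x
  rw [map_zero] at this
  exact this
theorem G_clS {M r : ℕ} {B : κ -> ℝ} (hdu : ∀ i k, Cl (W.c mu) r M (fun i => W.nu i.1.1) (fun j => dd i (W.u j.1.1 k)))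
    (hdB : ∀ i k, Cl (W.c mu) r M (fun i => B i.1.1 * W.nu i.1.1) (fun j => dd i (W.u j.1.1 k)))
    (hmu : ∀ k, 0 <= mu k) (hB : ∀ k, 0 <= B k) (i j : Fin 3) : Cl (W.c mu) (r + 1) M (fun i => B i.1.1) (fun k => S.G i j k.1.1) := by
  have key : ∀ r, (∀ i k, Cl (W.c mu) r M (fun i => W.nu i.1.1) (fun j => dd i (W.u j.1.1 k))) ->
      (∀ i k, Cl (W.c mu) r M (fun i => B i.1.1 * W.nu i.1.1) (fun j => dd i (W.u j.1.1 k))) ->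
      (∀ j, Cl (W.c mu) r M (fun i => B i.1.1) (fun k => S.G i j k.1.1)) -> ∀ j, Cl (W.c mu) (r + 1) M (fun i => B i.1.1) (fun k => S.G i j k.1.1) := by
    intro r hdu hdB h j
    refine Cl.build (h j) ?_ hdu
    refine congrW (F := fun k => ∑ l, (- dd j (W.u k l)) * S.G i l k + - dd j (W.u k i)) ?_ (fun k => (S.DG i j k).symm)
    exact Cl.add (Cl.sum _ fun l _ => (hdu j l).neg.mul' (h l) (Ls.eq fun i => mul_comm _ _)) (hdB j i).neg
  induction r generalizing j with
  | zero => exact key 0 hdu hdB (fun j => S.G_cl0 hdu hdB hmu hB i j) j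
  | succ r ih =>
    exact key _ hdu hdB (fun j => ih (fun i k => (hdu i k).down (Nat.le_succ _) le_rfl) (fun i k => (hdB i k).down (Nat.le_succ _) le_rfl) j) j
/-- explicit smallness -/
theorem G_small {A : κ -> ℝ} (hA : ∀ k, ∀ t ∈ W.win k, ∀ x i j, ‖dd i (W.u k j) (t, x)‖ <= A k) (hA' : ∀ k, 10000 * (W.τ k * A k) <= 1)
    (hA0 : ∀ k, 0 <= A k)
    (i j : Fin 3) (k : κ) (t : ℝ) (ht : t ∈ W.win k) (x : Spc) : ‖S.G i j k (t, x)‖ <= 1 / 1000 := by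
  have h := gron0 (W.hu k) (fun j => S.G i j k) (W.tr k t x ht) (6 / 10000) (2 / 10000) 0 (by norm_num) (by norm_num) le_rfl ?_ ?_ j
  . refine h.trans ?_
    rw [gronwallBound_of_K_ne_0 (by norm_num)]
    have := Real.exp_bound_div_one_sub_of_interval (x := 6 / 10000) (by norm_num) (by norm_num)
    norm_num at this ⊢
    linarith
  . intro j s hs y
    have hs' : s ∈ W.win k := by
      refine lt_of_le_of_lt ?_ (show |t - W.tk k| < 2 * W.τ k from ht)
      rcases Set.mem_uIcc.1 hs with h | h
      . rw [abs_sub_comm s, abs_sub_comm t, abs_of_nonneg (by linarith), abs_of_nonneg (by linarith)]; linarith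
      . rw [abs_of_nonneg (by linarith), abs_of_nonneg (by linarith)]; linarith
    rw [S.DG i j k s hs' y]
    set n := ‖fun j => S.G i j k (s, y)‖ with hn
    have hn0 : 0 <= n := norm_nonneg _
    have hb : ‖(∑ l, (- dd j (W.u k l)) * S.G i l k + - dd j (W.u k i)) (s, y)‖ <= 3 * (A k * n) + A k := by
      simp only [coe_add, coe_sum, coe_mul, coe_neg]
      refine (norm_add_le _ _).trans (add_le_add ((norm_sum_le _ _).trans ?_) (by rw [norm_neg]; exact hA k s hs' y _ _))
      calc _ <= ∑ l : Fin 3, A k * n := sum_le_sum fun l _ => by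
            rw [norm_mul, norm_neg]
            exact mul_le_mul (hA k s hs' y _ _) (norm_le_pi_norm (fun j => S.G i j k (s, y)) l) (norm_nonneg _) (hA0 k)
        _ = _ := by simp
    have h1 : |W.tk k - t| <= 2 * W.τ k := by rw [abs_sub_comm]; exact le_of_lt ht
    have h2 : |W.tk k - t| * A k <= 2 / 10000 := by nlinarith [hA' k, hA0 k]
    calc _ <= |W.tk k - t| * (3 * (A k * n) + A k) := mleL hb (abs_nonneg _)
      _ = (|W.tk k - t| * A k) * (3 * n + 1) := by ring
      _ <= 2 / 10000 * (3 * n + 1) := mleR h2 (by positivity)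
      _ = _ := by ring
  . intro j y
    have := eqT_dd (t := W.tk k) (f := 0) (g := S.φ k i) (fun x => by rw [S.ini, coe_zero]) j y
    rw [map_zero] at this
    rw [show S.G i j k (W.tk k, y) = 0 from this.symm]; simp
/-- D of phases vanishes -/
theorem D_ex (p : ℤ) (n : Fin 3 -> ℤ) (k : κ) : EqS (W.win k) 0 (DD (W.u k) (ex (S.φ k) p n)) := by
  have h : DD (W.u k) (ex (S.φ k) p n) = (2 * Real.pi * Complex.I * p : ℂ) • ((∑ i, cst (n i : ℂ) * (W.u k i + DD (W.u k) (S.φ k i))) * ex (S.φ k) p n) := by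
    simp only [DD_apply]
    unfold dt dd
    simp only [ex_dv (S.re k)]
    simp only [Fin.sum_univ_three, Pi.zero_apply, Pi.single_apply, Complex.ofReal_zero, map_zero, Algebra.smul_def]
    simp
    ring
  intro t ht x
  rw [h]
  have : ∀ i, DD (W.u k) (S.φ k i) (t, x) = - W.u k i (t, x) := fun i => S.D k i t ht x
  simp [this]
theorem D_pb (ρ : Sm) (k : κ) : EqS (W.win k) 0 (DD (W.u k) (pb (S.φ k) (W.tk k) ρ)) := by
  have h : DD (W.u k) (pb (S.φ k) (W.tk k) ρ) = ∑ i, pb (S.φ k) (W.tk k) (dd i ρ) * (W.u k i + DD (W.u k) (S.φ k i)) := by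
    simp only [DD_apply]
    have e1 := pb_dv (S.re k) (W.tk k) ρ ((1 : ℝ), (0 : Spc))
    have e2 := fun i : Fin 3 => pb_dv (S.re k) (W.tk k) ρ ((0 : ℝ), (Pi.single i 1 : Spc))
    change dt _ = _ at e1
    change ∀ i, dd i _ = _ at e2
    simp only [e1, e2]
    change ∑ i, _ * (_ + dt _) + ∑ i, _ * ∑ l, _ * (_ + dd i _) = _
    simp only [Fin.sum_univ_three, Pi.zero_apply, Pi.single_apply, Complex.ofReal_zero, map_zero]
    simp
    ring
  intro t ht x
  rw [h]
  have : ∀ i, DD (W.u k) (S.φ k i) (t, x) = - W.u k i (t, x) := fun i => S.D k i t ht x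
  simp [this]
/-- wave vector -/
def q (n : Fin 3 -> ℤ) (j : Fin 3) (k : κ) : Sm := cst (n j : ℂ) + ∑ i, cst (n i : ℂ) * S.G i j k
theorem dd_ex (p : ℤ) (n : Fin 3 -> ℤ) (j : Fin 3) (k : κ) :
    dd j (ex (S.φ k) p n) = (2 * Real.pi * Complex.I * p : ℂ) • (S.q n j k * ex (S.φ k) p n) := by
  have := ex_dv (S.re k) p n ((0 : ℝ), (Pi.single j 1 : Spc))
  change dd j _ = _ at this
  rw [this]
  congr 2
  unfold q G
  change ∑ i, _ * (_ + dd j _) = _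
  simp only [mul_add, sum_add_distrib]
  congr 1
  rw [sum_eq_single j] <;> simp +contextual [Pi.single_apply]
theorem q_cj (n : Fin 3 -> ℤ) (j : Fin 3) (k : κ) : Re (S.q n j k) := by
  unfold q
  refine Re.add ?_ (Re.sum fun i _ => Re.mul ?_ ((S.re k i).dd j))
  . exact ext' fun z => by change (starRingEnd ℂ) ((n j : ℤ) : ℂ) = _; rw [map_intCast]; rfl
  . exact ext' fun z => by change (starRingEnd ℂ) ((n i : ℤ) : ℂ) = _; rw [map_intCast]; rfl
theorem pb_ini (ρ : Sm) (k : κ) (x : Spc) : pb (S.φ k) (W.tk k) ρ (W.tk k, x) = ρ (W.tk k, x) := by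
  have e : dsp (S.φ k) (W.tk k, x) = x := by
    funext i
    simp [dsp, S.ini]
  rw [pb_apply, e]
theorem pb_cl {M r : ℕ} (hdu : ∀ i k, Cl (W.c mu) r M (fun i => W.nu i.1.1) (fun j => dd i (W.u j.1.1 k)))
    (hmu : ∀ k, 0 <= mu k) {ρ : κ -> Sm} {B : κ -> ℝ} (hB : ∀ k, 0 <= B k)
    (h0 : Cl (W.c0 mu) 0 M (fun i => B i.1) (fun i => ρ i.1)) :
    Cl (W.c mu) (r + 1) M (fun i => B i.1.1) (fun i => pb (S.φ i.1.1) (W.tk i.1.1) (ρ i.1.1)) := by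
  refine transp (F := fun k => pb (S.φ k) (W.tk k) (ρ k)) hdu hmu hB ?_ (fun k => S.D_pb _ k)
  refine h0.congr0 fun k x => ?_
  exact (S.pb_ini (ρ k.1) k.1 x).symm
end Flow
end Win
end
section
namespace Sm
/-- time reparametrisation -/
def rep (f : Sm) (k : ℝ -> ℝ) (hk : ContDiff ℝ ∞ k) : Sm :=
  ⟨fun z => f (k z.1, z.2), f.smooth.comp ((hk.comp contDiff_fst).prodMk contDiff_snd), fun t x n => f.per _ _ _⟩
theorem rep_apply (f : Sm) (k : ℝ -> ℝ) (hk : ContDiff ℝ ∞ k) (z : Zt) : rep f k hk z = f (k z.1, z.2) := rfl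
theorem dd_rep (f : Sm) (k : ℝ -> ℝ) (hk : ContDiff ℝ ∞ k) (j : Fin 3) (z : Zt) : dd j (rep f k hk) z = dd j f (k z.1, z.2) := by
  have h1 : HasFDerivAt (fun z : Zt => (k z.1, z.2)) _ z :=
    ((((hk.differentiable (by simp)) z.1).hasDerivAt.hasFDerivAt).comp z hasFDerivAt_fst).prodMk hasFDerivAt_snd
  have h2 := (f.diffAt (k z.1, z.2)).hasFDerivAt.comp z h1
  have h3 : dd j (rep f k hk) z = _ := congrArg (fun L => L ((0 : ℝ), (Pi.single j 1 : Spc))) h2.fderiv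
  rw [h3]
  simp
  rfl
end Sm
end
/-- Time slots with flows. -/
structure Slots (L : ℕ) (η C0 K0 : ℝ) where
  c : ℝ
  hc : 0 < c
  hc1 : c <= 1 / 100
  φ : Dat L η C0 K0 × ℤ -> Fin 3 -> Sm
  re : ∀ k i, Re (φ k i)
  ini : ∀ (k : Dat L η C0 K0 × ℤ) i x, φ k i (k.2 * (c / k.1.nu), x) = 0
  D : ∀ (k : Dat L η C0 K0 × ℤ) i, EqS {t | |t - k.2 * (c / k.1.nu)| < 2 * (c / k.1.nu)} (DD k.1.u (φ k i)) (- k.1.u i)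
  tr : ∀ (k : Dat L η C0 K0 × ℤ) t x, |t - k.2 * (c / k.1.nu)| < 2 * (c / k.1.nu) -> Traj k.1.u (k.2 * (c / k.1.nu)) t x
  small : ∀ k i j z, ‖dd j (φ k i) z‖ <= 1 / 1000
section
theorem slots_exist (hL : 2 <= L) : Nonempty (Slots L η C0 K0) := by
  obtain ⟨A, hA0, hA⟩ := Ls.bound (f := fun i : (𝔻 × Zt) => fun p : Fin 3 × Fin 3 => dd p.1 (i.1.u p.2) i.2)
    (g := fun i => i.1.b * i.1.nu) (by
      refine Asymptotics.isBigO_pi.2 fun p => ?_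
      exact (Dat.du_cl hL p.1 p.2 0).val)
  have hA' : ∀ (d : 𝔻) i j z, ‖dd j (d.u i) z‖ <= (A + 1) * d.nu := fun d i j z => by
    have h1 := (norm_le_pi_norm (fun p : Fin 3 × Fin 3 => dd p.1 (d.u p.2) z) (j, i)).trans (hA (d, z))
    dsimp only at h1
    rw [abs_of_pos (mul_pos d.hb d.nu0)] at h1
    nlinarith [d.bnu_le, d.nu0]
  set c : ℝ := (A + 1)⁻¹ / 100000 with hc
  have hA1 : 0 < A + 1 := by linarith
  have hc0 : 0 < c := by positivity
  have hcA : c * (A + 1) = 1 / 100000 := by rw [hc]; field_simp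
  have hc1 : c <= 1 / 100 := by nlinarith
  have hT : ∀ d : 𝔻, 0 < c / d.nu := fun d => div_pos hc0 d.nu0
  have hTA : ∀ d : 𝔻, c / d.nu * ((A + 1) * d.nu) = 1 / 100000 := fun d => by
    rw [<- hcA]; have := d.nu0.ne'; field_simp
  choose φ h1 h2 h3 h4 using fun k : 𝔻 × ℤ => flow_exists k.1.u k.1.ru ((A + 1) * k.1.nu) (k.2 * (c / k.1.nu)) (5 / 2 * (c / k.1.nu))
    (by have := hT k.1; positivity) (hA' k.1) (by nlinarith [hTA k.1])
  have hmem : ∀ (k : 𝔻 × ℤ) t, |t - k.2 * (c / k.1.nu)| < 2 * (5 / 2 * (c / k.1.nu)) ->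
      t ∈ Set.Ioo (k.2 * (c / k.1.nu) - 2 * (5 / 2 * (c / k.1.nu))) (k.2 * (c / k.1.nu) + 2 * (5 / 2 * (c / k.1.nu))) := fun k t ht => by
    rw [abs_lt] at ht; constructor <;> linarith [ht.1, ht.2]
  let W : Win (𝔻 × ℤ) := ⟨fun k => k.2 * (c / k.1.nu), fun k => 5 / 2 * (c / k.1.nu), fun k => k.1.u, fun k => k.1.nu,
    fun k => by have := hT k.1; positivity, fun k => k.1.nu0, fun k => by
      have : c / k.1.nu * k.1.nu = c := div_mul_cancel₀ _ k.1.nu0.ne'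
      nlinarith, fun k => k.1.ru, fun k t x ht => by
      obtain ⟨Y, hY, hY'⟩ := h4 k t (hmem k t ht) x
      exact ⟨Y, hY, hY'⟩⟩
  let S : W.Flow := ⟨φ, h1, h2, fun k i => by
    intro t ht x
    exact h3 k i t (hmem k t ht) x⟩
  have hsm := fun i j k t ht x => S.G_small (A := fun k => (A + 1) * k.1.nu) (fun k t _ x i j => hA' k.1 j i (t, x))
    (fun k => by change 10000 * (5 / 2 * (c / k.1.nu) * ((A + 1) * k.1.nu)) <= 1; nlinarith [hTA k.1]) (fun k => mul_nonneg hA1.le k.1.nu0.le) i j k t ht x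
  obtain ⟨κ, hκ, hκ1, hκ2⟩ := clamp_exists
  let kk : 𝔻 × ℤ -> ℝ -> ℝ := fun k t => k.2 * (c / k.1.nu) + c / k.1.nu * κ ((t - k.2 * (c / k.1.nu)) / (c / k.1.nu))
  have hkk : ∀ k, ContDiff ℝ ∞ (kk k) := fun k => contDiff_const.add (contDiff_const.mul (hκ.comp (by fun_prop)))
  have hkk1 : ∀ k t, |t - k.2 * (c / k.1.nu)| <= 2 * (c / k.1.nu) -> kk k t = t := fun k t ht => by
    have h := hT k.1
    have : |(t - k.2 * (c / k.1.nu)) / (c / k.1.nu)| <= 2 := by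
      rw [abs_div, abs_of_pos h, div_le_iff₀ h]; exact ht
    change _ + c / k.1.nu * κ _ = t
    rw [hκ1 _ this, mul_div_cancel₀ _ h.ne']; ring
  have hkk2 : ∀ k t, kk k t ∈ W.win k := fun k t => by
    change |k.2 * (c / k.1.nu) + c / k.1.nu * κ _ - k.2 * (c / k.1.nu)| < 2 * (5 / 2 * (c / k.1.nu))
    have h := hT k.1
    rw [add_sub_cancel_left, abs_mul, abs_of_pos h]
    nlinarith [hκ2 ((t - k.2 * (c / k.1.nu)) / (c / k.1.nu))]
  refine ⟨⟨c, hc0, hc1, fun k i => rep (φ k i) (kk k) (hkk k), fun k i => ?_, fun k i x => ?_, fun k i => ?_, fun k t x ht => ?_, fun k i j z => ?_⟩⟩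
  . exact re_of_im fun z => (h1 k i).im _
  . rw [rep_apply]; dsimp only
    rw [hkk1 k _ (by simp; exact (hT k.1).le)]; exact h2 k i x
  . have ho : IsOpen {t | |t - k.2 * (c / k.1.nu)| < 2 * (c / k.1.nu)} := isOpen_lt (by fun_prop) (by fun_prop)
    have he : EqS {t | |t - k.2 * (c / k.1.nu)| < 2 * (c / k.1.nu)} (rep (φ k i) (kk k) (hkk k)) (φ k i) := by
      intro t ht x
      rw [rep_apply]; dsimp only; rw [hkk1 k t (le_of_lt ht)]
    refine (he.DD ho _).trans ?_
    intro t ht x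
    refine h3 k i t (hmem k t ?_) x
    have ht' : |t - k.2 * (c / k.1.nu)| < 2 * (c / k.1.nu) := ht
    linarith [hT k.1]
  . exact W.tr k t x (by change |t - k.2 * (c / k.1.nu)| < 2 * (5 / 2 * (c / k.1.nu)); linarith [hT k.1])
  . rw [dd_rep]
    exact hsm i j k _ (hkk2 k z.1) z.2
namespace Slots
variable (Z : Slots L η C0 K0)
def T (d : 𝔻) : ℝ := Z.c / d.nu
theorem T0 (d : 𝔻) : 0 < Z.T d := div_pos Z.hc d.nu0
def W : Win (𝔻 × ℤ) := ⟨fun k => k.2 * Z.T k.1, fun k => Z.T k.1, fun k => k.1.u, fun k => k.1.nu,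
    fun k => Z.T0 k.1, fun k => k.1.nu0, fun k => by
      have : Z.T k.1 * k.1.nu = Z.c := div_mul_cancel₀ _ k.1.nu0.ne'
      rw [this]; linarith [Z.hc1], fun k => k.1.ru, fun k t x ht => Z.tr k t x ht⟩
def S : Z.W.Flow := ⟨Z.φ, Z.re, Z.ini, Z.D⟩
theorem G_small (i j : Fin 3) (k : 𝔻 × ℤ) (z : Zt) : ‖Z.S.G i j k z‖ <= 1 / 1000 := Z.small k i j z
/-- pulling back bounds from global contexts -/
theorem cl_W {r m : ℕ} {A : 𝔻 × Zt -> ℝ} {F : 𝔻 -> Sm}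
    (h : Cl (Dat.c0 L η C0 K0) r m A (fun i => F i.1)) :
    Cl (Z.W.c fun k => k.1.mu) r m (fun i => A (i.1.1.1, i.1.2)) (fun i => F i.1.1.1) :=
  h.comap (fun i : Z.W.Ix => (i.1.1.1, i.1.2)) rfl rfl Ls.rfl' Ls.rfl'
theorem cl_WX {r m : ℕ} {A : 𝔻 × Zt -> ℝ} {F : 𝔻 -> Sm}
    (h : Cl (Dat.cX L η C0 K0) r m A (fun i => F i.1)) :
    Cl (Z.W.c fun k => k.1.X) r m (fun i => A (i.1.1.1, i.1.2)) (fun i => F i.1.1.1) :=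
  h.comap (fun i : Z.W.Ix => (i.1.1.1, i.1.2)) rfl rfl Ls.rfl' Ls.rfl'
theorem cl_I {r m : ℕ} {A : 𝔻 × Zt -> ℝ} {F : 𝔻 -> Sm}
    (h : Cl (Dat.c0 L η C0 K0) r m A (fun i => F i.1)) :
    Cl (Z.W.c0 fun k => k.1.mu) r m (fun i => A (i.1.1, (i.1.2 * Z.T i.1.1, i.2))) (fun i => F i.1.1) :=
  h.comap (fun i : (𝔻 × ℤ) × Spc => (i.1.1, ((i.1.2 * Z.T i.1.1, i.2) : Zt))) rfl rfl Ls.rfl' Ls.rfl'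
theorem cl_IX {r m : ℕ} {A : 𝔻 × Zt -> ℝ} {F : 𝔻 -> Sm}
    (h : Cl (Dat.cX L η C0 K0) r m A (fun i => F i.1)) :
    Cl (Z.W.c0 fun k => k.1.X) r m (fun i => A (i.1.1, (i.1.2 * Z.T i.1.1, i.2))) (fun i => F i.1.1) :=
  h.comap (fun i : (𝔻 × ℤ) × Spc => (i.1.1, ((i.1.2 * Z.T i.1.1, i.2) : Zt))) rfl rfl Ls.rfl' Ls.rfl'
end Slots
end
section
namespace Sm
/-- reciprocal square root -/
def rsq (f : Sm) (hf : ∀ z, 0 < (f z).re) : Sm :=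
  ⟨fun z => (((Real.sqrt (f z).re)⁻¹ : ℝ) : ℂ), by
    refine ⟨Complex.ofRealCLM.contDiff.comp ?_, fun t x k => ?_⟩
    . exact ((re_smooth f).sqrt fun z => (hf z).ne').inv fun z => (Real.sqrt_pos.2 (hf z)).ne'
    . beta_reduce; rw [f.per]⟩
theorem rsq_apply (f : Sm) (hf : ∀ z, 0 < (f z).re) (z : Zt) : rsq f hf z = (((Real.sqrt (f z).re)⁻¹ : ℝ) : ℂ) := rfl
theorem rsq_re (f : Sm) (hf : ∀ z, 0 < (f z).re) : Re (rsq f hf) := re_of_im fun z => by rw [rsq_apply]; simp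
theorem rsq_mul {f : Sm} (hf : ∀ z, 0 < (f z).re) (h : Re f) : rsq f hf * rsq f hf * f = 1 := by
  apply ext'; intro z
  simp only [coe_mul, coe_one]
  have h1 : f z = ((f z).re : ℂ) := by
    apply Complex.ext <;> simp
    exact h.im z
  rw [rsq_apply, h1, <- Complex.ofReal_mul, <- Complex.ofReal_mul]
  norm_cast
  rw [<- mul_inv, Real.mul_self_sqrt (hf z).le, inv_mul_cancel₀ (hf z).ne']
theorem rsq_bd {f : Sm} (hf : ∀ z, 0 < (f z).re) (z : Zt) {c : ℝ} (hc : 0 < c) (h : c <= (f z).re) : ‖rsq f hf z‖ <= (Real.sqrt c)⁻¹ := by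
  rw [rsq_apply, Complex.norm_real, Real.norm_eq_abs, abs_of_nonneg (by positivity)]
  exact inv_anti₀ (Real.sqrt_pos.2 hc) (Real.sqrt_le_sqrt h)
/-- oscillatory inverse divergence, leading term -/
def par (Λ : ℝ) (q : Fin 3 -> Sm) (H : Sm) (F : Fin 3 -> Sm) (j l : Fin 3) : Sm :=
  ((Λ⁻¹ : ℝ) : ℂ) • ((-Complex.I) • ((q j * F l + q l * F j) * (H * H)) + Complex.I • ((∑ k, q k * F k) * (q j * q l) * ((H * H) * (H * H))))
def parF (Λ : ℝ) (q : Fin 3 -> Sm) (H : Sm) (F : Fin 3 -> Sm) (l : Fin 3) : Sm := -∑ j, dd j (par Λ q H F j l)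
theorem par_symm (Λ : ℝ) (q : Fin 3 -> Sm) (H : Sm) (F : Fin 3 -> Sm) (j l : Fin 3) : par Λ q H F j l = par Λ q H F l j := by
  unfold par; rw [add_comm (q j * F l), mul_comm (q j) (q l)]
section
variable {Λ : ℝ} {q : Fin 3 -> Sm} {H : Sm} {e : Sm}
theorem par_eq (hΛ : Λ ≠ 0) (hH : H * H * (∑ k, q k * q k) = 1)
    (he : ∀ j, dd j e = (Complex.I * Λ : ℂ) • (q j * e)) (F : Fin 3 -> Sm) (l : Fin 3) :
    ∑ j, dd j (e * par Λ q H F j l) + e * parF Λ q H F l = e * F l := by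
  have hI : algebraMap ℂ Sm Complex.I * algebraMap ℂ Sm Complex.I = -1 := by rw [<- map_mul, Complex.I_mul_I, map_neg, map_one]
  have hL : algebraMap ℂ Sm (Λ : ℂ) * algebraMap ℂ Sm ((Λ⁻¹ : ℝ) : ℂ) = 1 := by
    rw [<- map_mul, <- Complex.ofReal_mul, mul_inv_cancel₀ hΛ, Complex.ofReal_one, map_one]
  unfold parF
  simp only [Derivation.leibniz, smul_eq_mul, he, sum_add_distrib]
  rw [mul_neg, mul_sum, add_right_comm, add_neg_cancel, zero_add]
  unfold par
  simp only [Algebra.smul_def, map_mul, Fin.sum_univ_three, map_neg] at hH ⊢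
  have h2 : H * H * (q 0 * q 0 + q 1 * q 1 + q 2 * q 2) * (algebraMap ℂ Sm (Λ : ℂ) * algebraMap ℂ Sm ((Λ⁻¹ : ℝ) : ℂ)) * (algebraMap ℂ Sm Complex.I * algebraMap ℂ Sm Complex.I) = -1 := by rw [hH, hL, hI]; ring
  generalize algebraMap ℂ Sm Complex.I = i at *
  generalize algebraMap ℂ Sm (Λ : ℂ) = a at *
  generalize algebraMap ℂ Sm ((Λ⁻¹ : ℝ) : ℂ) = a' at *
  generalize hs : q 0 * F 0 + q 1 * F 1 + q 2 * F 2 = s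
  have hs' : s = q 0 * F 0 + q 1 * F 1 + q 2 * F 2 := hs.symm
  have : e * F l = e * F l * (-(i * i)) * (a * a') * (H * H * (q 0 * q 0 + q 1 * q 1 + q 2 * q 2)) := by rw [hI, hL, hH]; ring
  rw [this]
  linear_combination (e * q l * H * H * s * (i * i) * (a * a')) * hH + (i * i * (a * a') * e * q l * H * H) * hs'
def parN (Λ : ℝ) (q : Fin 3 -> Sm) (H : Sm) : ℕ -> (Fin 3 -> Sm) -> Fin 3 -> Fin 3 -> Sm
  | 0, _, _, _ => 0
  | (M + 1), F, j, l => par Λ q H F j l + parN Λ q H M (parF Λ q H F) j l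
def parR (Λ : ℝ) (q : Fin 3 -> Sm) (H : Sm) : ℕ -> (Fin 3 -> Sm) -> Fin 3 -> Sm
  | 0, F => F
  | (M + 1), F => parR Λ q H M (parF Λ q H F)
theorem parN_symm (M : ℕ) (F : Fin 3 -> Sm) (j l : Fin 3) : parN Λ q H M F j l = parN Λ q H M F l j := by
  induction M generalizing F with
  | zero => rfl
  | succ M ih => simp only [parN]; rw [par_symm, ih]
theorem parN_eq (hΛ : Λ ≠ 0) (hH : H * H * (∑ k, q k * q k) = 1)
    (he : ∀ j, dd j e = (Complex.I * Λ : ℂ) • (q j * e)) (M : ℕ) (F : Fin 3 -> Sm) (l : Fin 3) :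
    ∑ j, dd j (e * parN Λ q H M F j l) + e * parR Λ q H M F l = e * F l := by
  induction M generalizing F with
  | zero => simp [parN, parR]
  | succ M ih =>
    simp only [parN, parR, mul_add, map_add, sum_add_distrib]
    rw [add_assoc, ih, par_eq hΛ hH he]
theorem par_zero {S : Set ℝ} {F : Fin 3 -> Sm} (h : ∀ l, EqS S (F l) 0) (j l : Fin 3) : EqS S (par Λ q H F j l) 0 := by
  intro t ht x
  have : ∀ l, F l (t, x) = 0 := fun l => h l t ht x
  simp [par, this]
theorem parF_zero {S : Set ℝ} (hS : IsOpen S) {F : Fin 3 -> Sm} (h : ∀ l, EqS S (F l) 0) (l : Fin 3) : EqS S (parF Λ q H F l) 0 := by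
  intro t ht x
  have : ∀ j, dd j (par Λ q H F j l) (t, x) = 0 := fun j => by
    have := (par_zero (Λ := Λ) (q := q) (H := H) h j l).dd hS j t ht x
    rwa [map_zero] at this
  simp [parF, this]
theorem parN_zero {S : Set ℝ} (hS : IsOpen S) (M : ℕ) {F : Fin 3 -> Sm} (h : ∀ l, EqS S (F l) 0) (j l : Fin 3) : EqS S (parN Λ q H M F j l) 0 := by
  induction M generalizing F with
  | zero => exact EqS.refl _ _
  | succ M ih =>
    have := (par_zero (Λ := Λ) (q := q) (H := H) h j l).add (ih (parF_zero (Λ := Λ) (q := q) (H := H) hS h))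
    simpa [parN] using this
end
end Sm
section
variable {ι : Type} {c : Ctx ι} {r : ℕ} {A : ι -> ℝ} {Λ : ι -> ℝ} {q F : Fin 3 -> ι -> Sm} {H : ι -> Sm}
theorem par_cl {m : ℕ} (hq : ∀ j, Cl c r m (fun _ => 1) (q j)) (hH : Cl c r m (fun _ => 1) H) (hF : ∀ l, Cl c r m A (F l)) (j l : Fin 3) :
    Cl c r m (fun i => A i * (Λ i)⁻¹) (fun i => par (Λ i) (fun j => q j i) (H i) (fun l => F l i) j l) := by
  have h2 := hH.mul1 hH
  have h1 : Cl c r m A (fun i => (-Complex.I) • ((q j i * F l i + q l i * F j i) * (H i * H i)) + Complex.I • ((∑ k, q k i * F k i) * (q j i * q l i) * ((H i * H i) * (H i * H i)))) := by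
    refine Cl.add (Cl.smul _ (Cl.mul1' (Cl.add ((hq j).mul1 (hF l)) ((hq l).mul1 (hF j))) h2)) (Cl.smul _ ?_)
    exact Cl.mul1' (Cl.mul1' (Cl.sum _ fun k _ => (hq k).mul1 (hF k)) ((hq j).mul1 (hq l))) (h2.mul1 h2)
  refine (Cl.smulc (fun i => (((Λ i)⁻¹ : ℝ) : ℂ)) h1).trans (Ls.of' 1 fun i => ?_)
  rw [Complex.norm_real, one_mul, norm_mul, norm_norm, abs_mul, mul_comm]; rfl
theorem parF_cl {m : ℕ} (hq : ∀ j, Cl c r (m + 1) (fun _ => 1) (q j)) (hH : Cl c r (m + 1) (fun _ => 1) H)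
    (hF : ∀ l, Cl c r (m + 1) A (F l)) (l : Fin 3) :
    Cl c r m (fun i => A i * (c.mu i * (Λ i)⁻¹)) (fun i => parF (Λ i) (fun j => q j i) (H i) (fun l => F l i) l) := by
  refine Cl.neg (Cl.sum _ fun j _ => ((par_cl hq hH hF j l).dd j).trans (Ls.eq fun i => by ring))
theorem parR_cl (hq : ∀ j m, Cl c r m (fun _ => 1) (q j)) (hH : ∀ m, Cl c r m (fun _ => 1) H)
    (hF : ∀ l m, Cl c r m A (F l)) (M m : ℕ) (l : Fin 3) :
    Cl c r m (fun i => A i * (c.mu i * (Λ i)⁻¹) ^ M) (fun i => parR (Λ i) (fun j => q j i) (H i) M (fun l => F l i) l) := by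
  induction M generalizing F A with
  | zero => simpa [parR] using hF l m
  | succ M ih =>
    refine (ih (F := fun l i => parF (Λ i) (fun j => q j i) (H i) (fun l => F l i) l) (A := fun i => A i * (c.mu i * (Λ i)⁻¹)) ?_).trans (Ls.eq fun i => by ring)
    exact fun l m => parF_cl (fun j => hq j _) (hH _) (fun l => hF l _) l
theorem parN_cl (hq : ∀ j m, Cl c r m (fun _ => 1) (q j)) (hH : ∀ m, Cl c r m (fun _ => 1) H)
    (hm : Ls (fun i => c.mu i * (Λ i)⁻¹) (fun _ => 1))
    (hF : ∀ l m, Cl c r m A (F l)) (M m : ℕ) (j l : Fin 3) :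
    Cl c r m (fun i => A i * (Λ i)⁻¹) (fun i => parN (Λ i) (fun j => q j i) (H i) M (fun l => F l i) j l) := by
  induction M generalizing F with
  | zero => exact Cl.zero
  | succ M ih =>
    refine (par_cl (fun j => hq j _) (hH _) (fun l => hF l _) j l).add (ih (F := fun l i => parF (Λ i) (fun j => q j i) (H i) (fun l => F l i) l) ?_)
    exact fun l m => (parF_cl (fun j => hq j _) (hH _) (fun l => hF l _) l).trans (by
      have := (Ls.rfl' (f := A)).mul hm
      simpa using this)
end
end
section
/-- Directions (two families). -/
def dir (b : Bool) (a : Fin 6) : Fin 3 -> ℤ :=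
  if b then ![![4, 3, 0], ![4, -3, 0], ![0, 4, 3], ![0, 4, -3], ![3, 0, 4], ![-3, 0, 4]] a
  else ![![3, 4, 0], ![3, -4, 0], ![0, 3, 4], ![0, 3, -4], ![4, 0, 3], ![-4, 0, 3]] a
def axs : Fin 6 -> Fin 3 := ![2, 2, 0, 0, 1, 1]
def wre (a : Fin 6) (l : Fin 3) : ℤ := if l = axs a then 5 else 0
def wim (b : Bool) (a : Fin 6) (l : Fin 3) : ℤ :=
  if l = axs a then 0 else if l = axs a + 1 then dir b a (axs a + 2) else - dir b a (axs a + 1)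
def sgn (s : Bool) : ℤ := if s then -1 else 1
def dirS (b : Bool) (I : 𝕀) : Fin 3 -> ℤ := fun j => sgn I.2 * dir b I.1 j
def wS (b : Bool) (I : 𝕀) (l : Fin 3) : ℂ := (wre I.1 l : ℂ) + ((sgn I.2 * wim b I.1 l : ℤ) : ℂ) * Complex.I
def bar (I : 𝕀) : 𝕀 := (I.1, !I.2)
theorem dir_re : ∀ b a l, dir b a (l + 1) * wre a (l + 2) - dir b a (l + 2) * wre a (l + 1) = 5 * wim b a l := by decide
theorem dir_im : ∀ b a l, dir b a (l + 1) * wim b a (l + 2) - dir b a (l + 2) * wim b a (l + 1) = -5 * wre a l := by decide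
theorem sgn_sq (s : Bool) : sgn s * sgn s = 1 := by cases s <;> decide
theorem dirS_bar (b : Bool) (I : 𝕀) : dirS b (bar I) = - dirS b I := by
  obtain ⟨a, s⟩ := I
  funext j
  cases s <;> simp [dirS, bar, sgn]
theorem wS_bar (b : Bool) (I : 𝕀) (l : Fin 3) : wS b (bar I) l = (starRingEnd ℂ) (wS b I l) := by
  obtain ⟨a, s⟩ := I
  cases s <;> simp [wS, bar, sgn]
theorem bar_bar (I : 𝕀) : bar (bar I) = I := by simp [bar]
theorem dir_ne : ∀ b I b' J, (b = b' -> J ≠ bar I) -> ∃ j, dirS b I j + dirS b' J j ≠ 0 := by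
  set_option maxRecDepth 100000 in
  decide
theorem dirS_ne : ∀ b I, ∃ j, dirS b I j ≠ 0 := by decide
theorem dirS_le : ∀ b I j, |dirS b I j| <= 4 := by decide
theorem beltrami (b : Bool) (I : 𝕀) (l : Fin 3) :
    Complex.I * ((dirS b I (l + 1) : ℂ) * wS b I (l + 2) - (dirS b I (l + 2) : ℂ) * wS b I (l + 1)) = 5 * wS b I l := by
  have h1 : (dir b I.1 (l + 1) : ℂ) * wre I.1 (l + 2) - dir b I.1 (l + 2) * wre I.1 (l + 1) = 5 * wim b I.1 l := by
    exact_mod_cast dir_re b I.1 l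
  have h2 : (dir b I.1 (l + 1) : ℂ) * wim b I.1 (l + 2) - dir b I.1 (l + 2) * wim b I.1 (l + 1) = -5 * wre I.1 l := by
    exact_mod_cast dir_im b I.1 l
  have h3 : (sgn I.2 : ℂ) * sgn I.2 = 1 := by exact_mod_cast sgn_sq I.2
  simp only [dirS, wS]
  push_cast
  linear_combination (Complex.I * sgn I.2) * h1 + (Complex.I * Complex.I * (sgn I.2 * sgn I.2)) * h2 + (-5 * wre I.1 l * (Complex.I * Complex.I)) * h3 - 5 * wre I.1 l * Complex.I_mul_I
def dco (b : Bool) (a : Fin 6) : Fin 3 -> ℂ :=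
  if b then ![![256, 81, -144], ![256, 81, -144], ![-144, 256, 81], ![-144, 256, 81], ![81, -144, 256], ![81, -144, 256]] a
  else ![![81, 256, -144], ![81, 256, -144], ![-144, 81, 256], ![-144, 81, 256], ![256, -144, 81], ![256, -144, 81]] a
def oco (a : Fin 6) : ℂ := ![1, -1, 1, -1, 1, -1] a
/-- squared amplitudes -/
def fam (b : Bool) (a : Fin 6) (r : Fin 3 -> Fin 3 -> ℂ) : ℂ :=
  1 / 15000 + 1 / 482500 * (dco b a 0 * r 0 0 + dco b a 1 * r 1 1 + dco b a 2 * r 2 2) + 1 / 1200 * oco a * r (axs a + 1) (axs a + 2)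
theorem fam_eq (b : Bool) (r : Fin 3 -> Fin 3 -> ℂ) (hs : ∀ j l, r j l = r l j) (ht : r 0 0 + r 1 1 + r 2 2 = 0) (j l : Fin 3) :
    ∑ a, fam b a r * (50 * ((wre a j : ℂ) * wre a l + (wim b a j : ℂ) * wim b a l)) = (if j = l then 1 / 3 else 0) - r j l := by
  have h1 := hs 1 0
  have h2 := hs 2 0
  have h3 := hs 2 1
  have ht' : r 2 2 = - r 0 0 - r 1 1 := by linear_combination ht
  cases b <;> fin_cases j <;> fin_cases l <;>
    simp [Fin.sum_univ_six, fam, dco, oco, wre, wim, axs, dir, h1, h2, h3, ht'] <;> ring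
theorem fam_tr (b : Bool) (r : Fin 3 -> Fin 3 -> ℂ) (ht : r 0 0 + r 1 1 + r 2 2 = 0) : ∑ a, fam b a r = 1 / 2500 := by
  have ht' : r 2 2 = - r 0 0 - r 1 1 := by linear_combination ht
  cases b <;> simp [Fin.sum_univ_six, fam, dco, oco, axs, ht'] <;> ring
theorem fam_bd (b : Bool) (a : Fin 6) (r : Fin 3 -> Fin 3 -> ℂ) (h : ∀ j l, ‖r j l‖ <= 1 / 200) : ‖fam b a r - 1 / 15000‖ <= 1 / 60000 := by
  have hd : ∀ b a j, ‖dco b a j‖ <= 256 := by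
    intro b a j; cases b <;> fin_cases a <;> fin_cases j <;> simp [dco] <;> norm_num
  have ho : ‖oco a‖ <= 1 := by fin_cases a <;> simp [oco]
  have hp : ∀ j l, ‖dco b a j * r j l‖ <= 256 / 200 := fun j l => by
    rw [norm_mul]; nlinarith [hd b a j, h j l, norm_nonneg (dco b a j), norm_nonneg (r j l)]
  have e : fam b a r - 1 / 15000 = 1 / 482500 * (dco b a 0 * r 0 0 + dco b a 1 * r 1 1 + dco b a 2 * r 2 2) + 1 / 1200 * (oco a * r (axs a + 1) (axs a + 2)) := by
    unfold fam; ring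
  rw [e]
  refine (norm_add_le _ _).trans ?_
  rw [norm_mul, norm_mul (1 / 1200 : ℂ)]
  have h4 := norm_add₃_le (a := dco b a 0 * r 0 0) (b := dco b a 1 * r 1 1) (c := dco b a 2 * r 2 2)
  have h5 : ‖oco a * r (axs a + 1) (axs a + 2)‖ <= 1 / 200 := by
    rw [norm_mul]; nlinarith [h (axs a + 1) (axs a + 2), norm_nonneg (oco a), norm_nonneg (r (axs a + 1) (axs a + 2))]
  have e1 : ‖(1 / 482500 : ℂ)‖ = 1 / 482500 := by norm_num
  have e2 : ‖(1 / 1200 : ℂ)‖ = 1 / 1200 := by norm_num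
  rw [e1, e2]
  linarith [hp 0 0, hp 1 1, hp 2 2]
end
section
def stp (x : ℝ) : ℝ := Real.smoothTransition ((x - 3 / 10) / (4 / 10))
theorem stp_smooth : ContDiff ℝ ∞ stp := Real.smoothTransition.contDiff.comp (by fun_prop)
theorem stp_zero {x : ℝ} (h : x <= 3 / 10) : stp x = 0 := Real.smoothTransition.zero_of_nonpos (by
  apply div_nonpos_of_nonpos_of_nonneg <;> linarith)
theorem stp_one {x : ℝ} (h : 7 / 10 <= x) : stp x = 1 := Real.smoothTransition.one_of_one_le (by
  rw [le_div_iff₀ (by norm_num)]; linarith)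
/-- time cutoff -/
def chi (x : ℝ) : ℝ := Real.cos (Real.pi / 2 * stp x) * Real.sin (Real.pi / 2 * stp (x + 1))
theorem chi_smooth : ContDiff ℝ ∞ chi := by
  have h := stp_smooth
  have h2 : ContDiff ℝ ∞ (fun x : ℝ => stp (x + 1)) := h.comp (by fun_prop)
  unfold chi
  exact (Real.contDiff_cos.comp (contDiff_const.mul h)).mul (Real.contDiff_sin.comp (contDiff_const.mul h2))
theorem chi_zero {x : ℝ} (h : 7 / 10 <= |x|) : chi x = 0 := by
  unfold chi
  rcases le_abs.1 h with h | h
  . rw [stp_one h]; simp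
  . rw [stp_zero (x := x + 1) (by linarith)]; simp
theorem chi_sq {x : ℝ} (h : -(1 / 10) < x) (h' : x < 11 / 10) : chi x ^ 2 + chi (x - 1) ^ 2 = 1 := by
  unfold chi
  rw [stp_one (x := x + 1) (by linarith), stp_zero (x := x - 1) (by linarith), sub_add_cancel]
  simp
theorem chi_bd (n : ℕ) : ∃ B, ∀ x, |iteratedDeriv n chi x| <= B := by
  have hc : HasCompactSupport chi := HasCompactSupport.intro (K := Set.Icc (-1) 1) isCompact_Icc fun x hx => chi_zero (by
    by_contra h
    push Not at h
    rw [abs_lt] at h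
    exact hx ⟨by linarith [h.1], by linarith [h.2]⟩)
  have hn : HasCompactSupport (iteratedDeriv n chi) := by
    induction n with
    | zero => simpa using hc
    | succ n ih => rw [iteratedDeriv_succ]; exact ih.deriv
  obtain ⟨B, hB⟩ := hn.exists_bound_of_continuous (chi_smooth.continuous_iteratedDeriv n (by exact_mod_cast le_top))
  exact ⟨B, hB⟩
theorem tf_cl {ι : Type} {c : Ctx ι} {A : ι -> ℝ} (r m : ℕ) (f : ι -> ℝ -> ℝ) (hf : ∀ i, ContDiff ℝ ∞ (f i))
    (h : ∀ n ≤ r, Ls (fun i => iteratedDeriv n (f i) (c.pt i).1) (fun i => A i * c.nu i ^ n)) :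
    Cl c r m A (fun i => tf (f i) (hf i)) := by
  induction r generalizing f A with
  | zero =>
    refine .mk ?_ (fun k hk j => by simp only [dd_tf]; exact Cl.zero) (fun k hk => by omega)
    obtain ⟨C, hC, h'⟩ := (h 0 le_rfl).bound
    refine Ls.of' C fun i => ?_
    rw [tf_apply, Complex.norm_real]
    simpa using h' i
  | succ r ih =>
    refine .mk ?_ (fun k hk j => by simp only [dd_tf]; exact Cl.zero) (fun k hk => ?_)
    . obtain ⟨C, hC, h'⟩ := (h 0 (by omega)).bound
      refine Ls.of' C fun i => ?_
      rw [tf_apply, Complex.norm_real]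
      simpa using h' i
    . obtain rfl : r = k := by omega
      simp only [DD_tf]
      refine ih (fun i => deriv (f i)) _ fun n hn => ?_
      have := h (n + 1) (by omega)
      simp only [iteratedDeriv_succ'] at this
      exact this.trans (Ls.eq fun i => by ring)
theorem chi_iter (n : ℕ) (a s x : ℝ) : iteratedDeriv n (fun t => chi (t / a - s)) x = (a⁻¹) ^ n * iteratedDeriv n chi (x / a - s) := by
  have h1 := congrFun (iteratedDeriv_comp_const_mul (n := n) (f := fun y => chi (y - s)) ((chi_smooth.comp (by fun_prop : ContDiff ℝ ∞ fun y : ℝ => y - s)).of_le (by exact_mod_cast le_top)) a⁻¹) x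
  have h2 := congrFun (iteratedDeriv_comp_sub_const n chi s) (x / a)
  have e : (fun t => chi (t / a - s)) = fun t => chi (a⁻¹ * t - s) := by funext t; rw [div_eq_inv_mul]
  rw [e, h1, <- div_eq_inv_mul, h2]
/-- constant in the mollification bound -/
def BM : ℝ := Classical.choose (mol_bound fun _ => Bp.std)
theorem BM0 : 0 <= BM := (Classical.choose_spec (mol_bound fun _ => Bp.std)).1
theorem BM_spec (ε : ℝ) (t A : ℝ) (f : Sm) (h : ∀ x, ‖f (t, x)‖ <= A) (x : Spc) : ‖mo ε f (t, x)‖ <= BM * A :=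
  (Classical.choose_spec (mol_bound fun _ => Bp.std)).2 ε (t, x) A f fun y _ => h _
namespace Dat
/-- traceless part of the mollified stress -/
def Rd (d : 𝔻) (j l : Fin 3) : Sm := d.Re' j l - if j = l then cst (1 / 3) * ∑ i, d.Re' i i else 0
theorem Re_zero (d : 𝔻) {t : ℝ} (h : ∀ j l x, d.R j l (t, x) = 0) (j l : Fin 3) (x : Spc) : d.Re' j l (t, x) = 0 := by
  have := BM_spec (d.mu)⁻¹ t 0 (d.R j l) (fun x => by rw [h]; simp) x
  rw [mul_zero] at this
  exact norm_le_zero_iff.1 this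
theorem Re_le (d : 𝔻) (t : ℝ) (j l : Fin 3) (x : Spc) : ‖d.Re' j l (t, x)‖ <= BM * d.E ^ 2 :=
  BM_spec (d.mu)⁻¹ t _ (d.R j l) (fun x => (d.R0 j l (t, x)).trans (by
    have := d.ind1 t; nlinarith [sq_nonneg d.E])) x
theorem Rd_apply (d : 𝔻) (j l : Fin 3) (z : Zt) : d.Rd j l z = d.Re' j l z - if j = l then 1 / 3 * (d.Re' 0 0 z + d.Re' 1 1 z + d.Re' 2 2 z) else 0 := by
  unfold Rd; split_ifs <;> simp [Fin.sum_univ_three]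
theorem Rd_re (d : 𝔻) (j l : Fin 3) : Re (d.Rd j l) := re_of_im fun z => by
  have h := fun j l => (d.rRe j l).im z
  rw [Rd_apply]; split_ifs <;> simp [h]
theorem Rd_symm (d : 𝔻) (j l : Fin 3) : d.Rd j l = d.Rd l j := by
  unfold Rd; rw [d.symRe j l]; simp only [eq_comm]
theorem Rd_tr (d : 𝔻) (z : Zt) : d.Rd 0 0 z + d.Rd 1 1 z + d.Rd 2 2 z = 0 := by
  simp only [Rd_apply, if_true]; ring
theorem Rd_le (d : 𝔻) (t : ℝ) (j l : Fin 3) (x : Spc) : ‖d.Rd j l (t, x)‖ <= 2 * (BM * d.E ^ 2) := by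
  have h := d.Re_le t
  have h3 := norm_add₃_le (a := d.Re' 0 0 (t, x)) (b := d.Re' 1 1 (t, x)) (c := d.Re' 2 2 (t, x))
  have := h 0 0 x; have := h 1 1 x; have := h 2 2 x
  rw [Rd_apply]
  refine (norm_sub_le _ _).trans ?_
  split_ifs
  . rw [norm_mul]
    have : ‖(1 / 3 : ℂ)‖ = 1 / 3 := by norm_num
    rw [this]; linarith [h j l x]
  . have := norm_nonneg (d.Re' j l (t, x))
    simp; linarith [h j l x]
theorem Rd_zero (d : 𝔻) {t : ℝ} (h : ∀ j l x, d.R j l (t, x) = 0) (j l : Fin 3) (x : Spc) : d.Rd j l (t, x) = 0 := by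
  rw [Rd_apply]; simp [d.Re_zero h]
/-- traceless part of a bounded family -/
theorem Rd_clG {ι : Type} {c : Ctx ι} {r m : ℕ} {A : ι -> ℝ} (f : ι -> 𝔻) (h : ∀ j l, Cl c r m A (fun i => (f i).Re' j l)) (j l : Fin 3) :
    Cl c r m A (fun i => (f i).Rd j l) := by
  unfold Rd
  refine (h j l).sub ?_
  split_ifs
  . exact (Cl.cst1 _).mul1 (Cl.sum _ fun i _ => h i i)
  . exact Cl.zero
/-- the phase frequency -/
def ph (d : 𝔻) : ℤ := ⌈d.lam⌉
def Lam (d : 𝔻) : ℝ := 2 * Real.pi * d.ph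
theorem Lam_ge (d : 𝔻) : d.lam <= d.Lam := by
  have h1 := Int.le_ceil d.lam
  have h2 := d.lam0
  have h3 := Real.pi_gt_three
  unfold Lam ph; nlinarith
theorem Lam_le (d : 𝔻) : d.Lam <= 16 * d.lam := by
  have h1 := Int.ceil_lt_add_one d.lam
  have h2 := d.lam1
  have h3 := Real.pi_lt_four
  have h4 := Real.pi_pos
  unfold Lam ph; nlinarith
theorem Lam0 (d : 𝔻) : 0 < d.Lam := d.lam0.trans_le d.Lam_ge
end Dat
/-- parity -/
def pr (s : ℤ) : Bool := decide (s % 2 = 1)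
theorem pr_succ (s : ℤ) : pr (s + 1) ≠ pr s := by
  unfold pr; intro h; rw [decide_eq_decide] at h; omega
namespace Sm
def cr (q f : Fin 3 -> Sm) (l : Fin 3) : Sm := q (l + 1) * f (l + 2) - q (l + 2) * f (l + 1)
def cu (f : Fin 3 -> Sm) (l : Fin 3) : Sm := dd (l + 1) (f (l + 2)) - dd (l + 2) (f (l + 1))
end Sm
namespace Slots
variable (Z : Slots L η C0 K0)
def ts (k : 𝔻 × ℤ) : ℝ := k.2 * Z.T k.1
def rho (k : 𝔻 × ℤ) (j l : Fin 3) : Sm := cst ((((k.1.g (Z.ts k)) ^ 2)⁻¹ : ℝ) : ℂ) * k.1.Rd j l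
def rh (k : 𝔻 × ℤ) (j l : Fin 3) : Sm := pb (Z.S.φ k) (Z.W.tk k) (Z.rho k j l)
theorem rh_apply (k : 𝔻 × ℤ) (j l : Fin 3) (z : Zt) :
    Z.rh k j l z = ((((k.1.g (Z.ts k)) ^ 2)⁻¹ : ℝ) : ℂ) * k.1.Rd j l (Z.ts k, dsp (Z.S.φ k) z) := by
  unfold rh; rw [pb_apply]; unfold rho
  rw [coe_mul, Sm.coe_algebraMap]; rfl
theorem rh_re (k : 𝔻 × ℤ) (j l : Fin 3) : Re (Z.rh k j l) := re_of_im fun z => by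
  rw [rh_apply, Complex.im_ofReal_mul, (k.1.Rd_re j l).im, mul_zero]
theorem rh_symm (k : 𝔻 × ℤ) (j l : Fin 3) : Z.rh k j l = Z.rh k l j := by
  unfold rh rho; rw [k.1.Rd_symm]
theorem rh_tr (k : 𝔻 × ℤ) (z : Zt) : Z.rh k 0 0 z + Z.rh k 1 1 z + Z.rh k 2 2 z = 0 := by
  simp only [rh_apply, <- mul_add, Dat.Rd_tr, mul_zero]
theorem g_alt (k : 𝔻 × ℤ) : (∀ j l x, k.1.R j l (Z.ts k, x) = 0) ∨ K0 * k.1.E ^ 2 <= k.1.g (Z.ts k) ^ 2 := by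
  by_cases h : ∀ j l x, k.1.R j l (Z.ts k, x) = 0
  . exact Or.inl h
  . push Not at h
    obtain ⟨j, l, x, h⟩ := h
    exact Or.inr (k.1.gR _ _ x j l (by simp) h)
theorem rho_bd (hK : 1000 * BM + 1 <= K0) (k : 𝔻 × ℤ) (j l : Fin 3) (x : Spc) :
    ‖((((k.1.g (Z.ts k)) ^ 2)⁻¹ : ℝ) : ℂ) * k.1.Rd j l (Z.ts k, x)‖ <= 1 / 200 := by
  rcases Z.g_alt k with h | h
  . rw [k.1.Rd_zero h]; simp
  . have h1 := k.1.Rd_le (Z.ts k) j l x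
    have hE := k.1.hE
    have hB := BM0
    have hg : 0 < k.1.g (Z.ts k) ^ 2 := lt_of_lt_of_le (have : 0 < K0 := by linarith
            by positivity) h
    rw [norm_mul, Complex.norm_real, Real.norm_eq_abs, abs_of_pos (inv_pos.2 hg), inv_mul_le_iff₀ hg]
    nlinarith [sq_nonneg k.1.E, mleR hK (sq_nonneg k.1.E)]
theorem rh_bd (hK : 1000 * BM + 1 <= K0) (k : 𝔻 × ℤ) (j l : Fin 3) (z : Zt) : ‖Z.rh k j l z‖ <= 1 / 200 := by
  rw [rh_apply]; exact Z.rho_bd hK k j l _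
/-- squared amplitudes along the flow -/
def fS (k : 𝔻 × ℤ) (a : Fin 6) : Sm :=
  cst (1 / 15000) + cst (1 / 482500) * (cst (dco (pr k.2) a 0) * Z.rh k 0 0 + cst (dco (pr k.2) a 1) * Z.rh k 1 1 + cst (dco (pr k.2) a 2) * Z.rh k 2 2)
    + cst (1 / 1200 * oco a) * Z.rh k (axs a + 1) (axs a + 2)
theorem fS_apply (k : 𝔻 × ℤ) (a : Fin 6) (z : Zt) : Z.fS k a z = fam (pr k.2) a (fun j l => Z.rh k j l z) := by
  simp only [fS, fam, coe_add, coe_mul, Sm.coe_algebraMap]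
theorem dco_re (b : Bool) (a : Fin 6) (j : Fin 3) : (dco b a j).im = 0 := by
  cases b <;> fin_cases a <;> fin_cases j <;> simp [dco]
theorem oco_re (a : Fin 6) : (oco a).im = 0 := by fin_cases a <;> simp [oco]
theorem cst_re {c : ℂ} (h : c.im = 0) : Re (cst c) := re_of_im fun z => by rw [Sm.coe_algebraMap]; exact h
theorem fS_re (k : 𝔻 × ℤ) (a : Fin 6) : Re (Z.fS k a) := by
  unfold fS
  have h := fun j => cst_re (dco_re (pr k.2) a j)
  refine Re.add (Re.add (cst_re (by norm_num)) (Re.mul (cst_re (by norm_num)) (Re.add (Re.add ((h 0).mul (Z.rh_re k 0 0)) ((h 1).mul (Z.rh_re k 1 1))) ((h 2).mul (Z.rh_re k 2 2))))) (Re.mul (cst_re ?_) (Z.rh_re k _ _))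
  have := oco_re a
  simp [this]
theorem fS_ge (hK : 1000 * BM + 1 <= K0) (k : 𝔻 × ℤ) (a : Fin 6) (z : Zt) : 1 / 20000 <= (Z.fS k a z).re := by
  have h := fam_bd (pr k.2) a (fun j l => Z.rh k j l z) (fun j l => Z.rh_bd hK k j l z)
  rw [<- fS_apply] at h
  have h1 := (Complex.abs_re_le_norm _).trans h
  have e : (Z.fS k a z - 1 / 15000).re = (Z.fS k a z).re - 1 / 15000 := by
    rw [Complex.sub_re]; norm_num
  rw [e, abs_le] at h1
  linarith [h1.1]
end Slots
end
local notation "𝕂" => 1000 * BM + 1 ≤ K0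
section
namespace Sm
open Classical in
/-- total inverse square root -/
def rsT (f : Sm) : Sm := if h : ∀ z, 0 < (f z).re then rsq f h else 0
theorem rsT_eq {f : Sm} (h : ∀ z, 0 < (f z).re) : rsT f = rsq f h := by unfold rsT; rw [dif_pos h]
theorem rsT_re (f : Sm) : Re (rsT f) := by
  unfold rsT; split_ifs
  . exact rsq_re _ _
  . exact Re.zero
theorem rsT_mul {f : Sm} (h : Re f) {c : ℝ} (hc : 0 < c) (hf : ∀ z, c <= (f z).re) : rsT f * rsT f * f = 1 := by
  rw [rsT_eq fun z => hc.trans_le (hf z)]; exact rsq_mul _ h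
theorem rsT_cl {ι : Type} {c : Ctx ι} {r m : ℕ} {F : ι -> Sm} (hF : Cl c r m (fun _ => 1) F) (h : ∀ i, Re (F i)) {a : ℝ} (ha : 0 < a)
    (hf : ∀ i z, a <= (F i z).re) : Cl c r m (fun _ => 1) (fun i => rsT (F i)) := by
  refine Cl.rs hF (fun i => rsT_mul (h i) ha (hf i)) (Ls.of (Real.sqrt a)⁻¹ fun i => ?_)
  rw [rsT_eq fun z => ha.trans_le (hf i z), mul_one]
  exact rsq_bd _ _ ha (hf i _)
/-- twisted curl -/
def crl (Λ : ℝ) (q f : Fin 3 -> Sm) (l : Fin 3) : Sm := (Complex.I * Λ : ℂ) • cr q f l + cu f l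
theorem cu_mul {Λ : ℝ} {q : Fin 3 -> Sm} {e : Sm} (he : ∀ j, dd j e = (Complex.I * Λ : ℂ) • (q j * e)) (f : Fin 3 -> Sm) (l : Fin 3) :
    cu (fun l => e * f l) l = e * crl Λ q f l := by
  unfold crl cr cu
  simp only [Derivation.leibniz, smul_eq_mul, he, Algebra.smul_def]
  ring
theorem crl_sub (Λ : ℝ) (q f g : Fin 3 -> Sm) (l : Fin 3) : crl Λ q (fun l => f l - g l) l = crl Λ q f l - crl Λ q g l := by
  unfold crl cr cu
  simp only [map_sub, Algebra.smul_def]; ring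
theorem crl_smul (Λ : ℝ) (q f : Fin 3 -> Sm) (z : ℂ) (l : Fin 3) : crl Λ q (fun l => z • f l) l = z • crl Λ q f l := by
  unfold crl cr cu
  simp only [Derivation.map_smul]
  simp only [Algebra.smul_def]; ring
theorem div_cu (f : Fin 3 -> Sm) : ∑ l, dd l (cu f l) = 0 := by
  unfold cu
  simp only [Fin.sum_univ_three, map_sub]
  rw [show (1 : Fin 3) + 2 = 0 from rfl, show (1 : Fin 3) + 1 = 2 from rfl, show (2 : Fin 3) + 2 = 1 from rfl, show (2 : Fin 3) + 1 = 0 from rfl,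
    zero_add, zero_add, dd_comm 0 1, dd_comm 0 2, dd_comm 1 2]
  ring
theorem cj_crl (Λ : ℝ) {q : Fin 3 -> Sm} (hq : ∀ j, Re (q j)) (f : Fin 3 -> Sm) (l : Fin 3) :
    cj (crl Λ q f l) = crl Λ (fun j => - q j) (fun l => cj (f l)) l := by
  have h : ∀ j, cj (q j) = q j := hq
  unfold crl cr cu
  simp [cj_dd, h, Algebra.smul_def]
  ring
theorem crl_cl {ι : Type} {c : Ctx ι} {r m : ℕ} {Λ : ι -> ℝ} {A : ι -> ℝ} {q f : Fin 3 -> ι -> Sm} (hq : ∀ j, Cl c r m (fun _ => 1) (q j)) (hf : ∀ j, Cl c r (m + 1) A (f j))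
    (hL : Ls c.mu Λ) (l : Fin 3) : Cl c r m (fun i => A i * Λ i) (fun i => crl (Λ i) (fun j => q j i) (fun j => f j i) l) := by
  have h1 : Cl c r m A (fun i => cr (fun j => q j i) (fun j => f j i) l) :=
    ((hq _).mul1 ((hf _).down le_rfl (Nat.le_succ _))).sub ((hq _).mul1 ((hf _).down le_rfl (Nat.le_succ _)))
  have h2 : Cl c r m (fun i => A i * c.mu i) (fun i => cu (fun j => f j i) l) := ((hf _).dd _).sub ((hf _).dd _)
  refine ((h1.smulc fun i => (Complex.I * Λ i : ℂ)).trans (Ls.of' 1 fun i => ?_)).add (h2.trans (Ls.rfl'.mul hL))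
  simp [abs_mul, mul_comm]
end Sm
namespace Slots
variable (Z : Slots L η C0 K0)
def qn (k : 𝔻 × ℤ) (I : 𝕀) (j : Fin 3) : Sm := Z.S.q (dirS (pr k.2) I) j k
def cw (k : 𝔻 × ℤ) (I : 𝕀) (l : Fin 3) : Sm := cst (wS (pr k.2) I l)
def cq (k : 𝔻 × ℤ) (I : 𝕀) (l : Fin 3) : Sm := cr (Z.qn k I) (cw k I) l
def Sa (k : 𝔻 × ℤ) (a : Fin 6) : Sm := Z.fS k a * rsT (Z.fS k a)
def Qn (k : 𝔻 × ℤ) : Sm := ∑ a, cst 2 * Z.fS k a * (-∑ l, Z.cq k (a, false) l * Z.cq k (a, true) l)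
def hQ (k : 𝔻 × ℤ) : Sm := rsT (Z.Qn k)
theorem chs (a s : ℝ) : ContDiff ℝ ∞ (fun t : ℝ => chi (t / a - s)) := chi_smooth.comp (by fun_prop)
def ch (k : 𝔻 × ℤ) : Sm := tf (fun t => chi (t / Z.T k.1 - k.2)) (chs _ _)
def gg (d : 𝔻) : Sm := tf d.g d.hg
def al (k : 𝔻 × ℤ) (a : Fin 6) : Sm := gg k.1 * Z.ch k * (Z.Sa k a * Z.hQ k)
def om (k : 𝔻 × ℤ) (I : 𝕀) (l : Fin 3) : Sm := ((k.1.Lam⁻¹ : ℝ) : ℂ) • (Z.al k I.1 * cw k I l)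
def vv (k : 𝔻 × ℤ) (I : 𝕀) (l : Fin 3) : Sm := crl k.1.Lam (Z.qn k I) (Z.om k I) l
def EE (k : 𝔻 × ℤ) (I : 𝕀) (l : Fin 3) : Sm := crl k.1.Lam (Z.qn k I) (Z.vv k I) l - ((5 * k.1.Lam : ℝ) : ℂ) • Z.vv k I l
def ee (k : 𝔻 × ℤ) (I : 𝕀) : Sm := ex (Z.S.φ k) k.1.ph (dirS (pr k.2) I)
def rr (k : 𝔻 × ℤ) (I : 𝕀) (l : Fin 3) : Sm := Z.vv k I l - (5 : ℂ) • (Z.al k I.1 * cw k I l)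
theorem qn_re (k : 𝔻 × ℤ) (I : 𝕀) (j : Fin 3) : Re (Z.qn k I j) := Z.S.q_cj _ _ _
theorem qn_bar (k : 𝔻 × ℤ) (I : 𝕀) (j : Fin 3) : Z.qn k (bar I) j = - Z.qn k I j := by
  unfold qn Win.Flow.q; rw [dirS_bar]; simp [sum_neg_distrib]; ring
theorem cw_bar (k : 𝔻 × ℤ) (I : 𝕀) (l : Fin 3) : cw k (bar I) l = cj (cw k I l) := by
  unfold cw; rw [wS_bar]; apply ext'; intro z; simp
theorem cq_bar (k : 𝔻 × ℤ) (I : 𝕀) (l : Fin 3) : Z.cq k (bar I) l = - cj (Z.cq k I l) := by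
  have h : ∀ j, cj (Z.qn k I j) = Z.qn k I j := Z.qn_re k I
  unfold cq cr; simp only [qn_bar, cw_bar, cj_sub, cj_mul, h]; ring
theorem ee_bar (k : 𝔻 × ℤ) (I : 𝕀) : Z.ee k (bar I) = cj (Z.ee k I) := by
  unfold ee; rw [dirS_bar, ex_cj]
theorem ee_mul_bar (k : 𝔻 × ℤ) (I : 𝕀) : Z.ee k I * Z.ee k (bar I) = 1 := by
  unfold ee; rw [dirS_bar, <- ex_add, add_neg_cancel, ex_zero]
theorem dd_ee (k : 𝔻 × ℤ) (I : 𝕀) (j : Fin 3) : dd j (Z.ee k I) = (Complex.I * k.1.Lam : ℂ) • (Z.qn k I j * Z.ee k I) := by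
  unfold ee qn; rw [Z.S.dd_ex]; congr 1; unfold Dat.Lam; push_cast; ring
theorem D_ee (k : 𝔻 × ℤ) (I : 𝕀) : EqS (Z.W.win k) 0 (DD k.1.u (Z.ee k I)) := Z.S.D_ex _ _ _
theorem Sa_re (k : 𝔻 × ℤ) (a : Fin 6) : Re (Z.Sa k a) := (Z.fS_re k a).mul (rsT_re _)
theorem al_re (k : 𝔻 × ℤ) (a : Fin 6) : Re (Z.al k a) :=
  ((Re.tf _ _).mul (Re.tf _ _)).mul ((Z.Sa_re k a).mul (rsT_re _))
theorem om_bar (k : 𝔻 × ℤ) (I : 𝕀) (l : Fin 3) : Z.om k (bar I) l = cj (Z.om k I l) := by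
  have h : cj (Z.al k I.1) = Z.al k I.1 := Z.al_re k I.1
  unfold om; rw [cw_bar]; simp [h, bar]
theorem vv_bar (k : 𝔻 × ℤ) (I : 𝕀) (l : Fin 3) : Z.vv k (bar I) l = cj (Z.vv k I l) := by
  unfold vv; rw [cj_crl _ (Z.qn_re k I)]
  rw [show Z.qn k (bar I) = fun j => - Z.qn k I j from funext (Z.qn_bar k I), show Z.om k (bar I) = fun j => cj (Z.om k I j) from funext (Z.om_bar k I)]
theorem vv_eq (k : 𝔻 × ℤ) (I : 𝕀) (l : Fin 3) :
    Z.vv k I l = Complex.I • (Z.al k I.1 * Z.cq k I l) + ((k.1.Lam⁻¹ : ℝ) : ℂ) • cr (fun j => dd j (Z.al k I.1)) (cw k I) l := by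
  have hL : algebraMap ℂ Sm (k.1.Lam : ℂ) * algebraMap ℂ Sm ((k.1.Lam⁻¹ : ℝ) : ℂ) = 1 := by
    rw [<- map_mul, <- Complex.ofReal_mul, mul_inv_cancel₀ k.1.Lam0.ne', Complex.ofReal_one, map_one]
  unfold vv om crl cq cu cr
  simp only [Derivation.map_smul, Derivation.leibniz, cw, Derivation.map_algebraMap, smul_eq_mul, Algebra.smul_def, map_mul]
  linear_combination (algebraMap ℂ Sm Complex.I * Z.al k I.1 * (Z.qn k I (l + 1) * algebraMap ℂ Sm (wS (pr k.2) I (l + 2)) - Z.qn k I (l + 2) * algebraMap ℂ Sm (wS (pr k.2) I (l + 1)))) * hL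
theorem EE_eq (k : 𝔻 × ℤ) (I : 𝕀) (l : Fin 3) : Z.EE k I l = crl k.1.Lam (Z.qn k I) (Z.rr k I) l := by
  have hL : (k.1.Lam : ℂ) * ((k.1.Lam⁻¹ : ℝ) : ℂ) = 1 := by
    rw [<- Complex.ofReal_mul, mul_inv_cancel₀ k.1.Lam0.ne', Complex.ofReal_one]
  have e : Z.rr k I = fun l => Z.vv k I l - ((5 * k.1.Lam : ℝ) : ℂ) • Z.om k I l := by
    funext l; unfold rr om; rw [smul_smul]; push_cast at hL ⊢; rw [mul_assoc, hL, mul_one]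
  rw [e, crl_sub, crl_smul]; rfl
end Slots
end
section
namespace Slots
variable (Z : Slots L η C0 K0)
theorem qn_near (k : 𝔻 × ℤ) (I : 𝕀) (j : Fin 3) (z : Zt) : ‖Z.qn k I j z - (dirS (pr k.2) I j : ℂ)‖ <= 12 / 1000 := by
  have h : ∀ i, ‖((dirS (pr k.2) I i : ℤ) : ℂ) * Z.S.G i j k z‖ <= 4 / 1000 := fun i => by
    rw [norm_mul, Complex.norm_intCast]
    have h1 : |((dirS (pr k.2) I i : ℤ) : ℝ)| <= 4 := by exact_mod_cast dirS_le (pr k.2) I i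
    nlinarith [Z.G_small i j k z, abs_nonneg ((dirS (pr k.2) I i : ℤ) : ℝ), norm_nonneg (Z.S.G i j k z)]
  unfold qn Win.Flow.q
  rw [coe_add, Sm.coe_algebraMap, Fin.sum_univ_three]
  simp only [coe_add, coe_mul, Sm.coe_algebraMap, add_sub_cancel_left]
  refine norm_add₃_le.trans ?_
  linarith [h 0, h 1, h 2]
theorem wS_le (b : Bool) (I : 𝕀) (l : Fin 3) : ‖wS b I l‖ <= 9 := by
  unfold wS
  have h1 : ∀ b a l, |wim b a l| <= 4 := by decide
  have h2 : ∀ a l, |wre a l| <= 5 := by decide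
  refine (norm_add_le _ _).trans ?_
  rw [norm_mul, Complex.norm_I, mul_one, Complex.norm_intCast, Complex.norm_intCast]
  have h3 : |sgn I.2 * wim b I.1 l| <= 4 := by
    rw [abs_mul]
    have : |sgn I.2| = 1 := by cases I.2 <;> decide
    rw [this, one_mul]; exact h1 _ _ _
  have h4 : |((sgn I.2 * wim b I.1 l : ℤ) : ℝ)| <= 4 := by exact_mod_cast h3
  have h5 : |((wre I.1 l : ℤ) : ℝ)| <= 5 := by exact_mod_cast h2 I.1 l
  linarith
theorem cq_near (k : 𝔻 × ℤ) (I : 𝕀) (l : Fin 3) (z : Zt) : ‖Complex.I * Z.cq k I l z - 5 * wS (pr k.2) I l‖ <= 1 := by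
  rw [<- beltrami]
  unfold cq cr cw
  simp only [coe_sub, coe_mul, Sm.coe_algebraMap]
  rw [<- mul_sub, norm_mul, Complex.norm_I, one_mul]
  rw [show Z.qn k I (l + 1) z * wS (pr k.2) I (l + 2) - Z.qn k I (l + 2) z * wS (pr k.2) I (l + 1) - ((dirS (pr k.2) I (l + 1) : ℂ) * wS (pr k.2) I (l + 2) - (dirS (pr k.2) I (l + 2) : ℂ) * wS (pr k.2) I (l + 1))
    = (Z.qn k I (l + 1) z - (dirS (pr k.2) I (l + 1) : ℂ)) * wS (pr k.2) I (l + 2) - (Z.qn k I (l + 2) z - (dirS (pr k.2) I (l + 2) : ℂ)) * wS (pr k.2) I (l + 1) by ring]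
  refine (norm_sub_le _ _).trans ?_
  rw [norm_mul, norm_mul]
  have := Z.qn_near k I (l + 1) z; have := Z.qn_near k I (l + 2) z
  have := wS_le (pr k.2) I (l + 1); have := wS_le (pr k.2) I (l + 2)
  have h := fun l => norm_nonneg (wS (pr k.2) I l)
  have h' := fun l => norm_nonneg (Z.qn k I l z - (dirS (pr k.2) I l : ℂ))
  nlinarith [h (l + 1), h (l + 2), h' (l + 1), h' (l + 2)]
theorem cq_big (k : 𝔻 × ℤ) (I : 𝕀) (z : Zt) : 20 <= ‖Z.cq k I (axs I.1) z‖ := by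
  have h := Z.cq_near k I (axs I.1) z
  have e : wS (pr k.2) I (axs I.1) = 5 := by simp [wS, wre, wim]
  have h1 := norm_sub_norm_le (5 * wS (pr k.2) I (axs I.1)) (Complex.I * Z.cq k I (axs I.1) z)
  rw [norm_sub_rev] at h1
  rw [e, norm_mul Complex.I, Complex.norm_I, one_mul] at h1
  have : ‖(5 * 5 : ℂ)‖ = 25 := by norm_num
  rw [e] at h
  linarith
theorem Qn_eq (k : 𝔻 × ℤ) : Z.Qn k = ∑ a, cst 2 * Z.fS k a * (∑ l, Z.cq k (a, false) l * cj (Z.cq k (a, false) l)) := by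
  unfold Qn
  refine sum_congr rfl fun a _ => ?_
  have : ∀ l, Z.cq k (a, true) l = - cj (Z.cq k (a, false) l) := fun l => Z.cq_bar k (a, false) l
  simp [this]
theorem Qn_re (k : 𝔻 × ℤ) : Re (Z.Qn k) := by
  rw [Qn_eq]
  refine Re.sum fun a _ => Re.mul (Re.mul (cst_re (by simp)) (Z.fS_re k a)) (Re.sum fun l _ => ?_)
  unfold Sm.Re; simp [mul_comm]
theorem Qn_ge (hK : 𝕂) (k : 𝔻 × ℤ) (z : Zt) : 1 / 100 <= (Z.Qn k z).re := by
  rw [Qn_eq]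
  have h1 : ∀ a, 1 / 100 <= ((cst 2 * Z.fS k a * (∑ l, Z.cq k (a, false) l * cj (Z.cq k (a, false) l))) z).re := fun a => by
    have e : (∑ l, Z.cq k (a, false) l * cj (Z.cq k (a, false) l)) z = ((∑ l, ‖Z.cq k (a, false) l z‖ ^ 2 : ℝ) : ℂ) := by
      rw [Sm.coe_sum]; push_cast
      refine sum_congr rfl fun l _ => ?_
      rw [coe_mul, cj_apply, Complex.mul_conj']
    have h2 := Z.fS_ge hK k a z
    have h3 : 400 <= ∑ l, ‖Z.cq k (a, false) l z‖ ^ 2 := by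
      refine le_trans ?_ (single_le_sum (f := fun l => ‖Z.cq k (a, false) l z‖ ^ 2) (fun i _ => sq_nonneg _) (mem_univ (axs a)))
      have := Z.cq_big k (a, false) z
      dsimp only at this ⊢
      nlinarith
    rw [coe_mul, e, Complex.mul_re, Complex.ofReal_im, mul_zero, sub_zero, Complex.ofReal_re, coe_mul, Sm.coe_algebraMap]
    simp only [Complex.mul_re, Complex.re_ofNat, Complex.im_ofNat, zero_mul, sub_zero]
    nlinarith
  rw [Sm.coe_sum, Complex.re_sum]
  refine (h1 0).trans ?_
  refine single_le_sum (f := fun a => ((cst 2 * Z.fS k a * (∑ l, Z.cq k (a, false) l * cj (Z.cq k (a, false) l))) z).re) (fun i _ => le_trans (by norm_num) (h1 i)) (mem_univ 0)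
theorem hQ_mul (hK : 𝕂) (k : 𝔻 × ℤ) : Z.hQ k * Z.hQ k * Z.Qn k = 1 := rsT_mul (Z.Qn_re k) (by norm_num) (Z.Qn_ge hK k)
theorem Sa_mul (hK : 𝕂) (k : 𝔻 × ℤ) (a : Fin 6) : Z.Sa k a * Z.Sa k a = Z.fS k a := by
  have h := rsT_mul (Z.fS_re k a) (by norm_num) (Z.fS_ge hK k a)
  unfold Sa; linear_combination Z.fS k a * h
/-- hypotheses for the class bounds -/
structure Hy (mu : 𝔻 × ℤ -> ℝ) (r M : ℕ) : Prop where
  hdu : ∀ i k, Cl (Z.W.c mu) r M (fun i => i.1.1.1.nu) (fun j => dd i (j.1.1.1.u k))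
  hrho : ∀ j l, Cl (Z.W.c0 mu) 0 M (fun _ => 1) (fun i => Z.rho i.1 j l)
  hmu : ∀ k, 0 <= mu k
variable {Z} {mu : Dat L η C0 K0 × ℤ -> ℝ} {r M : ℕ}
namespace Hy
theorem G_cl (h : Z.Hy mu r M) (i j : Fin 3) : Cl (Z.W.c mu) (r + 1) M (fun _ => 1) (fun k => Z.S.G i j k.1.1) :=
  Z.S.G_clS (B := fun _ => 1) h.hdu (fun i k => (h.hdu i k).trans (Ls.eq fun _ => (one_mul _).symm)) h.hmu (fun _ => zero_le_one) i j
theorem rh_cl (h : Z.Hy mu r M) (j l : Fin 3) : Cl (Z.W.c mu) (r + 1) M (fun _ => 1) (fun i => Z.rh i.1.1 j l) :=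
  Z.S.pb_cl (ρ := fun k => Z.rho k j l) (B := fun _ => 1) h.hdu h.hmu (fun _ => zero_le_one) (h.hrho j l)
theorem fin_cst {ι κ : Type} [Finite κ] {c : Ctx ι} {r m : ℕ} (f : κ -> ℂ) (g : ι -> κ) : Cl c r m (fun _ => 1) (fun i => cst (f (g i))) := by
  cases nonempty_fintype κ
  refine Cl.cst _ (Ls.of (∑ k, ‖f k‖) fun i => ?_)
  rw [mul_one]
  exact single_le_sum (f := fun k => ‖f k‖) (fun _ _ => norm_nonneg _) (mem_univ _)
theorem cw_cl {c : Ctx Z.W.Ix} {r m : ℕ} (I : 𝕀) (l : Fin 3) : Cl c r m (fun _ => 1) (fun i => cw i.1.1 I l) :=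
  fin_cst (fun b => wS b I l) (fun i : Z.W.Ix => pr i.1.1.2)
theorem qn_cl (h : Z.Hy mu r M) (I : 𝕀) (j : Fin 3) : Cl (Z.W.c mu) (r + 1) M (fun _ => 1) (fun i => Z.qn i.1.1 I j) := by
  unfold qn Win.Flow.q
  exact (fin_cst (fun b => (dirS b I j : ℂ)) (fun i : Z.W.Ix => pr i.1.1.2)).add (Cl.sum _ fun l _ =>
    (fin_cst (fun b => (dirS b I l : ℂ)) (fun i : Z.W.Ix => pr i.1.1.2)).mul1 (h.G_cl l j))
theorem cr_cl {ι : Type} {c : Ctx ι} {r m : ℕ} {A : ι -> ℝ} {q f : ι -> Fin 3 -> Sm} (hq : ∀ j, Cl c r m (fun _ => 1) (fun i => q i j)) (hf : ∀ j, Cl c r m A (fun i => f i j))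
    (l : Fin 3) : Cl c r m A (fun i => cr (q i) (f i) l) := ((hq _).mul1 (hf _)).sub ((hq _).mul1 (hf _))
theorem cq_cl (h : Z.Hy mu r M) (I : 𝕀) (j : Fin 3) : Cl (Z.W.c mu) (r + 1) M (fun _ => 1) (fun i => Z.cq i.1.1 I j) :=
  cr_cl (fun j => h.qn_cl I j) (fun j => cw_cl I j) j
theorem fS_cl (h : Z.Hy mu r M) (a : Fin 6) : Cl (Z.W.c mu) (r + 1) M (fun _ => 1) (fun i => Z.fS i.1.1 a) := by
  have hd := fun j => fin_cst (c := Z.W.c mu) (r := r + 1) (m := M) (fun b => dco b a j) (fun i : Z.W.Ix => pr i.1.1.2)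
  unfold fS
  refine Cl.add (Cl.add (Cl.cst1 _) ((Cl.cst1 _).mul1 (Cl.add (Cl.add ?_ ?_) ?_))) ((Cl.cst1 _).mul1 (h.rh_cl _ _))
  . exact (hd 0).mul1 (h.rh_cl 0 0)
  . exact (hd 1).mul1 (h.rh_cl 1 1)
  . exact (hd 2).mul1 (h.rh_cl 2 2)
theorem Sa_cl (hK : 𝕂) (h : Z.Hy mu r M) (a : Fin 6) : Cl (Z.W.c mu) (r + 1) M (fun _ => 1) (fun i => Z.Sa i.1.1 a) :=
  (h.fS_cl a).mul1 (rsT_cl (h.fS_cl a) (fun i => Z.fS_re _ _) (by norm_num) fun i => Z.fS_ge hK _ _)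
theorem Qn_cl (h : Z.Hy mu r M) : Cl (Z.W.c mu) (r + 1) M (fun _ => 1) (fun i => Z.Qn i.1.1) :=
  Cl.sum _ fun a _ => ((Cl.cst1 _).mul1 (h.fS_cl a)).mul1 (Cl.neg (Cl.sum _ fun l _ => (h.cq_cl _ l).mul1 (h.cq_cl _ l)))
theorem hQ_cl (hK : 𝕂) (h : Z.Hy mu r M) : Cl (Z.W.c mu) (r + 1) M (fun _ => 1) (fun i => Z.hQ i.1.1) :=
  rsT_cl h.Qn_cl (fun i => Z.Qn_re _) (by norm_num) fun i => Z.Qn_ge hK _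
theorem ch_cl (r m : ℕ) : Cl (Z.W.c mu) r m (fun _ => 1) (fun i => Z.ch i.1.1) := by
  refine tf_cl r m _ _ fun n hn => ?_
  obtain ⟨B, hB⟩ := chi_bd n
  refine Ls.of (B * (Z.c⁻¹) ^ n) fun i => ?_
  rw [chi_iter, one_mul]
  have e : (Z.T i.1.1.1)⁻¹ = Z.c⁻¹ * i.1.1.1.nu := by unfold T; rw [inv_div, div_eq_inv_mul]
  rw [e, mul_pow, Real.norm_eq_abs, abs_mul, abs_of_nonneg (mul_nonneg (pow_nonneg (inv_nonneg.2 Z.hc.le) _) (pow_nonneg i.1.1.1.nu0.le _))]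
  have := hB ((((Z.W.c mu).pt i).1) / Z.T i.1.1.1 - i.1.1.2)
  have h2 : 0 <= Z.c⁻¹ ^ n * i.1.1.1.nu ^ n := (mul_nonneg (pow_nonneg (inv_nonneg.2 Z.hc.le) _) (pow_nonneg i.1.1.1.nu0.le _))
  calc _ <= Z.c⁻¹ ^ n * i.1.1.1.nu ^ n * B := by gcongr
    _ = B * Z.c⁻¹ ^ n * i.1.1.1.nu ^ n := by ring
theorem gg_cl (m : ℕ) : Cl (Z.W.c mu) 2 m (fun i => i.1.1.1.E * i.1.1.1.ind i.1.2.1) (fun i => gg i.1.1.1) := by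
  refine tf_cl 2 m _ _ fun n hn => Ls.of' |C0| fun i => ?_
  have hE := i.1.1.1.hE; have hi := i.1.1.1.ind0 i.1.2.1
  have hn0 := i.1.1.1.nu0
  have hb := i.1.1.1.bnu_le; have hb' := i.1.1.1.bnu
  have hb0 : 0 <= i.1.1.1.b * i.1.1.1.nu := (mul_pos i.1.1.1.hb hn0).le
  change |_| <= |C0| * |i.1.1.1.E * i.1.1.1.ind i.1.2.1 * i.1.1.1.nu ^ n|
  rw [<- abs_mul]
  have hC : 0 <= |C0| * (i.1.1.1.E * i.1.1.1.ind i.1.2.1) := by positivity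
  have hC1 : C0 * (i.1.1.1.E * i.1.1.1.ind i.1.2.1) <= |C0| * (i.1.1.1.E * i.1.1.1.ind i.1.2.1) := mleR (le_abs_self _) (by positivity)
  have key : |iteratedDeriv n i.1.1.1.g i.1.2.1| <= |C0| * (i.1.1.1.E * i.1.1.1.ind i.1.2.1) * i.1.1.1.nu ^ n := by
    interval_cases n
    . simpa using (i.1.1.1.bg0 i.1.2.1).trans hC1
    . rw [iteratedDeriv_one, pow_one]
      refine (i.1.1.1.bg1 _).trans ?_
      rw [hb', <- mul_assoc]
      exact mul_le_mul hC1 hb hb0 hC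
    . rw [iteratedDeriv_succ, iteratedDeriv_one]
      refine (i.1.1.1.bg2 _).trans ?_
      rw [hb', <- mul_assoc]
      exact mul_le_mul hC1 (pow_le_pow_left₀ hb0 hb 2) (by positivity) hC
  refine key.trans ?_
  rw [abs_mul, abs_of_nonneg (show 0 <= i.1.1.1.E * i.1.1.1.ind i.1.2.1 * i.1.1.1.nu ^ n by positivity), mul_assoc]
theorem al_cl (hK : 𝕂) (h : Z.Hy mu r M) (hr : r <= 1) (a : Fin 6) : Cl (Z.W.c mu) (r + 1) M (fun i => i.1.1.1.E * i.1.1.1.ind i.1.2.1) (fun i => Z.al i.1.1 a) :=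
  Cl.mul1' (Cl.mul1' ((gg_cl M).down (by omega) le_rfl) (ch_cl (r + 1) M)) ((h.Sa_cl hK a).mul1 (h.hQ_cl hK))
end Hy
end Slots
end
section
namespace Slots
variable (Z : Slots L η C0 K0)
theorem hrho_gen (hK : 𝕂) {mu : 𝔻 × ℤ -> ℝ} {M : ℕ}
    (h : ∀ j l, Cl (Z.W.c0 mu) 0 M (fun i => i.1.1.E ^ 2 * i.1.1.ind (Z.ts i.1)) (fun i => i.1.1.Re' j l)) (j l : Fin 3) :
    Cl (Z.W.c0 mu) 0 M (fun _ => 1) (fun i => Z.rho i.1 j l) := by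
  classical
  have hK0 : 1 <= K0 := by linarith [BM0]
  have h1 := Dat.Rd_clG (fun i : (𝔻 × ℤ) × Spc => i.1.1) h j l
  let z : (𝔻 × ℤ) × Spc -> ℂ := fun i => if (∀ j l x, i.1.1.R j l (Z.ts i.1, x) = 0) then 0 else ((((i.1.1.g (Z.ts i.1)) ^ 2)⁻¹ : ℝ) : ℂ)
  refine ((h1.smulc z).trans (Ls.of 1 fun i => ?_)).congr0 fun i x => ?_
  . by_cases hz : ∀ j l x, i.1.1.R j l (Z.ts i.1, x) = 0
    . simp [z, if_pos hz]
    . have hg := (Z.g_alt i.1).resolve_left hz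
      have hE := i.1.1.hE
      have h0 := i.1.1.ind0 (Z.ts i.1); have h1 := i.1.1.ind1 (Z.ts i.1)
      have hg2 : i.1.1.E ^ 2 <= i.1.1.g (Z.ts i.1) ^ 2 := by nlinarith [sq_nonneg i.1.1.E]
      have hg0 : 0 < i.1.1.g (Z.ts i.1) ^ 2 := lt_of_lt_of_le (by positivity) hg2
      simp only [z, if_neg hz, Complex.norm_real, Real.norm_eq_abs]
      rw [abs_of_nonneg (inv_nonneg.2 hg0.le), abs_of_nonneg (by positivity), inv_mul_le_iff₀ hg0]
      nlinarith [sq_nonneg i.1.1.E]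
  . change _ = (cst _ * _ : Sm) _
    simp only [coe_smul, coe_mul, coe_algebraMap, z]
    split_ifs with hz
    . have := i.1.1.Rd_zero hz j l x
      change _ = _ * i.1.1.Rd j l (Z.ts i.1, x)
      rw [this]; simp
    . rfl
theorem hy_mu (hL : 2 <= L) (hK : 𝕂) (M : ℕ) : Z.Hy (fun k => k.1.mu) 1 M where
  hdu i k := (Z.cl_W (F := fun d => dd i (d.u k)) (Dat.du_cl1 hL i k M)).trans (Ls.le (fun i => (mul_pos i.1.1.1.hb i.1.1.1.nu0).le) fun i => i.1.1.1.bnu_le)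
  hrho := Z.hrho_gen hK fun j l => Z.cl_I (F := fun d => d.Re' j l) (Dat.Re_cl j l M)
  hmu k := k.1.mu0.le
theorem hy_X (hL : 2 <= L) (hK : 𝕂) : Z.Hy (fun k => k.1.X) 0 1 where
  hdu i k := Z.cl_WX (F := fun d => dd i (d.u k)) (Dat.du_clX hL i k)
  hrho := Z.hrho_gen hK fun j l => Z.cl_IX (F := fun d => d.Re' j l) (Dat.Re_clX hL j l)
  hmu k := k.1.hX0.le
abbrev cm : Ctx Z.W.Ix := Z.W.c fun k => k.1.mu
variable {Z}
theorem bG (hL : 2 <= L) (M : ℕ) (i j : Fin 3) : Cl Z.cm 2 M (fun i => i.1.1.1.b) (fun k => Z.S.G i j k.1.1) :=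
  Z.S.G_clS (r := 1) (B := fun k => k.1.b)
    (fun i k => (Z.cl_W (F := fun d => dd i (d.u k)) (Dat.du_cl1 hL i k M)).trans (Ls.le (fun i => (mul_pos i.1.1.1.hb i.1.1.1.nu0).le) fun i => i.1.1.1.bnu_le))
    (fun i k => Z.cl_W (F := fun d => dd i (d.u k)) (Dat.du_cl1 hL i k M)) (fun k => k.1.mu0.le) (fun k => k.1.hb.le) i j
theorem bq (hL : 2 <= L) (M : ℕ) (I : 𝕀) (j : Fin 3) :
    Cl Z.cm 2 M (fun i => i.1.1.1.b) (fun k => Z.qn k.1.1 I j - cst (dirS (pr k.1.1.2) I j : ℂ)) := by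
  refine Dat.congr' (Cl.sum Finset.univ fun l _ => (Hy.fin_cst (fun b => (dirS b I l : ℂ)) (fun i : Z.W.Ix => pr i.1.1.2)).mul1 (bG hL M l j)) fun i => ?_
  unfold qn Win.Flow.q; ring
theorem bcq (hL : 2 <= L) (M : ℕ) (I : 𝕀) (l : Fin 3) :
    Cl Z.cm 2 M (fun i => i.1.1.1.b) (fun k => Complex.I • Z.cq k.1.1 I l - (5 : ℂ) • cw k.1.1 I l) := by
  refine Dat.congr' ((Cl.sub ((bq hL M I (l + 1)).mul1' (Hy.cw_cl I (l + 2))) ((bq hL M I (l + 2)).mul1' (Hy.cw_cl I (l + 1)))).smul Complex.I) fun k => ?_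
  apply ext'; intro z
  have := beltrami (pr k.1.1.2) I l
  simp only [cq, cr, cw, coe_smul, coe_sub, coe_mul, coe_algebraMap]
  linear_combination -this
end Slots
end
section
namespace Slots
variable {Z : Slots L η C0 K0}
abbrev sg (i : Z.W.Ix) : ℝ := i.1.1.1.E * i.1.1.1.ind i.1.2.1
theorem sg0 (i : Z.W.Ix) : 0 <= sg i := mul_nonneg i.1.1.1.hE.le (i.1.1.1.ind0 _)
theorem Lam_mu (d : 𝔻) : d.Lam⁻¹ * d.mu <= d.b := by
  rw [inv_mul_le_iff₀ d.Lam0]; unfold Dat.mu; nlinarith [d.Lam_ge, d.hb]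
theorem al2 (hL : 2 <= L) (hK : 𝕂) (M : ℕ) (a : Fin 6) : Cl Z.cm 2 M sg (fun i => Z.al i.1.1 a) :=
  (Z.hy_mu hL hK M).al_cl hK le_rfl a
theorem dal2 (hL : 2 <= L) (hK : 𝕂) (M : ℕ) (I : 𝕀) (l : Fin 3) :
    Cl Z.cm 2 M (fun i => i.1.1.1.b * sg i) (fun i => ((i.1.1.1.Lam⁻¹ : ℝ) : ℂ) • cr (fun j => dd j (Z.al i.1.1 I.1)) (cw i.1.1 I) l) := by
  have h := fun j => (al2 (Z := Z) hL hK (M + 1) I.1).dd j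
  refine Cl.trans (Cl.smulc (fun i : Z.W.Ix => ((i.1.1.1.Lam⁻¹ : ℝ) : ℂ)) (Cl.sub ((h _).mul1' (Hy.cw_cl I _)) ((h _).mul1' (Hy.cw_cl I _)))) (Ls.of 1 fun i => ?_)
  have h0 := inv_nonneg.2 i.1.1.1.Lam0.le
  have h1 := i.1.1.1.mu0.le
  rw [Complex.norm_real, Real.norm_eq_abs, Real.norm_eq_abs, abs_of_nonneg h0]
  change |_ * (_ * i.1.1.1.mu)| <= _
  rw [abs_of_nonneg (mul_nonneg h0 (mul_nonneg (sg0 i) h1))]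
  nlinarith [Lam_mu i.1.1.1, sg0 i]
theorem rr2 (hL : 2 <= L) (hK : 𝕂) (M : ℕ) (I : 𝕀) (l : Fin 3) :
    Cl Z.cm 2 M (fun i => i.1.1.1.b * sg i) (fun i => Z.rr i.1.1 I l) := by
  refine Dat.congr' (Cl.add (((bcq hL M I l).mul (al2 hL hK M I.1))) (dal2 hL hK M I l)) fun i => ?_
  unfold rr; rw [vv_eq]
  simp only [Algebra.smul_def]; ring
theorem b_sg (i : Z.W.Ix) : i.1.1.1.b * sg i <= sg i := mul_le_of_le_one_left (sg0 i) i.1.1.1.b1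
theorem bsg0 (i : Z.W.Ix) : 0 <= i.1.1.1.b * sg i := mul_nonneg i.1.1.1.hb.le (sg0 i)
theorem acw2 (hL : 2 <= L) (hK : 𝕂) (M : ℕ) (I : 𝕀) (l : Fin 3) :
    Cl Z.cm 2 M sg (fun i => (5 : ℂ) • (Z.al i.1.1 I.1 * cw i.1.1 I l)) := ((al2 hL hK M I.1).mul1' (Hy.cw_cl I l)).smul 5
theorem vv2 (hL : 2 <= L) (hK : 𝕂) (M : ℕ) (I : 𝕀) (l : Fin 3) :
    Cl Z.cm 2 M sg (fun i => Z.vv i.1.1 I l) :=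
  Dat.congr' (((rr2 hL hK M I l).trans (Ls.le bsg0 b_sg)).add (acw2 hL hK M I l)) fun i => by unfold rr; ring
theorem om2 (hL : 2 <= L) (hK : 𝕂) (M : ℕ) (I : 𝕀) (l : Fin 3) :
    Cl Z.cm 2 M (fun i => sg i * i.1.1.1.lam⁻¹) (fun i => Z.om i.1.1 I l) := by
  refine (((al2 hL hK M I.1).mul1' (Hy.cw_cl I l)).smulc (fun i : Z.W.Ix => ((i.1.1.1.Lam⁻¹ : ℝ) : ℂ))).trans (Ls.of 1 fun i => ?_)
  have h0 := inv_nonneg.2 i.1.1.1.Lam0.le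
  have h1 := inv_anti₀ i.1.1.1.lam0 i.1.1.1.Lam_ge
  rw [Complex.norm_real, Real.norm_eq_abs, Real.norm_eq_abs, abs_of_nonneg h0, abs_of_nonneg (mul_nonneg h0 (sg0 i))]
  nlinarith [sg0 i]
theorem EE2 (hL : 2 <= L) (hK : 𝕂) (M : ℕ) (I : 𝕀) (l : Fin 3) :
    Cl Z.cm 2 M (fun i => i.1.1.1.mu * sg i) (fun i => Z.EE i.1.1 I l) := by
  refine Dat.congr' ((crl_cl (Λ := fun i : Z.W.Ix => i.1.1.1.Lam) (q := fun j i => Z.qn i.1.1 I j) (f := fun j i => Z.rr i.1.1 I j) (fun j => (Z.hy_mu hL hK M).qn_cl I j) (fun j => rr2 hL hK (M + 1) I j) (Ls.le (fun i => i.1.1.1.mu0.le) fun i => ?_) l).trans (Ls.of 16 fun i => ?_)) fun i => ?_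
  . change i.1.1.1.mu <= i.1.1.1.Lam
    have := i.1.1.1.Lam_ge; have := i.1.1.1.b1; have := i.1.1.1.lam0
    unfold Dat.mu; nlinarith
  . rw [Real.norm_eq_abs, abs_of_nonneg (mul_nonneg (bsg0 i) i.1.1.1.Lam0.le)]
    have := mleL i.1.1.1.Lam_le (bsg0 i)
    refine this.trans (le_of_eq ?_)
    change _ = 16 * ((i.1.1.1.b * i.1.1.1.lam) * sg i); ring
  . rw [EE_eq]
theorem cw_sq (b : Bool) (a : Fin 6) : ∑ l, wS b (a, false) l * wS b (a, true) l = 50 := by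
  have h : ∀ b a, ∑ l, (wre a l * wre a l + wim b a l * wim b a l) = 50 := by decide
  have h2 : ((∑ l, (wre a l * wre a l + wim b a l * wim b a l) : ℤ) : ℂ) = 50 := by rw [h]; norm_num
  rw [<- h2]; push_cast
  refine sum_congr rfl fun l _ => ?_
  simp only [wS, sgn, if_true, Bool.false_eq_true, if_false]; push_cast
  linear_combination (-(wim b a l : ℂ) ^ 2) * Complex.I_sq
theorem fS_tr (k : 𝔻 × ℤ) : ∑ a, Z.fS k a = cst (1 / 2500) := by
  apply ext'; intro z
  rw [coe_sum]; simp only [fS_apply, coe_algebraMap]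
  exact fam_tr _ _ (Z.rh_tr k z)
theorem bQ (hL : 2 <= L) (hK : 𝕂) (M : ℕ) : Cl Z.cm 2 M (fun i => i.1.1.1.b) (fun i => Z.Qn i.1.1 - 1) := by
  have H := Z.hy_mu hL hK M
  refine Dat.congr' (Cl.sum Finset.univ fun a _ => Cl.mul1 ((Cl.cst1 2).mul1 (H.fS_cl a)) (Cl.sum Finset.univ fun l _ =>
    Cl.add ((bcq hL M (a, false) l).mul1' ((H.cq_cl (a, true) l).smul Complex.I)) (((Hy.cw_cl (a, false) l).smul 5).mul1 (bcq hL M (a, true) l)))) fun i => ?_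
  have e : ∀ a, ∑ l, cw i.1.1 (a, false) l * cw i.1.1 (a, true) l = cst 50 := fun a => by
    unfold cw; simp only [<- map_mul]; rw [<- map_sum, cw_sq]
  have e2 : ∑ a, (cst 2 * Z.fS i.1.1 a) * (cst 25 * ∑ l, cw i.1.1 (a, false) l * cw i.1.1 (a, true) l) = 1 := by
    simp only [e]; rw [<- sum_mul, <- mul_sum, fS_tr]; simp only [<- map_mul]; norm_num
  rw [<- e2]; unfold Qn; rw [<- sum_sub_distrib]
  refine sum_congr rfl fun a _ => ?_
  rw [<- mul_sub]; congr 1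
  rw [mul_sum, <- sum_neg_distrib, <- sum_sub_distrib]
  refine sum_congr rfl fun l _ => ?_
  apply ext'; intro z
  simp only [coe_smul, coe_sub, coe_mul, coe_algebraMap, coe_add, coe_neg]
  linear_combination (Z.cq i.1.1 (a, false) l z * Z.cq i.1.1 (a, true) l z) * Complex.I_sq
theorem bh (hL : 2 <= L) (hK : 𝕂) (M : ℕ) : Cl Z.cm 2 M (fun i => i.1.1.1.b) (fun i => Z.hQ i.1.1 * Z.hQ i.1.1 - 1) := by
  have H := (Z.hy_mu hL hK M).hQ_cl hK
  exact Dat.congr' ((H.mul1 H).mul1 (bQ hL hK M).neg) fun i => by linear_combination -Z.hQ_mul hK i.1.1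
/-- leading part of the self-interaction -/
def Ld (k : 𝔻 × ℤ) (j l : Fin 3) : Sm := gg k.1 * gg k.1 * (Z.ch k * Z.ch k) * (cst (if j = l then 1 / 3 else 0) - Z.rh k j l)
theorem Ld_eq (hK : 𝕂) (k : 𝔻 × ℤ) (j l : Fin 3) :
    ∑ I, ((5 : ℂ) • (Z.al k I.1 * cw k I j)) * ((5 : ℂ) • (Z.al k I.1 * cw k (bar I) l)) = Z.Ld k j l * (Z.hQ k * Z.hQ k) := by
  apply ext'; intro z
  rw [Fintype.sum_prod_type, coe_sum]
  have h := fam_eq (pr k.2) (fun j l => Z.rh k j l z) (fun j l => by rw [Z.rh_symm]) (Z.rh_tr k z) j l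
  have hs : ∀ a, Z.Sa k a z * Z.Sa k a z = fam (pr k.2) a (fun j l => Z.rh k j l z) := fun a => by
    rw [<- fS_apply, <- Z.Sa_mul hK, coe_mul]
  unfold Ld
  simp only [coe_mul, coe_sub, coe_algebraMap]
  rw [<- h, mul_sum, sum_mul]
  refine sum_congr rfl fun a _ => ?_
  rw [<- hs]
  rw [Fintype.sum_bool]
  simp only [al, cw, coe_mul, coe_add, coe_smul, coe_algebraMap, bar, wS, sgn, if_true, Bool.false_eq_true, if_false, Bool.not_true, Bool.not_false]
  push_cast
  linear_combination (-50 * (gg k.1 z) ^ 2 * (Z.ch k z) ^ 2 * (Z.Sa k a z) ^ 2 * (Z.hQ k z) ^ 2 * (wim (pr k.2) a j) * (wim (pr k.2) a l)) * Complex.I_sq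
theorem Low1 (hL : 2 <= L) (hK : 𝕂) (M : ℕ) (j l : Fin 3) :
    Cl Z.cm 2 M (fun i => i.1.1.1.b * (sg i) ^ 2) (fun i => ∑ I, Z.vv i.1.1 I j * Z.vv i.1.1 (bar I) l - Z.Ld i.1.1 j l) := by
  have H := Z.hy_mu hL hK M
  have hg := Hy.gg_cl (Z := Z) (mu := fun k => k.1.mu) M
  have hc := Hy.ch_cl (Z := Z) (mu := fun k => k.1.mu) 2 M
  have hLd : Cl Z.cm 2 M (fun i => (sg i) ^ 2) (fun i => Z.Ld i.1.1 j l) :=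
    ((((hg.mul hg).mul1' (hc.mul1 hc))).mul1' ((Cl.cst1 _).sub (H.rh_cl j l))).trans (Ls.eq fun i => by simp only [sg]; ring)
  refine Dat.congr' (Cl.add ((hLd.mul' (bh hL hK M) (Ls.eq fun i => mul_comm _ _))) (Cl.sum Finset.univ fun I _ =>
    Cl.add ((rr2 hL hK M I j).mul' (vv2 hL hK M (bar I) l) (Ls.eq fun i => by ring)) ((acw2 hL hK M I j).mul' (rr2 hL hK M (bar I) l) (Ls.eq fun i => by ring)))) fun i => ?_
  have e := Z.Ld_eq hK i.1.1 j l
  rw [mul_sub, <- e, mul_one, sub_add_eq_add_sub, <- sum_add_distrib]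
  congr 1
  refine sum_congr rfl fun I _ => ?_
  unfold rr
  have : (bar I).1 = I.1 := rfl
  rw [this]; ring
end Slots
end
section
namespace Slots
variable (Z : Slots L η C0 K0)
open Classical in
def jd (k : 𝔻 × ℤ) : ℝ := if ∀ t ∈ Z.W.win k, ∀ j l x, k.1.R j l (t, x) = 0 then 0 else 1
theorem jd0 (k : 𝔻 × ℤ) : 0 <= Z.jd k := by unfold jd; split_ifs <;> norm_num
theorem jd_ind (hK : 1 <= K0) (k : 𝔻 × ℤ) (t : ℝ) (ht : t ∈ Z.W.win k) : Z.jd k <= C0 ^ 2 * k.1.ind t ^ 2 := by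
  unfold jd; split_ifs with h
  . positivity
  . push Not at h
    obtain ⟨s, hs, j, l, x, h⟩ := h
    have hE := k.1.hE
    have hT : Z.T k.1 * k.1.nu = Z.c := div_mul_cancel₀ _ k.1.nu0.ne'
    have h1 : |t - s| <= 4 * Z.T k.1 := by
      have a : |t - k.2 * Z.T k.1| < 2 * Z.T k.1 := ht
      have b : |s - k.2 * Z.T k.1| < 2 * Z.T k.1 := hs
      rw [abs_lt] at a b; rw [abs_le]; constructor <;> linarith
    have h2 := k.1.gR t s x j l (by
      rw [k.1.bnu]
      have := k.1.bnu_le; have := Z.hc1; have := mul_pos k.1.hb k.1.nu0; have := Z.T0 k.1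
      calc _ <= (4 * Z.T k.1) * k.1.nu := mul_le_mul h1 k.1.bnu_le (by positivity) (by positivity)
        _ <= 1 := by rw [mul_assoc, hT]; linarith) h
    have h3 := k.1.bg0 t
    have h4 : k.1.g t ^ 2 <= (C0 * (k.1.E * k.1.ind t)) ^ 2 := by rw [<- sq_abs]; exact pow_le_pow_left₀ (abs_nonneg _) h3 2
    have h5 : 0 < k.1.E ^ 2 := by positivity
    have h6 : k.1.E ^ 2 * 1 <= k.1.E ^ 2 * (C0 ^ 2 * k.1.ind t ^ 2) := by nlinarith
    exact le_of_mul_le_mul_left h6 h5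
theorem Re_win (k : 𝔻 × ℤ) (j l : Fin 3) : EqS (Z.W.win k) (((Z.jd k : ℝ) : ℂ) • k.1.Re' j l) (k.1.Re' j l) := by
  intro t ht x
  unfold jd; split_ifs with h
  . rw [k.1.Re_zero (h t ht)]; simp
  . simp
theorem Rd_win (k : 𝔻 × ℤ) (j l : Fin 3) : EqS (Z.W.win k) (((Z.jd k : ℝ) : ℂ) • k.1.Rd j l) (k.1.Rd j l) := by
  intro t ht x
  unfold jd; split_ifs with h
  . rw [k.1.Rd_zero (h t ht)]; simp
  . simp
theorem ts_win (k : 𝔻 × ℤ) : Z.ts k ∈ Z.W.win k := by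
  change |k.2 * Z.T k.1 - k.2 * Z.T k.1| < 2 * Z.T k.1
  have := Z.T0 k.1
  simp [this]
theorem rho_win (k : 𝔻 × ℤ) (j l : Fin 3) (x : Spc) : ((Z.jd k : ℝ) : ℂ) * Z.rho k j l (Z.ts k, x) = Z.rho k j l (Z.ts k, x) := by
  have := Z.Rd_win k j l _ (Z.ts_win k) x
  unfold rho
  rw [coe_mul, <- this]; rw [coe_smul]
  unfold jd; split_ifs with h <;> simp
theorem rh_win (k : 𝔻 × ℤ) (j l : Fin 3) : Z.rh k j l = ((Z.jd k : ℝ) : ℂ) • Z.rh k j l := by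
  apply ext'; intro z
  rw [coe_smul]; exact (Z.rho_win k j l _).symm
def jz (i : Z.W.Ix) : ℂ := ((Z.jd i.1.1 : ℝ) : ℂ)
theorem jz_norm (i : Z.W.Ix) : ‖jz Z i‖ = Z.jd i.1.1 := by
  unfold jz; rw [Complex.norm_real, Real.norm_eq_abs, abs_of_nonneg (Z.jd0 _)]
variable {Z}
theorem jdDRe (hL : 2 <= L) (M : ℕ) (j l : Fin 3) : Cl Z.cm 0 M (fun i => i.1.1.1.b * (i.1.1.1.E ^ 2 * Z.jd i.1.1) * i.1.1.1.nu) (fun i => DD i.1.1.1.u (i.1.1.1.Rd j l)) := by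
  have h0 : ∀ j l, Cl Z.cm 0 M (fun i => i.1.1.1.b * (i.1.1.1.E ^ 2 * Z.jd i.1.1) * i.1.1.1.nu) (fun i => DD i.1.1.1.u (i.1.1.1.Re' j l)) := fun j l => by
    refine Z.W.congrW (F := fun k => ((Z.jd k : ℝ) : ℂ) • DD k.1.u (k.1.Re' j l)) (G := fun k => DD k.1.u (k.1.Re' j l)) (Cl.trans ((Z.cl_W (F := fun d => DD d.u (d.Re' j l)) (Dat.DRe_cl hL j l M)).smulc (jz Z)) (Ls.of 1 fun i => ?_)) fun k => ?_
    . have h1 := i.1.1.1.ind0 i.1.2.1; have h2 := i.1.1.1.ind1 i.1.2.1; have h3 := Z.jd0 i.1.1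
      have h4 := i.1.1.1.hb; have h5 := i.1.1.1.nu0
      rw [jz_norm, Real.norm_eq_abs, abs_of_nonneg (by positivity), one_mul]
      calc _ = i.1.1.1.b * (i.1.1.1.E ^ 2 * Z.jd i.1.1) * i.1.1.1.nu * i.1.1.1.ind i.1.2.1 := by ring
        _ <= _ := mul_le_of_le_one_right (by positivity) h2
    . have := (Z.Re_win k j l).DD (Z.W.win_open k) k.1.u
      simp only [Derivation.map_smul] at this; exact this
  unfold Dat.Rd
  simp only [map_sub]
  refine (h0 j l).sub ?_
  split_ifs
  . simp only [Derivation.leibniz, Derivation.map_algebraMap, smul_eq_mul, mul_zero, add_zero, map_sum]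
    exact (Cl.cst1 _).mul1 (Cl.sum _ fun i _ => h0 i i)
  . simpa using Cl.zero
def Zk (Z : Slots L η C0 K0) (k : 𝔻 × ℤ) (j l : Fin 3) : Sm := k.1.Rd j l - gg k.1 * gg k.1 * Z.rh k j l
theorem Zk_ini (hK : 1 <= K0) (k : 𝔻 × ℤ) (j l : Fin 3) (x : Spc) : Z.Zk k j l (Z.ts k, x) = 0 := by
  have h : Z.rh k j l (Z.ts k, x) = Z.rho k j l (Z.ts k, x) := Z.S.pb_ini _ k x
  unfold Zk
  rw [coe_sub, coe_mul, coe_mul, h]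
  unfold rho gg
  rw [coe_mul, coe_algebraMap, tf_apply]
  rcases Z.g_alt k with h | h
  . rw [k.1.Rd_zero h]; simp
  . have : k.1.g (Z.ts k) ≠ 0 := by
      intro h'; rw [h'] at h; have := k.1.hE; have : 0 < K0 * k.1.E ^ 2 := by positivity
      norm_num at h; linarith
    have h'' : ((k.1.g (Z.ts k) : ℝ) : ℂ) ≠ 0 := by exact_mod_cast this
    push_cast; field_simp; simp
theorem DZk (hL : 2 <= L) (hK : 𝕂) (M : ℕ) (j l : Fin 3) :
    Cl Z.cm 0 M (fun i => i.1.1.1.b * (i.1.1.1.E ^ 2 * Z.jd i.1.1) * i.1.1.1.nu) (fun i => DD i.1.1.1.u (Z.Zk i.1.1 j l)) := by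
  have hg : Cl Z.cm 0 M (fun i => i.1.1.1.E) (fun i => gg i.1.1.1) := ((Hy.gg_cl M).down (by omega) le_rfl).trans (Ls.of 1 fun i => by
    have h1 := i.1.1.1.ind0 i.1.2.1; have h2 := i.1.1.1.ind1 i.1.2.1; have := i.1.1.1.hE
    rw [Real.norm_eq_abs, abs_of_nonneg (by positivity)]; nlinarith)
  have hg' : Cl Z.cm 0 M (fun i => i.1.1.1.E * (i.1.1.1.b * i.1.1.1.nu)) (fun i => DD i.1.1.1.u (gg i.1.1.1)) := by
    unfold gg; simp only [DD_tf]
    refine tf_cl 0 M _ _ fun n hn => Ls.of' |C0| fun i => ?_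
    obtain rfl : n = 0 := by omega
    have h1 := i.1.1.1.ind0 i.1.2.1; have h2 := i.1.1.1.ind1 i.1.2.1; have := i.1.1.1.hE
    have hb := i.1.1.1.hb; have hn0 := i.1.1.1.nu0
    have := i.1.1.1.bg1 i.1.2.1
    rw [i.1.1.1.bnu] at this
    rw [iteratedDeriv_zero, pow_zero, mul_one, abs_of_pos (show 0 < i.1.1.1.E * (i.1.1.1.b * i.1.1.1.nu) by positivity)]
    refine this.trans ?_
    calc _ <= |C0| * (i.1.1.1.E * i.1.1.1.ind i.1.2.1 * (i.1.1.1.b * i.1.1.1.nu)) := mleR (le_abs_self _) (by positivity)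
      _ <= _ := mleL (mleR (mul_le_of_le_one_right (by positivity) h2) (by positivity)) (abs_nonneg _)
  have hr : Cl Z.cm 0 M (fun i => Z.jd i.1.1) (fun i => Z.rh i.1.1 j l) :=
    Dat.congr' (F := fun i : Z.W.Ix => ((Z.jd i.1.1 : ℝ) : ℂ) • Z.rh i.1.1 j l) (((((Z.hy_mu hL hK M).rh_cl j l).down (by omega) le_rfl).smulc (jz Z)).trans (Ls.of 1 fun i => by
      rw [jz_norm, mul_one, one_mul, Real.norm_eq_abs, abs_of_nonneg (Z.jd0 _)])) fun i => (Z.rh_win i.1.1 j l).symm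
  have h := (jdDRe (Z := Z) hL M j l).sub (((hg.mul hg').smul 2).mul' hr (Ls.eq fun i => by ring))
  refine h.congr fun i => ⟨Z.W.win i.1.1, Z.W.win_open i.1.1, i.2, ?_⟩
  intro t ht x
  have e := Z.S.D_pb (Z.rho i.1.1 j l) i.1.1 t ht x
  unfold Zk
  have e' : (0 : ℂ) = DD i.1.1.1.u (Z.rh i.1.1 j l) (t, x) := e
  simp only [map_sub, Derivation.leibniz, smul_eq_mul, coe_sub, coe_mul, coe_add, coe_smul, <- e']
  ring
theorem Zk1 (hL : 2 <= L) (hK : 𝕂) (M : ℕ) (j l : Fin 3) :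
    Cl Z.cm 1 M (fun i => i.1.1.1.b * (sg i) ^ 2) (fun i => Z.Zk i.1.1 j l) := by
  have H := Z.hy_mu hL hK M
  have hdu0 := fun a k => (H.hdu a k).down (Nat.zero_le 1) le_rfl
  have h0 : Cl (Z.W.c0 fun k => k.1.mu) 0 M (fun i => i.1.1.b * (i.1.1.E ^ 2 * Z.jd i.1)) (fun i => Z.Zk i.1 j l) :=
    Cl.congr0 Cl.zero fun i x => (Z.Zk_ini (by linarith [BM0]) i.1 j l x).symm
  have h := Z.W.gron1 (F := fun k => Z.Zk k j l) (B := fun k => k.1.b * (k.1.E ^ 2 * Z.jd k)) hdu0 H.hmu (fun k => by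
    have := Z.jd0 k; have := k.1.hb; positivity) h0 (DZk hL hK M j l)
  have h1 : Cl Z.cm 1 M (fun i => i.1.1.1.b * (i.1.1.1.E ^ 2 * Z.jd i.1.1)) (fun i => Z.Zk i.1.1 j l) := Cl.build h (DZk hL hK M j l) hdu0
  refine h1.trans (Ls.of (C0 ^ 2) fun i => ?_)
  have h2 := Z.jd_ind (by linarith [BM0]) i.1.1 i.1.2.1 i.2
  have h3 := Z.jd0 i.1.1; have hb := i.1.1.1.hb
  rw [Real.norm_eq_abs, abs_of_nonneg (by positivity)]
  have := mleL h2 (show 0 <= i.1.1.1.b * i.1.1.1.E ^ 2 by positivity)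
  calc _ = i.1.1.1.b * i.1.1.1.E ^ 2 * Z.jd i.1.1 := by ring
    _ <= _ := this
    _ = _ := by simp only [sg]; ring
end Slots
end
section
def Dat.cc (mu : 𝔻 -> ℝ) : Ctx (𝔻 × Zt) := ⟨fun i => i.2, fun i => i.1.u, fun i => mu i.1, fun i => i.1.nu⟩
abbrev Dat.cL (L : ℕ) (η C0 K0 : ℝ) : Ctx (Dat L η C0 K0 × Zt) := Dat.cc Dat.lam
theorem Dat.mu_le_lam (d : 𝔻) : d.mu <= d.lam := mul_le_of_le_one_left d.lam0.le d.b1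
theorem Dat.toL {r m : ℕ} {A : 𝔻 × Zt -> ℝ} {F : 𝔻 × Zt -> Sm} (h : Cl (Dat.cc Dat.mu) r m A F) : Cl (Dat.cL L η C0 K0) r m A F :=
  h.chg rfl rfl (Ls.le (fun i => i.1.mu0.le) fun i => i.1.mu_le_lam) Ls.rfl'
def sh (k : 𝔻 × ℤ) (p : Fin 2) : 𝔻 × ℤ := (k.1, k.2 + (p.val : ℤ))
def nx (k : 𝔻 × ℤ) : 𝔻 × ℤ := (k.1, k.2 + 1)
theorem sh0 (k : 𝔻 × ℤ) : sh k 0 = k := by simp [sh]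
theorem sh1 (k : 𝔻 × ℤ) : sh k 1 = nx k := rfl
namespace Slots
variable (Z : Slots L η C0 K0)
def J (k : 𝔻 × ℤ) : Set ℝ := {t | k.2 - 1 / 10 < t / Z.T k.1 ∧ t / Z.T k.1 < k.2 + 11 / 10}
theorem J_open (k : 𝔻 × ℤ) : IsOpen (Z.J k) := by
  exact (isOpen_Ioo (a := (k.2 : ℝ) - 1 / 10) (b := (k.2 : ℝ) + 11 / 10)).preimage (f := fun t : ℝ => t / Z.T k.1) (by fun_prop)
theorem J_win (k : 𝔻 × ℤ) (p : Fin 2) : Z.J k ⊆ Z.W.win (sh k p) := by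
  intro t ht
  change |t - ((k.2 + (p.val : ℤ) : ℤ) : ℝ) * Z.T k.1| < 2 * Z.T k.1
  have hT := Z.T0 k.1
  have h1 := ht.1; have h2 := ht.2
  rw [lt_div_iff₀ hT] at h1; rw [div_lt_iff₀ hT] at h2
  rw [abs_lt]; push_cast
  have : (p.val : ℝ) = 0 ∨ (p.val : ℝ) = 1 := by fin_cases p <;> simp
  rcases this with h | h <;> rw [h] <;> constructor <;> nlinarith
def sl (i : 𝔻 × Zt) : 𝔻 × ℤ := (i.1, ⌊i.2.1 / Z.T i.1⌋)
theorem sl_mem (i : 𝔻 × Zt) : i.2.1 ∈ Z.J (Z.sl i) := by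
  change _ ∧ _
  have h1 := Int.floor_le (i.2.1 / Z.T i.1); have h2 := Int.lt_floor_add_one (i.2.1 / Z.T i.1)
  constructor <;> simp only [sl] <;> linarith
theorem pull {mu : 𝔻 -> ℝ} {r m : ℕ} (A : 𝔻 × Zt -> ℝ) (f : 𝔻 × ℤ -> Sm)
    (h : Cl (Z.W.c fun k => mu k.1) r m (fun i => A (i.1.1.1, i.1.2)) (fun i => f i.1.1)) (p : Fin 2) :
    Cl (Dat.cc mu) r m A (fun i => f (sh (Z.sl i) p)) :=
  h.comap (c' := Dat.cc mu) (fun i : 𝔻 × Zt => (⟨(sh (Z.sl i) p, i.2), Z.J_win _ p (Z.sl_mem i)⟩ : Z.W.Ix)) rfl rfl Ls.rfl' Ls.rfl'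
theorem J_adj (k k' : 𝔻 × ℤ) (hk : k'.1 = k.1) {t : ℝ} (h : t ∈ Z.J k) (h' : t ∈ Z.J k') : k' = k ∨ k' = nx k ∨ k = nx k' := by
  obtain ⟨d, s⟩ := k; obtain ⟨d', s'⟩ := k'
  obtain rfl : d' = d := hk
  have h1 := h.1; have h2 := h.2; have h3 := h'.1; have h4 := h'.2
  simp only at h1 h2 h3 h4
  have a : (s' : ℝ) < s + 2 := by linarith
  have b : (s : ℝ) < s' + 2 := by linarith
  have a' : s' < s + 2 := by exact_mod_cast a
  have b' : s < s' + 2 := by exact_mod_cast b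
  simp only [nx, Prod.mk.injEq, true_and]
  omega
def Cmp (f : 𝔻 × ℤ -> Sm) : Prop := ∀ k, EqS (Z.J k ∩ Z.J (nx k)) (f k) (f (nx k))
variable {Z}
theorem Cmp.eq {f : 𝔻 × ℤ -> Sm} (h : Z.Cmp f) {k k' : 𝔻 × ℤ} (hk : k'.1 = k.1) {t : ℝ} (ht : t ∈ Z.J k) (ht' : t ∈ Z.J k') (x : Spc) :
    f k' (t, x) = f k (t, x) := by
  rcases Z.J_adj k k' hk ht ht' with rfl | rfl | rfl
  . rfl
  . exact (h k t ⟨ht, ht'⟩ x).symm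
  . exact h k' t ⟨ht', ht⟩ x
variable (Z)
theorem gl_ex {f : 𝔻 × ℤ -> Sm} (h : Z.Cmp f) (d : 𝔻) : ∃ g : Sm, ∀ z, g z = f (Z.sl (d, z)) z :=
  ⟨⟨fun z => f (Z.sl (d, z)) z, by
    have key : ∀ z0 : Zt, (fun z : Zt => f (Z.sl (d, z)) z) =ᶠ[nhds z0] f (Z.sl (d, z0)) := fun z0 => by
      have hm : (Prod.fst ⁻¹' Z.J (Z.sl (d, z0)) : Set Zt) ∈ nhds z0 := ((Z.J_open _).preimage continuous_fst).mem_nhds (Z.sl_mem (d, z0))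
      filter_upwards [hm] with z hz
      exact h.eq (k := Z.sl (d, z0)) (k' := Z.sl (d, z)) rfl hz (Z.sl_mem (d, z)) z.2
    exact contDiff_iff_contDiffAt.2 fun z0 => ((f (Z.sl (d, z0))).smooth.contDiffAt).congr_of_eventuallyEq (key z0),
    fun t x n => (f (Z.sl (d, (t, x)))).per t x n⟩, fun _ => rfl⟩
open Classical in
def gl (f : 𝔻 × ℤ -> Sm) (d : 𝔻) : Sm := if h : Z.Cmp f then Classical.choose (Z.gl_ex h d) else 0
variable {Z}
theorem Cmp.gl {f : 𝔻 × ℤ -> Sm} (h : Z.Cmp f) (k : 𝔻 × ℤ) : EqS (Z.J k) (Z.gl f k.1) (f k) := by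
  intro t ht x
  unfold Slots.gl; rw [dif_pos h, Classical.choose_spec (Z.gl_ex h k.1)]
  exact h.eq (k := k) (k' := Z.sl (k.1, (t, x))) rfl ht (Z.sl_mem (k.1, (t, x))) x
/-- vanishing of a slot function on overlaps -/
def Van (Z : Slots L η C0 K0) (f : 𝔻 × ℤ -> Sm) : Prop := ∀ k, EqS (Z.J k ∩ Z.J (nx k)) (f k) 0 ∧ EqS (Z.J k ∩ Z.J (nx k)) (f (nx (nx k))) 0
theorem Van.cmp {f : 𝔻 × ℤ -> Sm} (h : Z.Van f) : Z.Cmp (fun k => ∑ p, f (sh k p)) := by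
  intro k t ht x
  simp only [Fin.sum_univ_two, sh0, sh1, coe_add, (h k).1 t ht x, (h k).2 t ht x, coe_zero, zero_add, add_zero]
theorem van2_cmp {f : 𝔻 × ℤ -> 𝔻 × ℤ -> Sm} (h1 : ∀ k', Z.Van (fun k => f k k')) (h2 : ∀ k, Z.Van (fun k' => f k k')) :
    Z.Cmp (fun k => ∑ p, ∑ p', f (sh k p) (sh k p')) := by
  intro k t ht x
  simp only [Fin.sum_univ_two, sh0, sh1, coe_add, (h1 _ k).1 t ht x, (h1 _ k).2 t ht x, (h2 _ k).1 t ht x, (h2 _ k).2 t ht x, coe_zero, zero_add, add_zero]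
theorem Van.of {f : 𝔻 × ℤ -> Sm} (h : ∀ k S, IsOpen S -> EqS S (Z.ch k) 0 -> EqS S (f k) 0) : Z.Van f := by
  intro k
  have ho := (Z.J_open k).inter (Z.J_open (nx k))
  constructor
  . refine h k _ ho fun t ht x => ?_
    change ((chi (t / Z.T k.1 - k.2) : ℝ) : ℂ) = 0
    have h1 := ht.2.1
    simp only [nx] at h1; push_cast at h1
    rw [chi_zero (by rw [le_abs]; left; linarith)]; simp
  . refine h _ _ ho fun t ht x => ?_
    change ((chi (t / Z.T k.1 - ((k.2 + 1 + 1 : ℤ) : ℝ)) : ℝ) : ℂ) = 0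
    have h1 := ht.1.2
    rw [chi_zero (by rw [le_abs]; right; push_cast; linarith)]; simp
variable (Z)
theorem ee_cl (hL : 2 <= L) (hK : 𝕂) (M : ℕ) (p : Fin 2) (I : 𝕀) :
    Cl (Dat.cL L η C0 K0) 2 M (fun _ => 1) (fun i => Z.ee (sh (Z.sl i) p) I) := by
  refine Cl.expo (P := fun j i => (Complex.I * i.1.Lam : ℂ) • Z.qn (sh (Z.sl i) p) I j) (fun j => ?_) (fun j i => ?_) (fun i => ⟨_, Z.J_open (Z.sl i), Z.sl_mem i, (Z.D_ee (sh (Z.sl i) p) I).mono (Z.J_win _ p)⟩) (Ls.of 1 fun i => ?_)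
  . have := Dat.toL (Z.pull (fun _ => 1) (fun k => Z.qn k I j) ((Z.hy_mu hL hK M).qn_cl I j) p)
    refine (this.smulc fun i => (Complex.I * i.1.Lam : ℂ)).trans (Ls.of 16 fun i => ?_)
    have h := i.1.Lam0
    simp only [norm_mul, Complex.norm_I, Complex.norm_real, mul_one, one_mul, Real.norm_eq_abs, abs_abs]
    rw [abs_of_pos h]; exact i.1.Lam_le
  . rw [Z.dd_ee]; rw [smul_mul_assoc]; rfl
  . unfold ee; rw [ex_norm]; norm_num
end Slots
end
local notation "ℭ" => Dat.cL L η C0 K0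
section
namespace Sm
variable {S : Set ℝ}
theorem ez_mul {f : Sm} (h : EqS S f 0) (g : Sm) : EqS S (f * g) 0 := fun t ht x => by rw [coe_mul, h t ht x]; simp
theorem ez_mul' {f : Sm} (h : EqS S f 0) (g : Sm) : EqS S (g * f) 0 := by rw [mul_comm]; exact ez_mul h g
theorem ez_smul {f : Sm} (h : EqS S f 0) (z : ℂ) : EqS S (z • f) 0 := fun t ht x => by rw [coe_smul, h t ht x]; simp
theorem ez_sub {f g : Sm} (h : EqS S f 0) (h' : EqS S g 0) : EqS S (f - g) 0 := fun t ht x => by rw [coe_sub, h t ht x, h' t ht x]; simp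
theorem ez_add {f g : Sm} (h : EqS S f 0) (h' : EqS S g 0) : EqS S (f + g) 0 := fun t ht x => by rw [coe_add, h t ht x, h' t ht x]; simp
theorem ez_sum {κ : Type} {s : Finset κ} {f : κ -> Sm} (h : ∀ a ∈ s, EqS S (f a) 0) : EqS S (∑ a ∈ s, f a) 0 := fun t ht x => by
  rw [coe_sum, coe_zero]; exact sum_eq_zero fun a ha => by rw [h a ha t ht x]; rfl
theorem ez_dd (hS : IsOpen S) {f : Sm} (h : EqS S f 0) (j : Fin 3) : EqS S (dd j f) 0 := by simpa using h.dd hS j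
theorem ez_crl (hS : IsOpen S) (Λ : ℝ) (q : Fin 3 -> Sm) {f : Fin 3 -> Sm} (h : ∀ l, EqS S (f l) 0) (l : Fin 3) : EqS S (crl Λ q f l) 0 := by
  unfold crl cr cu
  exact ez_add (ez_smul (ez_sub (ez_mul' (h _) _) (ez_mul' (h _) _)) _) (ez_sub (ez_dd hS (h _) _) (ez_dd hS (h _) _))
theorem low_q {q : Fin 3 -> Sm} (hq : ∀ j, Re (q j)) (n : Fin 3 -> ℤ) (hn : ∃ j, n j ≠ 0) (h : ∀ j z, ‖q j z - n j‖ <= 24 / 1000) (z : Zt) :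
    1 / 2 <= ((∑ j, q j * q j) z).re := by
  have e : ∀ j, ((q j * q j) z).re = (q j z).re ^ 2 := fun j => by
    rw [coe_mul, Complex.mul_re, (hq j).im z]; ring
  rw [coe_sum, Complex.re_sum]
  simp only [e]
  obtain ⟨j, hj⟩ := hn
  have h1 : (1 : ℝ) <= |(n j : ℝ)| := by exact_mod_cast Int.one_le_abs hj
  have h2 : |(q j z).re - n j| <= 24 / 1000 := by
    refine le_trans ?_ (h j z)
    have := Complex.abs_re_le_norm (q j z - n j)
    simpa using this
  have h3 : 976 / 1000 <= |(q j z).re| := by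
    have := abs_sub_abs_le_abs_sub (n j : ℝ) (q j z).re
    rw [abs_sub_comm] at this; linarith
  have h4 : (q j z).re ^ 2 <= ∑ j, (q j z).re ^ 2 := single_le_sum (f := fun j => (q j z).re ^ 2) (fun i _ => sq_nonneg _) (mem_univ j)
  rw [<- sq_abs] at h4; nlinarith
end Sm
namespace Slots
variable (Z : Slots L η C0 K0)
def sqq (q : Fin 3 -> Sm) : Sm := rsT (∑ j, q j * q j)
def Fl (k : 𝔻 × ℤ) (I : 𝕀) (l : Fin 3) : Sm := DD k.1.u (Z.vv k I l) + ∑ j, Z.vv k I j * dd j (k.1.u l)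
def N1 (M : ℕ) (k : 𝔻 × ℤ) (I : 𝕀) (j l : Fin 3) : Sm := Z.ee k I * parN k.1.Lam (Z.qn k I) (sqq (Z.qn k I)) M (Z.Fl k I) j l
def R1 (M : ℕ) (k : 𝔻 × ℤ) (I : 𝕀) (l : Fin 3) : Sm := Z.ee k I * parR k.1.Lam (Z.qn k I) (sqq (Z.qn k I)) M (Z.Fl k I) l
def q2 (k : 𝔻 × ℤ) (I : 𝕀) (k' : 𝔻 × ℤ) (I' : 𝕀) (j : Fin 3) : Sm := Z.qn k I j + Z.qn k' I' j
def F2 (k : 𝔻 × ℤ) (I : 𝕀) (k' : 𝔻 × ℤ) (I' : 𝕀) (l : Fin 3) : Sm := -cr (Z.vv k I) (Z.EE k' I') l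
def Msk (k : 𝔻 × ℤ) (I : 𝕀) (k' : 𝔻 × ℤ) (I' : 𝕀) : Prop := k.2 = k'.2 -> I' ≠ bar I
instance (k : 𝔻 × ℤ) (I : 𝕀) (k' : 𝔻 × ℤ) (I' : 𝕀) : Decidable (Msk k I k' I') := by unfold Msk; infer_instance
def N2 (M : ℕ) (k : 𝔻 × ℤ) (I : 𝕀) (k' : 𝔻 × ℤ) (I' : 𝕀) (j l : Fin 3) : Sm :=
  if Msk k I k' I' then Z.ee k I * Z.ee k' I' * parN k.1.Lam (Z.q2 k I k' I') (sqq (Z.q2 k I k' I')) M (Z.F2 k I k' I') j l else 0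
def R2 (M : ℕ) (k : 𝔻 × ℤ) (I : 𝕀) (k' : 𝔻 × ℤ) (I' : 𝕀) (l : Fin 3) : Sm :=
  if Msk k I k' I' then Z.ee k I * Z.ee k' I' * parR k.1.Lam (Z.q2 k I k' I') (sqq (Z.q2 k I k' I')) M (Z.F2 k I k' I') l else 0
theorem low1 (k : 𝔻 × ℤ) (I : 𝕀) (z : Zt) : 1 / 2 <= ((∑ j, Z.qn k I j * Z.qn k I j) z).re :=
  low_q (Z.qn_re k I) (dirS (pr k.2) I) (dirS_ne _ _) (fun j z => (Z.qn_near k I j z).trans (by norm_num)) z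
theorem q2_re (k : 𝔻 × ℤ) (I : 𝕀) (k' : 𝔻 × ℤ) (I' : 𝕀) (j : Fin 3) : Re (Z.q2 k I k' I' j) := (Z.qn_re k I j).add (Z.qn_re k' I' j)
theorem low2 {k : 𝔻 × ℤ} {I : 𝕀} {k' : 𝔻 × ℤ} {I' : 𝕀} (h : pr k.2 = pr k'.2 -> I' ≠ bar I) (z : Zt) :
    1 / 2 <= ((∑ j, Z.q2 k I k' I' j * Z.q2 k I k' I' j) z).re :=
  low_q (Z.q2_re k I k' I') (fun j => dirS (pr k.2) I j + dirS (pr k'.2) I' j) (dir_ne _ _ _ _ h) (fun j z => by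
    unfold q2
    have := norm_add_le_of_le (Z.qn_near k I j z) (Z.qn_near k' I' j z)
    push_cast; rw [coe_add]
    refine le_trans (le_of_eq ?_) (this.trans (by norm_num)); congr 1; ring) z
theorem sqq1 (k : 𝔻 × ℤ) (I : 𝕀) : sqq (Z.qn k I) * sqq (Z.qn k I) * ∑ j, Z.qn k I j * Z.qn k I j = 1 :=
  rsT_mul (Re.sum fun j _ => (Z.qn_re k I j).mul (Z.qn_re k I j)) (by norm_num) (Z.low1 k I)
theorem sqq2 {k : 𝔻 × ℤ} {I : 𝕀} {k' : 𝔻 × ℤ} {I' : 𝕀} (h : pr k.2 = pr k'.2 -> I' ≠ bar I) :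
    sqq (Z.q2 k I k' I') * sqq (Z.q2 k I k' I') * ∑ j, Z.q2 k I k' I' j * Z.q2 k I k' I' j = 1 :=
  rsT_mul (Re.sum fun j _ => (Z.q2_re k I k' I' j).mul (Z.q2_re k I k' I' j)) (by norm_num) (Z.low2 h)
theorem msk_pr (k : 𝔻 × ℤ) (p p' : Fin 2) {I I' : 𝕀} (h : Msk (sh k p) I (sh k p') I') : pr (sh k p).2 = pr (sh k p').2 -> I' ≠ bar I := by
  intro hp
  by_cases hpp : p = p'
  . subst hpp; exact h rfl
  . exfalso
    have h0 := pr_succ k.2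
    fin_cases p <;> fin_cases p' <;> simp [sh] at hp hpp
    . exact h0 hp.symm
    . exact h0 hp
theorem ee2_dd (k : 𝔻 × ℤ) (I : 𝕀) (k' : 𝔻 × ℤ) (I' : 𝕀) (hk : k'.1 = k.1) (j : Fin 3) :
    dd j (Z.ee k I * Z.ee k' I') = (Complex.I * k.1.Lam : ℂ) • (Z.q2 k I k' I' j * (Z.ee k I * Z.ee k' I')) := by
  rw [Derivation.leibniz, Z.dd_ee, Z.dd_ee, hk]; unfold q2
  simp only [smul_eq_mul, Algebra.smul_def]; ring
theorem N1_eq (M : ℕ) (k : 𝔻 × ℤ) (I : 𝕀) (l : Fin 3) : ∑ j, dd j (Z.N1 M k I j l) + Z.R1 M k I l = Z.ee k I * Z.Fl k I l :=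
  parN_eq k.1.Lam0.ne' (Z.sqq1 k I) (Z.dd_ee k I) M _ l
theorem N2_eq (M : ℕ) (k : 𝔻 × ℤ) (p p' : Fin 2) (I I' : 𝕀) (l : Fin 3) :
    ∑ j, dd j (Z.N2 M (sh k p) I (sh k p') I' j l) + Z.R2 M (sh k p) I (sh k p') I' l = if Msk (sh k p) I (sh k p') I' then Z.ee (sh k p) I * Z.ee (sh k p') I' * Z.F2 (sh k p) I (sh k p') I' l else 0 := by
  unfold N2 R2
  split_ifs with h
  . exact parN_eq (sh k p).1.Lam0.ne' (Z.sqq2 (msk_pr k p p' h)) (Z.ee2_dd _ I _ I' rfl) M _ l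
  . simp
-- vanishing
variable {Z} {k : Dat L η C0 K0 × ℤ} {S : Set ℝ}
theorem v_al (h : EqS S (Z.ch k) 0) (a : Fin 6) : EqS S (Z.al k a) 0 := ez_mul (ez_mul' h _) _
theorem v_om (h : EqS S (Z.ch k) 0) (I : 𝕀) (l : Fin 3) : EqS S (Z.om k I l) 0 := ez_smul (ez_mul (v_al h _) _) _
theorem v_vv (hS : IsOpen S) (h : EqS S (Z.ch k) 0) (I : 𝕀) (l : Fin 3) : EqS S (Z.vv k I l) 0 := ez_crl hS _ _ (v_om h I) l
theorem v_EE (hS : IsOpen S) (h : EqS S (Z.ch k) 0) (I : 𝕀) (l : Fin 3) : EqS S (Z.EE k I l) 0 := ez_sub (ez_crl hS _ _ (v_vv hS h I) l) (ez_smul (v_vv hS h I l) _)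
theorem v_Fl (hS : IsOpen S) (h : EqS S (Z.ch k) 0) (I : 𝕀) (l : Fin 3) : EqS S (Z.Fl k I l) 0 :=
  ez_add (by simpa using (v_vv hS h I l).DD hS k.1.u) (ez_sum fun j _ => ez_mul (v_vv hS h I j) _)
theorem ez_neg {f : Sm} (h : EqS S f 0) : EqS S (-f) 0 := fun t ht x => by rw [coe_neg, h t ht x]; simp
theorem van_W (l : Fin 3) : Z.Van fun k => ∑ I, Z.ee k I * Z.om k I l := Van.of fun _ _ _ h => ez_sum fun I _ => ez_mul' (v_om h I l) _
theorem van_Q (j l : Fin 3) : Z.Van fun k => ∑ I, Z.vv k I j * Z.vv k (bar I) l := Van.of fun _ _ hS h => ez_sum fun I _ => ez_mul (v_vv hS h I j) _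
theorem van_N1 (M : ℕ) (j l : Fin 3) : Z.Van fun k => ∑ I, Z.N1 M k I j l := Van.of fun _ _ hS h => ez_sum fun I _ => ez_mul' (parN_zero hS M (v_Fl hS h I) j l) _
theorem cmp_N2 (M : ℕ) (j l : Fin 3) : Z.Cmp fun k => ∑ p, ∑ p', ∑ I, ∑ I', Z.N2 M (sh k p) I (sh k p') I' j l := by
  refine van2_cmp (f := fun k k' => ∑ I, ∑ I', Z.N2 M k I k' I' j l) (fun k' => Van.of fun k S hS h => ?_) (fun k => Van.of fun k' S hS h => ?_)
  . refine ez_sum fun I _ => ez_sum fun I' _ => ?_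
    unfold N2; split_ifs
    . exact ez_mul' (parN_zero hS M (fun l => ez_neg (ez_sub (ez_mul (v_vv hS h I _) _) (ez_mul (v_vv hS h I _) _))) j l) _
    . exact EqS.refl _ _
  . refine ez_sum fun I _ => ez_sum fun I' _ => ?_
    unfold N2; split_ifs
    . exact ez_mul' (parN_zero hS M (fun l => ez_neg (ez_sub (ez_mul' (v_EE hS h I' _) _) (ez_mul' (v_EE hS h I' _) _))) j l) _
    . exact EqS.refl _ _
end Slots
end
section
namespace Sm
theorem vec_id (a b : Fin 3 -> Sm) (ha : ∑ j, dd j (a j) = 0) (hb : ∑ j, dd j (b j) = 0) (l : Fin 3) :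
    ∑ j, dd j (a j * b l + b j * a l) = dd l (∑ i, a i * b i) - cr a (cu b) l - cr b (cu a) l := by
  unfold cr cu
  simp only [Fin.sum_univ_three] at *
  simp only [Derivation.leibniz, smul_eq_mul, map_add]
  fin_cases l <;> simp only [Fin.isValue, Fin.zero_eta, Fin.mk_one, Fin.reduceFinMk, zero_add, show (1 : Fin 3) + 2 = 0 from rfl, show (1 : Fin 3) + 1 = 2 from rfl, show (2 : Fin 3) + 2 = 1 from rfl, show (2 : Fin 3) + 1 = 0 from rfl]
  . linear_combination (b 0) * ha + (a 0) * hb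
  . linear_combination (b 1) * ha + (a 1) * hb
  . linear_combination (b 2) * ha + (a 2) * hb
theorem half_two (f : Sm) : cst (1 / 2) * (f + f) = f := by
  rw [<- two_mul, <- mul_assoc, show (2 : Sm) = cst 2 from (map_ofNat _ 2).symm, <- map_mul]; norm_num
theorem sum3 {Φ : Type} [Fintype Φ] (f : Φ -> Φ -> Fin 3 -> Sm) : ∑ j, ∑ A, ∑ B, f A B j = ∑ A, ∑ B, ∑ j, f A B j := by
  rw [sum_comm]; refine sum_congr rfl fun A _ => ?_; rw [sum_comm]
theorem cu_sum {α : Type} (s : Finset α) (a : α -> Fin 3 -> Sm) (l : Fin 3) : cu (fun j => ∑ x ∈ s, a x j) l = ∑ x ∈ s, cu (a x) l := by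
  unfold cu; simp only [map_sum, sum_sub_distrib]
theorem slice_id {Φ : Type} [Fintype Φ] [DecidableEq Φ] (br : Φ -> Φ) (hbr : ∀ A, br (br A) = A) (z : ℂ) (u : Fin 3 -> Sm) (hu : ∑ j, dd j (u j) = 0)
    (e : Φ -> Sm) (v E : Φ -> Fin 3 -> Sm) (hdiv : ∀ A, ∑ l, dd l (e A * v A l) = 0)
    (hcu : ∀ A l, cu (fun l => e A * v A l) l = e A * (E A l + z • v A l)) (hee : ∀ A, e A * e (br A) = 1) (l : Fin 3)
    (V : Fin 3 -> Sm) (hV : ∀ l, V l = ∑ A, e A * v A l) (Q : Fin 3 -> Fin 3 -> Sm) (hQ : ∀ j l, Q j l = ∑ A, v A j * v (br A) l) :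
    dt (V l) + ∑ j, dd j (u j * V l + V j * u l + V j * V l) - cst (1 / 2) * dd l (∑ i, V i * V i - ∑ i, Q i i)
    = ∑ A, e A * (DD u (v A l) + ∑ j, v A j * dd j (u l)) + ∑ A, v A l * DD u (e A)
      + ∑ A, ∑ B, (if B ≠ br A then e A * e B * (-cr (v A) (E B) l) else 0) + ∑ j, dd j (Q j l) := by
  obtain rfl : V = fun l => ∑ A, e A * v A l := funext hV
  obtain rfl : Q = fun j l => ∑ A, v A j * v (br A) l := funext fun j => funext fun l => hQ j l
  have bri : Function.Involutive br := hbr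
  have dV : ∑ j, dd j (∑ A, e A * v A j) = 0 := by
    simp only [map_sum]; rw [sum_comm]; exact sum_eq_zero fun A _ => hdiv A
  -- transport
  have h1 : dt (∑ A, e A * v A l) + ∑ j, dd j (u j * (∑ A, e A * v A l) + (∑ A, e A * v A j) * u l)
      = ∑ A, e A * (DD u (v A l) + ∑ j, v A j * dd j (u l)) + ∑ A, v A l * DD u (e A) := by
    have a : dt (∑ A, e A * v A l) + ∑ j, dd j (u j * (∑ A, e A * v A l) + (∑ A, e A * v A j) * u l)
        = DD u (∑ A, e A * v A l) + ∑ j, (∑ A, e A * v A j) * dd j (u l) := by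
      rw [DD_apply]
      simp only [Fin.sum_univ_three] at *
      simp only [Derivation.leibniz (dd _) (u _) (∑ A, e A * v A _), Derivation.leibniz (dd _) (∑ A, e A * v A _) (u _), map_add, smul_eq_mul] 
      linear_combination (∑ A, e A * v A l) * hu + (u l) * dV
    rw [a, map_sum]
    simp only [Derivation.leibniz, smul_eq_mul, sum_mul]
    rw [sum_comm, <- sum_add_distrib, <- sum_add_distrib]
    refine sum_congr rfl fun A _ => ?_
    simp only [mul_sum, mul_add, mul_assoc]; ring
  -- quadratic
  have key : ∀ A B : Φ, ∑ j, dd j ((e A * v A j) * (e B * v B l) + (e B * v B j) * (e A * v A l)) = dd l (∑ i, (e A * v A i) * (e B * v B i))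
      - e A * e B * cr (v A) (E B) l - e A * e B * cr (v B) (E A) l := by
    intro A B
    rw [vec_id (fun l => e A * v A l) (fun l => e B * v B l) (hdiv A) (hdiv B) l]
    rw [show cu (fun l => e A * v A l) = fun l => e A * (E A l + z • v A l) from funext (hcu A), show cu (fun l => e B * v B l) = fun l => e B * (E B l + z • v B l) from funext (hcu B)]
    unfold cr; simp only [Algebra.smul_def]; ring
  have h2 : (∑ j, dd j ((∑ A, e A * v A j) * (∑ A, e A * v A l))) + (∑ j, dd j ((∑ A, e A * v A j) * (∑ A, e A * v A l)))
      = dd l (∑ i, (∑ A, e A * v A i) * (∑ A, e A * v A i)) - (∑ A, ∑ B, e A * e B * cr (v A) (E B) l) - (∑ A, ∑ B, e A * e B * cr (v A) (E B) l) := by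
    have := sum_congr (rfl : (Finset.univ : Finset Φ) = _) fun A _ => sum_congr (rfl : (Finset.univ : Finset Φ) = _) fun B _ => key A B
    simp only [sum_sub_distrib] at this
    rw [sum_comm (f := fun A B => e A * e B * cr (v B) (E A) l)] at this
    have e1 : ∀ A B, e A * e B * cr (v B) (E A) l = e B * e A * cr (v B) (E A) l := fun A B => by ring
    simp only [e1] at this
    refine Eq.trans ?_ (this.trans ?_)
    . simp only [sum_mul_sum, map_sum, map_add, sum_add_distrib]
      congr 1
      . exact sum3 fun A B j => dd j (e A * v A j * (e B * v B l))
      . rw [sum3 fun A B j => dd j (e A * v A j * (e B * v B l))]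
        exact sum_comm (f := fun A B => ∑ j, dd j (e A * v A j * (e B * v B l)))
    . congr 2
      simp only [sum_mul_sum, map_sum]
      exact (sum3 fun A B i => dd l (e A * v A i * (e B * v B i))).symm
  have cyc : ∀ (f : Φ -> Sm), ∑ A, f (br A) = ∑ A, f A := fun f => Equiv.sum_comp bri.toPerm f
  have h3 : (∑ j, dd j (∑ A, v A j * v (br A) l)) + (∑ j, dd j (∑ A, v A j * v (br A) l)) = dd l (∑ i, ∑ A, v A i * v (br A) i)
      - (∑ A, cr (v A) (E (br A)) l) - (∑ A, cr (v A) (E (br A)) l) := by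
    have := sum_congr (rfl : (Finset.univ : Finset Φ) = _) fun A _ => key A (br A)
    have r1 : ∀ A (x y : Sm), e A * x * (e (br A) * y) = x * y := fun A x y => by linear_combination (x * y) * hee A
    have r2 : ∀ A (x y : Sm), e (br A) * x * (e A * y) = x * y := fun A x y => by linear_combination (x * y) * hee A
    simp only [sum_sub_distrib, hee, r1, r2, one_mul] at this
    have c1 := cyc fun A => cr (v A) (E (br A)) l
    simp only [hbr] at c1
    rw [c1] at this
    refine Eq.trans ?_ (this.trans ?_)
    . simp only [map_add, sum_add_distrib, map_sum]
      congr 1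
      . rw [sum_comm]
      . rw [sum_comm]
        have := cyc fun A => ∑ j, dd j (v A j * v (br A) l)
        simp only [hbr] at this
        rw [this]
    . congr 2
      simp only [map_sum]; rw [sum_comm]
  have h4 : ∑ A, ∑ B, (if B ≠ br A then e A * e B * (-cr (v A) (E B) l) else 0) = (∑ A, cr (v A) (E (br A)) l) - ∑ A, ∑ B, e A * e B * cr (v A) (E B) l := by
    rw [<- sum_sub_distrib]
    refine sum_congr rfl fun A _ => ?_
    have : ∀ B, (if B ≠ br A then e A * e B * (-cr (v A) (E B) l) else 0) = (if B = br A then e A * e B * cr (v A) (E B) l else 0) - e A * e B * cr (v A) (E B) l := fun B => by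
      by_cases h : B = br A <;> simp [h]
    simp only [this, sum_sub_distrib, Finset.sum_ite_eq', mem_univ, if_true, hee, one_mul]
  rw [h4, <- h1]
  have h2' := half_two (∑ j, dd j ((∑ A, e A * v A j) * (∑ A, e A * v A l)))
  have h3' := half_two (∑ j, dd j (∑ A, v A j * v (br A) l))
  have h5 := half_two (∑ A, ∑ B, e A * e B * cr (v A) (E B) l)
  have h6 := half_two (∑ A, cr (v A) (E (br A)) l)
  simp only [map_add, sum_add_distrib] at *
  rw [h2] at h2'; rw [h3] at h3'
  rw [map_sub]
  linear_combination -h2' + h3' - h5 + h6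
end Sm
end
section
namespace Sm
variable {S : Set ℝ}
theorem es_sum {κ : Type} {s : Finset κ} {f g : κ -> Sm} (h : ∀ a ∈ s, EqS S (f a) (g a)) : EqS S (∑ a ∈ s, f a) (∑ a ∈ s, g a) := fun t ht x => by
  rw [coe_sum, coe_sum]; exact sum_congr rfl fun a ha => h a ha t ht x
theorem es_sub {f f' g g' : Sm} (h : EqS S f f') (h' : EqS S g g') : EqS S (f - g) (f' - g') := fun t ht x => by
  rw [coe_sub, coe_sub, h t ht x, h' t ht x]
theorem es_cu (hS : IsOpen S) {f g : Fin 3 -> Sm} (h : ∀ l, EqS S (f l) (g l)) (l : Fin 3) : EqS S (cu f l) (cu g l) := by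
  unfold cu; exact es_sub ((h _).dd hS _) ((h _).dd hS _)
def remx (u V : Fin 3 -> Sm) (Q N : Fin 3 -> Fin 3 -> Sm) (l : Fin 3) : Sm :=
  dt (V l) + ∑ j, dd j (u j * V l + V j * u l + V j * V l) - cst (1 / 2) * dd l (∑ i, V i * V i - ∑ i, Q i i) - ∑ j, dd j (Q j l + N j l)
theorem remx_congr (hS : IsOpen S) (u : Fin 3 -> Sm) {V V' : Fin 3 -> Sm} {Q Q' N N' : Fin 3 -> Fin 3 -> Sm} (hV : ∀ l, EqS S (V l) (V' l))
    (hQ : ∀ j l, EqS S (Q j l) (Q' j l)) (hN : ∀ j l, EqS S (N j l) (N' j l)) (l : Fin 3) : EqS S (remx u V Q N l) (remx u V' Q' N' l) := by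
  unfold remx
  refine es_sub (es_sub (((hV l).dt hS).add (es_sum fun j _ => EqS.dd hS ((((EqS.refl _ _).mul (hV l)).add ((hV j).mul (EqS.refl _ _))).add ((hV j).mul (hV l))) j)) ((EqS.refl _ _).mul (EqS.dd hS ?_ l))) (es_sum fun j _ => ((hQ j l).add (hN j l)).dd hS j)
  exact es_sub (es_sum fun i _ => (hV i).mul (hV i)) (es_sum fun i _ => hQ i i)
end Sm
namespace Slots
variable (Z : Slots L η C0 K0)
def Ws (k : 𝔻 × ℤ) (l : Fin 3) : Sm := ∑ p, ∑ I, Z.ee (sh k p) I * Z.om (sh k p) I l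
def Vs (k : 𝔻 × ℤ) (l : Fin 3) : Sm := ∑ p, ∑ I, Z.ee (sh k p) I * Z.vv (sh k p) I l
def Qs (k : 𝔻 × ℤ) (j l : Fin 3) : Sm := ∑ p, ∑ I, Z.vv (sh k p) I j * Z.vv (sh k p) (bar I) l
def N1s (M : ℕ) (k : 𝔻 × ℤ) (j l : Fin 3) : Sm := ∑ p, ∑ I, Z.N1 M (sh k p) I j l
def N2s (M : ℕ) (k : 𝔻 × ℤ) (j l : Fin 3) : Sm := ∑ p, ∑ p', ∑ I, ∑ I', Z.N2 M (sh k p) I (sh k p') I' j l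
def Rs (M : ℕ) (k : 𝔻 × ℤ) (l : Fin 3) : Sm := ∑ p, ∑ I, Z.R1 M (sh k p) I l + ∑ p, ∑ p', ∑ I, ∑ I', Z.R2 M (sh k p) I (sh k p') I' l
def Wg (d : 𝔻) (l : Fin 3) : Sm := Z.gl (fun k => Z.Ws k l) d
def Vg (d : 𝔻) (l : Fin 3) : Sm := cu (Z.Wg d) l
def Qg (d : 𝔻) (j l : Fin 3) : Sm := Z.gl (fun k => Z.Qs k j l) d
def Ng (M : ℕ) (d : 𝔻) (j l : Fin 3) : Sm := Z.gl (fun k => Z.N1s M k j l) d + Z.gl (fun k => Z.N2s M k j l) d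
def rem (M : ℕ) (d : 𝔻) (l : Fin 3) : Sm := remx d.u (Z.Vg d) (Z.Qg d) (Z.Ng M d) l
def Pl (d : 𝔻) : Sm := cst (-(1 / 3)) * (gg d * gg d + ∑ i, d.Re' i i)
def Pg (d : 𝔻) : Sm := Pl d - cst (1 / 2) * (∑ i, Z.Vg d i * Z.Vg d i - ∑ i, Z.Qg d i i)
def T2 (M : ℕ) (d : 𝔻) (j l : Fin 3) : Sm := Z.Qg d j l + d.Re' j l + (if j = l then Pl d else 0) + Z.Ng M d j l
theorem W_J (k : 𝔻 × ℤ) (l : Fin 3) : EqS (Z.J k) (Z.Wg k.1 l) (Z.Ws k l) := (van_W (Z := Z) l).cmp.gl k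
theorem Q_J (k : 𝔻 × ℤ) (j l : Fin 3) : EqS (Z.J k) (Z.Qg k.1 j l) (Z.Qs k j l) := (van_Q (Z := Z) j l).cmp.gl k
theorem N_J (M : ℕ) (k : 𝔻 × ℤ) (j l : Fin 3) : EqS (Z.J k) (Z.Ng M k.1 j l) (Z.N1s M k j l + Z.N2s M k j l) :=
  ((van_N1 (Z := Z) M j l).cmp.gl k).add ((cmp_N2 (Z := Z) M j l).gl k)
theorem cu_ee (k : 𝔻 × ℤ) (I : 𝕀) (f : Fin 3 -> Sm) (l : Fin 3) : cu (fun l => Z.ee k I * f l) l = Z.ee k I * crl k.1.Lam (Z.qn k I) f l :=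
  cu_mul (Z.dd_ee k I) f l
theorem cu_Ws (k : 𝔻 × ℤ) (l : Fin 3) : cu (Z.Ws k) l = Z.Vs k l := by
  have : Z.Ws k = fun l => ∑ p, (fun l => ∑ I, (fun I l => Z.ee (sh k p) I * Z.om (sh k p) I l) I l) l := rfl
  rw [this, cu_sum]
  refine sum_congr rfl fun p _ => ?_
  rw [cu_sum]
  exact sum_congr rfl fun I _ => Z.cu_ee _ I _ l
theorem V_J (k : 𝔻 × ℤ) (l : Fin 3) : EqS (Z.J k) (Z.Vg k.1 l) (Z.Vs k l) := by
  rw [<- cu_Ws]; exact es_cu (Z.J_open k) (Z.W_J k) l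
theorem rem_J (M : ℕ) (k : 𝔻 × ℤ) (l : Fin 3) : EqS (Z.J k) (Z.rem M k.1 l) (Z.Rs M k l) := by
  refine (remx_congr (Z.J_open k) k.1.u (Z.V_J k) (Z.Q_J k) (Z.N_J M k) l).trans ?_
  have h := slice_id (Φ := Fin 2 × (𝕀)) (fun A => (A.1, bar A.2)) (fun A => by simp [bar_bar]) ((5 * k.1.Lam : ℝ) : ℂ) k.1.u k.1.divu
    (fun A => Z.ee (sh k A.1) A.2) (fun A => Z.vv (sh k A.1) A.2) (fun A => Z.EE (sh k A.1) A.2)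
    (fun A => by
      have : ∀ l, Z.ee (sh k A.1) A.2 * Z.vv (sh k A.1) A.2 l = cu (fun l => Z.ee (sh k A.1) A.2 * Z.om (sh k A.1) A.2 l) l := fun l => (Z.cu_ee _ _ _ l).symm
      simp only [this]; exact div_cu _)
    (fun A l => by rw [Z.cu_ee]; unfold EE; exact congrArg _ (sub_add_cancel _ _).symm) (fun A => Z.ee_mul_bar _ _) l (Z.Vs k) (fun l => by rw [Fintype.sum_prod_type]; rfl) (Z.Qs k) (fun j l => by rw [Fintype.sum_prod_type]; rfl)
  have h1 : ∑ A : Fin 2 × (𝕀), Z.ee (sh k A.1) A.2 * (DD k.1.u (Z.vv (sh k A.1) A.2 l) + ∑ j, Z.vv (sh k A.1) A.2 j * dd j (k.1.u l)) = ∑ j, dd j (Z.N1s M k j l) + ∑ p, ∑ I, Z.R1 M (sh k p) I l := by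
    rw [Fintype.sum_prod_type]
    unfold N1s; simp only [map_sum]
    rw [sum_comm (s := (Finset.univ : Finset (Fin 3))), <- sum_add_distrib]
    refine sum_congr rfl fun p _ => ?_
    rw [sum_comm (s := (Finset.univ : Finset (Fin 3))), <- sum_add_distrib]
    exact sum_congr rfl fun I _ => (Z.N1_eq M (sh k p) I l).symm
  have h2 : ∑ A : Fin 2 × (𝕀), ∑ B : Fin 2 × (𝕀), (if B ≠ (A.1, bar A.2) then Z.ee (sh k A.1) A.2 * Z.ee (sh k B.1) B.2 * (-cr (Z.vv (sh k A.1) A.2) (Z.EE (sh k B.1) B.2) l) else 0)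
      = ∑ j, dd j (Z.N2s M k j l) + ∑ p, ∑ p', ∑ I, ∑ I', Z.R2 M (sh k p) I (sh k p') I' l := by
    rw [Fintype.sum_prod_type]
    simp only [Fintype.sum_prod_type (f := fun B : Fin 2 × (𝕀) => ite _ _ _)]
    unfold N2s; simp only [map_sum]
    rw [sum_comm (s := (Finset.univ : Finset (Fin 3))), <- sum_add_distrib]
    refine sum_congr rfl fun p _ => ?_
    rw [sum_comm (s := (Finset.univ : Finset (Fin 3))), <- sum_add_distrib, sum_comm]
    refine sum_congr rfl fun p' _ => ?_
    rw [sum_comm (s := (Finset.univ : Finset (Fin 3))), <- sum_add_distrib]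
    refine sum_congr rfl fun I _ => ?_
    rw [sum_comm (s := (Finset.univ : Finset (Fin 3))), <- sum_add_distrib]
    refine sum_congr rfl fun I' _ => ?_
    rw [Z.N2_eq M k p p' I I' l]
    refine if_congr ?_ rfl rfl
    simp only [Msk, sh, ne_eq, Prod.mk.injEq, add_right_inj, Nat.cast_inj]
    constructor
    . intro h1 h2 h3; exact h1 ⟨(Fin.ext h2).symm, h3⟩
    . rintro h1 ⟨rfl, h3⟩; exact h1 rfl h3
  have h3 : EqS (Z.J k) (∑ A : Fin 2 × (𝕀), Z.vv (sh k A.1) A.2 l * DD k.1.u (Z.ee (sh k A.1) A.2)) 0 :=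
    ez_sum fun A _ => ez_mul' (((Z.D_ee (sh k A.1) A.2).mono (Z.J_win k A.1)).symm) _
  refine EqS.trans (g := Z.Rs M k l + ∑ A : Fin 2 × (𝕀), Z.vv (sh k A.1) A.2 l * DD k.1.u (Z.ee (sh k A.1) A.2)) ?_ (by simpa using (EqS.refl _ (Z.Rs M k l)).add h3)
  have : remx k.1.u (Z.Vs k) (Z.Qs k) (fun j l => Z.N1s M k j l + Z.N2s M k j l) l = Z.Rs M k l + ∑ A : Fin 2 × (𝕀), Z.vv (sh k A.1) A.2 l * DD k.1.u (Z.ee (sh k A.1) A.2) := by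
    unfold remx Rs
    rw [h, h1, h2]
    simp only [map_add, sum_add_distrib]; ring
  rw [this]; exact EqS.refl _ _
theorem mom (M : ℕ) (d : 𝔻) (l : Fin 3) : dt (Z.Vg d l) + ∑ j, dd j (d.u j * Z.Vg d l + Z.Vg d j * d.u l + Z.Vg d j * Z.Vg d l + d.Re' j l) + dd l (Z.Pg d)
    = Z.rem M d l + ∑ j, dd j (Z.T2 M d j l) := by
  unfold rem remx T2 Pg
  have h : ∑ j, dd j (if j = l then Pl d else 0) = dd l (Pl d) := by
    rw [sum_eq_single l]
    . simp
    . intro b _ hb; rw [if_neg hb, map_zero]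
    . simp
  have c : dd l (cst (1 / 2)) = 0 := Derivation.map_algebraMap _ _
  rw [map_sub (dd l) (Pl d), Derivation.leibniz (dd l) (cst (1 / 2)), c]
  simp only [map_add, sum_add_distrib, h, smul_eq_mul, mul_zero, add_zero]; ring
theorem aV_rem (M : ℕ) (d : 𝔻) (l : Fin 3) : aV (Z.rem M d l) = 0 := by
  have : Z.rem M d l = dt (Z.Vg d l) + (∑ j, dd j (d.u j * Z.Vg d l + Z.Vg d j * d.u l + Z.Vg d j * Z.Vg d l + d.Re' j l - Z.T2 M d j l) + dd l (Z.Pg d)) := by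
    have h := Z.mom M d l
    simp only [map_sub, sum_sub_distrib]; linear_combination -h
  rw [this, aV_add, aV_add, aV_sum, aV_dd, <- aV_dt]
  simp only [aV_dd, Finset.sum_const_zero, add_zero]
  unfold Vg cu; rw [aV_sub, aV_dd, aV_dd]; simp
end Slots
end
section
abbrev sD (i : 𝔻 × Zt) : ℝ := i.1.E * i.1.ind i.2.1
theorem sD0 (i : 𝔻 × Zt) : 0 <= sD i := mul_nonneg i.1.hE.le (i.1.ind0 _)
theorem sDE (i : 𝔻 × Zt) : sD i <= i.1.E := mul_le_of_le_one_right i.1.hE.le (i.1.ind1 _)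
theorem sD2 (i : 𝔻 × Zt) : sD i ^ 2 <= i.1.E ^ 2 * i.1.ind i.2.1 := by
  have h := i.1.ind0 i.2.1; have h1 := i.1.ind1 i.2.1; have := sq_nonneg i.1.E
  unfold sD; nlinarith [mul_nonneg this h]
abbrev Dat.cM (L : ℕ) (η C0 K0 : ℝ) : Ctx (Dat L η C0 K0 × Zt) := Dat.cc Dat.mu
namespace Slots
variable (Z : Slots L η C0 K0)
theorem pq (hL : 2 <= L) (hK : 𝕂) (p : Fin 2) (I : 𝕀) (j : Fin 3) (m : ℕ) : Cl (Dat.cM L η C0 K0) 2 m (fun _ => 1) (fun i => Z.qn (sh (Z.sl i) p) I j) :=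
  Z.pull (fun _ => 1) (fun k => Z.qn k I j) ((Z.hy_mu hL hK m).qn_cl I j) p
theorem pv (hL : 2 <= L) (hK : 𝕂) (p : Fin 2) (I : 𝕀) (j : Fin 3) (m : ℕ) : Cl (Dat.cM L η C0 K0) 2 m sD (fun i => Z.vv (sh (Z.sl i) p) I j) :=
  Z.pull sD (fun k => Z.vv k I j) (vv2 hL hK m I j) p
theorem pom (hL : 2 <= L) (hK : 𝕂) (p : Fin 2) (I : 𝕀) (j : Fin 3) (m : ℕ) : Cl (Dat.cM L η C0 K0) 2 m (fun i => sD i * i.1.lam⁻¹) (fun i => Z.om (sh (Z.sl i) p) I j) :=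
  Z.pull (fun i => sD i * i.1.lam⁻¹) (fun k => Z.om k I j) (om2 hL hK m I j) p
theorem pE (hL : 2 <= L) (hK : 𝕂) (p : Fin 2) (I : 𝕀) (j : Fin 3) (m : ℕ) : Cl (Dat.cM L η C0 K0) 2 m (fun i => i.1.mu * sD i) (fun i => Z.EE (sh (Z.sl i) p) I j) :=
  Z.pull (fun i => i.1.mu * sD i) (fun k => Z.EE k I j) (EE2 hL hK m I j) p
theorem pFl (hL : 2 <= L) (hK : 𝕂) (p : Fin 2) (I : 𝕀) (l : Fin 3) (m : ℕ) : Cl (Dat.cM L η C0 K0) 1 m (fun i => sD i * i.1.nu) (fun i => Z.Fl (sh (Z.sl i) p) I l) := by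
  refine (Cl.DD (Z.pv hL hK p I l m)).add (Cl.sum _ fun j _ => ?_)
  refine Cl.mul' (F := fun i => Z.vv (sh (Z.sl i) p) I j) (G := fun i => dd j (i.1.u l)) ((Z.pv hL hK p I j m).down (by norm_num) le_rfl) (Dat.du_cl1 hL j l m) (Ls.le (fun i => mul_nonneg (sD0 i) (mul_nonneg i.1.hb.le i.1.nu0.le)) fun i => mleL i.1.bnu_le (sD0 i))
theorem pF2 (hL : 2 <= L) (hK : 𝕂) (p p' : Fin 2) (I I' : 𝕀) (l : Fin 3) (m : ℕ) : Cl (Dat.cM L η C0 K0) 1 m (fun i => i.1.mu * sD i ^ 2) (fun i => Z.F2 (sh (Z.sl i) p) I (sh (Z.sl i) p') I' l) := by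
  have h : ∀ a b : Fin 3, Cl (Dat.cM L η C0 K0) 1 m (fun i => i.1.mu * sD i ^ 2) (fun i => Z.vv (sh (Z.sl i) p) I a * Z.EE (sh (Z.sl i) p') I' b) := fun a b =>
    Cl.mul' (F := fun i => Z.vv (sh (Z.sl i) p) I a) (G := fun i => Z.EE (sh (Z.sl i) p') I' b) ((Z.pv hL hK p I a m).down (by norm_num) le_rfl) ((Z.pE hL hK p' I' b m).down (by norm_num) le_rfl) (Ls.eq fun i => by ring)
  exact ((h _ _).sub (h _ _)).neg
theorem psq1 (hL : 2 <= L) (hK : 𝕂) (p : Fin 2) (I : 𝕀) (m : ℕ) : Cl (Dat.cM L η C0 K0) 1 m (fun _ => 1) (fun i => sqq (Z.qn (sh (Z.sl i) p) I)) :=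
  rsT_cl (F := fun i => ∑ j, Z.qn (sh (Z.sl i) p) I j * Z.qn (sh (Z.sl i) p) I j) (Cl.sum _ fun j _ => ((Z.pq hL hK p I j m).mul1 (Z.pq hL hK p I j m)).down (by norm_num) le_rfl) (fun i => Re.sum fun j _ => (Z.qn_re _ I j).mul (Z.qn_re _ I j)) (by norm_num : (0 : ℝ) < 1 / 2) (fun i z => Z.low1 _ I z)
theorem pq2 (hL : 2 <= L) (hK : 𝕂) (p p' : Fin 2) (I I' : 𝕀) (j : Fin 3) (m : ℕ) : Cl (Dat.cM L η C0 K0) 1 m (fun _ => 1) (fun i => Z.q2 (sh (Z.sl i) p) I (sh (Z.sl i) p') I' j) :=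
  ((Z.pq hL hK p I j m).add (Z.pq hL hK p' I' j m)).down (by norm_num) le_rfl
theorem psq2 (hL : 2 <= L) (hK : 𝕂) {p p' : Fin 2} {I I' : 𝕀} (h : ∀ k : 𝔻 × ℤ, Msk (sh k p) I (sh k p') I') (m : ℕ) : Cl (Dat.cM L η C0 K0) 1 m (fun _ => 1) (fun i => sqq (Z.q2 (sh (Z.sl i) p) I (sh (Z.sl i) p') I')) :=
  rsT_cl (F := fun i => ∑ j, Z.q2 (sh (Z.sl i) p) I (sh (Z.sl i) p') I' j * Z.q2 (sh (Z.sl i) p) I (sh (Z.sl i) p') I' j) (Cl.sum _ fun j _ => (Z.pq2 hL hK p p' I I' j m).mul1 (Z.pq2 hL hK p p' I I' j m)) (fun i => Re.sum fun j _ => (Z.q2_re _ I _ I' j).mul (Z.q2_re _ I _ I' j)) (by norm_num : (0 : ℝ) < 1 / 2) (fun i z => Z.low2 (msk_pr _ p p' (h _)) z)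
theorem msk_iff (k : 𝔻 × ℤ) (p p' : Fin 2) (I I' : 𝕀) : Msk (sh k p) I (sh k p') I' ↔ (p = p' -> I' ≠ bar I) := by
  simp only [Msk, sh, add_right_inj, Nat.cast_inj]
  exact ⟨fun h h' => h (by rw [h']), fun h h' => h (Fin.ext h')⟩
theorem mL : Ls (fun i : 𝔻 × Zt => i.1.mu * (i.1.Lam)⁻¹) (fun _ => 1) := Ls.le (fun i => mul_nonneg i.1.mu0.le (inv_nonneg.2 i.1.Lam0.le)) fun i => by
  rw [mul_comm]; exact (Lam_mu i.1).trans i.1.b1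
theorem mb (M : ℕ) (d : 𝔻) : (d.mu * d.Lam⁻¹) ^ M <= d.b ^ M := pow_le_pow_left₀ (mul_nonneg d.mu0.le (inv_nonneg.2 d.Lam0.le)) (by rw [mul_comm]; exact Lam_mu d) _
theorem nuL (i : 𝔻 × Zt) : sD i * i.1.nu * i.1.Lam⁻¹ <= i.1.b * (sD i * i.1.E) := by
  have h := Lam_mu i.1; have h0 := mul_nonneg (sD0 i) i.1.hE.le
  have : i.1.nu = i.1.mu * i.1.E := rfl
  rw [this]; nlinarith
theorem iL (i : 𝔻 × Zt) : 0 <= i.1.Lam⁻¹ := inv_nonneg.2 i.1.Lam0.le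
theorem pN1 (hL : 2 <= L) (hK : 𝕂) (M : ℕ) (p : Fin 2) (I : 𝕀) (j l : Fin 3) (m : ℕ) : Cl ℭ 1 m (fun i => i.1.b * (i.1.E ^ 2 * i.1.ind i.2.1)) (fun i => Z.N1 M (sh (Z.sl i) p) I j l) := by
  refine Cl.mul1 (F := fun i => Z.ee (sh (Z.sl i) p) I) ((Z.ee_cl hL hK m p I).down (by norm_num) le_rfl) (Dat.toL ?_)
  have := parN_cl (c := Dat.cM L η C0 K0) (Λ := fun i => i.1.Lam) (q := fun j i => Z.qn (sh (Z.sl i) p) I j) (H := fun i => sqq (Z.qn (sh (Z.sl i) p) I)) (F := fun l i => Z.Fl (sh (Z.sl i) p) I l)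
    (fun j m => (Z.pq hL hK p I j m).down (by norm_num) le_rfl) (Z.psq1 hL hK p I) mL (fun l m => Z.pFl hL hK p I l m) M m j l
  exact this.trans (Ls.le (fun i => mul_nonneg (mul_nonneg (sD0 i) i.1.nu0.le) (iL i)) fun i => (nuL i).trans (le_of_eq (by unfold sD; ring)))
theorem pR1 (hL : 2 <= L) (hK : 𝕂) (M : ℕ) (p : Fin 2) (I : 𝕀) (l : Fin 3) (m : ℕ) : Cl ℭ 1 m (fun i => sD i * i.1.nu * i.1.b ^ M) (fun i => Z.R1 M (sh (Z.sl i) p) I l) := by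
  refine Cl.mul1 (F := fun i => Z.ee (sh (Z.sl i) p) I) ((Z.ee_cl hL hK m p I).down (by norm_num) le_rfl) (Dat.toL ?_)
  have := parR_cl (c := Dat.cM L η C0 K0) (Λ := fun i => i.1.Lam) (q := fun j i => Z.qn (sh (Z.sl i) p) I j) (H := fun i => sqq (Z.qn (sh (Z.sl i) p) I)) (F := fun l i => Z.Fl (sh (Z.sl i) p) I l)
    (fun j m => (Z.pq hL hK p I j m).down (by norm_num) le_rfl) (Z.psq1 hL hK p I) (fun l m => Z.pFl hL hK p I l m) M m l
  exact this.trans (Ls.le (fun i => mul_nonneg (mul_nonneg (sD0 i) i.1.nu0.le) (pow_nonneg (mul_nonneg i.1.mu0.le (iL i)) _)) fun i => mleL (mb M i.1) (mul_nonneg (sD0 i) i.1.nu0.le))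
theorem pee2 (hL : 2 <= L) (hK : 𝕂) (p p' : Fin 2) (I I' : 𝕀) (m : ℕ) : Cl ℭ 1 m (fun _ => 1) (fun i => Z.ee (sh (Z.sl i) p) I * Z.ee (sh (Z.sl i) p') I') :=
  ((Z.ee_cl hL hK m p I).mul1 (Z.ee_cl hL hK m p' I')).down (by norm_num) le_rfl
theorem pN2 (hL : 2 <= L) (hK : 𝕂) (M : ℕ) (p p' : Fin 2) (I I' : 𝕀) (j l : Fin 3) (m : ℕ) : Cl ℭ 1 m (fun i => i.1.b * (i.1.E ^ 2 * i.1.ind i.2.1)) (fun i => Z.N2 M (sh (Z.sl i) p) I (sh (Z.sl i) p') I' j l) := by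
  unfold N2
  by_cases h : p = p' -> I' ≠ bar I
  . have h' := fun k : 𝔻 × ℤ => (msk_iff k p p' I I').2 h
    simp only [h', if_true]
    refine Cl.mul1 (Z.pee2 hL hK p p' I I' m) (Dat.toL ?_)
    have := parN_cl (c := Dat.cM L η C0 K0) (Λ := fun i => i.1.Lam) (q := fun j i => Z.q2 (sh (Z.sl i) p) I (sh (Z.sl i) p') I' j) (H := fun i => sqq (Z.q2 (sh (Z.sl i) p) I (sh (Z.sl i) p') I')) (F := fun l i => Z.F2 (sh (Z.sl i) p) I (sh (Z.sl i) p') I' l)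
      (Z.pq2 hL hK p p' I I') (Z.psq2 hL hK h') mL (fun l m => Z.pF2 hL hK p p' I I' l m) M m j l
    refine this.trans (Ls.le (fun i => mul_nonneg (mul_nonneg i.1.mu0.le (sq_nonneg _)) (iL i)) fun i => ?_)
    have h1 := Lam_mu i.1; have h2 := sD2 i; have h3 := i.1.hb
    calc _ = i.1.Lam⁻¹ * i.1.mu * sD i ^ 2 := by ring
      _ <= _ := mul_le_mul h1 h2 (sq_nonneg _) h3.le
  . have h' := fun k : 𝔻 × ℤ => (msk_iff k p p' I I').not.2 h
    simp only [h', if_false]; exact Cl.zero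
theorem pR2 (hL : 2 <= L) (hK : 𝕂) (M : ℕ) (p p' : Fin 2) (I I' : 𝕀) (l : Fin 3) (m : ℕ) : Cl ℭ 1 m (fun i => sD i * i.1.nu * i.1.b ^ M) (fun i => Z.R2 M (sh (Z.sl i) p) I (sh (Z.sl i) p') I' l) := by
  unfold R2
  by_cases h : p = p' -> I' ≠ bar I
  . have h' := fun k : 𝔻 × ℤ => (msk_iff k p p' I I').2 h
    simp only [h', if_true]
    refine Cl.mul1 (Z.pee2 hL hK p p' I I' m) (Dat.toL ?_)
    have := parR_cl (c := Dat.cM L η C0 K0) (Λ := fun i => i.1.Lam) (q := fun j i => Z.q2 (sh (Z.sl i) p) I (sh (Z.sl i) p') I' j) (H := fun i => sqq (Z.q2 (sh (Z.sl i) p) I (sh (Z.sl i) p') I')) (F := fun l i => Z.F2 (sh (Z.sl i) p) I (sh (Z.sl i) p') I' l)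
      (Z.pq2 hL hK p p' I I') (Z.psq2 hL hK h') (fun l m => Z.pF2 hL hK p p' I I' l m) M m l
    refine this.trans (Ls.le (fun i => mul_nonneg (mul_nonneg i.1.mu0.le (sq_nonneg _)) (pow_nonneg (mul_nonneg i.1.mu0.le (iL i)) _)) fun i => ?_)
    refine mul_le_mul ?_ (mb M i.1) (pow_nonneg (mul_nonneg i.1.mu0.le (iL i)) _) (mul_nonneg (sD0 i) i.1.nu0.le)
    have h2 := mleL (sDE i) (mul_nonneg i.1.mu0.le (sD0 i))
    calc _ = i.1.mu * sD i * sD i := by ring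
      _ <= _ := h2
      _ = _ := by rw [show i.1.nu = i.1.mu * i.1.E from rfl]; ring
  . have h' := fun k : 𝔻 × ℤ => (msk_iff k p p' I I').not.2 h
    simp only [h', if_false]; exact Cl.zero
theorem rem_cl (hL : 2 <= L) (hK : 𝕂) (M : ℕ) (l : Fin 3) (m : ℕ) : Cl ℭ 1 m (fun i => sD i * i.1.nu * i.1.b ^ M) (fun i => Z.rem M i.1 l) := by
  refine Cl.congr (F := fun i => Z.Rs M (Z.sl i) l) ?_ fun i => ⟨_, Z.J_open (Z.sl i), Z.sl_mem i, (Z.rem_J M (Z.sl i) l).symm⟩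
  exact (Cl.sum _ fun p _ => Cl.sum _ fun I _ => Z.pR1 hL hK M p I l m).add (Cl.sum _ fun p _ => Cl.sum _ fun p' _ => Cl.sum _ fun I _ => Cl.sum _ fun I' _ => Z.pR2 hL hK M p p' I I' l m)
theorem W_cl (hL : 2 <= L) (hK : 𝕂) (l : Fin 3) (m : ℕ) : Cl ℭ 2 m (fun i => sD i * i.1.lam⁻¹) (fun i => Z.Wg i.1 l) :=
  Cl.congr (F := fun i => Z.Ws (Z.sl i) l) (Cl.sum _ fun p _ => Cl.sum _ fun I _ => Cl.mul1 (Z.ee_cl hL hK m p I) (Dat.toL (Z.pom hL hK p I l m))) fun i => ⟨_, Z.J_open (Z.sl i), Z.sl_mem i, (Z.W_J (Z.sl i) l).symm⟩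
theorem V_cl (hL : 2 <= L) (hK : 𝕂) (l : Fin 3) (m : ℕ) : Cl ℭ 2 m sD (fun i => Z.Vg i.1 l) :=
  Cl.congr (F := fun i => Z.Vs (Z.sl i) l) (Cl.sum _ fun p _ => Cl.sum _ fun I _ => Cl.mul1 (Z.ee_cl hL hK m p I) (Dat.toL (Z.pv hL hK p I l m))) fun i => ⟨_, Z.J_open (Z.sl i), Z.sl_mem i, (Z.V_J (Z.sl i) l).symm⟩
theorem Q_cl (hL : 2 <= L) (hK : 𝕂) (j l : Fin 3) (m : ℕ) : Cl (Dat.cM L η C0 K0) 2 m (fun i => sD i ^ 2) (fun i => Z.Qg i.1 j l) :=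
  Cl.congr (F := fun i => Z.Qs (Z.sl i) j l) (Cl.sum _ fun p _ => Cl.sum _ fun I _ => Cl.mul' (Z.pv hL hK p I j m) (Z.pv hL hK p (bar I) l m) (Ls.eq fun i => by ring)) fun i => ⟨_, Z.J_open (Z.sl i), Z.sl_mem i, (Z.Q_J (Z.sl i) j l).symm⟩
theorem N_cl (hL : 2 <= L) (hK : 𝕂) (M : ℕ) (j l : Fin 3) (m : ℕ) : Cl ℭ 1 m (fun i => i.1.b * (i.1.E ^ 2 * i.1.ind i.2.1)) (fun i => Z.Ng M i.1 j l) := by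
  refine Cl.congr (F := fun i => Z.N1s M (Z.sl i) j l + Z.N2s M (Z.sl i) j l) ?_ fun i => ⟨_, Z.J_open (Z.sl i), Z.sl_mem i, (Z.N_J M (Z.sl i) j l).symm⟩
  exact (Cl.sum _ fun p _ => Cl.sum _ fun I _ => Z.pN1 hL hK M p I j l m).add (Cl.sum _ fun p _ => Cl.sum _ fun p' _ => Cl.sum _ fun I _ => Cl.sum _ fun I' _ => Z.pN2 hL hK M p p' I I' j l m)
end Slots
end
local notation "𝔐" => Dat.cM L η C0 K0
section
namespace Slots
variable (Z : Slots L η C0 K0)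
def lowS (k : 𝔻 × ℤ) (j l : Fin 3) : Sm := ∑ p, ((∑ I, Z.vv (sh k p) I j * Z.vv (sh k p) (bar I) l) - Z.Ld (sh k p) j l) + ∑ p, Z.ch (sh k p) * Z.ch (sh k p) * Z.Zk (sh k p) j l
theorem ch_sq (k : 𝔻 × ℤ) {t : ℝ} (ht : t ∈ Z.J k) (x : Spc) : Z.ch k (t, x) * Z.ch k (t, x) + Z.ch (nx k) (t, x) * Z.ch (nx k) (t, x) = 1 := by
  obtain ⟨h1, h2⟩ := ht
  have h := chi_sq (x := t / Z.T k.1 - k.2) (by linarith) (by linarith)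
  unfold ch nx
  simp only [tf_apply]
  push_cast
  rw [<- sub_sub, <- sq, <- sq]
  exact_mod_cast h
theorem low_J (k : 𝔻 × ℤ) (j l : Fin 3) : EqS (Z.J k) (Z.Qg k.1 j l + k.1.Re' j l + (if j = l then Pl k.1 else 0)) (Z.lowS k j l) := by
  refine EqS.trans (((Z.Q_J k j l).add (EqS.refl _ _)).add (EqS.refl _ _)) ?_
  intro t ht x
  have h := Z.ch_sq k ht x
  unfold lowS Qs Ld Zk Dat.Rd Pl
  simp only [Fin.sum_univ_two, sh0, sh1, show (nx k).1 = k.1 from rfl, coe_add, coe_sub, coe_mul, coe_algebraMap]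
  split_ifs <;> simp only [Fin.sum_univ_three, coe_mul, coe_add, coe_algebraMap, coe_zero]
  . linear_combination (((gg k.1) (t, x)) ^ 2 / 3 - (k.1.Re' j l) (t, x) + 1 / 3 * ((k.1.Re' 0 0) (t, x) + (k.1.Re' 1 1) (t, x) + (k.1.Re' 2 2) (t, x))) * h
  . linear_combination (- (k.1.Re' j l) (t, x)) * h
theorem bs2 : Ls (fun i : 𝔻 × Zt => i.1.b * sD i ^ 2) (fun i => i.1.b * (i.1.E ^ 2 * i.1.ind i.2.1)) :=
  Ls.le (fun i => mul_nonneg i.1.hb.le (sq_nonneg _)) fun i => mleL (sD2 i) i.1.hb.le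
theorem low_cl (hL : 2 <= L) (hK : 𝕂) (j l : Fin 3) (m : ℕ) : Cl 𝔐 1 m (fun i => i.1.b * (i.1.E ^ 2 * i.1.ind i.2.1)) (fun i => Z.Qg i.1 j l + i.1.Re' j l + (if j = l then Pl i.1 else 0)) := by
  refine Cl.congr (F := fun i => Z.lowS (Z.sl i) j l) ?_ fun i => ⟨_, Z.J_open (Z.sl i), Z.sl_mem i, (Z.low_J (Z.sl i) j l).symm⟩
  refine Cl.trans (A := fun i => i.1.b * sD i ^ 2) ?_ bs2
  refine (Cl.sum _ fun p _ => ?_).add (Cl.sum _ fun p _ => ?_)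
  . exact (Z.pull (fun i => i.1.b * sD i ^ 2) (fun k => (∑ I, Z.vv k I j * Z.vv k (bar I) l) - Z.Ld k j l) (Z.Low1 hL hK m j l) p).down (by norm_num) le_rfl
  . have h : Cl (Z.W.c fun k => k.1.mu) 1 m (fun _ => 1) (fun i => Z.ch i.1.1) := Hy.ch_cl 1 m
    exact Z.pull (fun i => i.1.b * sD i ^ 2) (fun k => Z.ch k * Z.ch k * Z.Zk k j l) ((h.mul1 h).mul1 (Z.Zk1 hL hK m j l)) p
theorem T2_cl (hL : 2 <= L) (hK : 𝕂) (M : ℕ) (j l : Fin 3) (m : ℕ) : Cl ℭ 1 m (fun i => i.1.b * (i.1.E ^ 2 * i.1.ind i.2.1)) (fun i => Z.T2 M i.1 j l) :=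
  (Dat.toL (Z.low_cl hL hK j l m)).add (Z.N_cl hL hK M j l m)
theorem gD (Z : Slots L η C0 K0) (m : ℕ) : Cl 𝔐 2 m sD (fun i => gg i.1) := Z.pull sD (fun k => gg k.1) (Hy.gg_cl (Z := Z) (mu := fun k => k.1.mu) m) 0
theorem Pg_cl (hL : 2 <= L) (hK : 𝕂) (m : ℕ) : Cl ℭ 1 m (fun i => i.1.E ^ 2 * i.1.ind i.2.1) (fun i => Z.Pg i.1) := by
  have s2 : Ls (fun i : 𝔻 × Zt => sD i * sD i) (fun i => i.1.E ^ 2 * i.1.ind i.2.1) := Ls.le (fun i => mul_self_nonneg _) fun i => by rw [<- sq]; exact sD2 i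
  have hg : Cl ℭ 1 m sD (fun i => gg i.1) := Dat.toL ((Z.gD m).down (by norm_num) le_rfl)
  have hV := fun l => (Z.V_cl hL hK l m).down (show 1 <= 2 by norm_num) le_rfl
  refine Cl.sub (Cl.mul1 (Cl.cst1 _) ((hg.mul' hg s2).add (Cl.sum _ fun i _ => Dat.toL (Dat.Re_cl1 hL i i m)))) (Cl.mul1 (Cl.cst1 _) ((Cl.sum _ fun i _ => (hV i).mul' (hV i) s2).sub (Cl.sum _ fun i _ => ?_)))
  exact (Dat.toL ((Z.Q_cl hL hK i i m).down (by norm_num) le_rfl)).trans (Ls.le (fun i => sq_nonneg _) fun i => sD2 i)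
def barE : (𝕀) ≃ (𝕀) := ⟨bar, bar, bar_bar, bar_bar⟩
theorem eqJ {d : 𝔻} {f g : Sm} (h : ∀ n : ℤ, EqS (Z.J (d, n)) f g) : f = g := by
  apply ext'; intro z
  exact h _ z.1 (Z.sl_mem (d, z)) z.2
theorem Q_symm (d : 𝔻) (j l : Fin 3) : Z.Qg d j l = Z.Qg d l j := Z.eqJ fun n => (Z.Q_J (d, n) j l).trans (EqS.trans (by
    have : Z.Qs (d, n) j l = Z.Qs (d, n) l j := by
      unfold Qs
      refine sum_congr rfl fun p _ => ?_
      rw [<- Equiv.sum_comp barE]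
      refine sum_congr rfl fun I _ => ?_
      simp only [barE, Equiv.coe_fn_mk, bar_bar, mul_comm]
    rw [this]; exact EqS.refl _ _) (Z.Q_J (d, n) l j).symm)
theorem N_symm (M : ℕ) (d : 𝔻) (j l : Fin 3) : Z.Ng M d j l = Z.Ng M d l j := Z.eqJ fun n => (Z.N_J M (d, n) j l).trans (EqS.trans (by
    have h1 : Z.N1s M (d, n) j l = Z.N1s M (d, n) l j := by
      unfold N1s N1; simp only [parN_symm M _ j l]
    have h2 : Z.N2s M (d, n) j l = Z.N2s M (d, n) l j := by
      unfold N2s N2; simp only [parN_symm M _ j l]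
    rw [h1, h2]; exact EqS.refl _ _) (Z.N_J M (d, n) l j).symm)
theorem T2_symm (M : ℕ) (d : 𝔻) (j l : Fin 3) : Z.T2 M d j l = Z.T2 M d l j := by
  unfold T2
  rw [Z.Q_symm, Z.N_symm, d.symRe]
  congr 2
  simp only [eq_comm]
theorem Ws_re (k : 𝔻 × ℤ) (l : Fin 3) : Re (Z.Ws k l) := by
  unfold Re Ws
  simp only [cj_sum, cj_mul]
  refine sum_congr rfl fun p _ => ?_
  rw [<- Equiv.sum_comp barE]
  refine sum_congr rfl fun I _ => ?_
  simp only [barE, Equiv.coe_fn_mk, Z.ee_bar, Z.om_bar, cj_cj]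
theorem Qs_re (k : 𝔻 × ℤ) (j l : Fin 3) : Re (Z.Qs k j l) := by
  unfold Re Qs
  simp only [cj_sum, cj_mul]
  refine sum_congr rfl fun p _ => ?_
  rw [<- Equiv.sum_comp barE]
  refine sum_congr rfl fun I _ => ?_
  simp only [barE, Equiv.coe_fn_mk, Z.vv_bar, cj_cj]
theorem reJ {d : 𝔻} {f : Sm} {g : ℤ -> Sm} (h : ∀ n : ℤ, EqS (Z.J (d, n)) f (g n)) (hg : ∀ n, Re (g n)) : Re f := re_of_im fun z => by
  rw [h _ z.1 (Z.sl_mem (d, z)) z.2]; exact (hg _).im _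
theorem W_re (d : 𝔻) (l : Fin 3) : Re (Z.Wg d l) := Z.reJ (fun n => Z.W_J (d, n) l) fun _ => Z.Ws_re _ l
theorem Q_re (d : 𝔻) (j l : Fin 3) : Re (Z.Qg d j l) := Z.reJ (fun n => Z.Q_J (d, n) j l) fun _ => Z.Qs_re _ j l
theorem V_re (d : 𝔻) (l : Fin 3) : Re (Z.Vg d l) := ((Z.W_re d _).dd _).sub ((Z.W_re d _).dd _)
theorem gg_re (d : 𝔻) : Re (gg d) := Re.tf _ _
theorem half_re (r : ℝ) : Re (cst (r : ℂ)) := by unfold Re; simp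
theorem Pl_re (d : 𝔻) : Re (Pl d) := by
  refine Re.mul ?_ (((gg_re d).mul (gg_re d)).add (Re.sum fun i _ => d.rRe i i))
  have := half_re (-(1 / 3)); push_cast at this; exact this
theorem Pg_re (d : 𝔻) : Re (Z.Pg d) := by
  refine (Pl_re d).sub (Re.mul ?_ ((Re.sum fun i _ => (Z.V_re d i).mul (Z.V_re d i)).sub (Re.sum fun i _ => Z.Q_re d i i)))
  have := half_re (1 / 2); push_cast at this; exact this
end Slots
theorem Sm.pt_dd {t : ℝ} {f : Sm} (h : EqS {t} f 0) (j : Fin 3) : EqS {t} (dd j f) 0 := by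
  rintro s rfl x
  have h1 := line_hasDerivAt 1 j f (s, x) 0
  have h2 : (fun r : ℝ => f (s, x + ((1 : ℝ) * r) • ev j)) = fun _ => 0 := funext fun r => h s rfl _
  simp only [] at h1
  rw [h2] at h1
  have := h1.unique (hasDerivAt_const _ _)
  simpa using this
namespace Slots
variable (Z : Slots L η C0 K0)
theorem al_van {d : 𝔻} {t : ℝ} (hg : d.g t = 0) (n : ℤ) (a : Fin 6) : EqS {t} (Z.al (d, n) a) 0 := by
  rintro s rfl x
  unfold al gg; simp only [coe_mul, tf_apply, hg, coe_zero]; simp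
theorem om_van {d : 𝔻} {t : ℝ} (hg : d.g t = 0) (n : ℤ) (I : 𝕀) (l : Fin 3) : EqS {t} (Z.om (d, n) I l) 0 := ez_smul (ez_mul (Z.al_van hg n I.1) _) _
theorem vv_van {d : 𝔻} {t : ℝ} (hg : d.g t = 0) (n : ℤ) (I : 𝕀) (l : Fin 3) : EqS {t} (Z.vv (d, n) I l) 0 := by
  have h := fun l => Z.om_van hg n I l
  unfold vv crl cr cu
  exact ez_add (ez_smul (ez_sub (ez_mul' (h _) _) (ez_mul' (h _) _)) _) (ez_sub (pt_dd (h _) _) (pt_dd (h _) _))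
theorem W_van {d : 𝔻} {t : ℝ} (hg : d.g t = 0) (l : Fin 3) : EqS {t} (Z.Wg d l) 0 := by
  rintro s rfl x
  refine (Z.W_J _ l s (Z.sl_mem (d, (s, x))) x).trans ?_
  exact (ez_sum fun p _ => ez_sum fun I _ => ez_mul' (Z.om_van hg _ I l) _ : EqS {s} (Z.Ws (Z.sl (d, (s, x))) l) 0) s rfl x
theorem Q_van {d : 𝔻} {t : ℝ} (hg : d.g t = 0) (j l : Fin 3) : EqS {t} (Z.Qg d j l) 0 := by
  rintro s rfl x
  refine (Z.Q_J _ j l s (Z.sl_mem (d, (s, x))) x).trans ?_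
  exact (ez_sum fun p _ => ez_sum fun I _ => ez_mul' (Z.vv_van hg _ _ l) _ : EqS {s} (Z.Qs (Z.sl (d, (s, x))) j l) 0) s rfl x
theorem V_van {d : 𝔻} {t : ℝ} (hg : d.g t = 0) (l : Fin 3) : EqS {t} (Z.Vg d l) 0 := ez_sub (pt_dd (Z.W_van hg _) _) (pt_dd (Z.W_van hg _) _)
theorem R_van (hK : 0 < K0) {d : 𝔻} {t : ℝ} (hg : d.g t = 0) (j l : Fin 3) (x : Spc) : d.R j l (t, x) = 0 := by
  by_contra h
  have := d.gR t t x j l (by simp) h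
  rw [hg] at this
  have h2 := mul_pos hK (pow_pos d.hE 2)
  norm_num at this; linarith
theorem P_van (hK : 0 < K0) {d : 𝔻} {t : ℝ} (hg : d.g t = 0) : EqS {t} (Z.Pg d) 0 := by
  have hR : ∀ i, EqS {t} (d.Re' i i) 0 := by
    rintro i s rfl x; rw [d.Re_zero (R_van hK hg)]; rfl
  have h1 : EqS {t} (gg d) 0 := by
    rintro s rfl x; unfold gg; rw [tf_apply, hg]; simp
  exact ez_sub (ez_mul' (ez_add (ez_mul' h1 _) (ez_sum fun i _ => hR i)) _) (ez_mul' (ez_sub (ez_sum fun i _ => ez_mul' (Z.V_van hg i) _) (ez_sum fun i _ => Z.Q_van hg i i)) _)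
end Slots
end
section
namespace Dat
theorem X_le_lam (d : 𝔻) : d.X <= d.lam := by unfold lam; nlinarith [d.N1, d.hX]
theorem X_b (d : 𝔻) : d.X <= d.b * d.lam := d.X_le_mu
theorem X_b2 (d : 𝔻) : d.X <= d.b * d.mu := by
  have := d.h1; have := d.hX0; unfold mu lam; nlinarith
theorem nu_le (d : 𝔻) : d.nu <= d.lam * d.E := mleR (mul_le_of_le_one_left d.lam0.le d.b1) d.hE.le
theorem bnu_b (d : 𝔻) : d.b * d.nu <= d.b * d.E * d.lam := by
  have := mleL d.nu_le d.hb.le; linarith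
theorem p_sz (d : 𝔻) : d.X * (d.N * d.b ^ 2 * d.E) ^ 2 <= d.b * d.E * (d.lam * d.E) := by
  have h2 := d.h2; have hX := d.hX0; have hN := d.hN; have hb := d.hb; have hE := d.hE
  calc _ = (d.N * d.b ^ 3) * (d.b * d.E * (d.N * d.X * d.E)) := by ring
    _ <= 1 * _ := mleR h2 (by positivity)
    _ = _ := by unfold lam; ring
theorem wdL {A : 𝔻 × Zt -> ℝ} {F : 𝔻 × Zt -> Sm} (m : ℕ) (hA : ∀ i, 0 <= A i)
    (h : ∀ (w : List (Fin 3)), w.length <= m -> ∀ i, ‖wd w (F i) i.2‖ <= i.1.X ^ w.length * A i) : Cl ℭ 0 m A F :=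
  wd_cl m 1 fun w hw i => by
    refine (h w hw i).trans ?_
    have h0 := pow_le_pow_left₀ i.1.hX0.le i.1.X_le_lam w.length
    have h1 : 0 <= A i * i.1.lam ^ w.length := mul_nonneg (hA i) (pow_nonneg i.1.lam0.le _)
    change _ <= 1 * |A i * i.1.lam ^ w.length|
    rw [abs_of_nonneg h1, one_mul, mul_comm]
    exact mleL h0 (hA i)
theorem inL {r m : ℕ} {A : 𝔻 × Zt -> ℝ} {F : 𝔻 × Zt -> Sm} (h : Cl (c0 L η C0 K0) r m A F) : Cl ℭ r m A F := toL h
def wv (d : 𝔻) (k : Fin 3) : Sm := d.v k - d.u k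
theorem dv_cl (i k : Fin 3) {m : ℕ} (hm : m + 1 <= L) : Cl ℭ 0 m (fun j => j.1.b * j.1.nu) (fun j => dd i (j.1.v k)) :=
  wdL m (fun i => (mul_pos i.1.hb i.1.nu0).le) fun w hw j => by rw [<- bnu]; exact j.1.bv k i w j.2 (by omega)
theorem dwv_cl (hL : 2 <= L) (i k : Fin 3) {m : ℕ} (hm : m + 1 <= L) : Cl ℭ 0 m (fun j => j.1.b * j.1.nu) (fun j => dd i (j.1.wv k)) := by
  refine congr' ((dv_cl i k hm).sub (inL (du_cl hL i k m))) fun j => ?_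
  unfold wv; rw [map_sub]
theorem wv_val (hL : 2 <= L) (k : Fin 3) : Ls (fun j : 𝔻 × Zt => j.1.wv k j.2) (fun j => j.1.b * j.1.E) := by
  obtain ⟨B, h0, hB⟩ := vu_bound (L := L) (η := η) (C0 := C0) (K0 := K0) hL
  refine Ls.of B fun j => ?_
  have h := hB j.1 k j.2
  rw [norm_sub_rev] at h
  refine h.trans (le_of_eq ?_)
  have := j.1.mu0.ne'
  unfold nu; field_simp
theorem wv_cl (hL : 2 <= L) (k : Fin 3) : Cl ℭ 0 L (fun j => j.1.b * j.1.E) (fun j => j.1.wv k) :=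
  .mk (wv_val hL k) (fun m hm j => (dwv_cl hL j k (by omega)).trans (Ls.le (fun i => (mul_pos i.1.hb i.1.nu0).le) fun i => i.1.bnu_b)) (fun _ h => by omega)
theorem dR_cl (i j l : Fin 3) {m : ℕ} (hm : m + 1 <= L) : Cl ℭ 0 m (fun i => i.1.X * (i.1.E ^ 2 * i.1.ind i.2.1)) (fun q => dd i (q.1.R j l)) :=
  wdL m (fun i => mul_nonneg i.1.hX0.le (mul_nonneg (sq_nonneg _) (i.1.ind0 _))) fun w hw q => by
    have := q.1.bR j l (i :: w) q.2 (by simp; omega)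
    simp only [wd, List.length_cons] at this
    refine this.trans (le_of_eq (by ring))
def wR (d : 𝔻) (j l : Fin 3) : Sm := d.R j l - d.Re' j l
theorem Xb_ind (i : 𝔻 × Zt) : i.1.X * (i.1.E ^ 2 * i.1.ind i.2.1) <= i.1.b * (i.1.E ^ 2 * i.1.ind i.2.1) * i.1.lam := by
  have := mleR i.1.X_b (mul_nonneg (sq_nonneg i.1.E) (i.1.ind0 i.2.1)); linarith
theorem Xb0 (i : 𝔻 × Zt) : 0 <= i.1.X * (i.1.E ^ 2 * i.1.ind i.2.1) := mul_nonneg i.1.hX0.le (mul_nonneg (sq_nonneg _) (i.1.ind0 _))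
theorem wR_cl (hL : 2 <= L) (j l : Fin 3) : Cl ℭ 0 L (fun i => i.1.b * (i.1.E ^ 2 * i.1.ind i.2.1)) (fun i => i.1.wR j l) := by
  refine .mk ?_ (fun m hm k => ?_) (fun _ h => by omega)
  . obtain ⟨B, h0, hB⟩ := mo_sub
    refine Ls.of B fun i => ?_
    have h := hB (i.1.mu)⁻¹ i.2.1 (i.1.X * (i.1.E ^ 2 * i.1.ind i.2.1)) (i.1.R j l) (inv_nonneg.2 i.1.mu0.le) (fun k x => i.1.R1 hL j l k (i.2.1, x)) i.2.2
    rw [norm_sub_rev] at h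
    refine h.trans (mleL ?_ h0)
    have h1 : (i.1.mu)⁻¹ * i.1.X <= i.1.b := by
      rw [inv_mul_le_iff₀ i.1.mu0, mul_comm]; exact i.1.X_b2
    have := mleR h1 (mul_nonneg (sq_nonneg i.1.E) (i.1.ind0 i.2.1)); linarith
  . have h1 : Cl ℭ 0 m (fun i => i.1.X * (i.1.E ^ 2 * i.1.ind i.2.1)) (fun i => dd k (i.1.R j l) - dd k (i.1.Re' j l)) := (dR_cl k j l (by omega)).sub ((inL (dRe_cl hL k j l m)).trans (Ls.eq fun i => by ring))
    exact congr' (h1.trans (Ls.le Xb0 Xb_ind)) fun i => by unfold wR; rw [map_sub]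
theorem Dvv (d : 𝔻) (l : Fin 3) : DD d.v (d.v l) = ∑ j, dd j (d.R j l) - dd l d.p := by
  rw [DD_apply, d.eq']; ring
theorem Duu (d : 𝔻) (l : Fin 3) : DD d.u (d.u l) = mo (d.mu)⁻¹ (DD d.v (d.v l)) + ∑ j, (d.u j * mo (d.mu)⁻¹ (dd j (d.v l)) - mo (d.mu)⁻¹ (d.v j * dd j (d.v l))) := by
  have e1 : dt (d.u l) = mo (d.mu)⁻¹ (dt (d.v l)) := by unfold u mo; rw [mol_dt]
  have e2 : ∀ q, dd q (d.u l) = mo (d.mu)⁻¹ (dd q (d.v l)) := by intro q; unfold u mo; rw [mol_dd]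
  rw [DD_apply, DD_apply, e1]
  simp only [e2, sum_sub_distrib]
  unfold mo
  simp only [map_add, map_sum]; ring
theorem Dvv_cl (l : Fin 3) {m : ℕ} (hm : m + 1 <= L) : Cl ℭ 0 m (fun i => i.1.b * i.1.E * (i.1.lam * i.1.E)) (fun i => DD i.1.v (i.1.v l)) := by
  have h1 : Cl ℭ 0 m (fun i => i.1.b * i.1.E * (i.1.lam * i.1.E)) (fun i => ∑ j, dd j (i.1.R j l)) := Cl.sum _ fun j _ => (dR_cl j j l hm).trans (Ls.le Xb0 fun i => by
    refine (Xb_ind i).trans ?_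
    have := mleL (i.1.ind1 i.2.1) (mul_nonneg (mul_nonneg i.1.hb.le (sq_nonneg i.1.E)) i.1.lam0.le)
    linarith)
  have h2 : Cl ℭ 0 m (fun i => i.1.b * i.1.E * (i.1.lam * i.1.E)) (fun i => dd l i.1.p) :=
    wdL m (fun i => by have := i.1.hb; have := i.1.hE; have := i.1.lam0; positivity) fun w hw q => (q.1.bp l w q.2 (by omega)).trans (mleL q.1.p_sz (pow_nonneg q.1.hX0.le _))
  exact congr' (h1.sub h2) fun i => (i.1.Dvv l).symm
theorem Duu_cl (hL : 2 <= L) (l : Fin 3) (m : ℕ) : Cl ℭ 0 m (fun i => i.1.b * i.1.E * (i.1.lam * i.1.E)) (fun i => DD i.1.u (i.1.u l)) := by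
  obtain ⟨B, h0, hB⟩ := (Dvv_cl (L := L) (η := η) (C0 := C0) (K0 := K0) l (m := 0) (by omega)).val.bound
  have h1 := mo_cl (L := L) (η := η) (C0 := C0) (K0 := K0) (h := fun i => DD i.1.v (i.1.v l)) (H := fun i => i.1.b * i.1.E * (i.1.lam * i.1.E)) B (fun i x => hB (i.1, (i.2.1, x))) m
  have h2 : ∀ q, _ := fun q => comm_cl (L := L) (η := η) (C0 := C0) (K0 := K0) hL (h := fun i => dd q (i.1.v l))
    (H := fun i => i.1.b * i.1.nu) 1 (fun i x => by
      rw [abs_of_nonneg (mul_nonneg i.1.hb.le i.1.nu0.le), one_mul]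
      exact i.1.v1 hL _ _ _) q m
  refine congr' ((inL h1).add (Cl.sum Finset.univ fun q _ => (inL (h2 q)).trans (Ls.le (fun i => ?_) fun i => ?_))) (fun i => (i.1.Duu l).symm)
  . have := i.1.hb; have := i.1.nu0; have := i.1.mu0; positivity
  . have hb := i.1.hb; have hn := i.1.nu0; have hm := i.1.mu0; have hE := i.1.hE; have hl := i.1.lam0
    calc _ = i.1.b * i.1.nu * (i.1.b * i.1.E) := by unfold nu; field_simp
      _ <= i.1.nu * (i.1.b * i.1.E) := mleR i.1.bnu_le (by positivity)
      _ <= i.1.lam * i.1.E * (i.1.b * i.1.E) := mleR i.1.nu_le (by positivity)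
      _ = _ := by ring
/-- small power of `b` beats the frequency -/
theorem exM (hη : 0 < η) : ∃ M : ℕ, ∀ d : 𝔻, d.b ^ M * d.lam ^ 6 <= 1 := by
  obtain ⟨n, hn⟩ := exists_nat_ge (1 / η)
  refine ⟨18 * (n + 1), fun d => ?_⟩
  have hN := d.N1; have hX := d.hX0
  have h1 : d.X <= d.N ^ n := by
    have h2 : d.X = (d.X ^ η) ^ (1 / η) := by
      rw [<- Real.rpow_mul hX.le, mul_one_div_cancel hη.ne', Real.rpow_one]
    rw [h2]
    calc _ <= d.N ^ (1 / η) := Real.rpow_le_rpow (Real.rpow_nonneg hX.le _) d.hη (by positivity)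
      _ <= d.N ^ (n : ℝ) := Real.rpow_le_rpow_of_exponent_le hN hn
      _ = _ := Real.rpow_natCast _ _
  have h3 : d.lam <= d.N ^ (n + 1) := by
    unfold lam; rw [pow_succ, mul_comm]; exact mleR h1 d.hN.le
  have h4 : (d.N * d.b ^ 3) ^ (6 * (n + 1)) <= 1 := pow_le_one₀ (mul_nonneg d.hN.le (pow_nonneg d.hb.le _)) d.h2
  calc _ <= d.b ^ (18 * (n + 1)) * (d.N ^ (n + 1)) ^ 6 := mleL (pow_le_pow_left₀ d.lam0.le h3 _) (pow_nonneg d.hb.le _)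
    _ = (d.N * d.b ^ 3) ^ (6 * (n + 1)) := by rw [mul_pow, <- pow_mul, <- pow_mul]; ring
    _ <= 1 := h4
end Dat
namespace Slots
variable (Z : Slots L η C0 K0)
abbrev bI (i : 𝔻 × Zt) : ℝ := i.1.b * (i.1.E ^ 2 * i.1.ind i.2.1)
theorem bI0 (i : 𝔻 × Zt) : 0 <= bI i := mul_nonneg i.1.hb.le (mul_nonneg (sq_nonneg _) (i.1.ind0 _))
abbrev cK (L : ℕ) (η C0 K0 : ℝ) : Ctx ((Dat L η C0 K0 × ℝ) × Spc) := cx (fun i => i.2) (fun i => i.1.u) (fun i => i.1.lam) (fun i => i.1.nu)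
def fK (i : (𝔻 × ℝ) × Spc) : 𝔻 × Zt := (i.1.1, (i.1.2, i.2))
theorem k1 : (cK L η C0 K0).pt = (Dat.cL L η C0 K0).pt ∘ fK := by
  funext i; rfl
theorem k2 : (cK L η C0 K0).u = (Dat.cL L η C0 K0).u ∘ fK := by
  funext i; rfl
theorem k3 : (Dat.cL L η C0 K0).mu ∘ fK = (cK L η C0 K0).mu := by
  funext i; rfl
theorem k4 : (Dat.cL L η C0 K0).nu ∘ fK = (cK L η C0 K0).nu := by
  funext i; rfl
theorem cK_comap {r m : ℕ} {A : 𝔻 × Zt -> ℝ} {F : 𝔻 × Zt -> Sm} (h : Cl ℭ r m A F) :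
    Cl (cK L η C0 K0) r m (A ∘ fK) (F ∘ fK) := Cl.comap fK h k1 k2 (by rw [k3]; exact Ls.rfl') (by rw [k4]; exact Ls.rfl')
theorem TT_cl (hL : 2 <= L) (hK : 𝕂) {M : ℕ} (hM : ∀ d : 𝔻, d.b ^ M * d.lam ^ 6 <= 1) (j l : Fin 3) (m : ℕ) :
    Cl ℭ 1 m bI (fun i => TT (Z.rem M i.1) j l) := by
  have hu : ∀ m j k, Cl (cK L η C0 K0) 0 m (fun i => i.1.1.nu) (fun i => dd j (i.1.1.u k)) := fun m j k =>
    cK_comap (A := fun i => i.1.nu) (F := fun i => dd j (i.1.u k)) (Cl.trans (A := fun i => i.1.b * i.1.nu) (Dat.inL (Dat.du_cl (L := L) (η := η) (C0 := C0) (K0 := K0) hL j k m)) (Ls.le (fun i => (mul_pos i.1.hb i.1.nu0).le) fun i => i.1.bnu_le))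
  have hF : ∀ l m, Cl (cK L η C0 K0) 1 m (fun i => i.1.1.E * i.1.1.ind i.1.2 * i.1.1.nu * i.1.1.b ^ M) (fun i => Z.rem M i.1.1 l) := fun l m =>
    cK_comap (Z.rem_cl hL hK M l m)
  have h := TT.cl1 (κ := 𝔻 × ℝ) (tm := fun i => i.2) (u := fun i => i.1.u) (mu := fun i => i.1.lam) (nu := fun i => i.1.nu) (F := fun l i => Z.rem M i.1 l) (A := fun i => i.1.E * i.1.ind i.2 * i.1.nu * i.1.b ^ M) hu (fun i => i.1.lam1) hF j l m
  have h' := Cl.comap (c := cK L η C0 K0) (A := fun i => i.1.1.E * i.1.1.ind i.1.2 * i.1.1.nu * i.1.1.b ^ M * i.1.1.lam ^ 5) (F := fun i => TT (Z.rem M i.1.1) j l) (c' := Dat.cL L η C0 K0) (f := fun i : 𝔻 × Zt => ((i.1, i.2.1), i.2.2)) h rfl rfl Ls.rfl' Ls.rfl'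
  refine Cl.trans (A := fun i => i.1.E * i.1.ind i.2.1 * i.1.nu * i.1.b ^ M * i.1.lam ^ 5) h' (Ls.le (fun i => ?_) fun i => ?_)
  . have := i.1.hE; have := i.1.hb; have := i.1.nu0; have := i.1.lam0; have := i.1.ind0 i.2.1; positivity
  . have h := mleR (hM i.1) (bI0 i)
    refine le_trans (le_of_eq ?_) (h.trans (le_of_eq (one_mul _)))
    unfold Dat.nu Dat.mu bI; ring
/-- the new stress, before taking real parts -/
def Rn (M : ℕ) (d : 𝔻) (j l : Fin 3) : Sm := d.wR j l + (d.wv j * Z.Vg d l + Z.Vg d j * d.wv l) + (Z.T2 M d j l + TT (Z.rem M d) j l)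
theorem Rn_symm (M : ℕ) (d : 𝔻) (j l : Fin 3) : Z.Rn M d j l = Z.Rn M d l j := by
  unfold Rn; rw [Z.T2_symm, TT_symm, show d.wR j l = d.wR l j by unfold Dat.wR; rw [d.symR, d.symRe]]; ring
def vn (d : 𝔻) (l : Fin 3) : Sm := d.v l + Z.Vg d l
theorem Rn_eq (M : ℕ) (d : 𝔻) (l : Fin 3) : dt (Z.vn d l) + ∑ j, dd j (Z.vn d j * Z.vn d l) + dd l (d.p + Z.Pg d) = ∑ j, dd j (Z.Rn M d j l) := by
  have h1 := Z.mom M d l; have h2 := d.eq l; have h3 := TT_div (Z.rem M d) l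
  rw [Z.aV_rem, sub_zero] at h3
  have e1 : ∀ j, Z.vn d j * Z.vn d l = d.v j * d.v l + (d.wv j * Z.Vg d l + Z.Vg d j * d.wv l) + (d.u j * Z.Vg d l + Z.Vg d j * d.u l + Z.Vg d j * Z.Vg d l) := fun j => by unfold vn Dat.wv; ring
  simp only [e1]
  simp only [map_add, sum_add_distrib] at h1 h2 ⊢
  unfold vn Rn Dat.wR
  simp only [map_add, map_sub, sum_add_distrib, sum_sub_distrib, h3] at h1 h2 ⊢
  linear_combination h1 + h2
def Rf (M : ℕ) (d : 𝔻) (j l : Fin 3) : Sm := cst (1 / 2) * (Z.Rn M d j l + cj (Z.Rn M d j l))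
theorem Rf_symm (M : ℕ) (d : 𝔻) (j l : Fin 3) : Z.Rf M d j l = Z.Rf M d l j := by unfold Rf; rw [Z.Rn_symm]
theorem Rf_re (M : ℕ) (d : 𝔻) (j l : Fin 3) : Re (Z.Rf M d j l) := by
  refine Re.mul ?_ ?_
  . have := half_re (1 / 2); push_cast at this; exact this
  . unfold Re; rw [cj_add, cj_cj, add_comm]
theorem vn_re (d : 𝔻) (l : Fin 3) : Re (Z.vn d l) := (d.rv l).add (Z.V_re d l)
theorem Rf_eq (M : ℕ) (d : 𝔻) (l : Fin 3) : dt (Z.vn d l) + ∑ j, dd j (Z.vn d j * Z.vn d l) + dd l (d.p + Z.Pg d) = ∑ j, dd j (Z.Rf M d j l) := by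
  have h1 := Z.Rn_eq M d l
  have h2 : Re (∑ j, dd j (Z.Rn M d j l)) := by
    rw [<- h1]
    exact ((Z.vn_re d l).dt.add (Re.sum fun j _ => ((Z.vn_re d j).mul (Z.vn_re d l)).dd j)).add ((d.rp.add (Z.Pg_re d)).dd l)
  unfold Re at h2
  rw [cj_sum] at h2
  rw [h1]
  have c : ∀ j, dd j (Z.Rf M d j l) = cst (1 / 2) * (dd j (Z.Rn M d j l) + cj (dd j (Z.Rn M d j l))) := fun j => by
    unfold Rf
    have c : dd j (cst (1 / 2)) = 0 := Derivation.map_algebraMap _ _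
    rw [Derivation.leibniz, c, map_add, cj_dd]; simp
  simp only [c, <- mul_sum, sum_add_distrib, h2]
  apply ext'; intro z
  simp only [coe_mul, coe_add, coe_algebraMap]; ring
end Slots
end
section
namespace Slots
variable (Z : Slots L η C0 K0)
def dw (d : 𝔻) (k : Fin 3) : Sm := d.wv k + Z.Vg d k
theorem vn_DD (d : 𝔻) (f : Sm) : DD (Z.vn d) f = DD d.u f + ∑ k, Z.dw d k * dd k f := by
  rw [DD_apply, DD_apply, add_assoc, <- sum_add_distrib]
  congr 1; refine sum_congr rfl fun k _ => ?_
  unfold vn dw Dat.wv; ring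
theorem vn_DD' (d : 𝔻) (f : Sm) : DD (Z.vn d) f = DD d.v f + ∑ k, Z.Vg d k * dd k f := by
  rw [DD_apply, DD_apply, add_assoc, <- sum_add_distrib]
  congr 1; refine sum_congr rfl fun k _ => ?_
  unfold vn; ring
theorem lE0 (i : 𝔻 × Zt) : 0 <= i.1.lam * i.1.E := mul_nonneg i.1.lam0.le i.1.hE.le
theorem VE_cl (hL : 2 <= L) (hK : 𝕂) (k : Fin 3) (m : ℕ) : Cl ℭ 0 m (fun i => i.1.E) (fun i => Z.Vg i.1 k) :=
  ((Z.V_cl hL hK k m).down (by omega) le_rfl).trans (Ls.le sD0 sDE)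
theorem dw_cl (hL : 2 <= L) (hK : 𝕂) (k : Fin 3) : Cl ℭ 0 L (fun i => i.1.E) (fun i => Z.dw i.1 k) :=
  ((Dat.wv_cl hL k).trans (Ls.le (fun i => (mul_pos i.1.hb i.1.hE).le) fun i => mul_le_of_le_one_left i.1.hE.le i.1.b1)).add (Z.VE_cl hL hK k L)
/-- bounds for a function and its derivative along the new velocity -/
def G2 (A : 𝔻 × Zt -> ℝ) (F : 𝔻 × Zt -> Sm) : Prop :=
  Cl ℭ 0 L A F ∧ ∀ m, m + 1 <= L -> Cl ℭ 0 m (fun i => A i * (i.1.lam * i.1.E)) (fun i => DD (Z.vn i.1) (F i))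
variable {Z} {A B : Dat L η C0 K0 × Zt -> ℝ} {F G : Dat L η C0 K0 × Zt -> Sm}
theorem G2.add (h : Z.G2 A F) (h' : Z.G2 A G) : Z.G2 A (fun i => F i + G i) :=
  ⟨h.1.add h'.1, fun m hm => Dat.congr' ((h.2 m hm).add (h'.2 m hm)) fun i => (map_add _ _ _).symm⟩
theorem G2.trans (h : Z.G2 A F) (h' : Ls A B) : Z.G2 B F :=
  ⟨h.1.trans h', fun m hm => (h.2 m hm).trans (h'.mul Ls.rfl')⟩
theorem G2.smul (z : ℂ) (h : Z.G2 A F) : Z.G2 A (fun i => z • F i) :=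
  ⟨h.1.smul z, fun m hm => Dat.congr' ((h.2 m hm).smul z) fun i => (Derivation.map_smul _ _ _).symm⟩
theorem G2.cj (h : Z.G2 A F) : Z.G2 A (fun i => Sm.cj (F i)) := by
  refine ⟨h.1.cj (fun i j => i.1.ru j), fun m hm => Dat.congr' ((h.2 m hm).cj (fun i j => i.1.ru j)) fun i => ?_⟩
  rw [DD_apply, DD_apply, cj_add, cj_sum, cj_dt]
  simp only [cj_mul, cj_dd]
  congr 1; refine sum_congr rfl fun k _ => ?_
  rw [show Sm.cj (Z.vn i.1 k) = Z.vn i.1 k from Z.vn_re i.1 k]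
theorem G2.mul (h : Z.G2 A F) (h' : Z.G2 B G) : Z.G2 (fun i => A i * B i) (fun i => F i * G i) := by
  refine ⟨h.1.mul h'.1, fun m hm => ?_⟩
  have h1 := (h.1.down le_rfl (show m <= L by omega)).mul (h'.2 m hm)
  have h2 := (h'.1.down le_rfl (show m <= L by omega)).mul (h.2 m hm)
  refine Dat.congr' ((h1.trans (B := fun i => A i * B i * (i.1.lam * i.1.E)) (Ls.eq fun i => by ring)).add (h2.trans (Ls.eq fun i => by ring))) fun i => ?_
  rw [Derivation.leibniz]; simp only [smul_eq_mul]
theorem G2.of1 (hL : 2 <= L) (hK : 𝕂) (h : Cl ℭ 1 L A F) : Z.G2 A F := by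
  refine ⟨h.down (by omega) le_rfl, fun m hm => ?_⟩
  have h1 : Cl ℭ 0 m (fun i => A i * i.1.nu) (fun i => DD i.1.u (F i)) := h.DD.down le_rfl (by omega)
  have h2 : Cl ℭ 0 m (fun i => A i * (i.1.lam * i.1.E)) (fun i => DD i.1.u (F i)) :=
    h1.trans (Ls.rfl'.mul (Ls.le (fun i => i.1.nu0.le) fun i => i.1.nu_le))
  refine Dat.congr' (h2.add (Cl.sum Finset.univ fun k _ => Cl.mul' ((Z.dw_cl hL hK k).down le_rfl (show m <= L by omega)) (((h.down (r' := 0) (m' := m + 1) (by omega) (by omega)).dd k)) ?_)) fun i => (Z.vn_DD i.1 (F i)).symm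
  exact Ls.eq fun i => by change i.1.E * (A i * i.1.lam) = _; ring
theorem wv_G2 (hL : 2 <= L) (hK : 𝕂) (l : Fin 3) : Z.G2 (fun i => i.1.b * i.1.E) (fun i => i.1.wv l) := by
  refine ⟨Dat.wv_cl hL l, fun m hm => ?_⟩
  have hs : Ls (fun i : 𝔻 × Zt => i.1.E * (i.1.b * i.1.nu)) (fun i => i.1.b * i.1.E * (i.1.lam * i.1.E)) :=
    Ls.le (fun i => mul_nonneg i.1.hE.le (mul_pos i.1.hb i.1.nu0).le) fun i => by
      have := mleL i.1.bnu_b i.1.hE.le; linarith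
  have h1 := Cl.sum (A := fun i : 𝔻 × Zt => i.1.b * i.1.E * (i.1.lam * i.1.E)) Finset.univ fun k _ => Cl.mul' (Z.VE_cl hL hK k m) (Dat.dv_cl k l hm) hs
  have h2 := Cl.sum (A := fun i : 𝔻 × Zt => i.1.b * i.1.E * (i.1.lam * i.1.E)) Finset.univ fun k _ => Cl.mul' ((Z.dw_cl hL hK k).down le_rfl (show m <= L by omega)) (Dat.inL (Dat.du_cl hL k l m)) hs
  refine Dat.congr' (((Dat.Dvv_cl l hm).add h1).sub ((Dat.Duu_cl hL l m).add h2)) fun i => ?_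
  rw [<- vn_DD', <- vn_DD, <- map_sub]; rfl
theorem wR_G2 (hL : 2 <= L) (hK : 𝕂) (j l : Fin 3) : Z.G2 bI (fun i => i.1.wR j l) := by
  refine ⟨Dat.wR_cl hL j l, fun m hm => ?_⟩
  have hn : Ls (fun i : 𝔻 × Zt => bI i * i.1.nu) (fun i => bI i * (i.1.lam * i.1.E)) := Ls.rfl'.mul (Ls.le (fun i => i.1.nu0.le) fun i => i.1.nu_le)
  have h0 : Cl ℭ 0 m (fun i => bI i * i.1.nu) (fun i => DD i.1.v (i.1.R j l)) :=
    Dat.wdL m (fun i => mul_nonneg (bI0 i) i.1.nu0.le) fun w hw i => (i.1.bDR j l w i.2 (by omega)).trans (le_of_eq (by rw [Dat.bnu]; ring))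
  have hs : Ls (fun i : 𝔻 × Zt => i.1.E * (i.1.X * (i.1.E ^ 2 * i.1.ind i.2.1))) (fun i => bI i * (i.1.lam * i.1.E)) :=
    Ls.le (fun i => mul_nonneg i.1.hE.le (Dat.Xb0 i)) fun i => by
      have := mleL (Dat.Xb_ind i) i.1.hE.le; linarith
  have h1 := Cl.sum (A := fun i : 𝔻 × Zt => bI i * (i.1.lam * i.1.E)) Finset.univ fun k _ => Cl.mul' (Z.VE_cl hL hK k m) (Dat.dR_cl k j l hm) hs
  have h2 := Cl.sum (A := fun i : 𝔻 × Zt => bI i * (i.1.lam * i.1.E)) Finset.univ fun k _ => Cl.mul' ((Z.dw_cl hL hK k).down le_rfl (show m <= L by omega)) ((Dat.inL (Dat.dRe_cl hL k j l m)).trans (B := fun i => i.1.X * (i.1.E ^ 2 * i.1.ind i.2.1)) (Ls.eq fun i => by ring)) hs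
  refine Dat.congr' (((h0.trans hn).add h1).sub (((Dat.inL (Dat.DRe_cl hL j l m)).trans hn).add h2)) fun i => ?_
  rw [<- vn_DD', <- vn_DD, <- map_sub]; rfl
theorem Rf_G2 (hL : 2 <= L) (hK : 𝕂) {M : ℕ} (hM : ∀ d : 𝔻, d.b ^ M * d.lam ^ 6 <= 1) (j l : Fin 3) : Z.G2 bI (fun i => Z.Rf M i.1 j l) := by
  have hV : ∀ k, Z.G2 sD (fun i => Z.Vg i.1 k) := fun k => G2.of1 hL hK ((Z.V_cl hL hK k L).down (by omega) le_rfl)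
  have hs : Ls (fun i : 𝔻 × Zt => i.1.b * i.1.E * sD i) bI := Ls.eq fun i => by unfold sD bI; ring
  have hs' : Ls (fun i : 𝔻 × Zt => sD i * (i.1.b * i.1.E)) bI := Ls.eq fun i => by unfold sD bI; ring
  have h1 : Z.G2 bI (fun i => Z.Rn M i.1 j l) := ((wR_G2 hL hK j l).add ((((wv_G2 hL hK j).mul (hV l)).trans hs).add (((hV j).mul (wv_G2 hL hK l)).trans hs'))).add
    ((G2.of1 hL hK (Z.T2_cl hL hK M j l L)).add (G2.of1 hL hK (Z.TT_cl hL hK hM j l L)))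
  have h2 := (h1.add h1.cj).smul (1 / 2)
  have e : (fun i : 𝔻 × Zt => Z.Rf M i.1 j l) = fun i => (1 / 2 : ℂ) • (Z.Rn M i.1 j l + Sm.cj (Z.Rn M i.1 j l)) := by
    funext i; unfold Rf; rw [Algebra.smul_def]
  rw [e]; exact h2
end Slots
/-- words of derivatives -/
theorem Cl.wd {c : Ctx (𝔻 × Zt)} {A : 𝔻 × Zt -> ℝ} {F : 𝔻 × Zt -> Sm} {m : ℕ} (h : Cl c 0 m A F) (w : List (Fin 3)) (hw : w.length <= m) :
    Ls (fun i => _root_.wd w (F i) (c.pt i)) (fun i => A i * c.mu i ^ w.length) := by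
  induction w generalizing A F m with
  | nil => simpa [_root_.wd] using h.val
  | cons i w ih =>
    obtain ⟨m, rfl⟩ : ∃ k, m = k + 1 := ⟨m - 1, by simp at hw; omega⟩
    have := ih (h.dd i) (by simpa using hw)
    simp only [_root_.wd, List.length_cons]
    exact this.trans (Ls.eq fun i => by ring)
end
section
namespace Sm
theorem vol_Tdom : volume Tdom = 1 := by
  unfold Tdom; rw [Real.volume_pi_Ico]; simp
theorem aV_bound {f : Sm} {t B : ℝ} (h : ∀ x, ‖f (t, x)‖ <= B) (y : Spc) : ‖aV f (t, y)‖ <= B := by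
  rw [<- int_Tdom f t y]
  have hv := vol_Tdom
  have := norm_setIntegral_le_of_norm_le_const (μ := volume) (s := Tdom) (f := fun x => f (t, x)) (C := B) (by rw [hv]; simp) fun x _ => h x
  rwa [Measure.real, hv, ENNReal.toReal_one, mul_one] at this
theorem aV_eqS {S : Set ℝ} {f g : Sm} (h : EqS S f g) : EqS S (aV f) (aV g) := fun t ht x => by
  rw [<- int_Tdom f t x, <- int_Tdom g t x]; simp only [h t ht]
theorem aV_const {f : Sm} (h : ∀ z y, f z = f (z.1, y)) : aV f = f := by
  apply ext'; rintro ⟨t, x⟩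
  have h1 := aV_bound (f := f - cst (f (t, x))) (t := t) (B := 0) (fun y => by simp [h (t, y) x]) x
  have h2 : aV (cst (f (t, x))) = cst (f (t, x)) := by
    have : ∀ y, aV (cst (f (t, x))) y = f (t, x) := fun y => by
      have := (int_Tdom (cst (f (t, x))) y.1 y.2).symm
      rw [this]; simp only [coe_algebraMap, integral_const, MeasurableSet.univ, Measure.restrict_apply, Set.univ_inter, smul_eq_mul]
      have hv := vol_Tdom
      simp [Measure.real, hv]
    exact ext' fun y => by rw [this]; simp
  rw [aV_sub, h2] at h1
  simpa [sub_eq_zero] using h1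
theorem aV_DD {u : Fin 3 -> Sm} (hu : ∑ k, dd k (u k) = 0) (f : Sm) : aV (DD u f) = dt (aV f) := by
  have : ∑ i, u i * dd i f = ∑ i, dd i (u i * f) := by
    simp only [Derivation.leibniz, smul_eq_mul, sum_add_distrib, <- mul_sum, hu]; simp
  rw [DD_apply, aV_add, this, aV_sum, aV_dt]; simp only [aV_dd, Finset.sum_const_zero, add_zero]
end Sm
namespace Slots
variable (Z : Slots L η C0 K0)
def lw (k : 𝔻 × ℤ) (I : 𝕀) (l : Fin 3) : Sm := ((k.1.Lam⁻¹ : ℝ) : ℂ) • cr (fun j => dd j (Z.al k I.1)) (cw k I) l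
def lead (k : 𝔻 × ℤ) (I : 𝕀) (l : Fin 3) : Sm := Complex.I • (Z.al k I.1 * Z.cq k I l)
def tq (k : 𝔻 × ℤ) : Sm := ∑ I, ∑ l, (Z.lead k I l * Z.lw k (bar I) l + Z.lw k I l * Z.lead k (bar I) l + Z.lw k I l * Z.lw k (bar I) l)
theorem tq_eq (hK : 𝕂) (k : 𝔻 × ℤ) : ∑ I, ∑ l, Z.vv k I l * Z.vv k (bar I) l = gg k.1 * gg k.1 * (Z.ch k * Z.ch k) + Z.tq k := by
  have h1 : ∑ I, ∑ l, Z.lead k I l * Z.lead k (bar I) l = gg k.1 * gg k.1 * (Z.ch k * Z.ch k) := by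
    have e : ∀ I l, Z.lead k I l * Z.lead k (bar I) l = - (Z.al k I.1 * Z.al k I.1 * (Z.cq k I l * Z.cq k (bar I) l)) := fun I l => by
      unfold lead; rw [smul_mul_smul_comm, Complex.I_mul_I, show (bar I).1 = I.1 from rfl, neg_one_smul]; ring
    have e2 : ∀ a, Z.al k a * Z.al k a = gg k.1 * gg k.1 * (Z.ch k * Z.ch k) * (Z.hQ k * Z.hQ k) * Z.fS k a := fun a => by
      rw [<- Z.Sa_mul hK k a]; unfold al; ring
    simp only [e, sum_neg_distrib, <- mul_sum]
    rw [Fintype.sum_prod_type]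
    have e3 : ∀ a : Fin 6, ∑ y : Bool, Z.al k (a, y).1 * Z.al k (a, y).1 * ∑ i, Z.cq k (a, y) i * Z.cq k (bar (a, y)) i = - (gg k.1 * gg k.1 * (Z.ch k * Z.ch k) * (Z.hQ k * Z.hQ k) * (cst 2 * Z.fS k a * (-∑ l, Z.cq k (a, false) l * Z.cq k (a, true) l))) := fun a => by
      rw [Fintype.sum_bool]
      simp only [e2, bar, Bool.not_true, Bool.not_false]
      rw [show (cst 2 : Sm) = 1 + 1 by apply ext'; intro z; simp only [coe_algebraMap, coe_add, coe_one]; norm_num]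
      have : ∑ i, Z.cq k (a, true) i * Z.cq k (a, false) i = ∑ i, Z.cq k (a, false) i * Z.cq k (a, true) i := sum_congr rfl fun _ _ => mul_comm _ _
      rw [this]; ring
    simp only [e3, sum_neg_distrib, neg_neg, <- mul_sum]
    have := Z.hQ_mul hK k; unfold Qn at this
    linear_combination (gg k.1 * gg k.1 * (Z.ch k * Z.ch k)) * this
  rw [<- h1]; unfold tq
  rw [<- sum_add_distrib]
  refine sum_congr rfl fun I _ => ?_
  rw [<- sum_add_distrib]
  refine sum_congr rfl fun l _ => ?_
  rw [Z.vv_eq, Z.vv_eq]; unfold lead lw; ring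
abbrev eN (i : 𝔻 × Zt) : ℝ := i.1.E ^ 2 * i.1.N⁻¹
theorem eN0 (i : 𝔻 × Zt) : 0 <= eN i := mul_nonneg (sq_nonneg _) (inv_nonneg.2 i.1.hN.le)
theorem sDe (i : 𝔻 × Zt) : sD i ^ 2 <= i.1.E ^ 2 := pow_le_pow_left₀ (sD0 i) (sDE i) 2
theorem X_Lam (d : 𝔻) : d.Lam⁻¹ * d.X <= d.N⁻¹ := by
  have h := d.Lam_ge; have h0 := d.Lam0
  rw [inv_mul_le_iff₀ h0, le_mul_inv_iff₀ d.hN, mul_comm]; exact h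
theorem toLX {r m : ℕ} {A : 𝔻 × Zt -> ℝ} {F : 𝔻 × Zt -> Sm} (h : Cl (Dat.cc Dat.X) r m A F) : Cl ℭ r m A F :=
  h.chg (c' := Dat.cL L η C0 K0) rfl rfl (Ls.le (fun i => i.1.hX0.le) fun i => i.1.X_le_lam) Ls.rfl'
theorem tq_cl (hL : 2 <= L) (hK : 𝕂) (p : Fin 2) : Cl ℭ 1 0 eN (fun i => Z.tq (sh (Z.sl i) p)) := by
  refine toLX (Z.pull (mu := Dat.X) eN (fun k => Z.tq k) ?_ p)
  have H := Z.hy_X hL hK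
  have ha : ∀ I l, Cl (Z.W.c fun k => k.1.X) 1 0 sg (fun i => Z.lead i.1.1 I l) := fun I l =>
    ((Cl.mul1' (H.al_cl hK (by omega) I.1) (H.cq_cl I l)).smul _).down le_rfl (by omega)
  have hw : ∀ I l, Cl (Z.W.c fun k => k.1.X) 1 0 (fun i => i.1.1.1.N⁻¹ * sg i) (fun i => Z.lw i.1.1 I l) := fun I l => by
    have h := fun j => (H.al_cl hK (by omega) I.1).dd j
    refine Cl.trans (Cl.smulc (fun i : Z.W.Ix => ((i.1.1.1.Lam⁻¹ : ℝ) : ℂ)) (Cl.sub ((h _).mul1' (Hy.cw_cl I _)) ((h _).mul1' (Hy.cw_cl I _)))) (Ls.of 1 fun i => ?_)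
    have h0 := inv_nonneg.2 i.1.1.1.Lam0.le
    rw [Complex.norm_real, Real.norm_eq_abs, Real.norm_eq_abs, abs_of_nonneg h0]
    change |_ * (_ * i.1.1.1.X)| <= _
    rw [abs_of_nonneg (mul_nonneg h0 (mul_nonneg (sg0 i) i.1.1.1.hX0.le))]
    nlinarith [X_Lam i.1.1.1, sg0 i]
  have hs : ∀ i : Z.W.Ix, sg i ^ 2 * i.1.1.1.N⁻¹ <= eN (i.1.1.1, i.1.2) := fun i => mleR (sDe (i.1.1.1, i.1.2)) (inv_nonneg.2 i.1.1.1.hN.le)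
  have hs0 : ∀ i : Z.W.Ix, 0 <= sg i ^ 2 * i.1.1.1.N⁻¹ := fun i => mul_nonneg (sq_nonneg _) (inv_nonneg.2 i.1.1.1.hN.le)
  refine Cl.sum _ fun I _ => Cl.sum _ fun l _ => Cl.add (Cl.add (Cl.mul' (ha I l) (hw (bar I) l) ?_) (Cl.mul' (hw I l) (ha (bar I) l) ?_)) (Cl.mul' (hw I l) (hw (bar I) l) ?_)
  . exact (Ls.eq fun i => by ring).trans (Ls.le hs0 hs)
  . exact (Ls.eq fun i => by ring).trans (Ls.le hs0 hs)
  . refine Ls.le (fun i => mul_self_nonneg _) fun i => le_trans ?_ (hs i)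
    have h1 := inv_le_one_of_one_le₀ i.1.1.1.N1
    have := mleL h1 (hs0 i)
    linarith
/-- pairs of oscillating terms -/
def f2 (k : 𝔻 × ℤ) (A B : Fin 2 × (𝕀)) (l : Fin 3) : Sm := if l = 0 then ∑ j, Z.vv (sh k A.1) A.2 j * Z.vv (sh k B.1) B.2 j else 0
def e2 (k : 𝔻 × ℤ) (A B : Fin 2 × (𝕀)) : Sm := Z.ee (sh k A.1) A.2 * Z.ee (sh k B.1) B.2
def X2 (M : ℕ) (k : 𝔻 × ℤ) (A B : Fin 2 × (𝕀)) (j : Fin 3) : Sm :=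
  if B = (A.1, bar A.2) then 0 else Z.e2 k A B * parN k.1.Lam (Z.q2 (sh k A.1) A.2 (sh k B.1) B.2) (sqq (Z.q2 (sh k A.1) A.2 (sh k B.1) B.2)) M (Z.f2 k A B) j 0
def Y2 (M : ℕ) (k : 𝔻 × ℤ) (A B : Fin 2 × (𝕀)) : Sm :=
  if B = (A.1, bar A.2) then 0 else Z.e2 k A B * parR k.1.Lam (Z.q2 (sh k A.1) A.2 (sh k B.1) B.2) (sqq (Z.q2 (sh k A.1) A.2 (sh k B.1) B.2)) M (Z.f2 k A B) 0
theorem msk_B {A B : Fin 2 × (𝕀)} (h : ¬ B = (A.1, bar A.2)) (k : 𝔻 × ℤ) : Msk (sh k A.1) A.2 (sh k B.1) B.2 :=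
  (msk_iff k A.1 B.1 A.2 B.2).2 fun h1 h2 => h (Prod.ext h1.symm h2)
theorem XY_eq (M : ℕ) (k : 𝔻 × ℤ) (A B : Fin 2 × (𝕀)) :
    ∑ j, dd j (Z.X2 M k A B j) + Z.Y2 M k A B = if B = (A.1, bar A.2) then 0 else Z.e2 k A B * ∑ j, Z.vv (sh k A.1) A.2 j * Z.vv (sh k B.1) B.2 j := by
  unfold X2 Y2
  split_ifs with h
  . simp
  . have he : ∀ j, dd j (Z.e2 k A B) = (Complex.I * k.1.Lam : ℂ) • (Z.q2 (sh k A.1) A.2 (sh k B.1) B.2 j * Z.e2 k A B) := fun j => Z.ee2_dd (sh k A.1) A.2 (sh k B.1) B.2 rfl j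
    have hf : Z.f2 k A B 0 = ∑ j, Z.vv (sh k A.1) A.2 j * Z.vv (sh k B.1) B.2 j := if_pos rfl
    rw [<- hf]
    generalize Z.f2 k A B = F
    have hq := Z.sqq2 (msk_pr k A.1 B.1 (msk_B h k))
    exact parN_eq (e := Z.e2 k A B) k.1.Lam0.ne' hq he M F 0
theorem Y2_cl (hL : 2 <= L) (hK : 𝕂) {M : ℕ} (hM : ∀ d : 𝔻, d.b ^ M * d.lam ^ 6 <= 1) (A B : Fin 2 × (𝕀)) :
    Cl ℭ 1 0 eN (fun i => Z.Y2 M (Z.sl i) A B) := by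
  unfold Y2
  split_ifs with h
  . exact Cl.zero
  . refine Cl.mul1 (Z.pee2 hL hK A.1 B.1 A.2 B.2 0) (Dat.toL ?_)
    have hf : ∀ l m, Cl 𝔐 1 m (fun i => i.1.E ^ 2) (fun i => Z.f2 (Z.sl i) A B l) := fun l m => by
      unfold f2; split_ifs
      . exact (Cl.sum _ fun j _ => Cl.mul' (Z.pv hL hK A.1 A.2 j m) (Z.pv hL hK B.1 B.2 j m) (Ls.le (fun i => mul_self_nonneg _) fun i => by rw [<- pow_two]; exact sDe i)).down (by norm_num) le_rfl
      . exact Cl.zero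
    have := parR_cl (c := Dat.cM L η C0 K0) (Λ := fun i => i.1.Lam) (q := fun j i => Z.q2 (sh (Z.sl i) A.1) A.2 (sh (Z.sl i) B.1) B.2 j) (H := fun i => sqq (Z.q2 (sh (Z.sl i) A.1) A.2 (sh (Z.sl i) B.1) B.2)) (F := fun l i => Z.f2 (Z.sl i) A B l)
      (Z.pq2 hL hK A.1 B.1 A.2 B.2) (Z.psq2 hL hK (msk_B h)) hf M 0 0
    refine this.trans (Ls.le (fun i => mul_nonneg (sq_nonneg _) (pow_nonneg (mul_nonneg i.1.mu0.le (iL i)) _)) fun i => mleL ((mb M i.1).trans ?_) (sq_nonneg _))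
    have h1 := hM i.1; have h2 := i.1.lam1; have h3 := i.1.hX
    have h4 : i.1.N <= i.1.lam ^ 6 := le_trans (by unfold Dat.lam; nlinarith [i.1.hN]) (le_self_pow₀ h2 (by norm_num))
    rw [<- one_div, le_div_iff₀ i.1.hN]
    exact (mleL h4 (pow_nonneg i.1.hb.le _)).trans h1
def Yk (M : ℕ) (k : 𝔻 × ℤ) : Sm := ∑ p, Z.tq (sh k p) + ∑ A, ∑ B, Z.Y2 M k A B
def en (d : 𝔻) : Sm := ∑ l, Z.Vg d l * Z.Vg d l - gg d * gg d
theorem en_J (hK : 𝕂) (M : ℕ) (k : 𝔻 × ℤ) : EqS (Z.J k) (Z.en k.1) (Z.Yk M k + ∑ A, ∑ B, ∑ j, dd j (Z.X2 M k A B j)) := by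
  have h1 : EqS (Z.J k) (Z.en k.1) (∑ l, Z.Vs k l * Z.Vs k l - gg k.1 * gg k.1) := es_sub (es_sum fun l _ => (Z.V_J k l).mul (Z.V_J k l)) (EqS.refl _ _)
  refine h1.trans ?_
  have hV : ∀ l, Z.Vs k l = ∑ A : Fin 2 × (𝕀), Z.ee (sh k A.1) A.2 * Z.vv (sh k A.1) A.2 l := fun l => by rw [Fintype.sum_prod_type]; rfl
  have h2 : ∑ l, Z.Vs k l * Z.Vs k l = ∑ A, ∑ B, Z.e2 k A B * ∑ j, Z.vv (sh k A.1) A.2 j * Z.vv (sh k B.1) B.2 j := by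
    simp only [hV, sum_mul_sum]
    rw [sum_comm]; refine sum_congr rfl fun A _ => ?_
    rw [sum_comm]; refine sum_congr rfl fun B _ => ?_
    rw [mul_sum]; refine sum_congr rfl fun l _ => ?_
    unfold e2; ring
  have h3 : ∀ A : Fin 2 × (𝕀), ∑ B, Z.e2 k A B * ∑ j, Z.vv (sh k A.1) A.2 j * Z.vv (sh k B.1) B.2 j = ∑ j, Z.vv (sh k A.1) A.2 j * Z.vv (sh k A.1) (bar A.2) j + ∑ B, (∑ j, dd j (Z.X2 M k A B j) + Z.Y2 M k A B) := fun A => by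
    simp only [XY_eq]
    rw [<- Finset.add_sum_erase _ _ (mem_univ (A.1, bar A.2)), <- Finset.add_sum_erase (f := fun B => ite _ _ _) _ (mem_univ (A.1, bar A.2)), if_pos rfl, zero_add]
    congr 1
    . unfold e2; rw [Z.ee_mul_bar, one_mul]
    . exact sum_congr rfl fun B hB => by rw [if_neg (Finset.ne_of_mem_erase hB)]
  have h4 : ∑ A : Fin 2 × (𝕀), ∑ j, Z.vv (sh k A.1) A.2 j * Z.vv (sh k A.1) (bar A.2) j = gg k.1 * gg k.1 * (Z.ch k * Z.ch k + Z.ch (nx k) * Z.ch (nx k)) + ∑ p, Z.tq (sh k p) := by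
    rw [Fintype.sum_prod_type]
    simp only [Z.tq_eq hK]
    rw [sum_add_distrib, Fin.sum_univ_two, sh0, sh1]
    rw [show (nx k).1 = k.1 from rfl]; ring
  intro t ht x
  have h5 := Z.ch_sq k ht x
  have h6 : ∑ l, Z.Vs k l * Z.Vs k l = gg k.1 * gg k.1 * (Z.ch k * Z.ch k + Z.ch (nx k) * Z.ch (nx k)) + ∑ p, Z.tq (sh k p) + ∑ A, ∑ B, (∑ j, dd j (Z.X2 M k A B j) + Z.Y2 M k A B) := by
    rw [h2, <- h4, <- sum_add_distrib]; exact sum_congr rfl fun A _ => h3 A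
  rw [h6]
  unfold Yk
  simp only [sum_add_distrib, coe_add, coe_sub, coe_mul]
  linear_combination (gg k.1 (t, x) * gg k.1 (t, x)) * h5
theorem en_aV (hK : 𝕂) (M : ℕ) (k : 𝔻 × ℤ) : EqS (Z.J k) (aV (Z.en k.1)) (aV (Z.Yk M k)) := by
  have h := aV_eqS (Z.en_J hK M k)
  rw [aV_add] at h
  simpa [aV_sum, aV_dd] using h
theorem en_dt (hK : 𝕂) (M : ℕ) (k : 𝔻 × ℤ) : EqS (Z.J k) (dt (aV (Z.en k.1))) (aV (DD k.1.u (Z.Yk M k))) := by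
  rw [aV_DD k.1.divu]
  exact (Z.en_aV hK M k).dt (Z.J_open k)
variable {Z} in
theorem en_x (f : 𝔻 × ℤ -> Sm) {G : 𝔻 × Zt -> ℝ} {C : ℝ} (h : ∀ i : 𝔻 × Zt, ‖f (Z.sl i) i.2‖ <= C * |G (i.1, (i.2.1, i.2.2))|) (hG : ∀ d t x y, G (d, (t, x)) = G (d, (t, y))) (i : 𝔻 × Zt) :
    ‖aV (f (Z.sl i)) (i.2.1, i.2.2)‖ <= C * |G i| := by
  refine aV_bound (fun x => ?_) i.2.2
  have h1 : Z.sl (i.1, (i.2.1, x)) = Z.sl i := rfl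
  have := h (i.1, (i.2.1, x))
  rw [h1] at this
  refine this.trans_eq ?_
  rw [show G i = G (i.1, (i.2.1, i.2.2)) from rfl, hG i.1 i.2.1 i.2.2 x]
theorem Yk_cl (hL : 2 <= L) (hK : 𝕂) {M : ℕ} (hM : ∀ d : 𝔻, d.b ^ M * d.lam ^ 6 <= 1) : Cl ℭ 1 0 eN (fun i => Z.Yk M (Z.sl i)) := by
  have h1 : Cl ℭ 1 0 eN (fun i => ∑ p, Z.tq (sh (Z.sl i) p)) := Cl.sum _ fun p _ => Z.tq_cl hL hK p
  have h2 : Cl ℭ 1 0 eN (fun i => ∑ A, ∑ B, Z.Y2 M (Z.sl i) A B) := Cl.sum _ fun A _ => Cl.sum _ fun B _ => Z.Y2_cl hL hK hM A B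
  exact h1.add h2
theorem en_0 (hK : 𝕂) (M : ℕ) (i : 𝔻 × Zt) : aV (Z.en i.1) i.2 = aV (Z.Yk M (Z.sl i)) (i.2.1, i.2.2) :=
  Z.en_aV hK M (Z.sl i) i.2.1 (Z.sl_mem i) i.2.2
theorem en_1 (hK : 𝕂) (M : ℕ) (i : 𝔻 × Zt) : dt (aV (Z.en i.1)) i.2 = aV (DD (Z.sl i).1.u (Z.Yk M (Z.sl i))) (i.2.1, i.2.2) :=
  Z.en_dt hK M (Z.sl i) i.2.1 (Z.sl_mem i) i.2.2
theorem Yk_val (hL : 2 <= L) (hK : 𝕂) (M : ℕ) (hM : ∀ d : 𝔻, d.b ^ M * d.lam ^ 6 <= 1) :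
    Ls (fun i : 𝔻 × Zt => Z.Yk M (Z.sl i) i.2) eN := by
  have h := Z.Yk_cl hL hK hM
  revert h
  generalize Z.Yk M = f
  exact fun h => h.val
theorem en_b0 (hL : 2 <= L) (hη : 0 < η) (hK : 𝕂) :
    ∃ C, 0 <= C ∧ ∀ i : 𝔻 × Zt, ‖aV (Z.en i.1) i.2‖ <= C * |eN i| := by
  obtain ⟨M, hM⟩ := Dat.exM (L := L) (C0 := C0) (K0 := K0) hη
  obtain ⟨C, hC, h1⟩ := (Z.Yk_val hL hK M hM).bound
  refine ⟨C, hC, fun i => ?_⟩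
  refine (congrArg norm (Z.en_0 hK M i)).trans_le ?_
  exact en_x (G := fun i => eN i) (C := C) (fun k => Z.Yk M k) h1 (fun _ _ _ _ => rfl) i
theorem en_b1 (hL : 2 <= L) (hη : 0 < η) (hK : 𝕂) :
    ∃ C, 0 <= C ∧ ∀ i : 𝔻 × Zt, ‖dt (aV (Z.en i.1)) i.2‖ <= C * |eN i * i.1.nu| := by
  obtain ⟨M, hM⟩ := Dat.exM (L := L) (C0 := C0) (K0 := K0) hη
  obtain ⟨C, hC, h1⟩ := (Z.Yk_cl hL hK hM).DD.val.bound
  refine ⟨C, hC, fun i => ?_⟩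
  refine (congrArg norm (Z.en_1 hK M i)).trans_le ?_
  exact en_x (G := fun i => eN i * i.1.nu) (C := C) (fun k => DD k.1.u (Z.Yk M k)) h1 (fun _ _ _ _ => rfl) i
end Slots
end
section
open scoped ContDiff Convolution
namespace Gc
abbrev kv (φ : ContDiffBump (0 : ℝ)) (k : ℝ -> ℝ) : ℝ -> ℝ := φ.normed volume ⋆[ContinuousLinearMap.lsmul ℝ ℝ, volume] k
theorem kv_deriv (φ : ContDiffBump (0 : ℝ)) {k : ℝ -> ℝ} {B : ℝ} (hk : Differentiable ℝ k) (hB : ∀ t, |deriv k t| <= B) (t : ℝ) : HasDerivAt (kv φ k) (kv φ (deriv k) t) t := by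
  have hi : Integrable (φ.normed volume) volume := φ.integrable_normed
  have hc : Continuous (φ.normed volume) := φ.continuous_normed
  refine (hasDerivAt_integral_of_dominated_loc_of_deriv_le (F := fun t s => φ.normed volume s * k (t - s)) (F' := fun t s => φ.normed volume s * deriv k (t - s)) (bound := fun s => φ.normed volume s * B) Filter.univ_mem ?_ ?_ ?_ ?_ (hi.mul_const B) ?_).2
  . exact Filter.Eventually.of_forall fun t => (hc.mul (hk.continuous.comp (continuous_const.sub continuous_id))).aestronglyMeasurable
  . exact (hc.mul (hk.continuous.comp (continuous_const.sub continuous_id))).integrable_of_hasCompactSupport (φ.hasCompactSupport_normed.mul_right)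
  . exact (hc.measurable.mul ((measurable_deriv k).comp (measurable_const.sub measurable_id))).aestronglyMeasurable
  . refine Filter.Eventually.of_forall fun s t _ => ?_
    rw [norm_mul, Real.norm_of_nonneg (φ.nonneg_normed s)]
    exact mleL (hB _) (φ.nonneg_normed s)
  . refine Filter.Eventually.of_forall fun s t _ => HasDerivAt.const_mul _ ?_
    exact (hk (t - s)).hasDerivAt.comp_sub_const t s
theorem kv_near (φ : ContDiffBump (0 : ℝ)) {k : ℝ -> ℝ} {z B t : ℝ} (hm : Measurable k) (h : ∀ s, |s - t| < φ.rOut -> |k s - z| <= B) : |kv φ k t - z| <= B := by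
  have := dist_convolution_le (μ := volume) (f := φ.normed volume) (g := k) (x₀ := t) (R := φ.rOut) (ε := B) (z₀ := z) ((abs_nonneg _).trans (h t (by simpa using φ.rOut_pos))) φ.support_normed_eq.subset φ.nonneg_normed φ.integral_normed hm.aestronglyMeasurable h
  exact this
def H (y : ℝ) : ℝ := y * Real.smoothTransition (y - 1)
theorem H_smooth : ContDiff ℝ ∞ H := contDiff_id.mul (Real.smoothTransition.contDiff.comp (contDiff_id.sub contDiff_const))
theorem H_lo {y : ℝ} (h : y <= 1) : H y = 0 := by unfold H; rw [Real.smoothTransition.zero_of_nonpos (by linarith), mul_zero]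
theorem H_hi {y : ℝ} (h : 2 <= y) : H y = y := by unfold H; rw [Real.smoothTransition.one_of_one_le (by linarith), mul_one]
theorem H1_hi {y : ℝ} (h : 2 < y) : deriv H y = 1 := by
  have : H =ᶠ[nhds y] id := Filter.eventually_of_mem (Ioi_mem_nhds h) fun z hz => H_hi (le_of_lt hz)
  rw [this.deriv_eq]; simp
theorem H1_lo {y : ℝ} (h : y < 1) : deriv H y = 0 := by
  have : H =ᶠ[nhds y] fun _ => 0 := Filter.eventually_of_mem (Iio_mem_nhds h) fun z hz => H_lo (le_of_lt hz)
  rw [this.deriv_eq]; simp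
theorem H2_hi {y : ℝ} (h : 2 < y) : deriv (deriv H) y = 0 := by
  have : deriv H =ᶠ[nhds y] fun _ => 1 := Filter.eventually_of_mem (Ioi_mem_nhds h) fun z hz => H1_hi hz
  rw [this.deriv_eq]; simp
theorem H2_lo {y : ℝ} (h : y < 1) : deriv (deriv H) y = 0 := by
  have : deriv H =ᶠ[nhds y] fun _ => 0 := Filter.eventually_of_mem (Iio_mem_nhds h) fun z hz => H1_lo hz
  rw [this.deriv_eq]; simp
theorem H_bd : ∃ B, 1 <= B ∧ ∀ y, |deriv H y| <= B ∧ |deriv (deriv H) y| <= B := by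
  have h1 := Sm.deriv_smooth H_smooth
  have h2 := Sm.deriv_smooth h1
  obtain ⟨B1, hB1⟩ := (isCompact_Icc (a := (1 : ℝ)) (b := 2)).exists_bound_of_continuousOn h1.continuous.continuousOn
  obtain ⟨B2, hB2⟩ := (isCompact_Icc (a := (1 : ℝ)) (b := 2)).exists_bound_of_continuousOn h2.continuous.continuousOn
  refine ⟨max 1 (max B1 B2), le_max_left _ _, fun y => ?_⟩
  have h0 : (1 : ℝ) <= max 1 (max B1 B2) := le_max_left _ _
  by_cases hy : y < 1
  . rw [H1_lo hy, H2_lo hy]; simp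
  by_cases hy' : 2 < y
  . rw [H1_hi hy', H2_hi hy']; simp
  have hm : y ∈ Set.Icc (1 : ℝ) 2 := ⟨not_lt.1 hy, not_lt.1 hy'⟩
  exact ⟨(hB1 y hm).trans ((le_max_left _ _).trans (le_max_right _ _)), (hB2 y hm).trans ((le_max_right _ _).trans (le_max_right _ _))⟩
theorem lip {k : ℝ -> ℝ} {B : ℝ} (hk : Differentiable ℝ k) (hB : ∀ t, |deriv k t| <= B) (s t : ℝ) : |k s - k t| <= B * |s - t| :=
  Convex.norm_image_sub_le_of_norm_deriv_le (fun x _ => hk x) (fun x _ => hB x) convex_univ (Set.mem_univ t) (Set.mem_univ s)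
theorem sq_bd {f : ℝ -> ℝ} {M : ℝ} (hM : 0 < M) (h0 : ∀ t, 0 <= f t) (h1 : Differentiable ℝ f) (h2 : Differentiable ℝ (deriv f)) (hB : ∀ t, |deriv (deriv f) t| <= M) (t : ℝ) : deriv f t ^ 2 <= 4 * f t * M := by
  set h := - deriv f t / (2 * M)
  have hd : ∀ s, HasDerivAt (fun s => f s - deriv f t * s) (deriv f s - deriv f t) s := fun s => by
    exact ((h1 s).hasDerivAt.fun_sub ((hasDerivAt_id s).const_mul (deriv f t))).congr_deriv (by simp)
  have := Convex.norm_image_sub_le_of_norm_hasDerivWithin_le (f := fun s => f s - deriv f t * s) (C := M * |h|) (s := Set.uIcc t (t + h)) (x := t) (y := t + h) (fun s _ => (hd s).hasDerivWithinAt) (fun s hs => by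
    refine (lip h2 hB s t).trans (mleL ?_ hM.le)
    have := Set.abs_sub_left_of_mem_uIcc hs
    simpa using this) (convex_uIcc _ _) Set.left_mem_uIcc Set.right_mem_uIcc
  have h3 := (le_abs_self _).trans this
  rw [add_sub_cancel_left, Real.norm_eq_abs, mul_assoc, abs_mul_abs_self] at h3
  have h4 := h0 (t + h)
  have h5 : 2 * M * h = - deriv f t := by unfold h; field_simp
  nlinarith
theorem exists_g : ∃ C : ℝ, 1 <= C ∧ ∀ (f : ℝ -> ℝ) (F M κ : ℝ), 0 < M -> 0 < κ -> (∀ t, 0 <= f t) -> Differentiable ℝ f -> Differentiable ℝ (deriv f) ->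
    (∀ t, |deriv f t| <= F) -> (∀ t, |deriv (deriv f) t| <= M) ->
    ∃ g : ℝ -> ℝ, ContDiff ℝ ∞ g ∧ (∀ t, |g t - f t| <= κ) ∧ (∀ t, |deriv g t - deriv f t| <= κ) ∧ (∀ t, |deriv (deriv g) t| <= C * M) ∧ ∀ t, f t = 0 -> g t = 0 := by
  obtain ⟨B, hB1, hB⟩ := H_bd
  refine ⟨9 * B, by linarith, fun f F M κ hM hκ h0 h1 h2 hF hM2 => ?_⟩
  have hF0 : 0 <= F := (abs_nonneg _).trans (hF 0)
  obtain ⟨ε, hε, he1, he2⟩ : ∃ ε : ℝ, 0 < ε ∧ 2 * ε <= κ / 2 ∧ 8 * ε * M * (B + 1) ^ 2 <= (κ / 2) ^ 2 := by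
    have hp : 0 < 8 * M * (B + 1) ^ 2 := by positivity
    refine ⟨min (κ / 4) ((κ / 2) ^ 2 / (8 * M * (B + 1) ^ 2)), lt_min (by linarith) (by positivity), by linarith [min_le_left (κ / 4) ((κ / 2) ^ 2 / (8 * M * (B + 1) ^ 2))], ?_⟩
    have := min_le_right (κ / 4) ((κ / 2) ^ 2 / (8 * M * (B + 1) ^ 2))
    rw [le_div_iff₀ hp] at this
    linarith
  have hsq := sq_bd hM h0 h1 h2 hM2
  set k : ℝ -> ℝ := fun t => ε * H (f t / ε) with hk
  have hk1 : ∀ t, HasDerivAt k (deriv H (f t / ε) * deriv f t) t := fun t => by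
    have e1 : HasDerivAt H (deriv H (f t / ε)) (f t / ε) := (H_smooth.differentiable (by simp) _).hasDerivAt
    have e2 := (e1.comp t ((h1 t).hasDerivAt.div_const ε)).const_mul ε
    convert! e2 using 1; field_simp
  have hk1' : deriv k = fun t => deriv H (f t / ε) * deriv f t := funext fun t => (hk1 t).deriv
  have hk2 : ∀ t, HasDerivAt (deriv k) (deriv (deriv H) (f t / ε) * (deriv f t / ε) * deriv f t + deriv H (f t / ε) * deriv (deriv f) t) t := fun t => by
    have e1 : HasDerivAt (deriv H) (deriv (deriv H) (f t / ε)) (f t / ε) := ((Sm.deriv_smooth H_smooth).differentiable (by simp) _).hasDerivAt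
    rw [hk1']
    exact (e1.comp t ((h1 t).hasDerivAt.div_const ε)).mul (h2 t).hasDerivAt
  have hkd : Differentiable ℝ k := fun t => (hk1 t).differentiableAt
  have hkd' : Differentiable ℝ (deriv k) := fun t => (hk2 t).differentiableAt
  have hb1 : ∀ t, |deriv k t| <= B * F := fun t => by
    rw [hk1', abs_mul]; exact mul_le_mul (hB _).1 (hF t) (abs_nonneg _) (by linarith)
  have hb2 : ∀ t, |deriv (deriv k) t| <= 9 * B * M := fun t => by
    rw [(hk2 t).deriv]
    have a2 : |deriv H (f t / ε) * deriv (deriv f) t| <= B * M := by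
      rw [abs_mul]; exact mul_le_mul (hB _).1 (hM2 t) (abs_nonneg _) (by linarith)
    have a1 : |deriv (deriv H) (f t / ε) * (deriv f t / ε) * deriv f t| <= B * (8 * M) := by
      rw [mul_assoc, abs_mul]
      by_cases hy : 2 < f t / ε
      . rw [H2_hi hy]; simp; positivity
      . rw [not_lt, div_le_iff₀ hε] at hy
        refine mul_le_mul (hB _).2 ?_ (abs_nonneg _) (by linarith)
        rw [show deriv f t / ε * deriv f t = deriv f t ^ 2 / ε by ring, abs_of_nonneg (by positivity), div_le_iff₀ hε]
        nlinarith [hsq t]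
    linarith [abs_add_le (deriv (deriv H) (f t / ε) * (deriv f t / ε) * deriv f t) (deriv H (f t / ε) * deriv (deriv f) t)]
  have hn0 : ∀ t, |k t - f t| <= κ / 2 := fun t => by
    by_cases hy : 2 <= f t / ε
    . rw [hk]; simp only [H_hi hy]; rw [mul_div_cancel₀ _ hε.ne', sub_self]; simp; positivity
    . rw [not_le, div_lt_iff₀ hε] at hy
      have e : k t = f t * Real.smoothTransition (f t / ε - 1) := by rw [hk]; simp only [H]; field_simp
      have s0 := Real.smoothTransition.nonneg (f t / ε - 1); have s1 := Real.smoothTransition.le_one (f t / ε - 1)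
      have := h0 t
      rw [e, abs_le]; constructor <;> nlinarith
  have hn1 : ∀ t, |deriv k t - deriv f t| <= κ / 2 := fun t => by
    rw [hk1']; beta_reduce
    by_cases hy : 2 < f t / ε
    . rw [H1_hi hy]; simp; positivity
    . rw [not_lt, div_le_iff₀ hε] at hy
      rw [show deriv H (f t / ε) * deriv f t - deriv f t = (deriv H (f t / ε) - 1) * deriv f t by ring]
      refine abs_le_of_sq_le_sq ?_ (by positivity)
      rw [mul_pow]
      have b1 : (deriv H (f t / ε) - 1) ^ 2 <= (B + 1) ^ 2 := by
        refine sq_le_sq' ?_ ?_ <;> linarith [abs_le.1 (hB (f t / ε)).1]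
      have b2 : deriv f t ^ 2 <= 8 * ε * M := by nlinarith [hsq t]
      refine (mul_le_mul b1 b2 (sq_nonneg _) (sq_nonneg _)).trans (by linarith)
  obtain ⟨δ, hδ, hd0, hd1, hd2⟩ : ∃ δ : ℝ, 0 < δ ∧ B * F * δ <= κ / 2 ∧ 9 * B * M * δ <= κ / 2 ∧ F * δ <= ε := by
    have hQ : 0 < B * F + 9 * B * M + F + 1 := by positivity
    refine ⟨min (κ / 2) ε / (B * F + 9 * B * M + F + 1), div_pos (lt_min (by linarith) hε) hQ, ?_, ?_, ?_⟩ <;>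
      rw [mul_div_assoc', div_le_iff₀ hQ]
    . have := min_le_left (κ / 2) ε; have := (lt_min (show 0 < κ / 2 by linarith) hε)
      have h3 : 0 <= 9 * B * M := by positivity
      have h4 : 0 <= B * F := by positivity
      nlinarith
    . have := min_le_left (κ / 2) ε; have := (lt_min (show 0 < κ / 2 by linarith) hε)
      have h3 : 0 <= 9 * B * M := by positivity
      have h4 : 0 <= B * F := by positivity
      nlinarith
    . have := min_le_right (κ / 2) ε; have := (lt_min (show 0 < κ / 2 by linarith) hε)
      have h3 : 0 <= 9 * B * M := by positivity
      have h4 : 0 <= B * F := by positivity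
      nlinarith
  let φ : ContDiffBump (0 : ℝ) := ⟨δ / 2, δ, by linarith, by linarith⟩
  have hgd : ∀ t, HasDerivAt (kv φ k) (kv φ (deriv k) t) t := kv_deriv φ hkd hb1
  have hgd1 : deriv (kv φ k) = kv φ (deriv k) := funext fun t => (hgd t).deriv
  refine ⟨kv φ k, φ.hasCompactSupport_normed.contDiff_convolution_left _ φ.contDiff_normed hkd.continuous.locallyIntegrable, fun t => ?_, fun t => ?_, fun t => ?_, fun t ht => ?_⟩
  . have := kv_near φ (z := k t) (B := κ / 2) (t := t) hkd.continuous.measurable fun s hs => (lip hkd hb1 s t).trans (le_trans (mleL (le_of_lt hs) (by positivity)) hd0)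
    linarith [abs_sub_le (kv φ k t) (k t) (f t), hn0 t]
  . rw [hgd1]
    have := kv_near φ (z := deriv k t) (B := κ / 2) (t := t) hkd'.continuous.measurable fun s hs => (lip hkd' hb2 s t).trans (le_trans (mleL (le_of_lt hs) (by positivity)) hd1)
    linarith [abs_sub_le (kv φ (deriv k) t) (deriv k t) (deriv f t), hn1 t]
  . rw [hgd1, (kv_deriv φ hkd' hb2 t).deriv]
    have := kv_near φ (z := 0) (B := 9 * B * M) (t := t) (measurable_deriv (deriv k)) fun s hs => by simpa using hb2 s
    simpa using this
  . have := kv_near φ (z := 0) (B := 0) (t := t) hkd.continuous.measurable fun s hs => by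
      have h3 := lip h1 hF s t
      rw [ht, sub_zero, abs_of_nonneg (h0 s)] at h3
      have h4 : F * |s - t| <= F * δ := mleL (le_of_lt hs) hF0
      rw [hk]; simp only; rw [H_lo (by rw [div_le_one hε]; linarith)]; simp
    simpa using this
end Gc
end
section
/-- The output of the construction. -/
structure Dat.Out (C : ℝ) (d : 𝔻) where
  V : Fin 3 -> Sm
  W : Fin 3 -> Sm
  P : Sm
  R : Fin 3 -> Fin 3 -> Sm
  rW : ∀ l, Re (W l)
  rP : Re P
  rR : ∀ j l, Re (R j l)
  symR : ∀ j l, R j l = R l j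
  VW : ∀ l, V l = cu W l
  eq : ∀ l, dt (d.v l + V l) + ∑ j, dd j ((d.v j + V j) * (d.v l + V l)) + dd l (d.p + P) = ∑ j, dd j (R j l)
  van : ∀ t, d.g t = 0 -> ∀ x, (∀ l, V l (t, x) = 0) ∧ P (t, x) = 0
  bR : ∀ j l w, w.length <= L -> ∀ z, ‖wd w (R j l) z‖ <= C * (d.b * (d.E ^ 2 * d.ind z.1) * d.lam ^ w.length)
  bDR : ∀ j l w, w.length + 1 <= L -> ∀ z, ‖wd w (DD (fun k => d.v k + V k) (R j l)) z‖ <= C * (d.b * (d.E ^ 2 * d.ind z.1) * (d.lam * d.E) * d.lam ^ w.length)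
  bV : ∀ l w, w.length <= L -> ∀ z, ‖wd w (V l) z‖ <= C * (d.E * d.lam ^ w.length)
  bP : ∀ w, w.length <= L -> ∀ z, ‖wd w P z‖ <= C * (d.E ^ 2 * d.lam ^ w.length)
  bW : ∀ l w, w.length <= L -> ∀ z, ‖wd w (W l) z‖ <= C * (d.E * d.lam⁻¹ * d.lam ^ w.length)
  bDV : ∀ l z, ‖DD d.v (V l) z‖ <= C * (d.E * d.nu)
  bDW : ∀ l z, ‖DD d.v (W l) z‖ <= C * (d.E * d.lam⁻¹ * d.nu)
  bDP : ∀ z, ‖DD d.v P z‖ <= C * (d.E ^ 2 * d.nu)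
  en0 : ∀ z, ‖aV (∑ l, V l * V l - Slots.gg d * Slots.gg d) z‖ <= C * (d.E ^ 2 * d.N⁻¹)
  en1 : ∀ z, ‖dt (aV (∑ l, V l * V l - Slots.gg d * Slots.gg d)) z‖ <= C * (d.E ^ 2 * d.N⁻¹ * d.nu)
variable {A : Dat L η C0 K0 × Zt -> ℝ} {F : Dat L η C0 K0 × Zt -> Sm} {m : ℕ}
theorem Cl.ub (h : Cl ℭ 0 m A F) (hA : ∀ i, 0 <= A i) :
    ∀ᶠ C : ℝ in Filter.atTop, ∀ w : List (Fin 3), w.length <= m -> ∀ i, ‖_root_.wd w (F i) i.2‖ <= C * (A i * i.1.lam ^ w.length) := by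
  refine (Filter.eventually_all_finite (List.finite_length_le (Fin 3) m)).2 fun w hw => ?_
  obtain ⟨C, _, h1⟩ := (h.wd w hw).bound
  filter_upwards [Filter.eventually_ge_atTop C] with D hD i
  have h0 : 0 <= A i * i.1.lam ^ w.length := mul_nonneg (hA i) (pow_nonneg i.1.lam0.le _)
  refine (h1 i).trans ?_
  change C * |A i * i.1.lam ^ w.length| <= _
  rw [abs_of_nonneg h0]
  exact mleR hD h0
theorem DDv_cl (hL : 2 <= L) (h : Cl ℭ 1 1 A F) : Cl ℭ 0 0 (fun i => A i * i.1.nu) (fun i => DD i.1.v (F i)) := by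
  refine Dat.congr' ((h.DD.down le_rfl (Nat.zero_le 1)).add (Cl.sum Finset.univ fun k _ => Cl.mul' ((Dat.wv_cl hL k).down le_rfl (Nat.zero_le L)) ((h.down (r' := 0) (m' := 1) (by omega) le_rfl).dd k) ?_)) fun i => ?_
  . exact Ls.eq fun i => by change i.1.b * i.1.E * (A i * i.1.lam) = A i * i.1.nu; unfold Dat.nu Dat.mu; ring
  . change DD i.1.u (F i) + _ = _
    rw [DD_apply, DD_apply, add_assoc, <- sum_add_distrib]
    congr 1; refine sum_congr rfl fun k _ => ?_
    unfold Dat.wv; ring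
theorem Cl.up {c : Ctx (𝔻 × Zt)} {r : ℕ} {B : 𝔻 × Zt -> ℝ} (h : Cl c r m A F) (h0 : ∀ i, 0 <= A i) (h1 : ∀ i, A i <= B i) : Cl c r m B F := h.trans (Ls.le h0 h1)
theorem outs (hL : 2 <= L) (hη : 0 < η) (hK : 𝕂) (hK' : 0 < K0) : ∃ C : ℝ, 1 <= C ∧ ∀ d : 𝔻, Nonempty (d.Out C) := by
  obtain ⟨Z⟩ := slots_exist (L := L) (η := η) (C0 := C0) (K0 := K0) hL
  obtain ⟨M, hM⟩ := Dat.exM (L := L) (C0 := C0) (K0 := K0) hη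
  have e0 : ∀ i : 𝔻 × Zt, 0 <= i.1.E := fun i => i.1.hE.le
  have l0 : ∀ i : 𝔻 × Zt, 0 <= i.1.lam⁻¹ := fun i => inv_nonneg.2 i.1.lam0.le
  have n0 : ∀ i : 𝔻 × Zt, 0 <= i.1.nu := fun i => i.1.nu0.le
  have cV : ∀ l m, Cl ℭ 2 m (fun i => i.1.E) (fun i => Z.Vg i.1 l) := fun l m => (Z.V_cl hL hK l m).up sD0 sDE
  have cW : ∀ l m, Cl ℭ 2 m (fun i => i.1.E * i.1.lam⁻¹) (fun i => Z.Wg i.1 l) := fun l m => (Z.W_cl hL hK l m).up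
    (fun i => mul_nonneg (sD0 i) (l0 i)) fun i => mleR (sDE i) (l0 i)
  have cP : ∀ m, Cl ℭ 1 m (fun i => i.1.E ^ 2) (fun i => Z.Pg i.1) := fun m => (Z.Pg_cl hL hK m).up
    (fun i => mul_nonneg (sq_nonneg _) (i.1.ind0 _)) fun i => mul_le_of_le_one_right (sq_nonneg _) (i.1.ind1 _)
  have q1 := Filter.eventually_all.2 fun j => Filter.eventually_all.2 fun l => (Z.Rf_G2 hL hK hM j l).1.ub Slots.bI0
  have q2 := Filter.eventually_all.2 fun j => Filter.eventually_all.2 fun l => ((Z.Rf_G2 hL hK hM j l).2 (L - 1) (by omega)).ub fun i => mul_nonneg (Slots.bI0 i) (Slots.lE0 i)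
  have q3 := Filter.eventually_all.2 fun l => ((cV l L).down (r' := 0) (by omega) le_rfl).ub e0
  have q4 := ((cP L).down (r' := 0) (by omega) le_rfl).ub fun i => sq_nonneg _
  have q5 := Filter.eventually_all.2 fun l => ((cW l L).down (r' := 0) (by omega) le_rfl).ub fun i => mul_nonneg (e0 i) (l0 i)
  have q6 := Filter.eventually_all.2 fun l => (DDv_cl hL ((cV l 1).down (r' := 1) (by omega) le_rfl)).ub fun i => mul_nonneg (e0 i) (n0 i)
  have q7 := Filter.eventually_all.2 fun l => (DDv_cl hL ((cW l 1).down (r' := 1) (by omega) le_rfl)).ub fun i => mul_nonneg (mul_nonneg (e0 i) (l0 i)) (n0 i)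
  have q8 := (DDv_cl hL (cP 1)).ub fun i => mul_nonneg (sq_nonneg _) (n0 i)
  obtain ⟨C1, _, h1⟩ := Z.en_b0 hL hη hK
  obtain ⟨C2, _, h2⟩ := Z.en_b1 hL hη hK
  obtain ⟨C, q1, q2, q3, q4, q5, q6, q7, q8, q9, qa, qb⟩ := (q1.and (q2.and (q3.and (q4.and (q5.and (q6.and (q7.and (q8.and
    ((Filter.eventually_ge_atTop C1).and ((Filter.eventually_ge_atTop C2).and (Filter.eventually_ge_atTop (1 : ℝ)))))))))))).exists
  refine ⟨C, qb, fun d => ⟨⟨Z.Vg d, Z.Wg d, Z.Pg d, Z.Rf M d, Z.W_re d, Z.Pg_re d, Z.Rf_re M d, Z.Rf_symm M d, fun l => rfl, Z.Rf_eq M d,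
    fun t ht x => ⟨fun l => Z.V_van ht l t rfl x, Z.P_van hK' ht t rfl x⟩, fun j l w hw z => q1 j l w hw (d, z),
    fun j l w hw z => q2 j l w (by omega) (d, z), fun l w hw z => q3 l w hw (d, z), fun w hw z => q4 w hw (d, z), fun l w hw z => q5 l w hw (d, z),
    fun l z => ?_, fun l z => ?_, fun z => ?_, fun z => ?_, fun z => ?_⟩⟩⟩
  . simpa [wd] using q6 l [] le_rfl (d, z)
  . simpa [wd] using q7 l [] le_rfl (d, z)
  . simpa [wd] using q8 [] le_rfl (d, z)
  . have h0 := Slots.eN0 (d, z)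
    have := h1 (d, z); rw [abs_of_nonneg h0] at this
    exact this.trans (mleR q9 h0)
  . have h0 : 0 <= Slots.eN (d, z) * d.nu := mul_nonneg (Slots.eN0 (d, z)) d.nu0.le
    have := h2 (d, z); rw [abs_of_nonneg h0] at this
    exact this.trans (mleR qa h0)
end
section
namespace Sm
/-- The real function `f` is represented by `F`. -/
def Rp (f : ℝ -> Spc -> ℝ) (F : Sm) : Prop := ∀ t x, ((f t x : ℝ) : ℂ) = F (t, x)
theorem Re.rp {F : Sm} (h : Re F) : Rp (fun t x => (F (t, x)).re) F := fun t x => h.coe (t, x)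
theorem Rp.exists {f : ℝ -> Spc -> ℝ} (h : ContDiff ℝ ∞ (fun q : ℝ × Spc => f q.1 q.2)) (hp : ∀ t, Per (f t)) : ∃ F, Rp f F :=
  ⟨⟨fun z => ((f z.1 z.2 : ℝ) : ℂ), Complex.ofRealCLM.contDiff.comp h, fun t x k => by beta_reduce; rw [hp t x k]⟩, fun _ _ => rfl⟩
theorem re_cd (F : Sm) : ContDiff ℝ ∞ (fun q : ℝ × Spc => (F (q.1, q.2)).re) := Complex.reCLM.contDiff.comp F.smooth
variable {f g : ℝ -> Spc -> ℝ} {F G : Sm}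
theorem Rp.re (h : Rp f F) : Re F := re_of_im fun z => by rw [<- h z.1 z.2]; simp
theorem Rp.nrm (h : Rp f F) (t : ℝ) (x : Spc) : |f t x| = ‖F (t, x)‖ := by rw [<- h]; simp
theorem Rp.inj' (h : Rp f F) (h' : Rp g F) (t : ℝ) (x : Spc) : f t x = g t x := Complex.ofReal_injective ((h t x).trans (h' t x).symm)
theorem Rp.add (h : Rp f F) (h' : Rp g G) : Rp (fun t x => f t x + g t x) (F + G) := fun t x => by simp [h t x, h' t x]
theorem Rp.sub (h : Rp f F) (h' : Rp g G) : Rp (fun t x => f t x - g t x) (F - G) := fun t x => by simp [h t x, h' t x]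
theorem Rp.mul (h : Rp f F) (h' : Rp g G) : Rp (fun t x => f t x * g t x) (F * G) := fun t x => by simp [h t x, h' t x]
theorem Rp.sum {f : Fin 3 -> ℝ -> Spc -> ℝ} {F : Fin 3 -> Sm} (h : ∀ i, Rp (f i) (F i)) : Rp (fun t x => ∑ i, f i t x) (∑ i, F i) := fun t x => by simp [h _ t x]
theorem hasF (F : Sm) (t : ℝ) (x : Spc) : HasFDerivAt (fun y : Spc => F (t, y)) ((fderiv ℝ F (t, x)).comp (ContinuousLinearMap.inr ℝ ℝ Spc)) x :=
  (F.diffAt (t, x)).hasFDerivAt.comp x (hasFDerivAt_prodMk_right t x)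
theorem Rp.pd (h : Rp f F) (j : Fin 3) : Rp (fun t x => _root_.pd j (f t) x) (dd j F) := fun t x => by
  have e : f t = fun y => Complex.reCLM (F (t, y)) := funext fun y => by rw [<- h]; simp
  have := Complex.reCLM.hasFDerivAt.comp x (hasF F t x)
  rw [<- (h.re.dd j).coe (t, x)]
  unfold _root_.pd; beta_reduce
  rw [e]
  exact congrArg (fun u : Spc →L[ℝ] ℝ => ((u (Pi.single j 1) : ℝ) : ℂ)) this.fderiv
theorem Rp.pt (h : Rp f F) : Rp (_root_.pt f) (dt F) := fun t x => by
  have e : (fun s => f s x) = fun s => Complex.reCLM (F (s, x)) := funext fun y => by rw [<- h]; simp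
  have := (Complex.reCLM.hasFDerivAt.comp t ((F.diffAt (t, x)).hasFDerivAt.comp t (hasFDerivAt_prodMk_left t x))).hasDerivAt
  rw [<- h.re.dt.coe (t, x)]
  unfold _root_.pt
  rw [e]
  exact congrArg _ this.deriv
theorem Rp.matD {v : ℝ -> Spc -> Spc} {V : Fin 3 -> Sm} (hv : ∀ k, Rp (fun t x => v t x k) (V k)) (h : Rp f F) : Rp (_root_.matD v f) (DD V F) := by
  rw [DD_apply]; exact h.pt.add (Rp.sum fun i => (hv i).mul (h.pd i))
theorem sl_cd (F : Sm) (t : ℝ) : ContDiff ℝ ∞ (fun y : Spc => F (t, y)) := F.smooth.comp (contDiff_prodMk_right t)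
theorem Rp.itn (h : Rp f F) (k : ℕ) (t : ℝ) (x : Spc) : ‖iteratedFDeriv ℝ k (f t) x‖ = ‖iteratedFDeriv ℝ k (fun y => F (t, y)) x‖ := by
  have e : f t = fun y => Complex.reCLM (F (t, y)) := funext fun y => by rw [<- h]; simp
  have e2 : (fun y => F (t, y)) = Complex.ofRealLI ∘ f t := funext fun y => (h t y).symm
  have hf : ContDiff ℝ ∞ (f t) := by rw [e]; exact Complex.reCLM.contDiff.comp (sl_cd F t)
  rw [e2, LinearIsometry.norm_iteratedFDeriv_comp_left _ (hf.contDiffAt (x := x)) (by exact_mod_cast le_top)]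
theorem fd_eq (F : Sm) (t : ℝ) : fderiv ℝ (fun y : Spc => F (t, y)) = fun y => ∑ j, ContinuousLinearMap.smulRightL ℝ Spc ℂ (ContinuousLinearMap.proj j) (dd j F (t, y)) := by
  funext y
  rw [(hasF F t y).fderiv]
  refine ContinuousLinearMap.coe_injective (LinearMap.pi_ext' fun j => LinearMap.ext_ring ?_)
  simp only [LinearMap.comp_apply, ContinuousLinearMap.coe_coe, ContinuousLinearMap.sum_apply, LinearMap.single_apply]
  rw [sum_eq_single j (fun b _ hb => ?_) (by simp)]
  . change _ = (Pi.single j (1 : ℝ) : Spc) j • dd j F (t, y)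
    rw [Pi.single_eq_same, one_smul]; rfl
  . change (Pi.single j (1 : ℝ) : Spc) b • dd b F (t, y) = 0
    rw [Pi.single_eq_of_ne hb, zero_smul]
theorem it_le (k : ℕ) {A : ℝ} (t : ℝ) (x : Spc) (h : ∀ w : List (Fin 3), w.length = k -> ‖wd w F (t, x)‖ <= A) : ‖iteratedFDeriv ℝ k (fun y => F (t, y)) x‖ <= 3 ^ k * A := by
  induction k generalizing F with
  | zero => simpa [wd] using h [] rfl
  | succ k ih =>
    rw [<- norm_iteratedFDeriv_fderiv, fd_eq]
    refine (congrArg norm (iteratedFDeriv_fun_sum_apply fun j _ => (((ContinuousLinearMap.contDiff (ContinuousLinearMap.smulRightL ℝ Spc ℂ (ContinuousLinearMap.proj j))).comp (sl_cd (dd j F) t)).of_le (by exact_mod_cast le_top)).contDiffAt)).trans_le ?_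
    refine (norm_sum_le_of_le (n := fun _ => 3 ^ k * A) _ fun j _ => ?_).trans (le_of_eq (by simp; ring))
    refine (ContinuousLinearMap.norm_iteratedFDeriv_comp_left _ ((sl_cd (dd j F) t).contDiffAt (x := x)) (by exact_mod_cast le_top)).trans ?_
    refine (mul_le_of_le_one_left (norm_nonneg _) ?_).trans (ih fun w hw => h (j :: w) (by simp [hw]))
    refine ContinuousLinearMap.opNorm_le_bound _ zero_le_one fun z => ?_
    rw [one_mul]
    refine ContinuousLinearMap.opNorm_le_bound _ (norm_nonneg _) fun y => ?_
    change ‖y j • z‖ <= _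
    rw [norm_smul, mul_comm]
    exact mleL (norm_le_pi_norm y j) (norm_nonneg _)
theorem le_it (F : Sm) (w : List (Fin 3)) (t : ℝ) (x : Spc) : ‖wd w F (t, x)‖ <= ‖iteratedFDeriv ℝ w.length (fun y => F (t, y)) x‖ := by
  induction w generalizing F with
  | nil => simp [wd]
  | cons i w ih =>
    rw [List.length_cons, <- norm_iteratedFDeriv_fderiv]
    refine (ih (dd i F)).trans ?_
    have e : (fun y => dd i F (t, y)) = fun y => ContinuousLinearMap.apply ℝ ℂ (Pi.single i (1 : ℝ) : Spc) (fderiv ℝ (fun y : Spc => F (t, y)) y) := by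
      funext y; rw [(hasF F t y).fderiv]; rfl
    rw [e]
    refine (ContinuousLinearMap.norm_iteratedFDeriv_comp_left _ (((sl_cd F t).fderiv_right (m := ∞) (by simp)).contDiffAt (x := x)) (by exact_mod_cast le_top)).trans ?_
    refine mul_le_of_le_one_left (norm_nonneg _) (ContinuousLinearMap.opNorm_le_bound _ zero_le_one fun u => ?_)
    refine (u.le_opNorm _).trans (le_of_eq ?_)
    rw [Pi.norm_single]; simp
theorem Rp.it (h : Rp f F) (k : ℕ) {A : ℝ} (t : ℝ) (x : Spc) (hw : ∀ w : List (Fin 3), w.length = k -> ‖wd w F (t, x)‖ <= A) : ‖iteratedFDeriv ℝ k (f t) x‖ <= 3 ^ k * A :=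
  (h.itn k t x).trans_le (it_le k t x hw)
theorem Rp.wd (h : Rp f F) (w : List (Fin 3)) (t : ℝ) (x : Spc) : ‖_root_.wd w F (t, x)‖ <= ‖iteratedFDeriv ℝ w.length (f t) x‖ :=
  (le_it F w t x).trans_eq (h.itn _ t x).symm
theorem Rp.fd (h : Rp f F) {A : ℝ} (t : ℝ) (x : Spc) (hw : ∀ i, ‖dd i F (t, x)‖ <= A) : ‖fderiv ℝ (f t) x‖ <= 3 * A := by
  rw [<- norm_iteratedFDeriv_one, <- pow_one (3 : ℝ)]
  refine h.it 1 t x fun w hw' => ?_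
  obtain ⟨i, rfl⟩ := List.length_eq_one_iff.1 hw'
  exact hw i
theorem EqS.wd0 {S : Set ℝ} (hS : IsOpen S) (h : EqS S F 0) (w : List (Fin 3)) : EqS S (_root_.wd w F) 0 := by
  induction w generalizing F with
  | nil => exact h
  | cons i w ih => exact ih (by simpa using h.dd hS i)
end Sm
end
section
namespace Sm
theorem Rp.iff {f g : ℝ -> Spc -> ℝ} {F G : Sm} (h : Rp f F) (h' : Rp g G) : (∀ t x, f t x = g t x) ↔ F = G :=
  ⟨fun e => ext' fun z => by rw [<- h z.1 z.2, <- h' z.1 z.2, e], fun e => h.inj' (e ▸ h')⟩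
theorem er_iff {v : ℝ -> Spc -> Spc} {p : ℝ -> Spc -> ℝ} {R : ℝ -> Spc -> Fin 3 -> Fin 3 -> ℝ} {v' : Fin 3 -> Sm} {p' : Sm} {R' : Fin 3 -> Fin 3 -> Sm}
    (hv : ∀ l, Rp (fun t x => v t x l) (v' l)) (hp : Rp p p') (hR : ∀ j l, Rp (fun t x => R t x j l) (R' j l)) :
    IsEulerReynolds v p R ↔ (∀ l, dt (v' l) + ∑ j, dd j (v' j * v' l) + dd l p' = ∑ j, dd j (R' j l)) ∧ ∑ j, dd j (v' j) = 0 := by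
  have a := fun l => (((hv l).pt.add (Rp.sum fun j => ((hv j).mul (hv l)).pd j)).add (hp.pd l)).iff (Rp.sum fun j => (hR j l).pd j)
  have c := (Rp.sum fun j => (hv j).pd j).iff (g := fun _ _ => 0) (G := 0) fun _ _ => by simp
  rw [<- c]; simp only [<- a]
  exact ⟨fun h => ⟨fun l t x => (h t x).1 l, fun t x => (h t x).2⟩, fun h t x => ⟨fun l => h.1 l t x, h.2 t x⟩⟩
theorem wd_add (w : List (Fin 3)) (f g : Sm) : wd w (f + g) = wd w f + wd w g := by
  induction w generalizing f g with
  | nil => rfl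
  | cons i w ih => simp [wd, ih]
end Sm
end
end
open Sm
open Finset (sum_congr sum_add_distrib sum_sub_distrib sum_comm sum_mul mul_sum mem_univ sum_neg_distrib sum_nonneg sum_eq_single single_le_sum sum_eq_zero sum_mul_sum sum_le_sum)
open scoped ContDiff
set_option maxHeartbeats 4000000
/-- The Main Lemma: one step of the convex integration iteration in the
Hölder setting, with control of frequency and energy levels, of the material
derivatives, of the prescribed energy, and of the supports. -/
theorem main_iteration_lemma (L : ℕ) (hL : 2 ≤ L) (η : ℝ) (hη : 0 < η) :
    ∃ K C : ℝ, 1 ≤ K ∧ 0 < C ∧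
      ∀ (Ξ ev eR : ℝ), 2 ≤ Ξ → 0 < eR → eR ≤ ev →
      ∀ (v : ℝ → Spc → Spc) (p : ℝ → Spc → ℝ) (R : ℝ → Spc → Fin 3 → Fin 3 → ℝ),
        ContDiff ℝ (⊤ : ℕ∞) (fun q : ℝ × Spc => v q.1 q.2) →
        ContDiff ℝ (⊤ : ℕ∞) (fun q : ℝ × Spc => p q.1 q.2) →
        ContDiff ℝ (⊤ : ℕ∞) (fun q : ℝ × Spc => R q.1 q.2) →
        (∀ t, Per (v t)) → (∀ t, Per (p t)) → (∀ t, Per (R t)) →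
        (∀ t x j l, R t x j l = R t x l j) →
        IsEulerReynolds v p R →
        FreqEnergyBelow L Ξ ev eR v p R →
      ∀ I : Set ℝ, I.Nonempty → (∀ t, t ∉ I → ∀ x, R t x = 0) →
      ∀ e : ℝ → ℝ, (∀ t, 0 ≤ e t) →
        (∀ t : ℝ, (∃ t' ∈ I, |t - t'| ≤ Ξ⁻¹ * (Real.sqrt ev)⁻¹) → K * eR ≤ e t) →
        Differentiable ℝ (fun t => Real.sqrt (e t)) →
        Differentiable ℝ (deriv (fun t => Real.sqrt (e t))) →
        (∀ t, Real.sqrt (e t) ≤ 1000 * Real.sqrt (K * eR)) →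
        (∀ t, |deriv (fun s => Real.sqrt (e s)) t|
            ≤ 1000 * (Ξ * Real.sqrt ev) * Real.sqrt (K * eR)) →
        (∀ t, |deriv (deriv (fun s => Real.sqrt (e s))) t|
            ≤ 1000 * (Ξ * Real.sqrt ev) ^ 2 * Real.sqrt (K * eR)) →
      ∀ N : ℝ, Ξ ^ η ≤ N → (ev / eR) ^ ((3 : ℝ) / 2) ≤ N →
      ∃ (V W : ℝ → Spc → Spc) (P : ℝ → Spc → ℝ)
        (R₁ : ℝ → Spc → Fin 3 → Fin 3 → ℝ),
        ContDiff ℝ (⊤ : ℕ∞) (fun q : ℝ × Spc => V q.1 q.2) ∧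
        ContDiff ℝ (⊤ : ℕ∞) (fun q : ℝ × Spc => W q.1 q.2) ∧
        ContDiff ℝ (⊤ : ℕ∞) (fun q : ℝ × Spc => P q.1 q.2) ∧
        ContDiff ℝ (⊤ : ℕ∞) (fun q : ℝ × Spc => R₁ q.1 q.2) ∧
        (∀ t, Per (V t)) ∧ (∀ t, Per (W t)) ∧ (∀ t, Per (P t)) ∧ (∀ t, Per (R₁ t)) ∧
        (∀ t x j l, R₁ t x j l = R₁ t x l j) ∧
        IsEulerReynolds (fun t x => v t x + V t x) (fun t x => p t x + P t x) R₁ ∧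
        FreqEnergyBelow L (C * N * Ξ) eR
          ((Real.sqrt (Real.sqrt ev / (Real.sqrt eR * N)))⁻¹ *
            (Real.sqrt ev * Real.sqrt eR / N))
          (fun t x => v t x + V t x) (fun t x => p t x + P t x) R₁ ∧
        (∀ t : ℝ, (∀ t' : ℝ, e t' ≠ 0 → Ξ⁻¹ * (Real.sqrt ev)⁻¹ < |t - t'|) →
          ∀ x, R₁ t x = 0) ∧
        (∀ t x, V t x = curl (W t) x) ∧
        (∀ t, e t = 0 → ∀ x, V t x = 0 ∧ P t x = 0) ∧
        (∀ t x l, |V t x l| ≤ C * Real.sqrt eR) ∧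
        (∀ t x l, ‖fderiv ℝ (fun y => V t y l) x‖ ≤ C * N * Ξ * Real.sqrt eR) ∧
        (∀ t x l, |matD v (fun s z => V s z l) t x|
            ≤ C * (Real.sqrt (Real.sqrt ev / (Real.sqrt eR * N)))⁻¹ *
                (Ξ * Real.sqrt ev * Real.sqrt eR)) ∧
        (∀ t x l, |W t x l| ≤ C * Ξ⁻¹ * N⁻¹ * Real.sqrt eR) ∧
        (∀ t x l, ‖fderiv ℝ (fun y => W t y l) x‖ ≤ C * Real.sqrt eR) ∧
        (∀ t x l, |matD v (fun s z => W s z l) t x|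
            ≤ C * (Real.sqrt (Real.sqrt ev / (Real.sqrt eR * N)))⁻¹ *
                (N⁻¹ * Real.sqrt ev * Real.sqrt eR)) ∧
        (∀ t : ℝ,
          |(∫ x in Tdom, ∑ l, (V t x l) ^ 2) - (∫ _x in Tdom, e t)| ≤ C * eR / N) ∧
        (∀ t : ℝ, DifferentiableAt ℝ
            (fun s => (∫ x in Tdom, ∑ l, (V s x l) ^ 2) - (∫ _x in Tdom, e s)) t) ∧
        (∀ t : ℝ,
          |deriv (fun s => (∫ x in Tdom, ∑ l, (V s x l) ^ 2) - (∫ _x in Tdom, e s)) t|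
            ≤ C * (Real.sqrt (Real.sqrt ev / (Real.sqrt eR * N)))⁻¹ *
                (Ξ * Real.sqrt ev * eR / N)) ∧
        (∀ t x, |P t x| ≤ C * eR) ∧
        (∀ t x, ‖fderiv ℝ (P t) x‖ ≤ C * N * Ξ * eR) ∧
        (∀ t x, |matD v P t x|
            ≤ C * (Real.sqrt (Real.sqrt ev / (Real.sqrt eR * N)))⁻¹ *
                (Ξ * Real.sqrt ev * eR)) := by
  obtain ⟨k, hk, hk1⟩ : ∃ k : ℝ, 1 <= k ∧ 1000 * BM + 1 <= k ^ 2 := by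
    refine ⟨1000 * |BM| + 1, by linarith [abs_nonneg BM], ?_⟩
    nlinarith [le_abs_self BM, abs_nonneg BM]
  obtain ⟨Cg, hCg, hg⟩ := Gc.exists_g
  obtain ⟨C, hC, hO⟩ := outs (L := L) (η := η) (C0 := (2000 * k + 1) * Cg) (K0 := k ^ 2) hL hη hk1 (by positivity)
  have hC0 : 0 < C := by linarith
  refine ⟨4 * k ^ 2, 3 * (1 + C) * C ^ 2, by nlinarith, by positivity, ?_⟩
  intro Ξ ev eR hX heR hev v p R sv sp sR pv pp pR symR hER hFE I _ hI e e0 heK df df2 bf0 bf1 bf2 N hN1 hN2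
  have hX0 : 0 < Ξ := by linarith
  have hN : 0 < N := lt_of_lt_of_le (Real.rpow_pos_of_pos hX0 η) hN1
  obtain ⟨E, hE, rfl⟩ : ∃ E : ℝ, 0 < E ∧ eR = E ^ 2 := ⟨√eR, Real.sqrt_pos.2 heR, (Real.sq_sqrt heR.le).symm⟩
  obtain ⟨b, hb, rfl⟩ : ∃ b : ℝ, 0 < b ∧ ev = (N * b ^ 2 * E) ^ 2 := by
    have h0 : 0 < √ev := Real.sqrt_pos.2 (heR.trans_le hev)
    refine ⟨√(√ev / (N * E)), by positivity, ?_⟩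
    rw [Real.sq_sqrt (by positivity), show N * (√ev / (N * E)) * E = √ev by field_simp, Real.sq_sqrt (heR.trans_le hev).le]
  have hNb : 1 <= N * b ^ 2 := by
    have := abs_le_of_sq_le_sq' hev (by positivity)
    exact le_of_mul_le_mul_right (by linarith) hE
  have hNb3 : N * b ^ 3 <= 1 := by
    rw [show (N * b ^ 2 * E) ^ 2 / E ^ 2 = (N * b ^ 2) ^ (2 : ℝ) by rw [Real.rpow_two]; field_simp, <- Real.rpow_mul (by positivity),
      show (2 : ℝ) * (3 / 2) = (3 : ℕ) by norm_num, Real.rpow_natCast] at hN2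
    have : (N * b ^ 3) ^ 2 <= 1 ^ 2 := le_of_mul_le_mul_left (by linarith) hN
    exact le_of_sq_le_sq this zero_le_one
  have q1 : √(E ^ 2) = E := Real.sqrt_sq hE.le
  have q2 : √((N * b ^ 2 * E) ^ 2) = N * b ^ 2 * E := Real.sqrt_sq (by positivity)
  have q3 : √(N * b ^ 2 * E / (E * N)) = b := by rw [show N * b ^ 2 * E / (E * N) = b ^ 2 by field_simp, Real.sqrt_sq hb.le]
  have q4 : √(4 * k ^ 2 * E ^ 2) = 2 * k * E := by rw [show 4 * k ^ 2 * E ^ 2 = (2 * k * E) ^ 2 by ring, Real.sqrt_sq (by positivity)]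
  have q5 : b⁻¹ * (N * b ^ 2 * E * E / N) = b * E ^ 2 := by field_simp
  obtain ⟨F1, F2, F3, F4⟩ := hFE
  simp only [q1, q2, q3, q4, q5] at heK bf0 bf1 bf2 F1 F2 F3 F4 ⊢
  have ef : ∀ t, √(e t) ^ 2 = e t := fun t => Real.sq_sqrt (e0 t)
  set a := Ξ * (N * b ^ 2 * E) with ha
  have ha0 : 0 < a := by positivity
  have hθ : ∀ t s : ℝ, |t - s| <= Ξ⁻¹ * (N * b ^ 2 * E)⁻¹ ↔ |t - s| * a <= 1 := fun t s => by
    rw [<- mul_inv, <- ha, <- one_div, le_div_iff₀ ha0]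
  obtain ⟨κ, hκ, κ1, κ2, κ3, κ4⟩ : ∃ κ : ℝ, 0 < κ ∧ κ <= E ∧ κ <= E * a ∧ κ * (4000 * k * E + E) <= E ^ 2 / N ∧ κ * (2 * (2000 * k * E * a + E * a + 2000 * k * E)) <= b * Ξ * E ^ 3 := by
    have p1 : 0 < 4000 * k * E + E := by positivity
    have p2 : 0 < 2 * (2000 * k * E * a + E * a + 2000 * k * E) := by positivity
    refine ⟨min (min E (E * a)) (min (E ^ 2 / N / (4000 * k * E + E)) (b * Ξ * E ^ 3 / (2 * (2000 * k * E * a + E * a + 2000 * k * E)))), by positivity,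
      (min_le_left _ _).trans (min_le_left _ _), (min_le_left _ _).trans (min_le_right _ _), ?_, ?_⟩
    . rw [<- le_div_iff₀ p1]; exact (min_le_right _ _).trans (min_le_left _ _)
    . rw [<- le_div_iff₀ p2]; exact (min_le_right _ _).trans (min_le_right _ _)
  have pM : 0 < 1000 * a ^ 2 * (2 * k * E) := by positivity
  obtain ⟨g, sg, g0, g1, g2, gz⟩ := hg (fun t => √(e t)) _ _ κ pM hκ (fun t => Real.sqrt_nonneg _) df df2 bf1 bf2
  choose v' hv' using fun l => Rp.exists (f := fun t x => v t x l) (contDiff_pi.1 sv l) fun t x k => congrFun (pv t x k) l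
  obtain ⟨p', hp'⟩ := Rp.exists sp pp
  choose R' hR' using fun j l => Rp.exists (f := fun t x => R t x j l) (contDiff_pi.1 (contDiff_pi.1 sR j) l) fun t x k => congrFun (congrFun (pR t x k) j) l
  have hDR := fun j l => Rp.matD hv' (hR' j l)
  obtain ⟨hER1, hER2⟩ := (er_iff hv' hp' hR').1 hER
  classical
  have off : ∀ t, (¬ ∃ t', |t - t'| * a <= 1 ∧ e t' ≠ 0) -> ∃ S : Set ℝ, IsOpen S ∧ t ∈ S ∧ ∀ s ∈ S, e s = 0 := fun t h => by
    refine ⟨{s | |t - s| * a < 1}, isOpen_lt (by fun_prop) continuous_const, by simp, fun s hs => ?_⟩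
    by_contra h'
    exact h ⟨s, le_of_lt hs, h'⟩
  have Rz : ∀ t x, e t = 0 -> R t x = 0 := fun t x h => hI t (fun ht => by
    have := heK t ⟨t, ht, by simp; positivity⟩
    have : 0 < 4 * k ^ 2 * E ^ 2 := by positivity
    linarith) x
  have R0 : ∀ t, (¬ ∃ t', |t - t'| * a <= 1 ∧ e t' ≠ 0) -> ∃ S : Set ℝ, IsOpen S ∧ t ∈ S ∧ ∀ j l, EqS S (R' j l) 0 := fun t h => by
    obtain ⟨S, h1, h2, h3⟩ := off t h
    exact ⟨S, h1, h2, fun j l s hs x => (hR' j l s x).symm.trans (by simp [Rz s x (h3 s hs)])⟩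
  have G0 : ∀ t, (¬ ∃ t', |t - t'| * a <= 1 ∧ e t' ≠ 0) -> g =ᶠ[nhds t] fun _ => 0 := fun t h => by
    obtain ⟨S, h1, h2, h3⟩ := off t h
    filter_upwards [h1.mem_nhds h2] with s hs
    exact gz s (by simp [h3 s hs])
  have N' : C ^ 2 * N * (b / C) ^ 2 * E = N * b ^ 2 * E := by field_simp
  have gb0 : ∀ t, |g t| <= 2000 * k * E + κ := fun t => by
    have := bf0 t; have h1 := abs_sub_abs_le_abs_sub (g t) √(e t); have h2 := g0 t
    rw [abs_of_nonneg (Real.sqrt_nonneg (e t))] at h1; linarith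
  have gb1 : ∀ t, |deriv g t| <= 2000 * k * E * a + κ := fun t => by
    have := bf1 t; have h1 := abs_sub_abs_le_abs_sub (deriv g t) (deriv (fun t => √(e t)) t); have h2 := g1 t
    linarith
  have hc : ∀ y : ℝ, 0 <= y -> (2000 * k + 1) * y <= (2000 * k + 1) * Cg * y := fun y hy => by
    have := mleL hCg (show 0 <= (2000 * k + 1) * y by positivity); linarith
  let d : Dat L η ((2000 * k + 1) * Cg) (k ^ 2) :=
    { X := Ξ, N := C ^ 2 * N, b := b / C, E := E, hX := hX, hb := by positivity, hE := hE
      h1 := by rw [show C ^ 2 * N * (b / C) ^ 2 = N * b ^ 2 by field_simp]; exact hNb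
      h2 := by
        rw [show C ^ 2 * N * (b / C) ^ 3 = N * b ^ 3 / C by field_simp]; exact (div_le_one hC0).2 (hNb3.trans hC)
      hη := hN1.trans (le_mul_of_one_le_left hN.le (one_le_pow₀ hC))
      v := v', p := p', R := R', rv := fun l => (hv' l).re, rp := hp'.re, rR := fun j l => (hR' j l).re
      symR := fun j l => ((hR' j l).iff (hR' l j)).1 fun t x => symR t x j l
      div := hER2, eq := hER1
      bv := fun l i w z h => by
        rw [N', <- mul_assoc, <- pow_succ]
        exact ((hv' l).wd (i :: w) z.1 z.2).trans (F1 _ (by simp) h z.1 z.2 l)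
      bp := fun i w z h => by
        rw [N', <- mul_assoc, <- pow_succ]
        exact (hp'.wd (i :: w) z.1 z.2).trans (F2 _ (by simp) h z.1 z.2)
      ind := fun t => if ∃ t', |t - t'| * a <= 1 ∧ e t' ≠ 0 then 1 else 0
      bR := fun j l w z h => by
        split_ifs with h1
        . rw [mul_one]; exact ((hR' j l).wd w z.1 z.2).trans (F3 _ h z.1 z.2 j l)
        . obtain ⟨S, s1, s2, s3⟩ := R0 _ h1
          have := (s3 j l).wd0 s1 w z.1 s2 z.2
          exact (congrArg norm this).trans_le (by simp)
      bDR := fun j l w z h => by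
        rw [N']
        split_ifs with h1
        . exact ((hDR j l).wd w z.1 z.2).trans ((F4 _ h z.1 z.2 j l).trans (le_of_eq (by ring)))
        . obtain ⟨S, s1, s2, s3⟩ := R0 _ h1
          have h0 : EqS S (DD v' (R' j l)) 0 := by simpa using (s3 j l).DD s1 v'
          have := h0.wd0 s1 w z.1 s2 z.2
          exact (congrArg norm this).trans_le (by simp)
      ind0 := fun t => by split_ifs <;> simp
      ind1 := fun t => by split_ifs <;> simp
      g := g, hg := sg
      bg0 := fun t => by
        split_ifs with h1
        . have := gb0 t; have := hc E hE.le; linarith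
        . rw [(G0 t h1).eq_of_nhds]; simp
      bg1 := fun t => by
        rw [N']
        split_ifs with h1
        . have := gb1 t; have := hc (E * a) (by positivity); linarith
        . rw [(G0 t h1).deriv.eq_of_nhds]; simp
      bg2 := fun t => by
        rw [N']
        split_ifs with h1
        . have := g2 t; have : 0 <= Cg * (E * a ^ 2) := by positivity
          linarith
        . rw [(G0 t h1).deriv.deriv.eq_of_nhds]; simp
      gR := fun t s x j l h h' => by
        rw [N'] at h
        have hs : s ∈ I := by
          by_contra hs; exact h' ((hR' j l s x).symm.trans (by simp [hI s hs x]))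
        have h1 : √(4 * k ^ 2 * E ^ 2) <= √(e t) := Real.sqrt_le_sqrt (heK t ⟨s, hs, (hθ t s).2 h⟩)
        rw [q4] at h1
        have h2 := abs_le.1 (g0 t); have := mleR hk hE.le
        rw [<- mul_pow]; exact pow_le_pow_left₀ (by positivity) (by linarith) 2 }
  obtain ⟨o⟩ := hO d
  have rV : ∀ l, Re (o.V l) := fun l => by rw [o.VW]; exact ((o.rW _).dd _).sub ((o.rW _).dd _)
  have hV := fun l => (rV l).rp
  have hW := fun l => (o.rW l).rp
  have hP := o.rP.rp
  have hR := fun j l => (o.rR j l).rp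
  have hv1 := fun l => (hv' l).add (hV l)
  have hp1 := hp'.add hP
  obtain ⟨Λ, hΛ⟩ : ∃ Λ, Λ = C ^ 2 * N * Ξ := ⟨_, rfl⟩
  have hΛ0 : 0 < Λ := by rw [hΛ]; positivity
  have dn : d.nu = C * (b * N * Ξ * E) := by change b / C * (C ^ 2 * N * Ξ) * E = _; field_simp
  have dl : d.lam = Λ := hΛ.symm
  have i1 := d.ind1
  have bR := o.bR
  have bDR := o.bDR
  have bV : ∀ l w, w.length <= L -> ∀ z, ‖wd w (o.V l) z‖ <= C * (E * d.lam ^ w.length) := o.bV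
  have bP : ∀ w, w.length <= L -> ∀ z, ‖wd w o.P z‖ <= C * (E ^ 2 * d.lam ^ w.length) := o.bP
  have bW : ∀ l w, w.length <= L -> ∀ z, ‖wd w (o.W l) z‖ <= C * (E * d.lam⁻¹ * d.lam ^ w.length) := o.bW
  have bDV : ∀ l z, ‖DD v' (o.V l) z‖ <= C * (E * d.nu) := o.bDV
  have bDW : ∀ l z, ‖DD v' (o.W l) z‖ <= C * (E * d.lam⁻¹ * d.nu) := o.bDW
  have bDP : ∀ z, ‖DD v' o.P z‖ <= C * (E ^ 2 * d.nu) := o.bDP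
  obtain ⟨en, hen⟩ : ∃ en, en = ∑ l, o.V l * o.V l - Slots.gg d * Slots.gg d := ⟨_, rfl⟩
  have en0 : ∀ z, ‖aV en z‖ <= C * (E ^ 2 * (C ^ 2 * N)⁻¹) := by rw [hen]; exact o.en0
  have en1 : ∀ z, ‖dt (aV en) z‖ <= C * (E ^ 2 * (C ^ 2 * N)⁻¹ * d.nu) := by rw [hen]; exact o.en1
  rw [dn] at bDV bDW bDP en1
  rw [dl] at bR bDR bV bP bW bDW
  obtain ⟨D, hD⟩ : ∃ D, D = 3 * (1 + C) * C ^ 2 := ⟨_, rfl⟩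
  have C1 : C <= C ^ 2 := le_self_pow₀ hC (by omega)
  have C2 : C ^ 2 <= C ^ 3 := pow_le_pow_right₀ hC (by omega)
  have C3 : 3 * C ^ 3 <= D := by rw [hD, show 3 * (1 + C) * C ^ 2 = 3 * C ^ 2 + 3 * C ^ 3 by ring]; linarith [sq_nonneg C]
  have hb1 : b <= 1 := by
    by_contra h; push Not at h
    have : N * b ^ 2 * 1 < N * b ^ 2 * b := by gcongr
    linarith
  have hN1' : 1 <= N := by linarith [mleL (pow_le_one₀ hb.le hb1 (n := 2)) hN.le]
  have hDΛ : D * N * Ξ = 3 * (1 + C) * Λ := by rw [hD, hΛ]; ring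
  have P0 : ∀ n : ℕ, 3 ^ n * Λ ^ n <= (D * N * Ξ) ^ n := fun n => by
    rw [hDΛ, <- mul_pow]; gcongr; linarith
  have P1 : ∀ n : ℕ, 1 <= n -> 3 ^ n * ((1 + C) * Λ ^ n) <= (D * N * Ξ) ^ n := fun n hn => by
    rw [hDΛ, mul_pow, mul_pow, mul_assoc]; gcongr; exact le_self_pow₀ (by linarith) (by omega)
  have P2 : ∀ n : ℕ, 1 <= n -> N * Ξ ^ n <= Λ ^ n := fun n hn => by
    rw [hΛ, mul_pow]; gcongr
    calc N <= C ^ 2 * N := le_mul_of_one_le_left hN.le (one_le_pow₀ hC)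
      _ <= _ := le_self_pow₀ (one_le_mul_of_one_le_of_one_le (one_le_pow₀ hC) hN1') (by omega)
  have Hf : ∀ c {x Y T : ℝ}, x <= c * Y -> c <= 3 * C ^ 3 -> 0 <= Y -> D * Y = T -> x <= T := fun c x Y T h1 h2 h3 h4 => by
    rw [<- h4]; exact h1.trans (mleR (h2.trans C3) h3)
  have fb : ∀ t, |√(e t)| <= 2000 * k * E := fun t => by rw [abs_of_nonneg (Real.sqrt_nonneg _)]; linarith [bf0 t]
  have Int : ∀ t, (∫ x in Tdom, ∑ l, (o.V l (t, x)).re ^ 2) - (∫ _x in Tdom, e t) = (aV en (t, 0)).re + (g t * g t - √(e t) * √(e t)) := fun t => by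
    have h1 := int_Tdom (∑ l, o.V l * o.V l) t 0
    have h2 : aV en = aV (∑ l, o.V l * o.V l) - Slots.gg d * Slots.gg d := by
      rw [hen, aV_sub, aV_const (f := Slots.gg d * Slots.gg d) fun z y => by simp [Slots.gg]]
    have h3 : ∀ x, (∑ l, o.V l * o.V l) (t, x) = ((∑ l, (o.V l (t, x)).re ^ 2 : ℝ) : ℂ) := fun x => by
      rw [<- Rp.sum (fun l => (hV l).mul (hV l)) t x]; simp only [sq]
    simp only [h3] at h1
    rw [integral_complex_ofReal] at h1
    have h4 : (aV en (t, 0)).re = (∫ x in Tdom, ∑ l, (o.V l (t, x)).re ^ 2) - g t * g t := by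
      rw [h2, coe_sub, <- h1]; simp [Slots.gg, d]
    have h5 : (∫ _x in Tdom, e t) = e t := by simp [Measure.real, vol_Tdom]
    rw [h4, h5, <- sq √(e t), ef]; ring
  have hen' : Rp (fun t x => (aV en (t, x)).re) (aV en) := by
    refine Re.rp (aV_re ?_)
    rw [hen]
    exact (Rp.sum fun l => (hV l).mul (hV l)).re.sub ((Re.tf g sg).mul (Re.tf g sg))
  have Der : ∀ t, HasDerivAt (fun s => (∫ x in Tdom, ∑ l, (o.V l (s, x)).re ^ 2) - (∫ _x in Tdom, e s))
      (pt (fun t x => (aV en (t, x)).re) t 0 + ((deriv g t * g t + g t * deriv g t) - (deriv (fun s => √(e s)) t * √(e t) + √(e t) * deriv (fun s => √(e s)) t))) t := fun t => by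
    simp only [Int]
    have h1 : HasDerivAt (fun s => (aV en (s, 0)).re) (pt (fun t x => (aV en (t, x)).re) t 0) t :=
      (((re_cd (aV en)).comp (contDiff_prodMk_left (0 : Spc))).differentiable (by simp) t).hasDerivAt
    have h2 := (sg.differentiable (by simp) t).hasDerivAt
    have h3 := (df t).hasDerivAt
    exact h1.fun_add ((h2.fun_mul h2).fun_sub (h3.fun_mul h3))
  rw [<- hD]
  refine ⟨fun t x l => (o.V l (t, x)).re, fun t x l => (o.W l (t, x)).re, fun t x => (o.P (t, x)).re, fun t x j l => (o.R j l (t, x)).re,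
    contDiff_pi.2 fun l => re_cd (o.V l), contDiff_pi.2 fun l => re_cd (o.W l), re_cd o.P, contDiff_pi.2 fun j => contDiff_pi.2 fun l => re_cd (o.R j l),
    fun t x k => funext fun l => congrArg Complex.re ((o.V l).per t x k), fun t x k => funext fun l => congrArg Complex.re ((o.W l).per t x k),
    fun t x k => congrArg Complex.re (o.P.per t x k), fun t x k => funext fun j => funext fun l => congrArg Complex.re ((o.R j l).per t x k),
    fun t x j l => congrArg (fun F : Sm => (F (t, x)).re) (o.symR j l), (er_iff hv1 hp1 hR).2 ⟨o.eq, ?_⟩, ⟨fun n hn hn' t x l => ?_, fun n hn hn' t x => ?_, fun n hn t x j l => ?_, fun n hn t x j l => ?_⟩,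
    fun t ht x => ?_, fun t x => ?_, fun t ht x => ?_, fun t x l => ?_, fun t x l => ?_, fun t x l => ?_, fun t x l => ?_, fun t x l => ?_, fun t x l => ?_,
    fun t => ?_, fun t => (Der t).differentiableAt, fun t => ?_, fun t x => ?_, fun t x => ?_, fun t x => ?_⟩
  . have : ∀ j, dd j (v' j + o.V j) = dd j (v' j) + dd j (cu o.W j) := fun j => by rw [o.VW, map_add]
    simp only [this, sum_add_distrib, hER2, div_cu, add_zero]
  . rw [q1]
    refine ((hv1 l).it n t x (A := (1 + C) * Λ ^ n * E) fun w hw => ?_).trans ?_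
    . subst hw
      rw [wd_add, coe_add]
      have h1 := ((hv' l).wd w t x).trans (F1 _ hn hn' t x l)
      have h2 := bV l w hn' (t, x)
      have h3 : Ξ ^ w.length * (N * b ^ 2 * E) <= Λ ^ w.length * E := by
        have : N * Ξ ^ w.length * b ^ 2 <= Λ ^ w.length * 1 := by gcongr; exacts [P2 _ hn, pow_le_one₀ hb.le hb1]
        have := mleR this hE.le
        linarith
      exact (norm_add_le _ _).trans (by linarith)
    . have := mleR (P1 n hn) hE.le; linarith
  . refine (hp1.it n t x (A := (1 + C) * Λ ^ n * E ^ 2) fun w hw => ?_).trans ?_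
    . subst hw
      rw [wd_add, coe_add]
      have h1 := (hp'.wd w t x).trans (F2 _ hn hn' t x)
      have h2 := bP w hn' (t, x)
      have h3 : Ξ ^ w.length * (N * b ^ 2 * E) ^ 2 <= Λ ^ w.length * E ^ 2 := by
        have h4 : N * b ^ 3 * b <= 1 := mul_le_one₀ hNb3 hb.le hb1
        have : N * Ξ ^ w.length * (N * b ^ 3 * b) <= Λ ^ w.length * 1 := by gcongr; exact P2 _ hn
        have := mleR this (sq_nonneg E)
        linarith
      exact (norm_add_le _ _).trans (by linarith)
    . have := mleR (P1 n hn) (sq_nonneg E); linarith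
  . refine ((hR j l).it n t x (A := Λ ^ n * (b * E ^ 2)) fun w hw => ?_).trans ?_
    . subst hw
      refine (bR j l w hn (t, x)).trans ?_
      change C * (b / C * (E ^ 2 * d.ind t) * _) <= _
      rw [show C * (b / C * (E ^ 2 * d.ind t) * Λ ^ w.length) = Λ ^ w.length * (b * E ^ 2) * d.ind t by field_simp]
      exact mul_le_of_le_one_right (by positivity) (i1 t)
    . have := mleR (P0 n) (show 0 <= b * E ^ 2 by positivity); linarith
  . rw [q1]
    refine ((Rp.matD hv1 (hR j l)).it n t x (A := Λ ^ n * Λ * (b * E ^ 3)) fun w hw => ?_).trans ?_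
    . subst hw
      refine (bDR j l w hn (t, x)).trans ?_
      change C * (b / C * (E ^ 2 * d.ind t) * (Λ * E) * _) <= _
      rw [show C * (b / C * (E ^ 2 * d.ind t) * (Λ * E) * Λ ^ w.length) = Λ ^ w.length * Λ * (b * E ^ 3) * d.ind t by field_simp]
      exact mul_le_of_le_one_right (by positivity) (i1 t)
    . have := mleR (P0 (n + 1)) (show 0 <= b * E ^ 3 by positivity)
      have h0 : 0 <= 3 ^ n * Λ ^ n * Λ * (b * E ^ 3) := by positivity
      rw [pow_succ 3, pow_succ Λ] at this; linarith
  . funext j l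
    have h0 : d.ind t = 0 := if_neg fun ⟨s, h1, h2⟩ => absurd ((hθ t s).2 h1) (not_le.2 (ht s h2))
    have := bR j l [] (Nat.zero_le L) (t, x)
    rw [h0, mul_zero, mul_zero, zero_mul, mul_zero] at this
    have : o.R j l (t, x) = 0 := norm_le_zero_iff.1 this
    change (o.R j l (t, x)).re = 0
    rw [this]; rfl
  . have h := fun l => ((hV l).iff (((hW (l + 2)).pd (l + 1)).sub ((hW (l + 1)).pd (l + 2)))).2 (o.VW l) t x
    funext l
    fin_cases l
    exacts [h 0, h 1, h 2]
  . have := o.van t (gz t (by simp [ht])) x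
    exact ⟨funext fun l => by change (o.V l (t, x)).re = 0; rw [this.1 l]; rfl, by change (o.P (t, x)).re = 0; rw [this.2]; rfl⟩
  . refine Hf C (Y := E) ?_ (by linarith) hE.le rfl
    have := bV l [] (Nat.zero_le L) (t, x)
    rw [(hV l).nrm]; simpa [wd] using this
  . refine Hf (3 * C ^ 3) (Y := N * Ξ * E) (((hV l).fd (A := C * (E * Λ ^ 1)) t x fun i => bV l [i] (by simp; omega) (t, x)).trans (le_of_eq ?_)) le_rfl (by positivity) (by ring)
    rw [hΛ]; ring
  . refine Hf (C ^ 2) (Y := b * N * Ξ * E ^ 2) (((Rp.matD hv' (hV l)).nrm t x).trans_le ((bDV l (t, x)).trans (le_of_eq (by ring)))) (by linarith) (by positivity) ?_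
    rw [ha]; field_simp
  . refine Hf 1 (Y := Ξ⁻¹ * N⁻¹ * E) ?_ (by linarith) (by positivity) (by ring)
    have h := bW l [] (Nat.zero_le L) (t, x)
    refine ((hW l).nrm t x).trans_le (h.trans ?_)
    rw [hΛ, List.length_nil, pow_zero, show C * (E * (C ^ 2 * N * Ξ)⁻¹ * 1) = C⁻¹ * (Ξ⁻¹ * N⁻¹ * E) by field_simp]
    gcongr; exact inv_le_one_of_one_le₀ hC
  . refine Hf (3 * C) (Y := E) (((hW l).fd (A := C * (E * Λ⁻¹ * Λ ^ 1)) t x fun i => bW l [i] (by simp; omega) (t, x)).trans (le_of_eq ?_)) (by linarith) hE.le rfl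
    field_simp
  . refine Hf 1 (Y := b * E ^ 2) (((Rp.matD hv' (hW l)).nrm t x).trans_le ((bDW l (t, x)).trans (le_of_eq ?_))) (by linarith) (by positivity) ?_
    . rw [hΛ]; field_simp
    . field_simp
  . refine Hf 2 (Y := E ^ 2 / N) ?_ (by linarith) (by positivity) (by ring)
    rw [Int]
    have h1 : |(aV en (t, 0)).re| <= E ^ 2 / N := (hen'.nrm t 0).trans_le ((en0 _).trans (by
      rw [show C * (E ^ 2 * (C ^ 2 * N)⁻¹) = C⁻¹ * (E ^ 2 / N) by field_simp]
      exact mul_le_of_le_one_left (by positivity) (inv_le_one_of_one_le₀ hC)))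
    have h2 : |g t * g t - √(e t) * √(e t)| <= E ^ 2 / N := by
      rw [show g t * g t - √(e t) * √(e t) = (g t - √(e t)) * (g t + √(e t)) by ring, abs_mul]
      refine (mul_le_mul (g0 t) ((abs_add_le _ _).trans (add_le_add (gb0 t) (fb t))) (abs_nonneg _) hκ.le).trans (le_trans ?_ κ3)
      exact mleL (by linarith) hκ.le
    exact (abs_add_le _ _).trans (by linarith)
  . refine Hf 2 (Y := b * Ξ * E ^ 3) ?_ (by linarith) (by positivity) (by rw [ha]; field_simp)
    rw [(Der t).deriv]
    have h1 := (hen'.pt.nrm t 0).trans_le ((en1 _).trans (le_of_eq (show C * (E ^ 2 * (C ^ 2 * N)⁻¹ * (C * (b * N * Ξ * E))) = b * Ξ * E ^ 3 by field_simp)))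
    refine (abs_add_le _ _).trans ?_
    have h2 : |deriv g t * g t + g t * deriv g t - (deriv (fun s => √(e s)) t * √(e t) + √(e t) * deriv (fun s => √(e s)) t)| <= b * Ξ * E ^ 3 := by
      rw [show ∀ x y z w : ℝ, x * y + y * x - (z * w + w * z) = 2 * ((y - w) * x + (x - z) * w) from fun x y z w => by ring, abs_mul, abs_two]
      refine le_trans ?_ κ4
      have h3 := mul_le_mul (g0 t) (gb1 t) (abs_nonneg _) hκ.le
      have h4 := mul_le_mul (g1 t) (fb t) (abs_nonneg _) hκ.le
      have h5 := abs_add_le ((g t - √(e t)) * deriv g t) ((deriv g t - deriv (fun s => √(e s)) t) * √(e t))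
      rw [abs_mul, abs_mul] at h5
      have h6 := mleL κ2 hκ.le
      linarith
    linarith
  . refine Hf C (Y := E ^ 2) ((hP.nrm t x).trans_le ?_) (by linarith) (by positivity) rfl
    simpa [wd] using bP [] (Nat.zero_le L) (t, x)
  . refine Hf (3 * C ^ 3) (Y := N * Ξ * E ^ 2) ((hP.fd (A := C * (E ^ 2 * Λ ^ 1)) t x fun i => bP [i] (by simp; omega) (t, x)).trans (le_of_eq ?_)) le_rfl (by positivity) (by ring)
    rw [hΛ]; ring
  . refine Hf (C ^ 2) (Y := b * N * Ξ * E ^ 3) (((Rp.matD hv' hP).nrm t x).trans_le ((bDP (t, x)).trans (le_of_eq (by ring)))) (by linarith) (by positivity) ?_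
    rw [ha]; field_simp
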